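/- If there is a geometric S-restricted drawing of a graph G, then there is also a crossing-confined geometric S-restricted drawing of G; moreover every vertex on the outer face in the old drawing can be kept on the outer face in the new drawing. In particular, a geometric S-restricted drawing of G with the minimum number of crossings is crossing confined. -/

import Mathlib

open scoped unitInterval

namespace OnePlanarity

/-- The six crossing types of a crossing in a 1-planar drawing. -/
inductive CrossingType : Type
  | full | almostFull | bowtie | arrow | chair | timesCross
  deriving DecidableEq

/-- The three crossing types in which the four endpoints of the crossing edges
lie on a common 4-cycle using the two crossing edges. -/
def goodTypes : Set CrossingType :=
  {CrossingType.full, CrossingType.almostFull, CrossingType.bowtie}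

/-- The three "bad" crossing types. -/
def badTypes : Set CrossingType :=
  {CrossingType.arrow, CrossingType.chair, CrossingType.timesCross}

variable {V : Type*} {W : Type*}

/-- `HasCrossingType G a b c d t` says that, assuming the edges `ab` and `cd` of `G`
cross, the subgraph of `G` induced by `{a,b,c,d}` witnesses the crossing type `t`. -/
def HasCrossingType (G : SimpleGraph V) (a b c d : V) : CrossingType → Prop
  | .full => G.Adj a c ∧ G.Adj a d ∧ G.Adj b c ∧ G.Adj b d
  | .almostFull =>
      (¬G.Adj a c ∧ G.Adj a d ∧ G.Adj b c ∧ G.Adj b d) ∨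
      (G.Adj a c ∧ ¬G.Adj a d ∧ G.Adj b c ∧ G.Adj b d) ∨
      (G.Adj a c ∧ G.Adj a d ∧ ¬G.Adj b c ∧ G.Adj b d) ∨
      (G.Adj a c ∧ G.Adj a d ∧ G.Adj b c ∧ ¬G.Adj b d)
  | .bowtie =>
      (G.Adj a c ∧ G.Adj b d ∧ ¬G.Adj a d ∧ ¬G.Adj b c) ∨
      (G.Adj a d ∧ G.Adj b c ∧ ¬G.Adj a c ∧ ¬G.Adj b d)
  | .arrow =>
      (G.Adj a c ∧ G.Adj a d ∧ ¬G.Adj b c ∧ ¬G.Adj b d) ∨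
      (G.Adj b c ∧ G.Adj b d ∧ ¬G.Adj a c ∧ ¬G.Adj a d) ∨
      (G.Adj a c ∧ G.Adj b c ∧ ¬G.Adj a d ∧ ¬G.Adj b d) ∨
      (G.Adj a d ∧ G.Adj b d ∧ ¬G.Adj a c ∧ ¬G.Adj b c)
  | .chair =>
      (G.Adj a c ∧ ¬G.Adj a d ∧ ¬G.Adj b c ∧ ¬G.Adj b d) ∨
      (¬G.Adj a c ∧ G.Adj a d ∧ ¬G.Adj b c ∧ ¬G.Adj b d) ∨
      (¬G.Adj a c ∧ ¬G.Adj a d ∧ G.Adj b c ∧ ¬G.Adj b d) ∨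
      (¬G.Adj a c ∧ ¬G.Adj a d ∧ ¬G.Adj b c ∧ G.Adj b d)
  | .timesCross => ¬G.Adj a c ∧ ¬G.Adj a d ∧ ¬G.Adj b c ∧ ¬G.Adj b d

/-- `IsArc A x y` says that `A` is the image of a simple curve from `x` to `y`. -/
def IsArc (A : Set (ℝ × ℝ)) (x y : ℝ × ℝ) : Prop :=
  ∃ f : I → ℝ × ℝ, Continuous f ∧ Function.Injective f ∧
    f 0 = x ∧ f 1 = y ∧ Set.range f = A

/-- A drawing of a graph `G` in the plane: vertices are mapped to distinct points,
every edge is mapped to a simple curve between the images of its endpoints avoiding the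
images of all other vertices, and two edges intersect in finitely many points. -/
structure Drawing (G : SimpleGraph V) where
  pos : V → ℝ × ℝ
  pos_inj : Function.Injective pos
  arc : Sym2 V → Set (ℝ × ℝ)
  arc_curve : ∀ e ∈ G.edgeSet, ∀ u v : V, e = s(u, v) → IsArc (arc e) (pos u) (pos v)
  arc_avoid : ∀ e ∈ G.edgeSet, ∀ w : V, pos w ∈ arc e → w ∈ e
  arc_finite_inter : ∀ e ∈ G.edgeSet, ∀ e' ∈ G.edgeSet, e ≠ e' →
    (arc e ∩ arc e').Finite

variable {G : SimpleGraph V}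

/-- `D.Crosses e e' p` : the distinct edges `e` and `e'` of `G` cross at the point `p`
(an intersection point of their curves which is not the image of a vertex). -/
def Drawing.Crosses (D : Drawing G) (e e' : Sym2 V) (p : ℝ × ℝ) : Prop :=
  e ∈ G.edgeSet ∧ e' ∈ G.edgeSet ∧ e ≠ e' ∧
    p ∈ D.arc e ∧ p ∈ D.arc e' ∧ p ∉ Set.range D.pos

/-- A drawing is 1-planar if every edge is involved in at most one crossing and
adjacent edges do not cross. -/
def Drawing.IsOnePlanar (D : Drawing G) : Prop :=
  (∀ e e₁ e₂ p q, D.Crosses e e₁ p → D.Crosses e e₂ q → e₁ = e₂ ∧ p = q) ∧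
  (∀ e e' p, D.Crosses e e' p → ∀ v : V, v ∈ e → v ∉ e')

/-- A drawing is `S`-restricted if it is 1-planar and every crossing has a type in `S`. -/
def Drawing.IsSRestricted (D : Drawing G) (S : Set CrossingType) : Prop :=
  D.IsOnePlanar ∧
  ∀ a b c d : V, ∀ p : ℝ × ℝ, D.Crosses s(a, b) s(c, d) p →
    ∃ t ∈ S, HasCrossingType G a b c d t

/-- A graph is 1-planar if it admits a 1-planar drawing. -/
def IsOnePlanarGraph (G : SimpleGraph V) : Prop :=
  ∃ D : Drawing G, D.IsOnePlanar

/-- A graph is `S`-restricted if it admits an `S`-restricted drawing. -/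
def SRestricted (G : SimpleGraph V) (S : Set CrossingType) : Prop :=
  ∃ D : Drawing G, D.IsSRestricted S

/-- A planar graph: one admitting a crossing-free drawing. -/
def IsPlanarGraph (G : SimpleGraph V) : Prop :=
  ∃ D : Drawing G, ∀ e e' p, ¬ D.Crosses e e' p

/-- A drawing is geometric if every edge is drawn as a straight-line segment. -/
def Drawing.IsGeometric (D : Drawing G) : Prop :=
  ∀ u v : V, G.Adj u v → D.arc s(u, v) = segment ℝ (D.pos u) (D.pos v)

/-- The point set of a drawing. -/
def Drawing.image (D : Drawing G) : Set (ℝ × ℝ) :=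
  Set.range D.pos ∪ ⋃ e ∈ G.edgeSet, D.arc e

/-- The set of points of the outer (unbounded) face of a point set `A`. -/
def outerRegion (A : Set (ℝ × ℝ)) : Set (ℝ × ℝ) :=
  {x | x ∉ A ∧ ¬ Bornology.IsBounded (connectedComponentIn Aᶜ x)}

/-- `Inside γ x` : the point `x` is separated from the outer face by the closed curve `γ`. -/
def Inside (γ : Set (ℝ × ℝ)) (x : ℝ × ℝ) : Prop :=
  x ∉ γ ∧ Bornology.IsBounded (connectedComponentIn γᶜ x)

/-- A vertex lies on (the boundary of) the outer face of a drawing. -/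
def Drawing.OnOuterFace (D : Drawing G) (v : V) : Prop :=
  D.pos v ∈ closure (outerRegion D.image)

/-- Two vertices are cofacial: they lie on the boundary of a common face. -/
def Drawing.Cofacial (D : Drawing G) (u v : V) : Prop :=
  ∃ p : ℝ × ℝ, p ∉ D.image ∧
    D.pos u ∈ closure (connectedComponentIn D.imageᶜ p) ∧
    D.pos v ∈ closure (connectedComponentIn D.imageᶜ p)

/-- A graph admits a geometric `S`-restricted drawing. -/
def GeoSRestricted (G : SimpleGraph V) (S : Set CrossingType) : Prop :=
  ∃ D : Drawing G, D.IsGeometric ∧ D.IsSRestricted S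

/-- `OGeoSRestricted G S O` : the graph `G` admits a geometric `S`-restricted drawing
in which the vertex of `O` (if any) lies on the outer face. -/
def OGeoSRestricted (G : SimpleGraph V) (S : Set CrossingType) (O : Set V) : Prop :=
  ∃ D : Drawing G, D.IsGeometric ∧ D.IsSRestricted S ∧ ∀ v ∈ O, D.OnOuterFace v

/-- `k`-connectivity. -/
def KConnected (k : ℕ) (G : SimpleGraph V) : Prop :=
  k < Nat.card V ∧ ∀ T : Set V, T.ncard < k → (G.induce Tᶜ).Connected

/-- A vertex has degree exactly two. -/
def DegTwo (G : SimpleGraph V) (w : V) : Prop :=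
  ∃ a b : V, a ≠ b ∧ G.neighborSet w = {a, b}

/-- The simple graph obtained from `G` by suppressing the degree-2 vertices in `W`. -/
def suppress (G : SimpleGraph V) (Ws : Set V) : SimpleGraph {v : V // v ∉ Ws} :=
  SimpleGraph.fromRel (fun a b =>
    G.Adj a.1 b.1 ∨ ∃ w ∈ Ws, G.Adj w a.1 ∧ G.Adj w b.1)

/-- A graph is internally 3-connected if it is obtained from a 3-connected (multi)graph by
subdividing a subset of its edges once each. -/
def InternallyThreeConnected (G : SimpleGraph V) : Prop :=
  ∃ Ws : Set V, (∀ w ∈ Ws, DegTwo G w) ∧ (∀ w ∈ Ws, ∀ u ∈ Ws, ¬ G.Adj w u) ∧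
    KConnected 3 (suppress G Ws)

/-- `IsSeparation G T X₁ X₂` : `(X₁, X₂)` is a separation of `G` induced by the separator `T`. -/
def IsSeparation (G : SimpleGraph V) (T X₁ X₂ : Set V) : Prop :=
  X₁ ∪ X₂ = Set.univ ∧ X₁ ∩ X₂ = T ∧ (X₁ \ T).Nonempty ∧ (X₂ \ T).Nonempty ∧
  ∀ u ∈ X₁ \ T, ∀ v ∈ X₂ \ T, ∀ p : G.Walk u v, ∃ w ∈ T, w ∈ p.support

end OnePlanarity
namespace OnePlanarity

variable {V : Type*} {G : SimpleGraph V}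

/-- A geometric `S`-restricted drawing is crossing confined if for each crossing, say
between `e` and `e'`, no other edge between vertices among the endpoints of `e` and `e'`
is involved in a crossing. -/
def Drawing.CrossingConfined (D : Drawing G) : Prop :=
  ∀ e e' p, D.Crosses e e' p → ∀ u v : V, (u ∈ e ∨ u ∈ e') → (v ∈ e ∨ v ∈ e') →
    s(u, v) ≠ e → s(u, v) ≠ e' → ∀ f q, ¬ D.Crosses s(u, v) f q

/-- The set of crossing points of a drawing. -/
def Drawing.crossingPoints (D : Drawing G) : Set (ℝ × ℝ) :=
  {p | ∃ e e', D.Crosses e e' p}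

/-- The point set of the drawing of the subgraph of `G` obtained by deleting the vertex
set `R` (together with all incident edges). -/
def Drawing.imageAvoiding (D : Drawing G) (R : Set V) : Set (ℝ × ℝ) :=
  (D.pos '' Rᶜ) ∪ ⋃ e ∈ G.edgeSet, ⋃ (_ : ∀ v ∈ R, v ∉ e), D.arc e

/-- A crossing point of the drawing restricted to `G - R`. -/
def Drawing.CrossPtAvoiding (D : Drawing G) (R : Set V) (q : ℝ × ℝ) : Prop :=
  ∃ e e', D.Crosses e e' q ∧ (∀ v ∈ R, v ∉ e) ∧ (∀ v ∈ R, v ∉ e')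

/-- The set of vertices (i.e. vertex points and crossing points of the planarization) of
the drawing of `G - R` that lie on the boundary of its outer face. -/
def Drawing.outerBoundaryVerticesAvoiding (D : Drawing G) (R : Set V) : Set (ℝ × ℝ) :=
  {x | (x ∈ D.pos '' Rᶜ ∨ D.CrossPtAvoiding R x) ∧
    x ∈ closure (outerRegion (D.imageAvoiding R))}

/-- A B-configuration on the edges `ss'`, `sb` and `s'b'` in which `sb` and `s'b'` cross:
`b` and `b'` lie inside the closed curve formed by `ss'`, the portion of `s'b'` from `s'`
to the crossing, and the portion of `sb` from the crossing to `s`. -/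
def Drawing.BConfig (D : Drawing G) (s s' b b' : V) : Prop :=
  G.Adj s s' ∧ G.Adj s b ∧ G.Adj s' b' ∧
  ∃ p, D.Crosses s(s, b) s(s', b') p ∧
  ∃ A₁ A₂ : Set (ℝ × ℝ), IsArc A₁ (D.pos s') p ∧ A₁ ⊆ D.arc s(s', b') ∧
    IsArc A₂ p (D.pos s) ∧ A₂ ⊆ D.arc s(s, b) ∧
    Inside (D.arc s(s, s') ∪ A₁ ∪ A₂) (D.pos b) ∧
    Inside (D.arc s(s, s') ∪ A₁ ∪ A₂) (D.pos b')

/-- A W-configuration with spine `s, s'` on the edges `sw₁`, `sw₂`, `s'w₁'`, `s'w₂'`,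
where `sw₁` crosses `s'w₁'` and `sw₂` crosses `s'w₂'`, and `w₁, w₂, w₁', w₂'` lie inside
the closed curve formed by the portions of the four edges between their crossings and the
spine vertices. -/
def Drawing.WConfig (D : Drawing G) (s s' w₁ w₂ w₁' w₂' : V) : Prop :=
  G.Adj s w₁ ∧ G.Adj s w₂ ∧ G.Adj s' w₁' ∧ G.Adj s' w₂' ∧
  ∃ p₁ p₂, D.Crosses s(s, w₁) s(s', w₁') p₁ ∧ D.Crosses s(s, w₂) s(s', w₂') p₂ ∧
  ∃ A₁ A₂ A₃ A₄ : Set (ℝ × ℝ),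
    IsArc A₁ (D.pos s) p₁ ∧ A₁ ⊆ D.arc s(s, w₁) ∧
    IsArc A₂ p₁ (D.pos s') ∧ A₂ ⊆ D.arc s(s', w₁') ∧
    IsArc A₃ (D.pos s') p₂ ∧ A₃ ⊆ D.arc s(s', w₂') ∧
    IsArc A₄ p₂ (D.pos s) ∧ A₄ ⊆ D.arc s(s, w₂) ∧
    Inside (A₁ ∪ A₂ ∪ A₃ ∪ A₄) (D.pos w₁) ∧
    Inside (A₁ ∪ A₂ ∪ A₃ ∪ A₄) (D.pos w₂) ∧
    Inside (A₁ ∪ A₂ ∪ A₃ ∪ A₄) (D.pos w₁') ∧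
    Inside (A₁ ∪ A₂ ∪ A₃ ∪ A₄) (D.pos w₂')

end OnePlanarity

/-- Real functions of the form `ξ ↦ m * ξ + c`. -/
def Aff (f : ℝ → ℝ) : Prop := ∃ m c : ℝ, ∀ ξ, f ξ = m * ξ + c

namespace Aff

variable {f g : ℝ → ℝ} {p q v l r : ℝ}

lemma three_pt (hf : Aff f) (p q v : ℝ) : (q - p) * f v = (q - v) * f p + (v - p) * f q := by
  obtain ⟨m, c, h⟩ := hf
  simp only [h]; ring

lemma eq_of_two (hf : Aff f) (hg : Aff g) (hpq : p < q) (hp : f p = g p) (hq : f q = g q)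
    (ξ : ℝ) : f ξ = g ξ := by
  refine mul_left_cancel₀ (sub_pos.2 hpq).ne' ?_
  rw [hf.three_pt, hg.three_pt, hp, hq]

lemma eq_of_touch (hf : Aff f) (hg : Aff g) (hlv : l < v) (hvr : v < r)
    (hl : g l ≤ f l) (hr : g r ≤ f r) (hv : f v = g v) (ξ : ℝ) : f ξ = g ξ := by
  have h1 := hf.three_pt l r v
  have h2 := hg.three_pt l r v
  exact hf.eq_of_two hg hlv (by nlinarith) hv ξ

lemma le_left (hf : Aff f) (hg : Aff g) (hpq : p < q) (hp : g p ≤ f p) (hq : f q = g q)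
    (hv : v ≤ p) : g v ≤ f v := by
  have h1 := hf.three_pt p q v
  have h2 := hg.three_pt p q v
  nlinarith

lemma pos_right (hf : Aff f) (hg : Aff g) (hpq : p < q) (hp : f p < g p) (hq : g q < f q)
    (hv : q ≤ v) : g v < f v := by
  have h1 := hf.three_pt p q v
  have h2 := hg.three_pt p q v
  nlinarith

lemma lt_of_common (hf : Aff f) (hg : Aff g) (hp : f p = g p) (hpq : p < q) (hq : g q < f q)
    (hv : p < v) : g v < f v := by
  have h1 := hf.three_pt p q v
  have h2 := hg.three_pt p q v
  nlinarith

end Aff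

/-- Affine interpolation of the heights `y` through the nodes `a` and `b`. -/
noncomputable def lin {N : Type*} (x y : N → ℝ) (a b : N) (ξ : ℝ) : ℝ :=
  y a + (y b - y a) * ((ξ - x a) / (x b - x a))

section lin
variable {N : Type*} {x y : N → ℝ} {a b v : N} {ξ : ℝ}

lemma lin_aff : Aff (lin x y a b) :=
  ⟨(y b - y a) / (x b - x a), y a - (y b - y a) * x a / (x b - x a), fun ξ => by
    simp only [lin]; ring⟩

@[simp] lemma lin_left : lin x y a b (x a) = y a := by simp [lin]

lemma lin_right (h : x a < x b) : lin x y a b (x b) = y b := by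
  simp [lin, div_self (sub_pos.2 h).ne']

lemma lin_neg : lin x (-y) a b ξ = - lin x y a b ξ := by
  simp only [lin, Pi.neg_apply]; ring

lemma lin_mirror (h : x a < x b) : lin (-x) y b a ξ = lin x y a b (-ξ) := by
  have : x b - x a ≠ 0 := by linarith
  have h3 : - x a - - x b ≠ 0 := by rwa [neg_sub_neg]
  simp only [lin, Pi.neg_apply]
  field_simp
  ring

lemma lin_eq_of_aff {g : ℝ → ℝ} (hg : Aff g) (h : x a < x b) (ha : y a = g (x a))
    (hb : y b = g (x b)) (ξ : ℝ) : lin x y a b ξ = g ξ :=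
  lin_aff.eq_of_two hg h (by rw [lin_left, ha]) (by rw [lin_right h, hb]) ξ

lemma exists_mix {l z u : ℝ} (h1 : l < z) (h2 : z < u) :
    ∃ θ, 0 < θ ∧ θ < 1 ∧ z = (1 - θ) * l + θ * u := by
  have h : 0 < u - l := by linarith
  refine ⟨(z - l) / (u - l), div_pos (by linarith) h, by rw [div_lt_one h]; linarith, ?_⟩
  field_simp
  ring

lemma lin_mix (h1 : x a < x v) (h2 : x v < x b) : ∃ l, 0 < l ∧ l < 1 ∧
    x v = (1 - l) * x a + l * x b ∧ ∀ y, lin x y a b (x v) = (1 - l) * y a + l * y b := by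
  obtain ⟨l, h3, h4, h5⟩ := exists_mix h1 h2
  refine ⟨l, h3, h4, h5, fun y => ?_⟩
  have := (lin_aff (x := x) (y := y) (a := a) (b := b)).three_pt (x a) (x b) (x v)
  rw [lin_left, lin_right (h1.trans h2), h5] at this
  rw [h5]
  refine mul_left_cancel₀ (sub_pos.2 (h1.trans h2)).ne' (this.trans ?_)
  ring

end lin

section core
variable {N : Type*}

/-- The lines through two edges change sides within the common range of the edges. -/
def Xing (x y : N → ℝ) (a b c e : N) : Prop :=
  ∃ ξ ξ' : ℝ, (x a ≤ ξ ∧ ξ ≤ x b ∧ x c ≤ ξ ∧ ξ ≤ x e) ∧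
    (x a ≤ ξ' ∧ ξ' ≤ x b ∧ x c ≤ ξ' ∧ ξ' ≤ x e) ∧
    lin x y a b ξ < lin x y c e ξ ∧ lin x y c e ξ' < lin x y a b ξ'

variable {x y y0 : N → ℝ} {E : N → N → Prop} {s d t : N}

lemma Xing.symm {a b c e : N} (h : Xing x y a b c e) : Xing x y c e a b := by
  obtain ⟨ξ, ξ', h1, h2, h3, h4⟩ := h
  exact ⟨ξ', ξ, ⟨h2.2.2.1, h2.2.2.2, h2.1, h2.2.1⟩, ⟨h1.2.2.1, h1.2.2.2, h1.1, h1.2.1⟩, h4, h3⟩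

lemma Xing.of_neg {a b c e : N} (h : Xing x (-y) a b c e) : Xing x y a b c e := by
  obtain ⟨ξ, ξ', h1, h2, h3, h4⟩ := h
  simp only [lin_neg, neg_lt_neg_iff] at h3 h4
  exact ⟨ξ', ξ, h2, h1, h4, h3⟩

lemma Xing.of_mirror {a b c e : N} (hab : x a < x b) (hce : x c < x e)
    (h : Xing (-x) y b a e c) : Xing x y a b c e := by
  obtain ⟨ξ, ξ', h1, h2, h3, h4⟩ := h
  rw [lin_mirror hab, lin_mirror hce] at h3 h4
  simp only [Pi.neg_apply] at h1 h2
  refine ⟨-ξ, -ξ', ?_, ?_, h3, h4⟩ <;> refine ⟨?_, ?_, ?_, ?_⟩ <;> linarith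

/-- The hypotheses on a family of straight edges (directed from left to right) with a
distinguished path `s, d, t` that are symmetric under reflections. -/
structure CoreBase (x y0 : N → ℝ) (E : N → N → Prop) (s d t : N) : Prop where
  inj : Function.Injective x
  lt : ∀ {a b}, E a b → x a < x b
  hon : ∀ {a b v}, E a b → x a < x v → x v < x b → y0 v ≠ lin x y0 a b (x v)
  pinch : ∀ {a b c e v}, E a b → E c e → x a < x v → x v < x b → x c < x v → x v < x e →
    lin x y0 c e (x v) < y0 v → y0 v < lin x y0 a b (x v) → ¬ Xing x y0 a b c e
  path_left : ∀ {a b}, E a b → ¬ Xing x y0 a b s d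
  path_right : ∀ {a b}, E a b → ¬ Xing x y0 a b d t
  hsd : E s d
  hdt : E d t

namespace CoreBase

lemma neg (h : CoreBase x y0 E s d t) : CoreBase x (-y0) E s d t where
  inj := h.inj
  lt := h.lt
  hon := fun h1 h2 h3 h4 => h.hon h1 h2 h3 (by simpa [lin_neg] using h4)
  pinch := fun h1 h2 h3 h4 h5 h6 h7 h8 h9 => by
    simp only [lin_neg, Pi.neg_apply, neg_lt_neg_iff] at h7 h8
    exact h.pinch h2 h1 h5 h6 h3 h4 h8 h7 h9.of_neg.symm
  path_left := fun h1 h2 => h.path_left h1 h2.of_neg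
  path_right := fun h1 h2 => h.path_right h1 h2.of_neg
  hsd := h.hsd
  hdt := h.hdt

lemma mirror (h : CoreBase x y0 E s d t) : CoreBase (-x) y0 (fun a b => E b a) t d s where
  inj := fun a b hab => h.inj (by simpa using hab)
  lt := fun h1 => by simpa using h.lt h1
  hon := fun h1 h2 h3 => by
    rw [lin_mirror (h.lt h1)]
    simp only [Pi.neg_apply, neg_lt_neg_iff, neg_neg] at h2 h3 ⊢
    exact h.hon h1 h3 h2
  pinch := fun h1 h2 h3 h4 h5 h6 h7 h8 h9 => by
    rw [lin_mirror (h.lt h2)] at h7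
    rw [lin_mirror (h.lt h1)] at h8
    simp only [Pi.neg_apply, neg_lt_neg_iff, neg_neg] at *
    exact h.pinch h1 h2 h4 h3 h6 h5 h7 h8 (h9.of_mirror (h.lt h1) (h.lt h2))
  path_left := fun h1 h2 => h.path_right h1 (h2.of_mirror (h.lt h1) (h.lt h.hdt))
  path_right := fun h1 h2 => h.path_left h1 (h2.of_mirror (h.lt h1) (h.lt h.hsd))
  hsd := h.hdt
  hdt := h.hsd

end CoreBase

/-- `y` touches an edge above `v`. -/
def UpE (x y0 : N → ℝ) (E : N → N → Prop) (y : N → ℝ) (v : N) : Prop :=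
  ∃ a b, E a b ∧ x a < x v ∧ x v < x b ∧ y0 v < lin x y0 a b (x v) ∧ y v = lin x y a b (x v)

/-- `y` touches an edge below `v`. -/
def DnE (x y0 : N → ℝ) (E : N → N → Prop) (y : N → ℝ) (v : N) : Prop :=
  ∃ a b, E a b ∧ x a < x v ∧ x v < x b ∧ lin x y0 a b (x v) < y0 v ∧ y v = lin x y a b (x v)

/-- `y` weakly satisfies the order constraints given by `y0`, and away from `d` a node
touches an edge above it iff it touches an edge below it. -/
structure WeakFix (x y0 : N → ℝ) (E : N → N → Prop) (d : N) (y : N → ℝ) : Prop where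
  up : ∀ {a b v}, E a b → x a < x v → x v < x b → y0 v < lin x y0 a b (x v) →
    y v ≤ lin x y a b (x v)
  dn : ∀ {a b v}, E a b → x a < x v → x v < x b → lin x y0 a b (x v) < y0 v →
    lin x y a b (x v) ≤ y v
  tight : ∀ {v}, v ≠ d → (UpE x y0 E y v ↔ DnE x y0 E y v)

/-- Strict validity. -/
structure StrictValid (x y0 : N → ℝ) (E : N → N → Prop) (y : N → ℝ) : Prop where
  up : ∀ {a b v}, E a b → x a < x v → x v < x b → y0 v < lin x y0 a b (x v) →
    y v < lin x y a b (x v)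
  dn : ∀ {a b v}, E a b → x a < x v → x v < x b → lin x y0 a b (x v) < y0 v →
    lin x y a b (x v) < y v

lemma upE_neg {v : N} : UpE x (-y0) E (-y) v ↔ DnE x y0 E y v := by
  simp [UpE, DnE, lin_neg]

lemma dnE_neg {v : N} : DnE x (-y0) E (-y) v ↔ UpE x y0 E y v := by
  simp [UpE, DnE, lin_neg]

lemma upE_mirror {v : N} (hlt : ∀ a b, E a b → x a < x b) :
    UpE (-x) y0 (fun a b => E b a) y v ↔ UpE x y0 E y v := by
  constructor
  · rintro ⟨a, b, h1, h2, h3, h4, h5⟩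
    rw [lin_mirror (hlt _ _ h1)] at h4 h5
    simp only [Pi.neg_apply, neg_lt_neg_iff, neg_neg] at *
    exact ⟨b, a, h1, h3, h2, h4, h5⟩
  · rintro ⟨a, b, h1, h2, h3, h4, h5⟩
    refine ⟨b, a, h1, ?_, ?_, ?_, ?_⟩
    · simpa
    · simpa
    · rw [lin_mirror (hlt _ _ h1)]; simpa
    · rw [lin_mirror (hlt _ _ h1)]; simpa

lemma dnE_mirror {v : N} (hlt : ∀ a b, E a b → x a < x b) :
    DnE (-x) y0 (fun a b => E b a) y v ↔ DnE x y0 E y v := by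
  rw [← upE_neg, ← upE_neg, upE_mirror hlt]

lemma WeakFix.neg (h : WeakFix x y0 E d y) : WeakFix x (-y0) E d (-y) where
  up := fun h1 h2 h3 h4 => by
    simp only [lin_neg, Pi.neg_apply, neg_lt_neg_iff, neg_le_neg_iff] at *
    exact h.dn h1 h2 h3 h4
  dn := fun h1 h2 h3 h4 => by
    simp only [lin_neg, Pi.neg_apply, neg_lt_neg_iff, neg_le_neg_iff] at *
    exact h.up h1 h2 h3 h4
  tight := fun hv => by rw [upE_neg, dnE_neg]; exact (h.tight hv).symm

lemma WeakFix.mirror (h : WeakFix x y0 E d y) (hlt : ∀ {a b}, E a b → x a < x b) :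
    WeakFix (-x) y0 (fun a b => E b a) d y where
  up := fun h1 h2 h3 h4 => by
    rw [lin_mirror (hlt h1)] at *
    simp only [Pi.neg_apply, neg_lt_neg_iff, neg_neg] at *
    exact h.up h1 h3 h2 h4
  dn := fun h1 h2 h3 h4 => by
    rw [lin_mirror (hlt h1)] at *
    simp only [Pi.neg_apply, neg_lt_neg_iff, neg_neg] at *
    exact h.dn h1 h3 h2 h4
  tight := fun hv => (upE_mirror (x := x) (E := E) fun _ _ => hlt).trans
    ((h.tight hv).trans (dnE_mirror (x := x) (E := E) fun _ _ => hlt).symm)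

namespace CoreBase

variable (H : CoreBase x y0 E s d t)
include H

lemma exists_left (hy : WeakFix x y0 E d y) {a b c e v : N} (hab : E a b) (hce : E c e)
    (hx : ¬ Xing x y0 a b c e) (h1 : x a < x v) (h2 : x v ≤ x b) (h3 : x c < x v)
    (h4 : x v ≤ x e) (h5 : lin x y0 c e (x v) < lin x y0 a b (x v)) :
    ∃ l < x v, x c ≤ l ∧ lin x y c e l ≤ lin x y a b l := by
  have key : ∀ ξ, x a ≤ ξ → x c ≤ ξ → ξ < x v → lin x y0 c e ξ ≤ lin x y0 a b ξ :=
    fun ξ g1 g2 g3 => not_lt.1 fun h => hx ⟨ξ, x v, ⟨g1, g3.le.trans h2, g2, g3.le.trans h4⟩,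
      ⟨h1.le, h2, h3.le, h4⟩, h, h5⟩
  rcases lt_trichotomy (x a) (x c) with g | g | g
  · have k := key _ g.le le_rfl h3
    have h := h3.trans_le h2
    rw [lin_left] at k
    exact ⟨x c, h3, le_rfl, lin_left.trans_le (hy.up hab g h (k.lt_of_ne (H.hon hab g h)))⟩
  · obtain rfl := H.inj g
    exact ⟨x a, h3, le_rfl, by simp⟩
  · have k := key _ le_rfl g.le h1
    have h := h1.trans_le h4
    rw [lin_left] at k
    exact ⟨x a, h1, g.le, (hy.dn hce g h (k.lt_of_ne (H.hon hce g h).symm)).trans_eq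
      lin_left.symm⟩

lemma collinear_of_touch (hy : WeakFix x y0 E d y) {a b c e v : N} (hab : E a b) (hce : E c e)
    (h1 : x a < x v) (h2 : x v < x b) (h3 : x c < x v) (h4 : x v < x e)
    (hup : y0 v < lin x y0 a b (x v)) (hdn : lin x y0 c e (x v) < y0 v)
    (tu : y v = lin x y a b (x v)) (td : y v = lin x y c e (x v)) (ξ : ℝ) :
    lin x y a b ξ = lin x y c e ξ := by
  have hx := H.pinch hab hce h1 h2 h3 h4 hdn hup
  have h5 := hdn.trans hup
  have ha := H.lt hab
  have hc := H.lt hce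
  obtain ⟨l, hl, -, hl'⟩ := H.exists_left hy hab hce hx h1 h2.le h3 h4.le h5
  obtain ⟨r, hr, -, hr'⟩ := H.mirror.exists_left (hy.mirror H.lt) hab hce
    (fun h => hx (h.of_mirror ha hc)) (v := v) (by simpa) (by simpa using h1.le) (by simpa)
    (by simpa using h3.le) (by rw [lin_mirror ha, lin_mirror hc]; simpa)
  rw [lin_mirror ha, lin_mirror hc] at hr'
  exact lin_aff.eq_of_touch lin_aff hl (lt_neg_of_lt_neg hr) hl' hr' (tu.symm.trans td) ξ

lemma squeeze_left (hy : WeakFix x y0 E d y) {a b : N} (hab : E a b)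
    (h1 : x a < x d) (h2 : x d < x b) (hup : y0 d < lin x y0 a b (x d))
    (tu : y d = lin x y a b (x d)) : y s ≤ lin x y a b (x s) := by
  have hsd := H.lt H.hsd
  obtain ⟨l, hl, h3, h4⟩ := H.exists_left hy hab H.hsd (H.path_left hab) h1 h2.le hsd le_rfl
    (by rwa [lin_right hsd])
  simpa using lin_aff.le_left lin_aff hl h4 (by rw [lin_right hsd, tu]) h3

lemma squeeze_right (hy : WeakFix x y0 E d y) {a b : N} (hab : E a b)
    (h1 : x a < x d) (h2 : x d < x b) (hup : y0 d < lin x y0 a b (x d))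
    (tu : y d = lin x y a b (x d)) : y t ≤ lin x y a b (x t) := by
  have hlt := H.lt hab
  have := H.mirror.squeeze_left (hy.mirror H.lt) (a := b) (b := a) hab (by simpa) (by simpa)
    (by rw [lin_mirror hlt]; simpa) (by rw [lin_mirror hlt]; simpa)
  rw [lin_mirror hlt] at this
  simpa using this

lemma chord_le (hy : WeakFix x y0 E d y) (hd : UpE x y0 E y d) : lin x y s t (x d) ≤ y d := by
  obtain ⟨a, b, hab, h1, h2, h3, h4⟩ := hd
  have hs := H.squeeze_left hy hab h1 h2 h3 h4
  have ht := H.squeeze_right hy hab h1 h2 h3 h4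
  obtain ⟨l, hl, hl1, -, h⟩ := lin_mix (x := x) (H.lt H.hsd) (H.lt H.hdt)
  rw [h4, h y, ← lin_eq_of_aff (x := x) (y := fun z => lin x y a b (x z)) (lin_aff (y := y))
    ((H.lt H.hsd).trans (H.lt H.hdt)) rfl rfl, h]
  nlinarith

lemma le_chord (hy : WeakFix x y0 E d y) (hd : DnE x y0 E y d) : y d ≤ lin x y s t (x d) := by
  simpa [lin_neg] using H.neg.chord_le hy.neg (upE_neg.2 hd)

end CoreBase
end core

section core
variable {N : Type*}

lemma lt_chord [Finite N] {x y0 : N → ℝ} {on : N → Prop} {l r v : N} (hx : Function.Injective x)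
    (h : ∀ z, on z → x l < x z → x z < x r → ∃ a b, on a ∧ on b ∧ x l ≤ x a ∧ x b ≤ x r ∧
      x a < x z ∧ x z < x b ∧ y0 z < lin x y0 a b (x z))
    (hv : on v) (h1 : x l < x v) (h2 : x v < x r) : y0 v < lin x y0 l r (x v) := by
  have hlr := h1.trans h2
  let f := fun z => y0 z - lin x y0 l r (x z)
  have step : ∀ z, on z → x l < x z → x z < x r →
      ∃ w, on w ∧ x l ≤ x w ∧ x w ≤ x r ∧ f z < f w := by
    intro z hz hl hr
    obtain ⟨a, b, ha, hb, h3, h4, h5, h6, h7⟩ := h z hz hl hr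
    by_contra! hc
    have ka := hc a ha h3 (h5.trans hr).le
    have kb := hc b hb (hl.trans h6).le h4
    obtain ⟨m, hm, hm1, -, k⟩ := lin_mix h5 h6
    have k1 := lin_eq_of_aff (x := x) (y := fun z => lin x y0 l r (x z)) (lin_aff (y := y0))
      (h5.trans h6) rfl rfl (x z)
    rw [k] at h7 k1
    simp only [f] at ka kb
    nlinarith
  obtain ⟨M, ⟨hM, hl, hr⟩, hmax⟩ := Set.exists_max_image {z | on z ∧ x l ≤ x z ∧ x z ≤ x r} f
    (Set.toFinite _) ⟨v, hv, h1.le, h2.le⟩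
  obtain ⟨w, hw, hw1, hw2, hlt⟩ := step v hv h1 h2
  have hM0 : f M ≤ 0 := by
    rcases hl.eq_or_lt with hl | hl
    · simp [f, ← hx hl]
    rcases hr.eq_or_lt with hr | hr
    · simp [f, hx hr, lin_right hlr]
    obtain ⟨w, hw, hw1, hw2, hlt⟩ := step M hM hl hr
    exact absurd hlt (not_lt.2 (hmax w ⟨hw, hw1, hw2⟩))
  exact sub_neg.1 ((hlt.trans_le (hmax w ⟨hw, hw1, hw2⟩)).trans_le hM0)

lemma exists_next_uncovered [Finite N] {x : N → ℝ} {on cov : N → Prop} {v : N} (hv : cov v)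
    (hcov : ∀ z, cov z → ∃ b, on b ∧ x z < x b) :
    ∃ r, on r ∧ x v < x r ∧ ¬ cov r ∧ ∀ z, on z → x v < x z → x z < x r → cov z := by
  have hne : {z | on z ∧ x v < x z ∧ ¬ cov z}.Nonempty := by
    obtain ⟨b, hb, hvb⟩ := hcov v hv
    obtain ⟨M, hM, hmax⟩ := Set.exists_max_image {z | on z} x (Set.toFinite _) ⟨b, hb⟩
    refine ⟨M, hM, hvb.trans_le (hmax b hb), fun hc => ?_⟩
    obtain ⟨b', hb', hlt⟩ := hcov M hc
    exact absurd hlt (not_lt.2 (hmax b' hb'))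
  obtain ⟨r, hr, hmin⟩ := Set.exists_min_image _ x (Set.toFinite _) hne
  refine ⟨r, hr.1, hr.2.1, hr.2.2, fun z hz h1 h2 => ?_⟩
  by_contra hc
  exact absurd h2 (not_lt.2 (hmin z ⟨hz, h1, hc⟩))

/-- An edge both of whose ends have heights on the graph of `g`. -/
structure OnEdge (x y : N → ℝ) (E : N → N → Prop) (g : ℝ → ℝ) (a b : N) : Prop where
  edge : E a b
  left : y a = g (x a)
  right : y b = g (x b)

/-- A node on the line `g` that lies in the interior of an edge on that line. -/
def Covered (x y : N → ℝ) (E : N → N → Prop) (g : ℝ → ℝ) (z : N) : Prop :=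
  y z = g (x z) ∧ ∃ a b, OnEdge x y E g a b ∧ x a < x z ∧ x z < x b

/-- A maximal stretch of a line on which all nodes on the line are covered. -/
structure Window (x y : N → ℝ) (E : N → N → Prop) (g : ℝ → ℝ) (l r : N) : Prop where
  onl : y l = g (x l)
  onr : y r = g (x r)
  ncl : ¬ Covered x y E g l
  ncr : ¬ Covered x y E g r
  cov : ∀ z, y z = g (x z) → x l < x z → x z < x r → Covered x y E g z

variable {x y y0 : N → ℝ} {E : N → N → Prop} {s d t l r : N} {g : ℝ → ℝ}

lemma exists_window [Finite N] (hx : Function.Injective x) {v : N} (hv : Covered x y E g v) :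
    ∃ l r, Window x y E g l r ∧ x l < x v ∧ x v < x r := by
  obtain ⟨r, hr, hvr, hcr, hcov⟩ := exists_next_uncovered (x := x)
    (on := fun z => y z = g (x z)) hv
    (fun z hz => by
      obtain ⟨_, a, b, h1, h2, h3⟩ := hz
      exact ⟨b, h1.right, h3⟩)
  obtain ⟨l, hl, hlv, hcl, hcov'⟩ := exists_next_uncovered (x := -x)
    (on := fun z => y z = g (x z)) hv
    (fun z hz => by
      obtain ⟨_, a, b, h1, h2, h3⟩ := hz
      exact ⟨a, h1.left, by simpa⟩)
  simp only [Pi.neg_apply, neg_lt_neg_iff] at hlv hcov'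
  refine ⟨l, r, ⟨hl, hr, hcl, hcr, fun z hz h1 h2 => ?_⟩, hlv, hvr⟩
  rcases lt_trichotomy (x z) (x v) with h | h | h
  · exact hcov' z hz h h1
  · rwa [hx h]
  · exact hcov z hz h h2

namespace Window

lemma le_right (W : Window x y E g l r) {a b : N} (h : OnEdge x y E g a b) (ha : x a < x r) :
    x b ≤ x r := by
  by_contra hb
  exact W.ncr ⟨W.onr, a, b, h, ha, not_le.1 hb⟩

lemma le_left (W : Window x y E g l r) {a b : N} (h : OnEdge x y E g a b) (hb : x l < x b) :
    x l ≤ x a := by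
  by_contra ha
  exact W.ncl ⟨W.onl, a, b, h, not_le.1 ha, hb⟩

end Window

/-- an edge on the line covers `z` from above (in the old heights) -/
def OnUp (x y0 y : N → ℝ) (E : N → N → Prop) (g : ℝ → ℝ) (z : N) : Prop :=
  ∃ a b, OnEdge x y E g a b ∧ x a < x z ∧ x z < x b ∧ y0 z < lin x y0 a b (x z)

/-- an edge on the line covers `z` from below (in the old heights) -/
def OnDn (x y0 y : N → ℝ) (E : N → N → Prop) (g : ℝ → ℝ) (z : N) : Prop :=
  ∃ a b, OnEdge x y E g a b ∧ x a < x z ∧ x z < x b ∧ lin x y0 a b (x z) < y0 z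

lemma onUp_neg {z : N} : OnUp x (-y0) y E g z ↔ OnDn x y0 y E g z := by
  simp [OnUp, OnDn, lin_neg]

lemma Window.chord_of_onUp (W : Window x y E g l r) {z : N} (h : OnUp x y0 y E g z)
    (h1 : x l < x z) (h2 : x z < x r) : ∃ a b, y a = g (x a) ∧ y b = g (x b) ∧ x l ≤ x a ∧
      x b ≤ x r ∧ x a < x z ∧ x z < x b ∧ y0 z < lin x y0 a b (x z) := by
  obtain ⟨a, b, hab, h5, h6, h7⟩ := h
  exact ⟨a, b, hab.left, hab.right, W.le_left hab (h1.trans h6), W.le_right hab (h5.trans h2),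
    h5, h6, h7⟩

namespace CoreBase

variable (H : CoreBase x y0 E s d t)
include H

lemma onEdge_touch (hg : Aff g) {a b z : N}
    (h : OnEdge x y E g a b) (hz : y z = g (x z)) : y z = lin x y a b (x z) := by
  rw [lin_eq_of_aff hg (H.lt h.edge) h.left h.right, hz]

lemma onUp_and_onDn (hy : WeakFix x y0 E d y) (hg : Aff g) {z : N} (hz : Covered x y E g z)
    (ht : UpE x y0 E y z ↔ DnE x y0 E y z) : OnUp x y0 y E g z ∧ OnDn x y0 y E g z := by
  obtain ⟨hzg, a, b, hab, k1, k2⟩ := hz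
  have k0 := H.onEdge_touch hg hab hzg
  have hl := lin_eq_of_aff hg (H.lt hab.edge) hab.left hab.right
  have on : ∀ {a' b'}, E a' b' → (∀ ξ, lin x y a' b' ξ = g ξ) → OnEdge x y E g a' b' :=
    fun h k => ⟨h, by rw [← k, lin_left], by rw [← k, lin_right (H.lt h)]⟩
  rcases lt_or_gt_of_ne (H.hon hab.edge k1 k2) with h | h
  · obtain ⟨a', b', hab', h1, h2, h3, h4⟩ := ht.1 ⟨a, b, hab.edge, k1, k2, h, k0⟩
    exact ⟨⟨a, b, hab, k1, k2, h⟩, a', b', on hab' fun ξ => by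
      rw [← H.collinear_of_touch hy hab.edge hab' k1 k2 h1 h2 h h3 k0 h4, hl], h1, h2, h3⟩
  · obtain ⟨a', b', hab', h1, h2, h3, h4⟩ := ht.2 ⟨a, b, hab.edge, k1, k2, h, k0⟩
    exact ⟨⟨a', b', on hab' fun ξ => by
      rw [H.collinear_of_touch hy hab' hab.edge h1 h2 k1 k2 h3 h h4 k0, hl], h1, h2, h3⟩,
      a, b, hab, k1, k2, h⟩

lemma strictValid_of_tight [Finite N] (hy : WeakFix x y0 E d y)
    (hd : UpE x y0 E y d ↔ DnE x y0 E y d) : StrictValid x y0 E y := by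
  have tight : ∀ v, UpE x y0 E y v ↔ DnE x y0 E y v := fun v => by
    by_cases h : v = d
    · rwa [h]
    · exact hy.tight h
  have key : ∀ {a b v}, E a b → x a < x v → x v < x b → y v ≠ lin x y a b (x v) := by
    intro a b v hab h1 h2 h3
    obtain ⟨l, r, W, hl, hr⟩ := exists_window (g := lin x y a b) H.inj
      ⟨h3, a, b, ⟨hab, lin_left.symm, (lin_right (h1.trans h2)).symm⟩, h1, h2⟩
    have both := fun z hz k1 k2 => H.onUp_and_onDn hy lin_aff (W.cov z hz k1 k2) (tight z)
    have k1 := lt_chord (y0 := y0) H.inj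
      (fun z hz k1 k2 => W.chord_of_onUp (both z hz k1 k2).1 k1 k2) h3 hl hr
    have k2 := lt_chord (y0 := -y0) H.inj
      (fun z hz k1 k2 => W.chord_of_onUp (onUp_neg.2 (both z hz k1 k2).2) k1 k2) h3 hl hr
    rw [lin_neg] at k2
    exact lt_asymm k1 (neg_lt_neg_iff.1 k2)
  exact ⟨fun h1 h2 h3 h4 => (hy.up h1 h2 h3 h4).lt_of_ne (key h1 h2 h3),
    fun h1 h2 h3 h4 => (hy.dn h1 h2 h3 h4).lt_of_ne (key h1 h2 h3).symm⟩

end CoreBase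
end core

section core
variable {N : Type*} {x y y0 : N → ℝ} {E : N → N → Prop} {s d t l r : N} {g : ℝ → ℝ}

/-- The hypotheses under which the bend at `d` of the path `s, d, t` can be straightened. -/
structure CoreHyp (x y0 : N → ℝ) (E : N → N → Prop) (s d t : N) : Prop
    extends CoreBase x y0 E s d t where
  sides : ∀ {a b c e}, E a b → E c e → Xing x y0 a b c e → E a e
  nst : ¬ E s t
  bend : y0 d < lin x y0 s t (x d)
  low_left : ∀ {a ξ}, E a d → ξ < x d → lin x y0 a d ξ < lin x y0 s d ξ →
    E a t ∧ lin x y0 a t (x d) < y0 d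
  low_right : ∀ {b ξ}, E d b → x d < ξ → lin x y0 d b ξ < lin x y0 d t ξ →
    E s b ∧ lin x y0 s b (x d) < y0 d

lemma CoreHyp.mirror (h : CoreHyp x y0 E s d t) :
    CoreHyp (-x) y0 (fun a b => E b a) t d s where
  toCoreBase := h.toCoreBase.mirror
  sides := fun h1 h2 h3 => h.sides h2 h1 (h3.of_mirror (h.lt h1) (h.lt h2)).symm
  nst := h.nst
  bend := by
    rw [lin_mirror ((h.lt h.hsd).trans (h.lt h.hdt))]
    simpa using h.bend
  low_left := fun {a ξ} h1 h2 h3 => by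
    rw [lin_mirror (h.lt h1), lin_mirror (h.lt h.hdt)] at h3
    have := h.low_right h1 (by simp only [Pi.neg_apply] at h2; linarith) h3
    refine ⟨this.1, ?_⟩
    rw [lin_mirror (h.lt this.1)]
    simpa using this.2
  low_right := fun {a ξ} h1 h2 h3 => by
    rw [lin_mirror (h.lt h1), lin_mirror (h.lt h.hsd)] at h3
    have := h.low_left h1 (by simp only [Pi.neg_apply] at h2; linarith) h3
    refine ⟨this.1, ?_⟩
    rw [lin_mirror (h.lt this.1)]
    simpa using this.2

lemma OnEdge.mirror {a b : N} (h : OnEdge x y E g a b) :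
    OnEdge (-x) y (fun a b => E b a) (fun ξ => g (-ξ)) b a :=
  ⟨h.edge, by simpa using h.right, by simpa using h.left⟩

lemma OnEdge.of_mirror {a b : N} (h : OnEdge (-x) y (fun a b => E b a) (fun ξ => g (-ξ)) b a) :
    OnEdge x y E g a b :=
  ⟨h.edge, by simpa using h.right, by simpa using h.left⟩

lemma covered_mirror {z : N} :
    Covered (-x) y (fun a b => E b a) (fun ξ => g (-ξ)) z ↔ Covered x y E g z := by
  constructor
  · rintro ⟨h, a, b, h1, h2, h3⟩
    exact ⟨by simpa using h, b, a, h1.of_mirror, by simpa using h3, by simpa using h2⟩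
  · rintro ⟨h, a, b, h1, h2, h3⟩
    exact ⟨by simpa using h, b, a, h1.mirror, by simpa using h3, by simpa using h2⟩

lemma Window.mirror (W : Window x y E g l r) :
    Window (-x) y (fun a b => E b a) (fun ξ => g (-ξ)) r l where
  onl := by simpa using W.onr
  onr := by simpa using W.onl
  ncl := by rw [covered_mirror]; exact W.ncr
  ncr := by rw [covered_mirror]; exact W.ncl
  cov := fun z hz h1 h2 => by
    rw [covered_mirror]
    exact W.cov z (by simpa using hz) (by simpa using h2) (by simpa using h1)

namespace CoreHyp

variable (H : CoreHyp x y0 E s d t)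
include H

lemma eq_left_end [Finite N] (W : Window x y E g l r) (hld : x l < x d)
    (hdr : x d < x r) (hs : y s = g (x s)) (hd : y d = g (x d)) (ht : y t = g (x t))
    (hdn : ∀ z, y z = g (x z) → x l < x z → x z < x r → z ≠ d → OnDn x y0 y E g z)
    (hnd : ¬ OnDn x y0 y E g d) : s = l := by
  have hsd := H.lt H.hsd
  have hdt := H.lt H.hdt
  have hls : x l ≤ x s := W.le_left ⟨H.hsd, hs, hd⟩ hld
  have low : ∀ p : N × N, OnEdge x y E g p.1 p.2 → ∀ ξ, x s ≤ ξ → ξ < x d → x p.1 ≤ ξ →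
      ξ < x p.2 → ¬ lin x y0 p.1 p.2 ξ < lin x y0 s d ξ := by
    by_contra hcon
    push Not at hcon
    obtain ⟨p, hp⟩ := hcon
    obtain ⟨⟨a, b⟩, ⟨hab, ξ, h1, h2, h3, h4, h5⟩, hmax⟩ := Set.exists_max_image
      {p : N × N | OnEdge x y E g p.1 p.2 ∧ ∃ ξ, x s ≤ ξ ∧ ξ < x d ∧ x p.1 ≤ ξ ∧
        ξ < x p.2 ∧ lin x y0 p.1 p.2 ξ < lin x y0 s d ξ} (fun p => x p.2) (Set.toFinite _) ⟨p, hp⟩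
    simp only at hab h3 h4 h5 hmax
    have key : ∀ ξ', x a ≤ ξ' → ξ' ≤ x b → x s ≤ ξ' → ξ' ≤ x d →
        lin x y0 a b ξ' ≤ lin x y0 s d ξ' := by
      intro ξ' g1 g2 g3 g4
      by_contra hlt
      push Not at hlt
      exact H.path_left hab.edge ⟨ξ, ξ', ⟨h3, h4.le, h1, h2.le⟩, ⟨g1, g2, g3, g4⟩, h5, hlt⟩
    have hab' := H.lt hab.edge
    rcases lt_trichotomy (x b) (x d) with hb | hb | hb
    · have hsb : x s < x b := h1.trans_lt h4
      have k := key (x b) hab'.le le_rfl hsb.le hb.le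
      rw [lin_right hab'] at k
      have k2 := lt_of_le_of_ne k (H.hon H.hsd hsb hb)
      have hbd : b ≠ d := fun h => hb.ne (by rw [h])
      obtain ⟨a', b', hab1, m1, m2, m3⟩ :=
        hdn b hab.right (hls.trans_lt hsb) (hb.trans hdr) hbd
      have := hmax (a', b') ⟨hab1, x b, hsb.le, hb, m1.le, m2, m3.trans k2⟩
      exact absurd m2 (not_lt.2 this)
    · have hbd := H.inj hb
      subst hbd
      obtain ⟨h6, h7⟩ := H.low_left hab.edge h2 h5
      exact hnd ⟨a, t, ⟨h6, hab.left, ht⟩, hab', hdt, h7⟩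
    · have had : x a < x d := h3.trans_lt h2
      have k := key (x d) had.le hb.le hsd.le le_rfl
      rw [lin_right hsd] at k
      exact hnd ⟨a, b, hab, had, hb, lt_of_le_of_ne k (H.hon hab.edge had hb).symm⟩
  by_contra hne
  have hls' : x l < x s := lt_of_le_of_ne hls fun h => hne (H.inj h.symm)
  obtain ⟨a, b, hab, m1, m2, m3⟩ := hdn s hs hls' (hsd.trans hdr) fun h => by
    rw [h] at hsd; exact hsd.false
  exact low (a, b) hab (x s) le_rfl hsd m1.le m2 (by simpa using m3)

lemma eq_right_end [Finite N] (W : Window x y E g l r) (hld : x l < x d)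
    (hdr : x d < x r) (hs : y s = g (x s)) (hd : y d = g (x d)) (ht : y t = g (x t))
    (hdn : ∀ z, y z = g (x z) → x l < x z → x z < x r → z ≠ d → OnDn x y0 y E g z)
    (hnd : ¬ OnDn x y0 y E g d) : t = r := by
  refine H.mirror.eq_left_end W.mirror (by simpa) (by simpa) (by simpa) (by simpa) (by simpa)
    (fun z h1 h2 h3 h4 => ?_) fun ⟨a, b, h1, h2, h3, h4⟩ => hnd ⟨b, a, h1.of_mirror, ?_⟩
  · obtain ⟨a, b, k1, k2, k3, k4⟩ :=
      hdn z (by simpa using h1) (by simpa using h3) (by simpa using h2) h4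
    refine ⟨b, a, k1.mirror, by simpa, by simpa, ?_⟩
    rw [lin_mirror (H.lt k1.edge)]
    simpa
  · rw [lin_mirror (H.lt h1.edge)] at h4
    simp_all

lemma false_of_window [Finite N] (W : Window x y E g s t) (hd : y d = g (x d))
    (hup : ∀ z, y z = g (x z) → x s < x z → x z < x t → OnUp x y0 y E g z) : False := by
  have hsd := H.lt H.hsd
  have hdt := H.lt H.hdt
  obtain ⟨ρ, ⟨hρ, hρg, hρt⟩, hmax⟩ := Set.exists_max_image
    {ρ | E s ρ ∧ y ρ = g (x ρ) ∧ x ρ ≤ x t} (fun ρ => lin x y0 s ρ (x s + 1))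
    (Set.toFinite _) ⟨d, H.hsd, hd, hdt.le⟩
  have hsρ := H.lt hρ
  have hρt' : x ρ < x t := lt_of_le_of_ne hρt fun h => H.nst (H.inj h ▸ hρ)
  have steep : ∀ b, E s b → y b = g (x b) → x b ≤ x t → ∀ ξ, x s < ξ →
      ¬ lin x y0 s ρ ξ < lin x y0 s b ξ := by
    intro b h1 h2 h3 ξ h4 h5
    have := lin_aff.lt_of_common (lin_aff (x := x) (y := y0) (a := s) (b := ρ)) (by simp) h4 h5
      (v := x s + 1) (by linarith)
    exact absurd this (not_lt.2 (hmax b ⟨h1, h2, h3⟩))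
  obtain ⟨a, b, hab, k1, k2, k3⟩ := hup ρ hρg hsρ hρt'
  obtain ⟨⟨a, b⟩, ⟨hab, hsa, ξ, h1, h2, h3, h4, h5⟩, hmin⟩ := Set.exists_min_image
    {p : N × N | OnEdge x y E g p.1 p.2 ∧ x s ≤ x p.1 ∧ ∃ ξ, x s < ξ ∧ ξ ≤ x ρ ∧ x p.1 ≤ ξ ∧
      ξ ≤ x p.2 ∧ lin x y0 s ρ ξ < lin x y0 p.1 p.2 ξ} (fun p => x p.1) (Set.toFinite _)
    ⟨(a, b), hab, W.le_left hab (hsρ.trans k2), x ρ, hsρ, le_rfl, k1.le, k2.le, by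
      rwa [lin_right hsρ]⟩
  simp only at hab hsa h3 h4 h5 hmin
  have hab' := H.lt hab.edge
  have hbt : x b ≤ x t := W.le_right hab (h3.trans_lt (h2.trans_lt hρt'))
  rcases hsa.eq_or_lt with hsa | hsa
  · have := H.inj hsa
    subst this
    exact steep b hab.edge hab.right hbt ξ h1 h5
  · have haρ : x a < x ρ := by
      refine lt_of_le_of_ne (h3.trans h2) fun h => ?_
      have h' := H.inj h
      subst h'
      have : ξ = x a := le_antisymm h2 h3
      subst this
      rw [lin_left, lin_right hsρ] at h5
      exact h5.false
    rcases lt_or_gt_of_ne (H.hon hρ hsa haρ) with h6 | h6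
    · have hx : Xing x y0 s ρ a b := by
        refine ⟨ξ, x a, ⟨h1.le, h2, h3, h4⟩, ⟨hsa.le, haρ.le, le_rfl, hab'.le⟩, h5, ?_⟩
        rwa [lin_left]
      have haξ : x a < ξ := lt_of_le_of_ne h3 fun h => by
        rw [← h, lin_left] at h5; exact lt_asymm h5 h6
      have hsb := H.sides hρ hab.edge hx
      refine steep b hsb hab.right hbt (x b) (H.lt hsb) ?_
      have := lin_aff.pos_right (lin_aff (x := x) (y := y0) (a := s) (b := ρ)) haξ
        (by rwa [lin_left]) h5 h4
      rw [lin_right hab'] at this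
      rwa [lin_right (H.lt hsb)]
    · obtain ⟨a', b', hab1, m1, m2, m3⟩ := hup a hab.left hsa (haρ.trans hρt')
      have := hmin (a', b') ⟨hab1, W.le_left hab1 (hsa.trans m2), x a, hsa, haρ.le, m1.le, m2.le,
        h6.trans m3⟩
      exact absurd m1 (not_lt.2 this)

omit H in
lemma on_of_chord (hst : x s < x d) (hdt : x d < x t) (hg : Aff g) (hs : y s ≤ g (x s))
    (ht : y t ≤ g (x t)) (hd : g (x d) = lin x y s t (x d)) :
    y s = g (x s) ∧ y t = g (x t) := by
  have := hg.eq_of_touch (lin_aff (x := x) (y := y) (a := s) (b := t)) hst hdt (by simpa)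
    (by rwa [lin_right (hst.trans hdt)]) hd
  exact ⟨by rw [this, lin_left], by rw [this, lin_right (hst.trans hdt)]⟩

theorem strictValid_of_chord [Finite N] (hy : WeakFix x y0 E d y)
    (hd : y d = lin x y s t (x d)) : StrictValid x y0 E y := by
  have hsd := H.lt H.hsd
  have hdt := H.lt H.hdt
  have base := H.toCoreBase
  by_cases hbal : UpE x y0 E y d ↔ DnE x y0 E y d
  · exact base.strictValid_of_tight hy hbal
  exfalso
  have main : ∀ g : ℝ → ℝ, Aff g → Covered x y E g d → y s = g (x s) → y t = g (x t) → False := by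
    intro g hg hcov hs ht
    obtain ⟨l, r, W, hl, hr⟩ := exists_window H.inj hcov
    have both := fun z hz k1 k2 h => base.onUp_and_onDn hy hg (W.cov z hz k1 k2) (hy.tight h)
    have hls := W.le_left ⟨H.hsd, hs, hcov.1⟩ hl
    have htr := W.le_right ⟨H.hdt, hcov.1, ht⟩ hr
    by_cases hdn : OnDn x y0 y E g d
    · have k1 := lt_chord (y0 := y0) (on := fun z => y z = g (x z)) H.inj (fun z k1 k2 k3 => by
        by_cases hz : z = d
        · subst hz
          exact ⟨s, t, hs, ht, hls, htr, hsd, hdt, H.bend⟩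
        · exact W.chord_of_onUp (both z k1 k2 k3 hz).1 k2 k3) hcov.1 hl hr
      have k2 := lt_chord (y0 := -y0) H.inj (fun z k1 k2 k3 => W.chord_of_onUp (onUp_neg.2 (by
        by_cases hz : z = d
        · rwa [hz]
        · exact (both z k1 k2 k3 hz).2)) k2 k3) hcov.1 hl hr
      rw [lin_neg] at k2
      exact lt_asymm k1 (neg_lt_neg_iff.1 k2)
    · have hsl := H.eq_left_end W hl hr hs hcov.1 ht (fun z a b c e => (both z a b c e).2) hdn
      have htr := H.eq_right_end W hl hr hs hcov.1 ht (fun z a b c e => (both z a b c e).2) hdn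
      subst hsl htr
      refine H.false_of_window W hcov.1 fun z k1 k2 k3 => ?_
      by_cases hz : z = d
      · subst hz
        obtain ⟨_, a, b, hab, m1, m2⟩ := hcov
        rcases lt_or_gt_of_ne (H.hon hab.edge m1 m2) with h | h
        · exact ⟨a, b, hab, m1, m2, h⟩
        · exact absurd ⟨a, b, hab, m1, m2, h⟩ hdn
      · exact (both z k1 k2 k3 hz).1
  by_cases hu : UpE x y0 E y d
  · obtain ⟨a, b, hab, h1, h2, h3, h4⟩ := hu
    obtain ⟨hs, ht⟩ := on_of_chord hsd hdt lin_aff (base.squeeze_left hy hab h1 h2 h3 h4)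
      (base.squeeze_right hy hab h1 h2 h3 h4) (h4.symm.trans hd)
    exact main (lin x y a b) lin_aff ⟨h4, a, b, ⟨hab, lin_left.symm,
      (lin_right (h1.trans h2)).symm⟩, h1, h2⟩ hs ht
  · have hn : DnE x y0 E y d := by tauto
    obtain ⟨a, b, hab, h1, h2, h3, h4⟩ := hn
    have k1 := base.neg.squeeze_left hy.neg hab h1 h2 (by simpa [lin_neg]) (by simpa [lin_neg])
    have k2 := base.neg.squeeze_right hy.neg hab h1 h2 (by simpa [lin_neg]) (by simpa [lin_neg])
    obtain ⟨hs, ht⟩ := on_of_chord hsd hdt lin_aff k1 k2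
      (by rw [lin_neg, lin_neg, ← hd, h4])
    simp only [lin_neg, Pi.neg_apply, neg_inj] at hs ht
    exact main (lin x y a b) lin_aff ⟨h4, a, b, ⟨hab, lin_left.symm,
      (lin_right (h1.trans h2)).symm⟩, h1, h2⟩ hs ht

end CoreHyp
end core

section core
variable {N : Type*} {x y y' y0 φ θ : N → ℝ} {E : N → N → Prop} {s d t v : N}
  {T K κ τ c : ℝ}

lemma mix_eq {z l u : ℝ} {θ : ℝ} (hτ : 0 ≤ τ) (hτ1 : τ < 1) (hθ : 0 < θ) (hθ1 : θ < 1)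
    (hz : (1 - τ) * ((1 - θ) * l + θ * u) + τ * c = z) (hl : l ≤ z) (hu : u ≤ z) (hc : c ≤ z) :
    z = l ∧ z = u := by
  have h1 := mul_nonneg hτ (sub_nonneg.2 hc)
  have h2 := sub_pos.2 hτ1
  have h3 := mul_pos h2 (sub_pos.2 hθ1)
  have h4 := mul_pos h2 hθ
  have h5 := mul_nonneg h3.le (sub_nonneg.2 hl)
  have h6 := mul_nonneg h4.le (sub_nonneg.2 hu)
  constructor <;> refine le_antisymm (not_lt.1 fun h => ?_) ‹_›
  · nlinarith [mul_pos h3 (sub_pos.2 h)]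
  · nlinarith [mul_pos h4 (sub_pos.2 h)]

variable [Fintype N]

open Classical in
/-- The upper barrier at `v`: the lowest among `T` and the edges that are above `v` in `y0`. -/
noncomputable def upper (x y0 : N → ℝ) (E : N → N → Prop) (T : ℝ) (y : N → ℝ) (v : N) : ℝ :=
  Finset.univ.inf' (@Finset.univ_nonempty _ _ ⟨(v, v)⟩) fun q : N × N =>
    if E q.1 q.2 ∧ x q.1 < x v ∧ x v < x q.2 ∧ y0 v < lin x y0 q.1 q.2 (x v)
    then lin x y q.1 q.2 (x v) else T

/-- The lower barrier at `v`. -/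
noncomputable def lower (x y0 : N → ℝ) (E : N → N → Prop) (T : ℝ) (y : N → ℝ) (v : N) : ℝ :=
  - upper x (-y0) E T (-y) v

lemma le_upper_iff : c ≤ upper x y0 E T y v ↔ c ≤ T ∧ ∀ a b, E a b → x a < x v → x v < x b →
    y0 v < lin x y0 a b (x v) → c ≤ lin x y a b (x v) := by
  simp only [upper, Finset.le_inf'_iff, Finset.mem_univ, true_imp_iff, Prod.forall]
  refine ⟨fun h => ⟨by simpa using h v v, fun a b h1 h2 h3 h4 => ?_⟩, fun h a b => ?_⟩
  · simpa [h1, h2, h3, h4] using h a b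
  · grind

lemma lt_upper_iff : c < upper x y0 E T y v ↔ c < T ∧ ∀ a b, E a b → x a < x v → x v < x b →
    y0 v < lin x y0 a b (x v) → c < lin x y a b (x v) := by
  simp only [upper, Finset.lt_inf'_iff, Finset.mem_univ, true_imp_iff, Prod.forall]
  refine ⟨fun h => ⟨by simpa using h v v, fun a b h1 h2 h3 h4 => ?_⟩, fun h a b => ?_⟩
  · simpa [h1, h2, h3, h4] using h a b
  · grind

lemma lower_lt_iff : lower x y0 E T y v < c ↔ -T < c ∧ ∀ a b, E a b → x a < x v → x v < x b →
    lin x y0 a b (x v) < y0 v → lin x y a b (x v) < c := by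
  rw [lower, neg_lt, lt_upper_iff]
  simp only [lin_neg, Pi.neg_apply, neg_lt_neg_iff, neg_lt]

lemma upper_le_bound : upper x y0 E T y v ≤ T := (le_upper_iff.1 le_rfl).1

lemma upper_neg : upper x (-y0) E T (-y) v = - lower x y0 E T y v := by
  rw [lower, neg_neg]

lemma lower_neg : lower x (-y0) E T (-y) v = - upper x y0 E T y v := by
  rw [lower, neg_neg, neg_neg]

lemma continuous_upper (v : N) : Continuous fun y => upper x y0 E T y v := by
  refine Continuous.finset_inf'_apply _ fun q _ => ?_
  unfold lin
  split_ifs <;> fun_prop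

lemma continuous_lower (v : N) : Continuous fun y => lower x y0 E T y v :=
  ((continuous_upper v).comp continuous_neg).neg

/-- The averaging operator. -/
noncomputable def relax (x y0 : N → ℝ) (E : N → N → Prop) (T : ℝ) (θ y : N → ℝ) (v : N) : ℝ :=
  (1 - θ v) * lower x y0 E T y v + θ v * upper x y0 E T y v

open Classical in
/-- The averaging operator with the height of `d` partially drawn to the chord `s t`. -/
noncomputable def relaxTo (x y0 : N → ℝ) (E : N → N → Prop) (T : ℝ) (θ : N → ℝ) (s d t : N)
    (τ : ℝ) (y : N → ℝ) (v : N) : ℝ :=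
  if v = d then (1 - τ) * relax x y0 E T θ y v + τ * lin x y s t (x v)
  else relax x y0 E T θ y v

lemma relaxTo_neg : relaxTo x (-y0) E T (1 - θ) s d t τ (-y) = - relaxTo x y0 E T θ s d t τ y := by
  funext v
  simp only [relaxTo, relax, upper_neg, lower_neg, lin_neg, Pi.neg_apply, Pi.sub_apply,
    Pi.one_apply]
  split_ifs <;> ring

omit [Fintype N] in
lemma exists_weight [Finite N] (x : N → ℝ) (v : N) : ∃ φ : N → ℝ, ∃ κ : ℝ, 0 ≤ κ ∧ κ < 1 ∧
    (∀ v, 0 < φ v) ∧ ∀ a b v, x a < x v → x v < x b → lin x φ a b (x v) ≤ κ * φ v := by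
  have : Nonempty N := ⟨v⟩
  obtain ⟨m, hm⟩ := Finite.exists_max fun v => x v ^ 2
  let φ : N → ℝ := fun v => x m ^ 2 + 1 - x v ^ 2
  have hpos : ∀ v, 0 < φ v := fun v => by linarith [hm v]
  let r : N × N × N → ℝ := fun q => lin x φ q.1 q.2.1 (x q.2.2) / φ q.2.2
  let B : Set (N × N × N) := {q | x q.1 < x q.2.2 ∧ x q.2.2 < x q.2.1}
  have hr : ∀ q ∈ B, r q < 1 := by
    rintro ⟨a, b, v⟩ ⟨h1, h2⟩
    obtain ⟨l, h3, h4, h5, h6⟩ := lin_mix h1 h2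
    rw [div_lt_one (hpos v), h6]
    dsimp only [φ] at *
    rw [h5]
    nlinarith [mul_pos (mul_pos h3 (sub_pos.2 h4)) (pow_pos (sub_pos.2 (h1.trans h2)) 2)]
  rcases B.eq_empty_or_nonempty with hB | hB
  · exact ⟨φ, 0, le_rfl, one_pos, hpos, fun a b v h1 h2 =>
      (hB.subset (show (a, b, v) ∈ B from ⟨h1, h2⟩)).elim⟩
  obtain ⟨q, hq, hmax⟩ := Set.exists_max_image B r (Set.toFinite _) hB
  refine ⟨φ, max 0 (r q), le_max_left _ _, max_lt one_pos (hr q hq), hpos, fun a b v h1 h2 => ?_⟩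
  rw [← div_le_iff₀ (hpos v)]
  exact (hmax (a, b, v) ⟨h1, h2⟩).trans (le_max_right _ _)

lemma relaxTo_le_add (hsd : x s < x d) (hdt : x d < x t)
    (hκ : ∀ a b v, x a < x v → x v < x b → lin x φ a b (x v) ≤ κ * φ v)
    (hK : 0 ≤ K) (hnn : ∀ v, 0 ≤ κ * φ v) (hφ : ∀ v, y v ≤ y' v + K * φ v)
    (hθ : ∀ v, 0 < θ v ∧ θ v < 1) (h0 : 0 ≤ τ) (h1 : τ ≤ 1) (v : N) :
    relaxTo x y0 E T θ s d t τ y v ≤ relaxTo x y0 E T θ s d t τ y' v + K * (κ * φ v) := by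
  have hl {y y' : N → ℝ} (hφ : ∀ v, y v ≤ y' v + K * φ v) {a b v} (h1 : x a < x v)
      (h2 : x v < x b) : lin x y a b (x v) ≤ lin x y' a b (x v) + K * (κ * φ v) := by
    have h5 := mul_le_mul_of_nonneg_left (hκ a b v h1 h2) hK
    obtain ⟨l, h3, h4, -, h⟩ := lin_mix h1 h2
    rw [h] at h5 ⊢
    rw [h]
    nlinarith [mul_le_mul_of_nonneg_left (hφ a) (sub_pos.2 h4).le,
      mul_le_mul_of_nonneg_left (hφ b) h3.le]
  have hu {y0 y y' : N → ℝ} (hφ : ∀ v, y v ≤ y' v + K * φ v) :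
      upper x y0 E T y v - K * (κ * φ v) ≤ upper x y0 E T y' v := by
    rw [le_upper_iff]
    have := le_upper_iff.1 (le_refl (upper x y0 E T y v))
    exact ⟨by linarith [mul_nonneg hK (hnn v)], fun a b h1 h2 h3 h4 => by
      linarith [this.2 a b h1 h2 h3 h4, hl hφ h2 h3]⟩
  have hu1 := hu (y0 := y0) hφ
  have hu2 := hu (y0 := -y0) (y := -y') (y' := -y) fun v => by
    simp only [Pi.neg_apply]; linarith [hφ v]
  have key : relax x y0 E T θ y v ≤ relax x y0 E T θ y' v + K * (κ * φ v) := by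
    have := hθ v
    unfold relax lower
    nlinarith
  unfold relaxTo
  split_ifs with h
  · subst h
    nlinarith [hl hφ hsd hdt]
  · exact key

lemma exists_relaxTo_fixed (hsd : x s < x d) (hdt : x d < x t) (hθ : ∀ v, 0 < θ v ∧ θ v < 1) :
    ∃ Y : unitInterval → N → ℝ, Continuous Y ∧
      (∀ τ : unitInterval, relaxTo x y0 E T θ s d t τ (Y τ) = Y τ) ∧
      ∀ (τ : unitInterval) (y : N → ℝ), relaxTo x y0 E T θ s d t τ y = y → y = Y τ := by
  obtain ⟨φ, κ, hκ0, hκ1, hpos, hκ⟩ := exists_weight x d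
  let Ψ : unitInterval → (N → ℝ) → N → ℝ := fun τ z v =>
    relaxTo x y0 E T θ s d t τ (fun w => φ w * z w) v / φ v
  have hcontr : ∀ τ, ContractingWith κ.toNNReal (Ψ τ) := by
    intro τ
    refine ⟨by rw [Real.toNNReal_lt_one]; exact hκ1, LipschitzWith.of_dist_le_mul fun z z' => ?_⟩
    rw [Real.coe_toNNReal _ hκ0, dist_pi_le_iff (mul_nonneg hκ0 dist_nonneg)]
    intro v
    have (z z' : N → ℝ) := relaxTo_le_add (y0 := y0) (E := E) (T := T) hsd hdt hκ
      (y := fun w => φ w * z w) (y' := fun w => φ w * z' w) (K := dist z z') dist_nonneg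
      (fun v => mul_nonneg hκ0 (hpos v).le) (fun w => by
        nlinarith [hpos w, (abs_le.1 ((Real.dist_eq _ _).symm.trans_le (dist_le_pi_dist z z' w))).2])
      hθ τ.2.1 τ.2.2 v
    have h2 := this z' z
    rw [dist_comm] at h2
    rw [Real.dist_eq, ← sub_div, abs_div, abs_of_pos (hpos v), div_le_iff₀ (hpos v), abs_le]
    constructor <;> linarith [this z z']
  let Z : unitInterval → N → ℝ := fun τ => (hcontr τ).fixedPoint
  have hZ : ∀ τ, Ψ τ (Z τ) = Z τ := fun τ => (hcontr τ).fixedPoint_isFixedPt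
  have hcont : Continuous Z := by
    rw [continuous_iff_continuousAt]
    intro ν
    have h1 : Continuous fun τ : unitInterval => Ψ τ (Z ν) := by
      refine continuous_pi fun v => Continuous.div_const ?_ _
      unfold relaxTo
      split_ifs <;> fun_prop
    have h2 := ((continuous_const (y := Z ν)).dist h1).div_const (1 - κ.toNNReal) |>.tendsto ν
    rw [hZ, dist_self, zero_div] at h2
    rw [ContinuousAt, tendsto_iff_dist_tendsto_zero]
    refine squeeze_zero (fun _ => dist_nonneg) (fun τ => ?_) h2
    rw [dist_comm]
    exact (hcontr τ).dist_fixedPoint_le (Z ν)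
  have hcancel : ∀ v (c : ℝ), φ v * (c / φ v) = c := fun v c =>
    mul_div_cancel₀ c (hpos v).ne'
  refine ⟨fun τ v => φ v * Z τ v, by fun_prop, fun τ => ?_, fun τ y hy => ?_⟩ <;> funext v
  · exact (hcancel v _).symm.trans (congrArg (φ v * ·) (congrFun (hZ τ) v))
  · have h1 : Function.IsFixedPt (Ψ τ) fun v => y v / φ v := by
      funext v
      simp only [Ψ, hcancel, hy]
    change y v = φ v * Z τ v
    rw [← show y v / φ v = Z τ v from congrFun ((hcontr τ).fixedPoint_unique h1) v, hcancel]

/-- A state between its barriers. -/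
def Between (x y0 : N → ℝ) (E : N → N → Prop) (T : ℝ) (y : N → ℝ) : Prop :=
  ∀ v, lower x y0 E T y v ≤ y v ∧ y v ≤ upper x y0 E T y v

lemma Between.neg (h : Between x y0 E T y) : Between x (-y0) E T (-y) := fun v => by
  rw [lower_neg, upper_neg]
  exact ⟨neg_le_neg (h v).2, neg_le_neg (h v).1⟩

lemma Between.lt_bound (hsd : x s < x d) (hdt : x d < x t) (hT : 0 < T)
    (h : Between x y0 E T y) (hθ : ∀ v, 0 < θ v ∧ θ v < 1) (h0 : 0 ≤ τ) (h1 : τ ≤ 1)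
    (hfix : relaxTo x y0 E T θ s d t τ y = y) (v : N) : y v < T := by
  have hle : ∀ v, y v ≤ T := fun v => (h v).2.trans upper_le_bound
  by_contra hv
  obtain ⟨w, hw, hmax⟩ := Set.exists_max_image {w | y w = T} x (Set.toFinite _)
    ⟨v, le_antisymm (hle v) (not_lt.1 hv)⟩
  have hlin : ∀ {a b}, x a < x w → x w < x b → lin x y a b (x w) < T := fun {a b} h1 h2 => by
    obtain ⟨l, h3, h4, -, h⟩ := lin_mix h1 h2
    rw [h]
    nlinarith [hle a, (hle b).lt_of_ne fun hb => (hmax b hb).not_gt h2]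
  have hr : relax x y0 E T θ y w < T := by
    have h2 : upper x y0 E T y w ≤ T := upper_le_bound
    have h3 : lower x y0 E T y w < T :=
      lower_lt_iff.2 ⟨by linarith, fun a b _ h1 h2 _ => hlin h1 h2⟩
    have := hθ w
    unfold relax
    nlinarith
  have hf : _ = T := (congrFun hfix w).trans hw
  unfold relaxTo at hf
  split_ifs at hf with hwd
  · subst hwd
    rcases h0.eq_or_lt with rfl | h0 <;> nlinarith [hlin hsd hdt]
  · exact hr.ne hf

namespace CoreHyp

variable (H : CoreHyp x y0 E s d t)
include H

lemma weakFix_of_between (hT : 0 < T) (h : Between x y0 E T y)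
    (hθ : ∀ v, 0 < θ v ∧ θ v < 1) (h0 : 0 ≤ τ) (h1 : τ ≤ 1)
    (hfix : relaxTo x y0 E T θ s d t τ y = y) :
    WeakFix x y0 E d y ∧ (∀ v, -T < y v ∧ y v < T) ∧
    (τ < 1 → (UpE x y0 E y d ↔ DnE x y0 E y d)) := by
  have b1 := h.lt_bound (H.lt H.hsd) (H.lt H.hdt) hT hθ h0 h1 hfix
  have b2 := h.neg.lt_bound (H.lt H.hsd) (H.lt H.hdt) hT (θ := 1 - θ)
    (fun v => by simpa using (hθ v).symm) h0 h1 (by rw [relaxTo_neg, hfix])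
  have hup {y0 y : N → ℝ} {v : N} (h : Between x y0 E T y) (hlt : y v < T) :
      UpE x y0 E y v ↔ y v = upper x y0 E T y v := by
    have hu := (le_upper_iff.1 (h v).2).2
    constructor
    · rintro ⟨a, b, h1, h2, h3, h4, h5⟩
      exact le_antisymm (h v).2 (h5 ▸ (le_upper_iff.1 le_rfl).2 a b h1 h2 h3 h4)
    · refine fun h1 => by_contra fun hn => h1.not_lt (lt_upper_iff.2 ⟨hlt, fun a b h1 h2 h3 h4 =>
        (hu a b h1 h2 h3 h4).lt_of_ne fun h5 => hn ⟨a, b, h1, h2, h3, h4, h5⟩⟩)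
  have u v := hup (v := v) h (b1 v)
  have l v : DnE x y0 E y v ↔ y v = lower x y0 E T y v := by
    rw [← upE_neg, hup h.neg (b2 v), upper_neg]
    simp
  have bal {τ c : ℝ} {v : N} (h0 : 0 ≤ τ) (h1 : τ < 1)
      (hf : (1 - τ) * relax x y0 E T θ y v + τ * c = y v) (hU : UpE x y0 E y v → c ≤ y v)
      (hD : DnE x y0 E y v → y v ≤ c) : UpE x y0 E y v ↔ DnE x y0 E y v := by
    have hv := hθ v
    have hb := h v
    unfold relax at hf
    rw [u, l] at *
    refine ⟨fun hu => (mix_eq h0 h1 hv.1 hv.2 hf hb.1 hu.ge (hU hu)).1, fun hl => ?_⟩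
    have := (mix_eq (z := -y v) (l := -lower x y0 E T y v) (u := -upper x y0 E T y v) (c := -c)
      h0 h1 hv.1 hv.2 (by linarith) (by linarith) (by linarith) (by linarith [hD hl])).2
    linarith
  have hW : WeakFix x y0 E d y := by
    refine ⟨fun {a b v} => (le_upper_iff.1 (h v).2).2 a b, fun {a b v} h1 h2 h3 h4 => ?_, ?_⟩
    · have := (le_upper_iff.1 (h.neg v).2).2 a b h1 h2 h3 (by simpa [lin_neg])
      simpa [lin_neg] using this
    · intro v hv
      have hf := congrFun hfix v
      rw [relaxTo, if_neg hv] at hf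
      exact bal (c := y v) le_rfl one_pos (by simpa) (fun _ => le_rfl) fun _ => le_rfl
  refine ⟨hW, fun v => ⟨neg_lt.1 (b2 v), b1 v⟩, fun h1 => ?_⟩
  have hf := congrFun hfix d
  rw [relaxTo, if_pos rfl] at hf
  exact bal h0 h1 hf (H.toCoreBase.chord_le hW) (H.toCoreBase.le_chord hW)

lemma strict_of_between (hT : 0 < T) (h : Between x y0 E T y)
    (hθ : ∀ v, 0 < θ v ∧ θ v < 1) (h0 : 0 ≤ τ) (h1 : τ < 1)
    (hfix : relaxTo x y0 E T θ s d t τ y = y) (v : N) :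
    lower x y0 E T y v < y v ∧ y v < upper x y0 E T y v := by
  obtain ⟨hW, hb, hbal⟩ := H.weakFix_of_between hT h hθ h0 h1.le hfix
  have hS := H.toCoreBase.strictValid_of_tight hW (hbal h1)
  rw [lower_lt_iff, lt_upper_iff]
  exact ⟨⟨(hb v).1, fun a b => hS.dn⟩, (hb v).2, fun a b => hS.up⟩

theorem exists_straight : ∃ y, StrictValid x y0 E y ∧ y d = lin x y s t (x d) := by
  have : Nonempty N := ⟨d⟩
  obtain ⟨m, hm⟩ := Finite.exists_max fun v => |y0 v|
  have hT0 : 0 < |y0 m| + 1 := by positivity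
  generalize hTm : |y0 m| + 1 = T at hT0
  have hbar : ∀ v, lower x y0 E T y0 v < y0 v ∧ y0 v < upper x y0 E T y0 v := fun v => by
    have := abs_lt.1 (show |y0 v| < T by linarith [hm v])
    exact ⟨lower_lt_iff.2 ⟨this.1, fun a b _ _ _ h => h⟩,
      lt_upper_iff.2 ⟨this.2, fun a b _ _ _ h => h⟩⟩
  choose θ hθ0 hθ1 hθe using fun v => exists_mix (hbar v).1 (hbar v).2
  have hθ v := And.intro (hθ0 v) (hθ1 v)
  obtain ⟨Y, hYc, hYf, hYu⟩ := exists_relaxTo_fixed (x := x) (y0 := y0) (E := E) (T := T) (θ := θ)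
    (H.lt H.hsd) (H.lt H.hdt) hθ
  have hY0 : Y 0 = y0 := by
    refine (hYu 0 y0 ?_).symm
    funext v
    simp [relaxTo, relax, ← hθe]
  let g : unitInterval → ℝ := fun τ => Finset.univ.inf' Finset.univ_nonempty fun v =>
    min (Y τ v - lower x y0 E T (Y τ) v) (upper x y0 E T (Y τ) v - Y τ v)
  have hg : Continuous g := Continuous.finset_inf'_apply _ fun v _ =>
    (((continuous_apply v).sub (continuous_lower v)).min
      ((continuous_upper v).sub (continuous_apply v))).comp hYc
  have hB τ : 0 ≤ g τ ↔ Between x y0 E T (Y τ) := by simp [g, Finset.le_inf'_iff, Between]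
  have hS τ : 0 < g τ ↔ ∀ v, lower x y0 E T (Y τ) v < Y τ v ∧ Y τ v < upper x y0 E T (Y τ) v := by
    simp [g, Finset.lt_inf'_iff]
  have h1 : Between x y0 E T (Y 1) := by
    refine (hB 1).1 (not_lt.1 fun hn => ?_)
    obtain ⟨τ, hτ⟩ := mem_range_of_exists_le_of_exists_ge hg ⟨1, hn.le⟩
      ⟨0, ((hS 0).2 (by rwa [hY0])).le⟩
    refine hτ.not_gt ((hS τ).2 (H.strict_of_between hT0 ((hB τ).1 hτ.ge) hθ τ.2.1
      (lt_of_le_of_ne τ.2.2 fun h => hn.ne ?_) (hYf τ)))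
    rw [← hτ, show τ = 1 from Subtype.ext h]
  have hfix := hYf 1
  have hd := congrFun hfix d
  rw [relaxTo, if_pos rfl] at hd
  have hd : Y 1 d = lin x (Y 1) s t (x d) := by simpa using hd.symm
  exact ⟨Y 1, H.strictValid_of_chord
    (H.weakFix_of_between hT0 h1 hθ zero_le_one le_rfl (by simpa using hfix)).1 hd, hd⟩

end CoreHyp
end core

section orientation

/-- Twice the signed area of the triangle `a b c`. -/
def cr (a b c : ℝ × ℝ) : ℝ := (b.1 - a.1) * (c.2 - a.2) - (b.2 - a.2) * (c.1 - a.1)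

/-- `v` lies in the interior of the triangle `a b c`. -/
def InTri (a b c v : ℝ × ℝ) : Prop :=
  (0 < cr a b v ∧ 0 < cr b c v ∧ 0 < cr c a v) ∨ (cr a b v < 0 ∧ cr b c v < 0 ∧ cr c a v < 0)

/-- The segments `a b` and `c e` cross properly. -/
def Crs (a b c e : ℝ × ℝ) : Prop := cr a b c * cr a b e < 0 ∧ cr c e a * cr c e b < 0

variable {a b c e v : ℝ × ℝ}

lemma cr_rot (a b c : ℝ × ℝ) : cr b c a = cr a b c := by unfold cr; ring
lemma cr_swap (a b c : ℝ × ℝ) : cr b a c = - cr a b c := by unfold cr; ring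
lemma cr_swap' (a b c : ℝ × ℝ) : cr a c b = - cr a b c := by unfold cr; ring
@[simp] lemma cr_self_left (a c : ℝ × ℝ) : cr a a c = 0 := by unfold cr; ring
@[simp] lemma cr_self_right (a c : ℝ × ℝ) : cr a c c = 0 := by unfold cr; ring
@[simp] lemma cr_self_outer (a c : ℝ × ℝ) : cr a c a = 0 := by unfold cr; ring

lemma cr_add (a b c v : ℝ × ℝ) : cr a b v + cr b c v + cr c a v = cr a b c := by
  unfold cr; ring

lemma InTri.rot (h : InTri a b c v) : InTri b c a v := by
  unfold InTri at *; tauto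

lemma InTri.swap (h : InTri a b c v) : InTri b a c v := by
  unfold InTri at *
  rw [cr_swap a b, cr_swap c a, cr_swap b c]
  rcases h with h | h
  · exact .inr ⟨by linarith, by linarith, by linarith⟩
  · exact .inl ⟨by linarith, by linarith, by linarith⟩

lemma inTri_rot : InTri b c a v ↔ InTri a b c v := ⟨fun h => h.rot.rot, InTri.rot⟩
lemma inTri_swap : InTri b a c v ↔ InTri a b c v := ⟨InTri.swap, InTri.swap⟩

lemma InTri.cr_ne (h : InTri a b c v) : cr a b c ≠ 0 := by
  have := cr_add a b c v
  rcases h with h | h <;> intro h0 <;> linarith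

lemma Crs.symm (h : Crs a b c e) : Crs c e a b := ⟨h.2, h.1⟩

lemma Crs.swap_left (h : Crs a b c e) : Crs b a c e := by
  unfold Crs at *
  rw [cr_swap a b, cr_swap a b, mul_comm (cr c e b)]
  exact ⟨by linarith [h.1], h.2⟩

lemma crs_comm : Crs a b c e ↔ Crs c e a b := ⟨Crs.symm, Crs.symm⟩
lemma crs_swap_left : Crs b a c e ↔ Crs a b c e := ⟨Crs.swap_left, Crs.swap_left⟩
lemma crs_swap_right : Crs a b e c ↔ Crs a b c e := by
  rw [crs_comm, crs_swap_left, crs_comm]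

lemma Crs.ne (h : Crs a b c e) : a ≠ b ∧ c ≠ e ∧ a ≠ c ∧ a ≠ e ∧ b ≠ c ∧ b ≠ e := by
  unfold Crs at h
  refine ⟨?_, ?_, ?_, ?_, ?_, ?_⟩ <;> rintro rfl <;> simp at h

/-- `v` is below the segment `a b`. -/
def Bel (a b v : ℝ × ℝ) : Prop :=
  (a.1 < v.1 ∧ v.1 < b.1 ∧ cr a b v < 0) ∨ (b.1 < v.1 ∧ v.1 < a.1 ∧ 0 < cr a b v)

lemma Bel.swap (h : Bel a b v) : Bel b a v := by
  unfold Bel at *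
  rw [cr_swap a b]
  rcases h with h | h
  · exact .inr ⟨h.1, h.2.1, by linarith⟩
  · exact .inl ⟨h.1, h.2.1, by linarith⟩

lemma bel_swap : Bel b a v ↔ Bel a b v := ⟨Bel.swap, Bel.swap⟩

lemma inTri_iff_bel (hva : v.1 ≠ a.1) (hvb : v.1 ≠ b.1) (hvc : v.1 ≠ c.1) (hab : cr a b v ≠ 0)
    (hbc : cr b c v ≠ 0) (hca : cr a c v ≠ 0) :
    InTri a b c v ↔ (Bel a b v ↔ (Bel b c v ↔ Bel a c v)) := by
  have key : cr b c v * (v.1 - a.1) + cr a b v * (v.1 - c.1) = cr a c v * (v.1 - b.1) := by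
    unfold cr; ring
  rw [InTri, cr_swap a c v, Bel, Bel, Bel]
  generalize cr a b v = A at *
  generalize cr b c v = B at *
  generalize cr a c v = C at *
  rw [ne_iff_lt_or_gt] at *
  rcases hva with h1 | h1 <;> rcases hvb with h2 | h2 <;> rcases hvc with h3 | h3 <;>
  rcases hab with h4 | h4 <;> rcases hbc with h5 | h5 <;> rcases hca with h6 | h6 <;>
  simp [*, h1.not_gt, h2.not_gt, h3.not_gt, h4.not_gt, h5.not_gt, h6.not_gt] <;> nlinarith

end orientation

section preservation

variable {a b c e v a' b' c' e' v' : ℝ × ℝ}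

lemma cr_pos_congr (ha : a'.1 = a.1) (hb : b'.1 = b.1) (hc : c'.1 = c.1) (hab : a.1 ≠ b.1)
    (hbc : b.1 ≠ c.1) (hac : a.1 ≠ c.1) (h0 : cr a b c ≠ 0) (h0' : cr a' b' c' ≠ 0)
    (h1 : Bel a' b' c' ↔ Bel a b c) (h2 : Bel b' c' a' ↔ Bel b c a)
    (h3 : Bel a' c' b' ↔ Bel a c b) : 0 < cr a' b' c' ↔ 0 < cr a b c := by
  rw [Bel, Bel, cr_rot a b c, cr_rot a' b' c'] at h2
  rw [Bel, Bel, cr_swap' a, cr_swap' a'] at h3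
  rw [Bel, Bel] at h1
  rw [ha, hb, hc] at *
  grind

set_option maxHeartbeats 1000000 in
lemma crs_iff_bel (hac : a.1 ≠ c.1) (hae : a.1 ≠ e.1) (hbc : b.1 ≠ c.1) (hbe : b.1 ≠ e.1)
    (k1 : cr a b c ≠ 0) (k2 : cr a b e ≠ 0) (k3 : cr c e a ≠ 0) (k4 : cr c e b ≠ 0)
    (hab : a.1 ≠ b.1) : Crs a b c e ↔ (Bel a b c ↔ (Bel a b e ↔ (Bel c e a ↔ (Bel c e b ↔
      ((a.1 < c.1 ↔ b.1 < c.1) ↔ ¬ (a.1 < e.1 ↔ b.1 < e.1)))))) := by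
  wlog h : a.1 < b.1 generalizing a b
  · have sw {p q r : ℝ × ℝ} (h : cr p q r ≠ 0) : cr q p r ≠ 0 := by rwa [cr_swap, neg_ne_zero]
    rw [← crs_swap_left, this hbc hbe hac hae (sw k1) (sw k2) k4 k3 hab.symm
      (hab.symm.lt_of_le (not_lt.1 h)), bel_swap, bel_swap (a := a)]
    clear * -
    grind
  have e1 : cr c e a * (b.1 - a.1) = - cr a b c * (e.1 - a.1) + cr a b e * (c.1 - a.1) := by
    unfold cr; ring
  have e2 : cr c e b * (b.1 - a.1) = - cr a b c * (e.1 - b.1) + cr a b e * (c.1 - b.1) := by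
    unfold cr; ring
  unfold Crs Bel
  clear hab
  generalize cr a b c = A at *
  generalize cr a b e = B at *
  generalize cr c e a = C at *
  generalize cr c e b = D at *
  rw [ne_iff_lt_or_gt] at *
  rcases hac with h1 | h1 <;> rcases hae with h2 | h2 <;> rcases hbc with h3 | h3 <;>
  rcases hbe with h4 | h4 <;> rcases k1 with h5 | h5 <;> rcases k2 with h6 | h6 <;>
  rcases k3 with h7 | h7 <;> rcases k4 with h8 | h8 <;>
  simp [*, h1.not_gt, h2.not_gt, h3.not_gt, h4.not_gt, h5.not_gt, h6.not_gt, h7.not_gt, h8.not_gt,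
    mul_neg_iff] <;> nlinarith

end preservation

section config

/-- No three distinct points of the configuration are collinear. -/
def GenPos {N : Type*} (S : Set N) (P : N → ℝ × ℝ) : Prop :=
  ∀ a ∈ S, ∀ b ∈ S, ∀ c ∈ S, a ≠ b → b ≠ c → a ≠ c → cr (P a) (P b) (P c) ≠ 0

/-- The straight-line drawings `P` and `P'` of `E` agree in the combinatorial data of triangles,
quadrilaterals and crossings. -/
structure SameOn {N : Type*} (S : Set N) (P P' : N → ℝ × ℝ) (E : N → N → Prop) : Prop where
  orient : ∀ a ∈ S, ∀ b ∈ S, ∀ c ∈ S, E a b → E b c → E a c →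
    (0 < cr (P' a) (P' b) (P' c) ↔ 0 < cr (P a) (P b) (P c))
  tri : ∀ a ∈ S, ∀ b ∈ S, ∀ c ∈ S, ∀ v ∈ S, E a b → E b c → E a c → v ≠ a → v ≠ b → v ≠ c →
    (InTri (P' a) (P' b) (P' c) (P' v) ↔ InTri (P a) (P b) (P c) (P v))
  quad : ∀ a ∈ S, ∀ b ∈ S, ∀ c ∈ S, ∀ e ∈ S, ∀ v ∈ S, E a b → E b c → E c e → E e a → a ≠ c →
    v ≠ a → v ≠ b → v ≠ c → v ≠ e →
    ((InTri (P' a) (P' b) (P' c) (P' v) ↔ InTri (P' a) (P' c) (P' e) (P' v)) ↔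
      (InTri (P a) (P b) (P c) (P v) ↔ InTri (P a) (P c) (P e) (P v)))
  crs : ∀ a ∈ S, ∀ b ∈ S, ∀ c ∈ S, ∀ e ∈ S, E a b → E c e →
    (Crs (P' a) (P' b) (P' c) (P' e) ↔ Crs (P a) (P b) (P c) (P e))

variable {N : Type*} {S : Set N} {P P' : N → ℝ × ℝ} {E : N → N → Prop}

lemma Crs.ne_of {a b c e : N} (h : Crs (P a) (P b) (P c) (P e)) :
    a ≠ b ∧ c ≠ e ∧ a ≠ c ∧ a ≠ e ∧ b ≠ c ∧ b ≠ e := by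
  have := h.ne
  refine ⟨?_, ?_, ?_, ?_, ?_, ?_⟩ <;> rintro rfl <;> simp at this

lemma SameOn.of_bel (hx : ∀ v, (P' v).1 = (P v).1) (hinj : ∀ a ∈ S, ∀ b ∈ S, a ≠ b →
    (P a).1 ≠ (P b).1) (hE : ∀ a b, E a b → a ≠ b) (hgp : GenPos S P) (hgp' : GenPos S P')
    (hB : ∀ a ∈ S, ∀ b ∈ S, ∀ v ∈ S, E a b → (Bel (P' a) (P' b) (P' v) ↔ Bel (P a) (P b) (P v))) :
    SameOn S P P' E := by
  have tri {Q : N → ℝ × ℝ} (hQ : ∀ v, (Q v).1 = (P v).1) (hg : GenPos S Q) {a b c v} (ha : a ∈ S)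
      (hb : b ∈ S) (hc : c ∈ S) (hv : v ∈ S) (e1 : a ≠ b) (e2 : b ≠ c) (e3 : a ≠ c) (va : v ≠ a)
      (vb : v ≠ b) (vc : v ≠ c) : InTri (Q a) (Q b) (Q c) (Q v) ↔
      (Bel (Q a) (Q b) (Q v) ↔ (Bel (Q b) (Q c) (Q v) ↔ Bel (Q a) (Q c) (Q v))) := by
    refine inTri_iff_bel ?_ ?_ ?_ (hg _ ha _ hb _ hv e1 vb.symm va.symm)
      (hg _ hb _ hc _ hv e2 vc.symm vb.symm) (hg _ ha _ hc _ hv e3 vc.symm va.symm) <;>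
    rw [hQ, hQ] <;> apply hinj <;> assumption
  have crs {Q : N → ℝ × ℝ} (hQ : ∀ v, (Q v).1 = (P v).1) (hg : GenPos S Q) {a b c e} (ha : a ∈ S)
      (hb : b ∈ S) (hc : c ∈ S) (he : e ∈ S) (e1 : a ≠ b) (e2 : c ≠ e)
      (hd : a ≠ c ∧ a ≠ e ∧ b ≠ c ∧ b ≠ e) := crs_iff_bel (a := Q a) (b := Q b) (c := Q c)
      (e := Q e) (by rw [hQ, hQ]; exact hinj _ ha _ hc hd.1)
      (by rw [hQ, hQ]; exact hinj _ ha _ he hd.2.1) (by rw [hQ, hQ]; exact hinj _ hb _ hc hd.2.2.1)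
      (by rw [hQ, hQ]; exact hinj _ hb _ he hd.2.2.2) (hg _ ha _ hb _ hc e1 hd.2.2.1 hd.1)
      (hg _ ha _ hb _ he e1 hd.2.2.2 hd.2.1) (hg _ hc _ he _ ha e2 hd.2.1.symm hd.1.symm)
      (hg _ hc _ he _ hb e2 hd.2.2.2.symm hd.2.2.1.symm)
      (by rw [hQ, hQ]; exact hinj _ ha _ hb e1)
  refine ⟨fun a ha b hb c hc h1 h2 h3 => ?_, fun a ha b hb c hc v hv h1 h2 h3 va vb vc => ?_,
    fun a ha b hb c hc e he v hv h1 h2 h3 h4 e3 va vb vc ve => ?_,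
    fun a ha b hb c hc e he h1 h2 => ?_⟩
  · have e1 := hE _ _ h1
    have e2 := hE _ _ h2
    have e3 := hE _ _ h3
    exact cr_pos_congr (hx _) (hx _) (hx _) (hinj _ ha _ hb e1) (hinj _ hb _ hc e2)
      (hinj _ ha _ hc e3) (hgp _ ha _ hb _ hc e1 e2 e3) (hgp' _ ha _ hb _ hc e1 e2 e3)
      (hB _ ha _ hb _ hc h1) (hB _ hb _ hc _ ha h2) (hB _ ha _ hc _ hb h3)
  · rw [tri (fun _ => rfl) hgp ha hb hc hv (hE _ _ h1) (hE _ _ h2) (hE _ _ h3) va vb vc,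
      tri hx hgp' ha hb hc hv (hE _ _ h1) (hE _ _ h2) (hE _ _ h3) va vb vc,
      hB _ ha _ hb _ hv h1, hB _ hb _ hc _ hv h2, hB _ ha _ hc _ hv h3]
  · have b4 := hB _ he _ ha _ hv h4
    rw [bel_swap, bel_swap (a := P a)] at b4
    rw [tri (fun _ => rfl) hgp ha hb hc hv (hE _ _ h1) (hE _ _ h2) e3 va vb vc,
      tri (fun _ => rfl) hgp ha hc he hv e3 (hE _ _ h3) (hE _ _ h4).symm va vc ve,
      tri hx hgp' ha hb hc hv (hE _ _ h1) (hE _ _ h2) e3 va vb vc,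
      tri hx hgp' ha hc he hv e3 (hE _ _ h3) (hE _ _ h4).symm va vc ve,
      hB _ ha _ hb _ hv h1, hB _ hb _ hc _ hv h2, hB _ hc _ he _ hv h3, b4]
    clear * -
    grind
  · by_cases hd : a ≠ c ∧ a ≠ e ∧ b ≠ c ∧ b ≠ e
    · rw [crs (fun _ => rfl) hgp ha hb hc he (hE _ _ h1) (hE _ _ h2) hd,
        crs hx hgp' ha hb hc he (hE _ _ h1) (hE _ _ h2) hd, hB _ ha _ hb _ hc h1,
        hB _ ha _ hb _ he h1, hB _ hc _ he _ ha h2, hB _ hc _ he _ hb h2, hx, hx, hx, hx]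
    · exact iff_of_false (fun h => hd h.ne_of.2.2) (fun h => hd h.ne_of.2.2)

end config

section bridge

variable {N : Type*} {x y : N → ℝ} {a b c e : N}

/-- The planar configuration with given coordinates. -/
def pts (x y : N → ℝ) (v : N) : ℝ × ℝ := (x v, y v)

lemma cr_pts (h : x a < x b) (v : N) : cr (pts x y a) (pts x y b) (pts x y v) =
    (x b - x a) * (y v - lin x y a b (x v)) := by
  have : x b - x a ≠ 0 := by linarith
  simp only [cr, pts, lin]
  field_simp
  ring

lemma cr_pts_neg (h : x a < x b) {v : N} :
    cr (pts x y a) (pts x y b) (pts x y v) < 0 ↔ y v < lin x y a b (x v) := by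
  rw [cr_pts h, ← neg_pos, ← mul_neg, mul_pos_iff_of_pos_left (by linarith), neg_pos]
  exact sub_neg

lemma cr_pts_pos (h : x a < x b) {v : N} :
    0 < cr (pts x y a) (pts x y b) (pts x y v) ↔ lin x y a b (x v) < y v := by
  rw [cr_pts h, mul_pos_iff_of_pos_left (by linarith)]
  exact sub_pos

lemma Xing.crs (hab : x a < x b) (hce : x c < x e) (h : Xing x y a b c e) :
    Crs (pts x y a) (pts x y b) (pts x y c) (pts x y e) := by
  obtain ⟨ξ, ξ', h1, h2, h3, h4⟩ := h
  obtain ⟨m, n, hf⟩ := lin_aff (x := x) (y := y) (a := a) (b := b)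
  obtain ⟨m', n', hg⟩ := lin_aff (x := x) (y := y) (a := c) (b := e)
  have a1 := lin_left (x := x) (y := y) (a := a) (b := b)
  have a2 := lin_right (y := y) hab
  have a3 := lin_left (x := x) (y := y) (a := c) (b := e)
  have a4 := lin_right (y := y) hce
  rw [hf] at a1 a2
  rw [hg] at a3 a4
  simp only [hf, hg] at h3 h4
  unfold Crs
  rw [cr_pts hab, cr_pts hab, cr_pts hce, cr_pts hce, hf, hf, hg, hg, ← a1, ← a2, ← a3, ← a4]
  have p1 := sub_pos.2 hab
  have p2 := sub_pos.2 hce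
  have key {u v w : ℝ} (hu : 0 < u) (h : v * w < 0) : u * v * (u * w) < 0 := by
    have := mul_neg_of_pos_of_neg (mul_pos hu hu) h
    linarith
  have slope {q q' u w k l : ℝ} (h1 : u * q + w < 0) (h2 : 0 < u * q' + w) (hk : k ≤ q)
      (hl : q ≤ l) (hk' : k ≤ q') (hl' : q' ≤ l) : (u * k + w) * (u * l + w) < 0 := by
    rcases lt_trichotomy u 0 with hu | rfl | hu
    · exact mul_neg_of_pos_of_neg (by nlinarith) (by nlinarith)
    · linarith
    · exact mul_neg_of_neg_of_pos (by nlinarith) (by nlinarith)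
  have k (k l : ℝ) := slope (q := ξ) (q' := ξ') (u := m - m') (w := n - n') (k := k) (l := l)
    (by linarith) (by linarith)
  refine ⟨key p1 ?_, key p2 ?_⟩
  · linarith [k (x c) (x e) h1.2.2.1 h1.2.2.2 h2.2.2.1 h2.2.2.2]
  · linarith [k (x a) (x b) h1.1 h1.2.1 h2.1 h2.2.1]

end bridge

section wedge

variable {a b c e v : ℝ × ℝ}

lemma inTri_of_between (h1 : a.1 < v.1) (h2 : v.1 < b.1) (h3 : c.1 < v.1) (h4 : v.1 < e.1)
    (h5 : cr a b v < 0) (h6 : 0 < cr c e v) (hX : Crs a b c e) :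
    InTri c e b v ∨ InTri a b e v ∨ InTri c e a v ∨ InTri a b c v := by
  have k1 : cr a b v * (e.1 - v.1) + cr e b v * (v.1 - a.1) + cr e a v * (b.1 - v.1) = 0 := by
    unfold cr; ring
  have k2 : cr c e v * (v.1 - a.1) + cr e a v * (v.1 - c.1) + cr c a v * (e.1 - v.1) = 0 := by
    unfold cr; ring
  have i1 := cr_add a b e v
  have i2 := cr_add a b c v
  have hX := hX.1
  unfold InTri
  rw [cr_swap e b v] at *
  rw [cr_swap c a v]
  rcases le_or_gt (cr e b v) 0 with h | h
  · have : 0 < cr e a v := by nlinarith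
    have : cr c a v < 0 := by nlinarith
    grind
  · by_contra hn
    have : 0 ≤ cr e a v := by grind
    have : cr c a v < 0 := by nlinarith
    have : cr e a v = 0 := by grind
    have : cr b c v = 0 := by grind
    nlinarith

end wedge

section density

variable {N : Type*} {x y : N → ℝ}

lemma exists_genPos [Finite N] (hx : Function.Injective x) {U : Set (N → ℝ)} (hU : U ∈ nhds y) :
    ∃ y' ∈ U, GenPos Set.univ (pts x y') := by
  have := Fintype.ofFinite N
  let Y : ℝ → N → ℝ := fun τ v => y v + τ * x v ^ 2
  have hY : Continuous Y := by fun_prop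
  have hY0 : Y 0 = y := by simp [Y]
  let bad : N × N × N → Set ℝ := fun q => {τ | q.1 ≠ q.2.1 ∧ q.2.1 ≠ q.2.2 ∧ q.1 ≠ q.2.2 ∧
    cr (pts x (Y τ) q.1) (pts x (Y τ) q.2.1) (pts x (Y τ) q.2.2) = 0}
  have hbad : ∀ q, (bad q).Finite := by
    rintro ⟨a, b, c⟩
    refine Set.Subsingleton.finite ?_
    rintro τ ⟨h1, h2, h3, h4⟩ ν ⟨-, -, -, h5⟩
    simp only [cr, pts, Y] at h4 h5
    have hne : (x b - x a) * ((x c - x a) * (x c - x b)) ≠ 0 :=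
      mul_ne_zero (sub_ne_zero.2 (hx.ne h1.symm)) (mul_ne_zero (sub_ne_zero.2 (hx.ne h3.symm))
        (sub_ne_zero.2 (hx.ne h2.symm)))
    refine mul_right_cancel₀ hne ?_
    linear_combination h4 - h5
  have hfin : (⋃ q, bad q).Finite := Set.finite_iUnion hbad
  have h0 : Y ⁻¹' U ∈ nhds (0 : ℝ) := hY.continuousAt.preimage_mem_nhds (by rwa [hY0])
  obtain ⟨τ, hτ, hτ'⟩ := ((infinite_of_mem_nhds 0 h0).sdiff hfin).nonempty
  refine ⟨Y τ, hτ, fun a _ b _ c _ h1 h2 h3 h4 => hτ' ?_⟩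
  exact Set.mem_iUnion.2 ⟨(a, b, c), h1, h2, h3, h4⟩

end density

section flatten

variable {N : Type*} {S : Set N} {P : N → ℝ × ℝ} {E : N → N → Prop} {s d t : N}

/-- The hypotheses under which the bent path `s d t` can be straightened. -/
structure FlatHyp (S : Set N) (P : N → ℝ × ℝ) (E : N → N → Prop) (s d t : N) : Prop where
  mem_s : s ∈ S
  mem_d : d ∈ S
  mem_t : t ∈ S
  symm : ∀ {a b}, E a b → E b a
  ne : ∀ {a b}, E a b → a ≠ b
  gp : GenPos S P
  sides : ∀ {a b c e}, a ∈ S → b ∈ S → c ∈ S → e ∈ S → E a b → E c e →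
    Crs (P a) (P b) (P c) (P e) → E a c
  wedge : ∀ {a b c e v}, a ∈ S → b ∈ S → c ∈ S → e ∈ S → v ∈ S → E a b → E c e →
    Crs (P a) (P b) (P c) (P e) → ¬ InTri (P a) (P b) (P c) (P v)
  sd : E s d
  dt : E d t
  nst : ¬ E s t
  unc_s : ∀ {a b}, a ∈ S → b ∈ S → E a b → ¬ Crs (P a) (P b) (P s) (P d)
  unc_t : ∀ {a b}, a ∈ S → b ∈ S → E a b → ¬ Crs (P a) (P b) (P d) (P t)
  s_ne_t : s ≠ t
  nbr : ∀ {k}, k ∈ S → E k d → k ≠ s → k ≠ t →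
    (E k s ∧ E k t ∧ ¬ InTri (P d) (P k) (P t) (P s) ∧ ¬ InTri (P d) (P k) (P s) (P t)) ∨
    (0 < cr (P d) (P s) (P k) * cr (P d) (P s) (P t) ∧
      0 < cr (P d) (P k) (P t) * cr (P d) (P s) (P t))

lemma FlatHyp.swap (H : FlatHyp S P E s d t) : FlatHyp S P E t d s where
  mem_s := H.mem_t
  mem_d := H.mem_d
  mem_t := H.mem_s
  symm := H.symm
  ne := H.ne
  gp := H.gp
  sides := H.sides
  wedge := H.wedge
  sd := H.symm H.dt
  dt := H.symm H.sd
  nst := fun h => H.nst (H.symm h)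
  unc_s := fun h1 h2 h3 h4 => H.unc_t h1 h2 h3 (crs_swap_right.1 h4)
  unc_t := fun h1 h2 h3 h4 => H.unc_s h1 h2 h3 (crs_swap_right.1 h4)
  s_ne_t := H.s_ne_t.symm
  nbr := fun h1 h2 h3 h4 => by
    rcases H.nbr h1 h2 h4 h3 with h | ⟨h, h'⟩
    · exact .inl ⟨h.2.1, h.1, h.2.2.2, h.2.2.1⟩
    · refine .inr ⟨?_, ?_⟩
      · rwa [cr_swap' (P d) (P s) (P t), mul_neg, ← neg_mul, ← cr_swap' (P d)]
      · rwa [cr_swap' (P d) (P s) (P t), mul_neg, ← neg_mul, ← cr_swap' (P d)]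

/-- The result of straightening the path `s d t`, up to a small bend. -/
structure FlatRes (S : Set N) (P P' : N → ℝ × ℝ) (E : N → N → Prop) (s d t : N) (ω : ℝ) :
    Prop where
  gp : GenPos S P'
  same : SameOn S P P' E
  side : 0 < ω * (cr (P s) (P d) (P t) * cr (P' s) (P' d) (P' t))
  near : ∀ {u}, u ∈ S → u ≠ s → u ≠ d → u ≠ t →
    0 < cr (P' s) (P' t) (P' u) * cr (P' d) (P' t) (P' u) ∧
    0 < cr (P' s) (P' t) (P' u) * cr (P' s) (P' d) (P' u)

lemma FlatRes.swap {P' : N → ℝ × ℝ} {ω : ℝ} (h : FlatRes S P P' E s d t ω) :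
    FlatRes S P P' E t d s ω where
  gp := h.gp
  same := h.same
  side := by
    have e1 : cr (P t) (P d) (P s) = - cr (P s) (P d) (P t) := by unfold cr; ring
    have e2 : cr (P' t) (P' d) (P' s) = - cr (P' s) (P' d) (P' t) := by unfold cr; ring
    rw [e1, e2, neg_mul_neg]
    exact h.side
  near := fun h1 h2 h3 h4 => by
    have := h.near h1 h4 h3 h2
    rw [cr_swap (P' s) (P' t), cr_swap (P' s) (P' d), cr_swap (P' d) (P' t), neg_mul_neg,
      neg_mul_neg]
    exact this.symm

end flatten

section coord

variable {N : Type*} {x y : N → ℝ} {E : N → N → Prop} {s d t : N}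

private lemma FlatHyp.low {S : Set N} {P : N → ℝ × ℝ} {k : N} (H : FlatHyp S P E s d t)
    (hk : k ∈ S) (hkd : E k d) (hks : k ≠ s) (hkt : k ≠ t)
    (h : cr (P s) (P d) (P k) * cr (P s) (P d) (P t) < 0) :
    E k t ∧ 0 < cr (P k) (P t) (P d) * cr (P s) (P d) (P t) := by
  have e1 : cr (P t) (P d) (P s) = - cr (P s) (P d) (P t) := by unfold cr; ring
  have e2 : cr (P d) (P k) (P s) = cr (P s) (P d) (P k) := by unfold cr; ring
  rcases H.nbr hk hkd hks hkt with ⟨-, h1, h2, -⟩ | ⟨h1, -⟩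
  · have h3 := H.unc_s hk H.mem_t h1
    have := H.gp k hk t H.mem_t s H.mem_s hkt H.s_ne_t.symm hks
    have := H.gp k hk t H.mem_t d H.mem_d hkt (H.ne H.dt).symm (H.ne hkd)
    simp only [InTri, Crs, e1, e2, mul_neg_iff, mul_pos_iff] at *
    grind
  · rw [cr_swap, cr_swap (P s) (P d), neg_mul_neg] at h1
    exact absurd h h1.not_gt

private lemma aff_lt {m n m' n' ξ u p : ℝ} (he : m * p + n = m' * p + n')
    (h : m * ξ + n < m' * ξ + n') (hs : 0 < (ξ - p) * (u - p)) : m * u + n < m' * u + n' := by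
  rcases mul_pos_iff.1 hs with h | h <;> nlinarith

lemma FlatHyp.coreHyp (H : FlatHyp Set.univ (pts x y) E s d t) (hx : Function.Injective x)
    (hsd : x s < x d) (hdt : x d < x t)
    (hb : 0 < cr (pts x y s) (pts x y d) (pts x y t)) :
    CoreHyp x y (fun a b => E a b ∧ x a < x b) s d t where
  inj := hx
  lt := fun h => h.2
  hon := fun {a b v} h1 h2 h3 h4 => by
    refine H.gp a trivial b trivial v trivial (H.ne h1.1) ?_ ?_ ?_
    · rintro rfl; exact h3.ne rfl
    · rintro rfl; exact h2.ne rfl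
    · rw [cr_pts h1.2, h4, sub_self, mul_zero]
  pinch := fun {a b c e v} h1 h2 h3 h4 h5 h6 h7 h8 h9 => by
    have hX := h9.crs h1.2 h2.2
    rcases inTri_of_between (a := pts x y a) (b := pts x y b) (c := pts x y c) (e := pts x y e)
      (v := pts x y v) h3 h4 h5 h6 ((cr_pts_neg h1.2).2 h8)
      ((cr_pts_pos h2.2).2 h7) hX with h | h | h | h
    · exact H.wedge trivial trivial trivial trivial trivial h2.1 (H.symm h1.1)
        (crs_swap_right.2 hX.symm) h
    · exact H.wedge trivial trivial trivial trivial trivial h1.1 (H.symm h2.1)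
        (crs_swap_right.2 hX) h
    · exact H.wedge trivial trivial trivial trivial trivial h2.1 h1.1 hX.symm h
    · exact H.wedge trivial trivial trivial trivial trivial h1.1 h2.1 hX h
  path_left := fun h1 h2 => H.unc_s trivial trivial h1.1 (h2.crs h1.2 hsd)
  path_right := fun h1 h2 => H.unc_t trivial trivial h1.1 (h2.crs h1.2 hdt)
  hsd := ⟨H.sd, hsd⟩
  hdt := ⟨H.dt, hdt⟩
  sides := fun {a b c e} h1 h2 h3 => by
    have hX := h3.crs h1.2 h2.2
    refine ⟨H.sides trivial trivial trivial trivial h1.1 (H.symm h2.1) (crs_swap_right.2 hX), ?_⟩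
    obtain ⟨ξ, -, h4, -⟩ := h3
    exact lt_of_le_of_ne (h4.1.trans h4.2.2.2) (hx.ne hX.ne_of.2.2.2.1)
  nst := fun h => H.nst h.1
  bend := by
    rw [← cr_pts_neg (hsd.trans hdt), cr_swap', neg_lt_zero]
    exact hb
  low_left := fun {a ξ} h1 h2 h3 => by
    obtain ⟨m, n, hf⟩ := lin_aff (x := x) (y := y) (a := a) (b := d)
    obtain ⟨m', n', hg⟩ := lin_aff (x := x) (y := y) (a := s) (b := d)
    have hlow : cr (pts x y s) (pts x y d) (pts x y a) < 0 := by
      rw [cr_pts_neg hsd, hg, ← lin_left (x := x) (y := y) (a := a) (b := d), hf]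
      rw [hf, hg] at h3
      refine aff_lt (p := x d) ?_ h3 (by nlinarith [h1.2])
      rw [← hf, ← hg, lin_right h1.2, lin_right hsd]
    have := H.low trivial h1.1 (by rintro rfl; exact h3.ne rfl)
      (by rintro rfl; exact (h1.2.trans hdt).ne rfl) (mul_neg_of_neg_of_pos hlow hb)
    have hat := h1.2.trans hdt
    exact ⟨⟨this.1, hat⟩, (cr_pts_pos hat).1 (pos_of_mul_pos_left this.2 hb.le)⟩
  low_right := fun {b ξ} h1 h2 h3 => by
    obtain ⟨m, n, hf⟩ := lin_aff (x := x) (y := y) (a := d) (b := b)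
    obtain ⟨m', n', hg⟩ := lin_aff (x := x) (y := y) (a := d) (b := t)
    have hlow : cr (pts x y d) (pts x y t) (pts x y b) < 0 := by
      rw [cr_pts_neg hdt, hg, ← lin_right (y := y) h1.2, hf]
      rw [hf, hg] at h3
      refine aff_lt (p := x d) ?_ h3 (by nlinarith [h1.2])
      rw [← hf, ← hg, lin_left, lin_left]
    have := H.swap.low trivial (H.symm h1.1) (by rintro rfl; exact h3.ne rfl)
      (by rintro rfl; exact (hsd.trans h1.2).ne rfl)
    have e1 : cr (pts x y t) (pts x y d) (pts x y s) = - cr (pts x y s) (pts x y d) (pts x y t) := by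
      unfold cr; ring
    rw [cr_swap (pts x y d), e1, neg_mul_neg, cr_swap (pts x y s), neg_mul_neg] at this
    have := this (mul_neg_of_neg_of_pos hlow hb)
    have hsb := hsd.trans h1.2
    exact ⟨⟨H.symm this.1, hsb⟩, (cr_pts_pos hsb).1 (pos_of_mul_pos_left this.2 hb.le)⟩

end coord

section coord

open Filter Topology

variable {N : Type*} {x y : N → ℝ} {E : N → N → Prop} {s d t : N}

lemma continuous_cr_pts (x : N → ℝ) (a b c : N) :
    Continuous fun y : N → ℝ => cr (pts x y a) (pts x y b) (pts x y c) := by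
  simp only [cr, pts]; fun_prop

lemma isOpen_strictValid [Finite N] (x y : N → ℝ) (E : N → N → Prop) :
    IsOpen {y' | StrictValid x y E y'} := by
  have : {y' | StrictValid x y E y'} = (⋂ a, ⋂ b, ⋂ v, {y' | E a b → x a < x v → x v < x b →
      y v < lin x y a b (x v) → y' v < lin x y' a b (x v)}) ∩
      (⋂ a, ⋂ b, ⋂ v, {y' | E a b → x a < x v → x v < x b →
      lin x y a b (x v) < y v → lin x y' a b (x v) < y' v}) := by
    ext y'
    simp only [Set.mem_inter_iff, Set.mem_iInter]
    exact ⟨fun h => ⟨fun a b v => h.up, fun a b v => h.dn⟩,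
      fun h => ⟨fun {a b v} => h.1 a b v, fun {a b v} => h.2 a b v⟩⟩
  rw [this]
  have hlin (a b v : N) : Continuous fun y' : N → ℝ => lin x y' a b (x v) := by
    simp only [lin]; fun_prop
  refine IsOpen.inter ?_ ?_ <;>
  · refine isOpen_iInter_of_finite fun a => isOpen_iInter_of_finite fun b =>
      isOpen_iInter_of_finite fun v => ?_
    by_cases h : E a b ∧ x a < x v ∧ x v < x b ∧ y v < lin x y a b (x v) <;>
    by_cases h' : E a b ∧ x a < x v ∧ x v < x b ∧ lin x y a b (x v) < y v <;>
    first
    | simp only [h, forall_const]; exact isOpen_lt (by fun_prop) (hlin a b v)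
    | simp only [h', forall_const]; exact isOpen_lt (hlin a b v) (by fun_prop)
    | convert isOpen_univ using 1; ext; simp; tauto

lemma sameOn_of_strictValid {y' : N → ℝ} (hx : Function.Injective x)
    (hsymm : ∀ {a b}, E a b → E b a) (hne : ∀ {a b}, E a b → a ≠ b)
    (hgp : GenPos Set.univ (pts x y)) (hgp' : GenPos Set.univ (pts x y'))
    (h : StrictValid x y (fun a b => E a b ∧ x a < x b) y') :
    SameOn Set.univ (pts x y) (pts x y') E := by
  refine SameOn.of_bel (fun v => rfl) (fun a _ b _ hab => hx.ne hab) (fun a b => hne) hgp hgp' ?_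
  intro a _ b _ v _ hab
  wlog hlt : x a < x b generalizing a b
  · rw [bel_swap, ← bel_swap (a := pts x y a)]
    exact this _ trivial _ trivial (hsymm hab)
      (lt_of_le_of_ne (not_lt.1 hlt) (hx.ne (hne hab)).symm)
  by_cases h1 : x a < x v ∧ x v < x b
  · have bl (y : N → ℝ) : Bel (pts x y a) (pts x y b) (pts x y v) ↔
        cr (pts x y a) (pts x y b) (pts x y v) < 0 := by
      simp [Bel, pts, h1, h1.1.not_gt]
    rw [bl, bl, cr_pts_neg hlt, cr_pts_neg hlt]
    refine ⟨fun h2 => ?_, h.up ⟨hab, hlt⟩ h1.1 h1.2⟩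
    by_contra h3
    refine h2.not_ge (h.dn ⟨hab, hlt⟩ h1.1 h1.2 (lt_of_le_of_ne (not_lt.1 h3) fun h4 => ?_)).le
    refine hgp a trivial b trivial v trivial (hne hab) ?_ ?_ (by rw [cr_pts hlt, h4]; ring) <;>
      rintro rfl <;> simp at h1
  · simp only [Bel, pts]
    grind

theorem FlatHyp.exists_flat_coord [Finite N] (H : FlatHyp Set.univ (pts x y) E s d t)
    (hx : Function.Injective x) (hsd : x s < x d) (hdt : x d < x t)
    (hb : 0 < cr (pts x y s) (pts x y d) (pts x y t)) {ω : ℝ} (hω : ω ≠ 0) :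
    ∃ y', FlatRes Set.univ (pts x y) (pts x y') E s d t ω := by
  classical
  have := Fintype.ofFinite N
  have hst := hsd.trans hdt
  obtain ⟨y₀, hy₀, hd₀⟩ := (H.coreHyp hx hsd hdt hb).exists_straight
  set V := {y' | StrictValid x y (fun a b => E a b ∧ x a < x b) y'} with hV
  have hVo : IsOpen V := isOpen_strictValid _ _ _
  have hsd' : s ≠ d := H.ne H.sd
  have htd' : t ≠ d := (H.ne H.dt).symm
  have e (y' : N → ℝ) (z : ℝ) {u} (h : u ≠ d) :
      pts x (Function.update y' d z) u = pts x y' u := by simp [pts, h]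
  have ed (y' : N → ℝ) (z : ℝ) : pts x (Function.update y' d z) d = (x d, z) := by simp [pts]
  let Z : (N → ℝ) → ℝ → N → ℝ := fun y' δ => Function.update y' d (lin x y' s t (x d) - ω * δ)
  have hZ : Continuous (fun y' => Z y' 0) :=
    continuous_id.update d (by simp only [lin]; fun_prop)
  have hZ₀ : Z y₀ 0 = y₀ := by simp [Z, ← hd₀]
  obtain ⟨y₁, hy₁, hg₁⟩ := exists_genPos hx
    (hZ.continuousAt.preimage_mem_nhds (hVo.mem_nhds (by rw [hZ₀]; exact hy₀)))
  set W := V ∩ ⋂ u, {y' | u ≠ s → u ≠ d → u ≠ t →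
    0 < cr (pts x y' s) (pts x y' t) (pts x y' u) * cr (pts x y' d) (pts x y' t) (pts x y' u) ∧
    0 < cr (pts x y' s) (pts x y' t) (pts x y' u) * cr (pts x y' s) (pts x y' d) (pts x y' u)}
    with hW
  have hWo : IsOpen W := by
    refine hVo.inter (isOpen_iInter_of_finite fun u => ?_)
    simp only [Set.ofPred_forall]
    refine isOpen_iInter_of_finite fun _ => isOpen_iInter_of_finite fun _ =>
      isOpen_iInter_of_finite fun _ => .inter ?_ ?_ <;>
    exact isOpen_lt continuous_const
      ((continuous_cr_pts x _ _ _).mul (continuous_cr_pts x _ _ _))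
  have hst0 : x t - x s ≠ 0 := (sub_pos.2 hst).ne'
  have hy₂ : Z y₁ 0 ∈ W := by
    refine ⟨hy₁, Set.mem_iInter.2 fun u h1 h2 h3 => ?_⟩
    have p := mul_self_pos.2 (hg₁ s trivial t trivial u trivial H.s_ne_t h3.symm h1.symm)
    have k1 : cr (x d, lin x y₁ s t (x d) - ω * 0) (pts x y₁ t) (pts x y₁ u) =
        (x t - x d) / (x t - x s) * cr (pts x y₁ s) (pts x y₁ t) (pts x y₁ u) := by
      simp only [cr, pts, lin]; field_simp; ring
    have k2 : cr (pts x y₁ s) (x d, lin x y₁ s t (x d) - ω * 0) (pts x y₁ u) =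
        (x d - x s) / (x t - x s) * cr (pts x y₁ s) (pts x y₁ t) (pts x y₁ u) := by
      simp only [cr, pts, lin]; field_simp; ring
    rw [e _ _ hsd', e _ _ htd', e _ _ h2, ed, k1, k2]
    have := mul_pos (div_pos (sub_pos.2 hdt) (sub_pos.2 hst)) p
    have := mul_pos (div_pos (sub_pos.2 hsd) (sub_pos.2 hst)) p
    constructor <;> linarith
  have hZW : ∀ᶠ δ in 𝓝[>] (0 : ℝ), Z y₁ δ ∈ W := nhdsWithin_le_nhds
    ((continuous_const.update d (by fun_prop)).continuousAt.preimage_mem_nhds (hWo.mem_nhds hy₂))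
  obtain ⟨δ, hδW, hδ : 0 < δ⟩ := (hZW.and self_mem_nhdsWithin).exists
  have hside : 0 < ω * cr (pts x (Z y₁ δ) s) (pts x (Z y₁ δ) d) (pts x (Z y₁ δ) t) := by
    have k : cr (pts x y₁ s) (x d, lin x y₁ s t (x d) - ω * δ) (pts x y₁ t) =
        ω * δ * (x t - x s) := by
      simp only [cr, pts, lin]; field_simp; ring
    rw [e _ _ hsd', e _ _ htd', ed, k]
    have := mul_pos (mul_pos (mul_self_pos.2 hω) hδ) (sub_pos.2 hst)
    linarith
  have hopen : IsOpen (W ∩ {y' | 0 < ω * cr (pts x y' s) (pts x y' d) (pts x y' t)}) :=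
    hWo.inter (isOpen_lt continuous_const (continuous_const.mul (continuous_cr_pts x _ _ _)))
  obtain ⟨y', ⟨⟨hv, hn⟩, hs⟩, hg⟩ := exists_genPos hx (hopen.mem_nhds ⟨hδW, hside⟩)
  refine ⟨y', hg, sameOn_of_strictValid hx H.symm H.ne H.gp hg hv, ?_,
    fun {u} _ h1 h2 h3 => Set.mem_iInter.1 hn u h1 h2 h3⟩
  have := mul_pos hb hs
  linarith

end coord

section scaling

variable {M : ℝ × ℝ → ℝ × ℝ} {k : ℝ}

lemma inTri_map (hM : ∀ p q r, cr (M p) (M q) (M r) = k * cr p q r) (hk : 0 < k)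
    {a b c v : ℝ × ℝ} : InTri (M a) (M b) (M c) (M v) ↔ InTri a b c v := by
  simp only [InTri, hM, mul_pos_iff_of_pos_left hk, ← neg_pos (a := k * _), ← mul_neg]
  simp only [neg_pos]

lemma crs_map (hM : ∀ p q r, cr (M p) (M q) (M r) = k * cr p q r) (hk : 0 < k)
    {a b c e : ℝ × ℝ} : Crs (M a) (M b) (M c) (M e) ↔ Crs a b c e := by
  have key (u v : ℝ) : k * u * (k * v) < 0 ↔ u * v < 0 := by
    rw [mul_mul_mul_comm, ← neg_pos, ← mul_neg, mul_pos_iff_of_pos_left (mul_pos hk hk), neg_pos]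
  simp only [Crs, hM, key]

end scaling

section flatten

variable {N : Type*} {S : Set N} {P : N → ℝ × ℝ} {E : N → N → Prop} {s d t : N}

lemma GenPos.ne_of (h : GenPos S P) {a b c : N} (ha : a ∈ S) (hb : b ∈ S) (hc : c ∈ S)
    (hab : a ≠ b) (hbc : b ≠ c) (hac : a ≠ c) : P a ≠ P b := fun he =>
  h a ha b hb c hc hab hbc hac (by rw [he]; simp)

lemma GenPos.injOn (h : GenPos S P) (hs : s ∈ S) (hd : d ∈ S) (ht : t ∈ S) (h1 : s ≠ d)
    (h2 : d ≠ t) (h3 : s ≠ t) : Set.InjOn P S := by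
  intro a ha b hb hab
  by_contra hne
  have k {c} (hc : c ∈ S) (h1 : c ≠ a) (h2 : c ≠ b) := h.ne_of ha hb hc hne h2.symm h1.symm hab
  grind +splitImp

private lemma exists_direction (hS : S.Finite) (hP : Set.InjOn P S)
    {p q : ℝ × ℝ} (hpq : p.1 * q.2 - p.2 * q.1 ≠ 0) : ∃ τ : ℝ, 0 < τ ∧ ∀ a ∈ S, ∀ b ∈ S, a ≠ b →
      (P a).1 * (p.2 + τ * q.2) - (P a).2 * (p.1 + τ * q.1) ≠
      (P b).1 * (p.2 + τ * q.2) - (P b).2 * (p.1 + τ * q.1) := by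
  let bad : N × N → Set ℝ := fun ab => {τ | ab.1 ∈ S ∧ ab.2 ∈ S ∧ ab.1 ≠ ab.2 ∧
      (P ab.1).1 * (p.2 + τ * q.2) - (P ab.1).2 * (p.1 + τ * q.1) =
      (P ab.2).1 * (p.2 + τ * q.2) - (P ab.2).2 * (p.1 + τ * q.1)}
  have hbad : ∀ ab ∈ S ×ˢ S, (bad ab).Finite := by
    rintro ⟨a, b⟩ -
    refine Set.Subsingleton.finite ?_
    rintro τ ⟨h1, h2, h3, h4⟩ ν ⟨-, -, -, h5⟩
    by_contra hne
    have hB : ((P a).1 - (P b).1) * q.2 = ((P a).2 - (P b).2) * q.1 :=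
      mul_left_cancel₀ (sub_ne_zero.2 hne) (by linear_combination h4 - h5)
    exact h3 (hP h1 h2 (Prod.ext
      (mul_right_cancel₀ hpq (by linear_combination (p.1 + τ * q.1) * hB - q.1 * h4))
      (mul_right_cancel₀ hpq (by linear_combination (p.2 + τ * q.2) * hB - q.2 * h4))))
  have hfin : (⋃ ab ∈ S ×ˢ S, bad ab).Finite := (hS.prod hS).biUnion hbad
  obtain ⟨τ, hτ, hτ'⟩ := ((Set.Ioi_infinite (0 : ℝ)).sdiff hfin).nonempty
  refine ⟨τ, hτ, fun a ha b hb hab he => hτ' ?_⟩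
  simp only [Set.mem_iUnion]
  exact ⟨(a, b), ⟨ha, hb⟩, ha, hb, hab, he⟩

theorem FlatHyp.exists_flat (H : FlatHyp S P E s d t) (hS : S.Finite) {ω : ℝ} (hω : ω ≠ 0) :
    ∃ P', FlatRes S P P' E s d t ω := by
  wlog hb : 0 < cr (P s) (P d) (P t) generalizing s t
  · have hne := H.gp s H.mem_s d H.mem_d t H.mem_t (H.ne H.sd) (H.ne H.dt) H.s_ne_t
    have e : cr (P t) (P d) (P s) = - cr (P s) (P d) (P t) := by unfold cr; ring
    obtain ⟨P', h⟩ := this H.swap (by rw [e, neg_pos]; exact lt_of_le_of_ne (not_lt.1 hb) hne)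
    exact ⟨P', h.swap⟩
  classical
  have hinj := H.gp.injOn H.mem_s H.mem_d H.mem_t (H.ne H.sd) (H.ne H.dt) H.s_ne_t
  obtain ⟨τ, hτ, hD⟩ := exists_direction (p := P s - P d) (q := P t - P d) hS hinj (by
    have : cr (P s) (P d) (P t) = -((P s - P d).1 * (P t - P d).2 - (P s - P d).2 * (P t - P d).1) := by
      simp only [cr, Prod.fst_sub, Prod.snd_sub]; ring
    rw [this] at hb
    intro h; rw [h] at hb; simp at hb)
  set D : ℝ × ℝ := P s - P d + τ • (P t - P d) with hDdef
  let M : ℝ × ℝ → ℝ × ℝ := fun v => (v.1 * D.2 - v.2 * D.1, v.1 * D.1 + v.2 * D.2)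
  have hM : ∀ p q r, cr (M p) (M q) (M r) = (D.1 ^ 2 + D.2 ^ 2) * cr p q r := by
    intro p q r; simp only [M, cr]; ring
  have hxd : (M (P s)).1 < (M (P d)).1 := by
    have : (M (P d)).1 - (M (P s)).1 = τ * cr (P s) (P d) (P t) := by
      simp [M, cr, hDdef]; ring
    have := mul_pos hτ hb
    linarith
  have hdt : (M (P d)).1 < (M (P t)).1 := by
    have : (M (P t)).1 - (M (P d)).1 = cr (P s) (P d) (P t) := by
      simp [M, cr, hDdef]; ring
    linarith
  have hk : 0 < D.1 ^ 2 + D.2 ^ 2 := by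
    by_contra hk
    have h1 : D.1 = 0 := by nlinarith [sq_nonneg D.1, sq_nonneg D.2]
    have h2 : D.2 = 0 := by nlinarith [sq_nonneg D.1, sq_nonneg D.2]
    simp [M, h1, h2] at hxd
  have : Finite S := hS.to_subtype
  let x : S → ℝ := fun v => (M (P v)).1
  let y : S → ℝ := fun v => (M (P v)).2
  have hp : ∀ v h, pts x y ⟨v, h⟩ = M (P v) := fun v h => rfl
  have hi {a b c v : ℝ × ℝ} := inTri_map (a := a) (b := b) (c := c) (v := v) hM hk
  have hc {a b c e : ℝ × ℝ} := crs_map (a := a) (b := b) (c := c) (e := e) hM hk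
  have hm (r r' : ℝ) : 0 < (D.1 ^ 2 + D.2 ^ 2) * r * ((D.1 ^ 2 + D.2 ^ 2) * r') ↔ 0 < r * r' := by
    rw [mul_mul_mul_comm, mul_pos_iff_of_pos_left (mul_pos hk hk)]
  have H' : FlatHyp Set.univ (pts x y) (fun a b : S => E a b)
      ⟨s, H.mem_s⟩ ⟨d, H.mem_d⟩ ⟨t, H.mem_t⟩ :=
    { mem_s := trivial
      mem_d := trivial
      mem_t := trivial
      symm := H.symm
      ne := fun h h' => H.ne h (congrArg Subtype.val h')
      gp := by simpa [GenPos, hp, hM, hk.ne'] using H.gp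
      sides := by
        simp only [Subtype.forall, hp, hc]
        exact fun {a ha b hb c hc e he} _ _ _ _ => H.sides ha hb hc he
      wedge := by
        simp only [Subtype.forall, hp, hc, hi]
        exact fun {a ha b hb c hc e he v hv} _ _ _ _ _ => H.wedge ha hb hc he hv
      sd := H.sd
      dt := H.dt
      nst := H.nst
      unc_s := by
        simp only [Subtype.forall, hp, hc]
        exact fun {a ha b hb} _ _ => H.unc_s ha hb
      unc_t := by
        simp only [Subtype.forall, hp, hc]
        exact fun {a ha b hb} _ _ => H.unc_t ha hb
      s_ne_t := fun h => H.s_ne_t (congrArg Subtype.val h)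
      nbr := by
        simp only [Subtype.forall, hp, hM, hi, hm, Ne, Subtype.mk.injEq]
        exact fun {k hk} _ => H.nbr hk }
  obtain ⟨y', r1, ⟨r2, r3, r4, r5⟩, r6, r7⟩ := H'.exists_flat_coord
    (fun a b h => by
      by_contra hne
      exact hD a a.2 b b.2 (Subtype.coe_ne_coe.2 hne) h) hxd hdt
    (by rw [hp, hp, hp, hM]; exact mul_pos hk hb) hω
  let P' : N → ℝ × ℝ := fun v => if h : v ∈ S then pts x y' ⟨v, h⟩ else 0
  have hP' : ∀ v h, pts x y' ⟨v, h⟩ = P' v := fun v h => by simp [P', h]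
  refine ⟨P', by simpa [GenPos, hP'] using r1, ⟨?_, ?_, ?_, ?_⟩, ?_, ?_⟩
  · simpa [hp, hP', hM, hk] using r2
  · simpa [hp, hP', hi] using r3
  · simpa [hp, hP', hi] using r4
  · simpa [hp, hP', hc] using r5
  · rw [hp, hp, hp, hM, hP', hP', hP', mul_assoc, mul_left_comm] at r6
    exact (mul_pos_iff_of_pos_left hk).1 r6
  · intro u hu
    simpa [hP'] using r7 (u := ⟨u, hu⟩) trivial

end flatten

section triangles

variable {a b c e v w : ℝ × ℝ}

lemma InTri.pos (h : InTri a b c v) (hp : 0 < cr a b c) :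
    0 < cr a b v ∧ 0 < cr b c v ∧ 0 < cr c a v := by
  have := cr_add a b c v
  rcases h with h | h
  · exact h
  · linarith [h.1, h.2.1, h.2.2]

lemma cr_bary (x y p q r w : ℝ × ℝ) : cr x y w * cr p q r =
    cr q r w * cr x y p + cr r p w * cr x y q + cr p q w * cr x y r := by
  unfold cr; ring

private lemma cr_mul_cr (a b c v w : ℝ × ℝ) :
    cr v w a * cr a b c = cr c a v * cr a b w - cr a b v * cr c a w := by
  unfold cr; ring

lemma InTri.trans (h : InTri a b c v) (h' : InTri v a b w) : InTri a b c w := by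
  have e1 := cr_mul_cr a b c v w
  have e2 := cr_mul_cr b c a v w
  have h1 := cr_add a b c v
  have h2 : cr a b w + cr v w b - cr v w a = cr a b v := by unfold cr; ring
  rw [cr_rot a b c] at e2
  rw [InTri, cr_swap v b, cr_swap' v w b, cr_swap' v w a] at h'
  unfold InTri at h ⊢
  rcases h with ⟨k1, k2, k3⟩ | ⟨k1, k2, k3⟩ <;> rcases h' with ⟨l1, l2, l3⟩ | ⟨l1, l2, l3⟩
  · exact .inl ⟨l2, by nlinarith, by nlinarith⟩
  · nlinarith
  · nlinarith
  · exact .inr ⟨l2, by nlinarith, by nlinarith⟩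

lemma InTri.exit (hv : InTri a b c v) (hw : ¬ InTri a b c w) (n1 : cr a b w ≠ 0)
    (n2 : cr b c w ≠ 0) (n3 : cr c a w ≠ 0) (m1 : cr v a w ≠ 0) (m2 : cr v b w ≠ 0)
    (m3 : cr v c w ≠ 0) : Crs v w a b ∨ Crs v w b c ∨ Crs v w c a := by
  have e1 := cr_mul_cr a b c v w
  have e2 := cr_mul_cr b c a v w
  have e3 := cr_mul_cr c a b v w
  have h1 := cr_add a b c v
  rw [cr_swap', neg_ne_zero] at m1 m2 m3
  rw [cr_rot a b c] at e2
  rw [← cr_rot c] at e3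
  unfold InTri Crs at *
  generalize cr a b c = D at *
  generalize cr v w a = p at *
  generalize cr v w b = q at *
  generalize cr v w c = r at *
  generalize cr a b v = x at *
  generalize cr b c v = y at *
  generalize cr c a v = z at *
  generalize cr a b w = x' at *
  generalize cr b c w = y' at *
  generalize cr c a w = z' at *
  rw [ne_iff_lt_or_gt] at *
  rcases hv with ⟨h5, h6, h7⟩ | ⟨h5, h6, h7⟩ <;>
  rcases n1 with n1 | n1 <;> rcases n2 with n2 | n2 <;> rcases n3 with n3 | n3 <;>
  rcases m1 with m1 | m1 <;> rcases m2 with m2 | m2 <;> rcases m3 with m3 | m3 <;>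
  simp [*, n1.not_gt, n2.not_gt, n3.not_gt, m1.not_gt, m2.not_gt, m3.not_gt, mul_neg_iff,
    h5.not_gt, h6.not_gt, h7.not_gt] at hw ⊢ <;> nlinarith

set_option maxHeartbeats 1000000 in
lemma Crs.triangle (h : Crs v w a c) (hv : ¬ InTri a b c v) (hw : ¬ InTri a b c w)
    (m : cr v w b ≠ 0) (n1 : cr a b v ≠ 0) (n2 : cr b c v ≠ 0) (n3 : cr a b w ≠ 0)
    (n4 : cr b c w ≠ 0) (hb : cr a b c ≠ 0) :
    Crs v w a b ∨ Crs v w b c := by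
  have e1 := cr_mul_cr a b c v w
  have e2 := cr_mul_cr b c a v w
  have e3 := cr_mul_cr c a b v w
  have h1 := cr_add a b c v
  have h2 := cr_add a b c w
  rw [cr_rot a b c] at e2
  rw [← cr_rot c] at e3
  rw [← crs_swap_right] at h
  unfold InTri Crs at *
  generalize cr a b c = D at *
  generalize cr v w a = p at *
  generalize cr v w b = q at *
  generalize cr v w c = r at *
  generalize cr a b v = x at *
  generalize cr b c v = y at *
  generalize cr c a v = z at *
  generalize cr a b w = x' at *
  generalize cr b c w = y' at *
  generalize cr c a w = z' at *
  rw [mul_neg_iff, mul_neg_iff] at h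
  rw [ne_iff_lt_or_gt] at *
  rcases h with ⟨⟨h3, h4⟩ | ⟨h3, h4⟩, ⟨h5, h6⟩ | ⟨h5, h6⟩⟩ <;> rcases hb with hb | hb <;>
  rcases n1 with n1 | n1 <;> rcases n2 with n2 | n2 <;> rcases n3 with n3 | n3 <;>
  rcases n4 with n4 | n4 <;> rcases m with m | m <;>
  simp [*, n1.not_gt, n2.not_gt, n3.not_gt, n4.not_gt, m.not_gt, h3.not_gt, h4.not_gt,
    h5.not_gt, h6.not_gt, mul_neg_iff] at hv hw ⊢ <;> nlinarith

end triangles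

section quad

variable {p s t o r v w k : ℝ × ℝ}

lemma Crs.of_cone (h1 : 0 < cr w t k) (h2 : 0 < cr w k p) (h : 0 < cr w t p)
    (hk : ¬ InTri w t p k) (h0 : cr t p k ≠ 0) : Crs w k t p := by
  have e : cr p w k = cr w k p := by unfold cr; ring
  have h3 : cr t p k < 0 :=
    lt_of_le_of_ne (not_lt.1 fun h' => hk (.inl ⟨h1, h', by rwa [e]⟩)) h0
  refine ⟨mul_neg_of_neg_of_pos ?_ h2, mul_neg_of_pos_of_neg ?_ h3⟩
  · rw [cr_swap']; linarith
  · rwa [cr_rot]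

lemma cone_cases (h1 : 0 < cr w s t) (h2 : 0 < cr w t p) (h3 : 0 < cr w p s)
    (n1 : cr w s k ≠ 0) (n2 : cr w t k ≠ 0) (n3 : cr w p k ≠ 0) :
    (0 < cr w s k ∧ 0 < cr w k t) ∨ (0 < cr w t k ∧ 0 < cr w k p) ∨
      (0 < cr w p k ∧ 0 < cr w k s) := by
  have h : cr w t p * cr w s k + cr w p s * cr w t k + cr w s t * cr w p k = 0 := by
    unfold cr; ring
  rw [cr_swap' w t k, cr_swap' w p k, cr_swap' w s k]
  rw [ne_iff_lt_or_gt] at *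
  rcases n1 with n1 | n1 <;> rcases n2 with n2 | n2 <;> rcases n3 with n3 | n3 <;>
  simp [*, n1.not_gt, n2.not_gt, n3.not_gt] <;> nlinarith

lemma quad_cover (p1 : 0 < cr p s t) (p2 : 0 < cr p t o) (p3 : 0 < cr p o r) (p4 : 0 < cr p r s)
    (v1 : 0 < cr s t v) (v2 : 0 < cr t o v) (v3 : 0 < cr o r v) (v4 : 0 < cr r s v)
    (n1 : cr p s v ≠ 0) (n2 : cr p t v ≠ 0) (n3 : cr p o v ≠ 0) (n4 : cr p r v ≠ 0)
    (n : cr p s o ≠ 0) :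
    InTri p s t v ∨ InTri p t o v ∨ InTri p o r v ∨ InTri p r s v := by
  have k1 := cone_cases (k := v) p1 p2
  have k2 := cone_cases (k := v) p3 p4
  rw [InTri, InTri, InTri, InTri, ← cr_rot t p v, ← cr_rot o p v, ← cr_rot r p v, ← cr_rot s p v]
  grind [cr_swap']

lemma not_inTri_half (p1 : 0 < cr p s t) (p2 : 0 < cr p t o) (p3 : 0 < cr p o r)
    (p4 : 0 < cr p r s) (q1 : 0 < cr s t o) (q2 : 0 < cr t o r) (q3 : 0 < cr o r s)
    (q4 : 0 < cr r s t)
    (n1 : cr p s v ≠ 0) (n2 : cr p t v ≠ 0) (n3 : cr p o v ≠ 0) (n4 : v ≠ r → cr p r v ≠ 0)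
    (n : cr p s o ≠ 0) (e1 : ¬ InTri p s t v) (e2 : ¬ InTri p t o v) (e3 : ¬ InTri p o r v)
    (e4 : ¬ InTri p r s v) : ¬ InTri s t o v := by
  intro h
  obtain ⟨h1, h2, h3⟩ := h.pos q1
  have h4 : 0 < cr o r v := by
    have := cr_bary o r s t o v
    rw [cr_self_outer, mul_zero, add_zero, cr_rot t o r] at this
    refine pos_of_mul_pos_left (b := cr s t o) ?_ q1.le
    rw [this]; positivity
  have h5 : 0 < cr r s v := by
    have := cr_bary r s s t o v
    rw [cr_self_right, mul_zero, zero_add, cr_rot o r s] at this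
    refine pos_of_mul_pos_left (b := cr s t o) ?_ q1.le
    rw [this]; positivity
  have hr : v ≠ r := by rintro rfl; simp at h4
  have := quad_cover p1 p2 p3 p4 h1 h2 h4 h5 n1 n2 n3 (n4 hr) n
  tauto

end quad

section kites

/-- A straight-line drawing of `E` on `S` in general position, with outer triangle `A B C`, in which
the crossings are of the kind `Cx` and full, and in which the nodes of `K` are centres of empty
star-shaped quadrilaterals. -/
structure KiteHyp {N : Type*} (S K : Set N) (cor : N → ZMod 4 → N) (E : N → N → Prop)
    (Cx : N → N → N → N → Prop) (A B C : N) (P : N → ℝ × ℝ) : Prop where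
  fin : S.Finite
  gp : GenPos S P
  symm : ∀ {a b}, E a b → E b a
  ne : ∀ {a b}, E a b → a ≠ b
  sides : ∀ {a b c e}, a ∈ S → b ∈ S → c ∈ S → e ∈ S → E a b → E c e →
    Crs (P a) (P b) (P c) (P e) → E a c
  wedge : ∀ {a b c e v}, a ∈ S → b ∈ S → c ∈ S → e ∈ S → v ∈ S → E a b → E c e →
    Crs (P a) (P b) (P c) (P e) → ¬ InTri (P a) (P b) (P c) (P v)
  cx : ∀ {a b c e}, a ∈ S → b ∈ S → c ∈ S → e ∈ S → E a b → E c e →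
    Crs (P a) (P b) (P c) (P e) → Cx a b c e
  memA : A ∈ S
  memB : B ∈ S
  memC : C ∈ S
  AB : E A B
  BC : E B C
  AC : E A C
  nmemA : A ∉ K
  nmemB : B ∉ K
  nmemC : C ∉ K
  inside : ∀ {v}, v ∈ S → v ≠ A → v ≠ B → v ≠ C → InTri (P A) (P B) (P C) (P v)
  sub : K ⊆ S
  cor_mem : ∀ {p}, p ∈ K → ∀ i, cor p i ∈ S
  cor_nmem : ∀ {p}, p ∈ K → ∀ i, cor p i ∉ K
  cor_inj : ∀ {p}, p ∈ K → Function.Injective (cor p)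
  spoke : ∀ {p}, p ∈ K → ∀ i, E p (cor p i)
  nbr : ∀ {p v}, p ∈ K → v ∈ S → E p v → ∃ i, v = cor p i
  side : ∀ {p}, p ∈ K → ∀ i, E (cor p i) (cor p (i + 1))
  pos : ∀ {p}, p ∈ K → ∀ i, 0 < cr (P p) (P (cor p i)) (P (cor p (i + 1)))
  empty : ∀ {p v}, p ∈ K → ∀ i, v ∈ S →
    ¬ InTri (P p) (P (cor p i)) (P (cor p (i + 1))) (P v)
  unc_spoke : ∀ {p a b}, p ∈ K → ∀ i, a ∈ S → b ∈ S → E a b →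
    ¬ Crs (P a) (P b) (P p) (P (cor p i))
  unc_side : ∀ {p a b}, p ∈ K → ∀ i, a ∈ S → b ∈ S → E a b →
    ¬ Crs (P a) (P b) (P (cor p i)) (P (cor p (i + 1)))
  ndiag : ∀ {p}, p ∈ K → ∀ i, ¬ E (cor p i) (cor p (i + 2))
  diag_ne : ∀ {p q}, p ∈ K → q ∈ K → p ≠ q → ∀ i j,
    ¬ (cor p i = cor q j ∧ cor p (i + 2) = cor q (j + 2))
  diag_cx : ∀ {p}, p ∈ K → ∀ i,
    Cx (cor p i) (cor p (i + 2)) (cor p (i + 1)) (cor p (i + 3)) ∧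
    Cx (cor p i) (cor p (i + 2)) (cor p (i + 3)) (cor p (i + 1))

namespace KiteHyp

variable {N : Type*} {S K : Set N} {cor : N → ZMod 4 → N} {E : N → N → Prop}
  {Cx : N → N → N → N → Prop} {A B C : N} {P P' : N → ℝ × ℝ} {p : N}

lemma transport (H : KiteHyp S K cor E Cx A B C P) (hgp : GenPos S P') (hs : SameOn S P P' E) :
    KiteHyp S K cor E Cx A B C P' where
  __ := H
  gp := hgp
  sides ha hb hc he h1 h2 h := H.sides ha hb hc he h1 h2 ((hs.crs _ ha _ hb _ hc _ he h1 h2).1 h)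
  wedge {a b c e v} ha hb hc he hv h1 h2 h := by
    have h' := (hs.crs _ ha _ hb _ hc _ he h1 h2).1 h
    by_cases va : v = a
    · subst va; intro h; exact absurd h (by simp [InTri])
    by_cases vb : v = b
    · subst vb; intro h; exact absurd h (by simp [InTri])
    by_cases vc : v = c
    · subst vc; intro h; exact absurd h (by simp [InTri])
    rw [hs.tri _ ha _ hb _ hc _ hv h1 (H.sides hb ha hc he (H.symm h1) h2 h'.swap_left)
      (H.sides ha hb hc he h1 h2 h') va vb vc]
    exact H.wedge ha hb hc he hv h1 h2 h'
  cx ha hb hc he h1 h2 h := H.cx ha hb hc he h1 h2 ((hs.crs _ ha _ hb _ hc _ he h1 h2).1 h)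
  inside hv v1 v2 v3 :=
    (hs.tri _ H.memA _ H.memB _ H.memC _ hv H.AB H.BC H.AC v1 v2 v3).2 (H.inside hv v1 v2 v3)
  pos hp i := (hs.orient _ (H.sub hp) _ (H.cor_mem hp _) _ (H.cor_mem hp _) (H.spoke hp _)
    (H.side hp _) (H.spoke hp _)).2 (H.pos hp i)
  empty {p v} hp i hv := by
    by_cases va : v = p
    · subst va; intro h; exact absurd h (by simp [InTri])
    by_cases vb : v = cor p i
    · subst vb; intro h; exact absurd h (by simp [InTri])
    by_cases vc : v = cor p (i + 1)
    · subst vc; intro h; exact absurd h (by simp [InTri])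
    rw [hs.tri _ (H.sub hp) _ (H.cor_mem hp _) _ (H.cor_mem hp _) _ hv (H.spoke hp _)
      (H.side hp _) (H.spoke hp _) va vb vc]
    exact H.empty hp i hv
  unc_spoke hp i ha hb h := by
    rw [hs.crs _ ha _ hb _ (H.sub hp) _ (H.cor_mem hp _) h (H.spoke hp _)]
    exact H.unc_spoke hp i ha hb h
  unc_side hp i ha hb h := by
    rw [hs.crs _ ha _ hb _ (H.cor_mem hp _) _ (H.cor_mem hp _) h (H.side hp _)]
    exact H.unc_side hp i ha hb h

lemma cor_ne (H : KiteHyp S K cor E Cx A B C P) (hp : p ∈ K) {i j : ZMod 4} (h : i ≠ j) :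
    cor p i ≠ cor p j := fun h' => h (H.cor_inj hp h')

lemma ne_cor (H : KiteHyp S K cor E Cx A B C P) {q : N} (hp : p ∈ K) (hq : q ∈ K) (i : ZMod 4) :
    q ≠ cor p i := by
  rintro rfl
  exact H.cor_nmem hp i hq

lemma gp_cor (H : KiteHyp S K cor E Cx A B C P) (hp : p ∈ K) {i j : ZMod 4} (h : i ≠ j) {v : N}
    (hv : v ∈ S) (h1 : v ≠ cor p i) (h2 : v ≠ cor p j) :
    cr (P (cor p i)) (P (cor p j)) (P v) ≠ 0 :=
  H.gp _ (H.cor_mem hp _) _ (H.cor_mem hp _) _ hv (H.cor_ne hp h) h2.symm h1.symm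

lemma gp_spoke (H : KiteHyp S K cor E Cx A B C P) (hp : p ∈ K) {i : ZMod 4} {v : N}
    (hv : v ∈ S) (h1 : v ≠ p) (h2 : v ≠ cor p i) :
    cr (P p) (P (cor p i)) (P v) ≠ 0 :=
  H.gp _ (H.sub hp) _ (H.cor_mem hp _) _ hv (H.ne_cor hp hp i) h2.symm h1.symm

lemma flatHyp (H : KiteHyp S K cor E Cx A B C P) (hp : p ∈ K) (i : ZMod 4)
    (hi : cr (P (cor p i)) (P (cor p (i + 1))) (P (cor p (i + 2))) < 0) :
    FlatHyp S P E (cor p i) (cor p (i + 1)) (cor p (i + 2)) where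
  mem_s := H.cor_mem hp _
  mem_d := H.cor_mem hp _
  mem_t := H.cor_mem hp _
  symm := H.symm
  ne := H.ne
  gp := H.gp
  sides := H.sides
  wedge := H.wedge
  sd := H.side hp i
  dt := by have := H.side hp (i + 1); rwa [add_assoc] at this
  nst := H.ndiag hp i
  unc_s := H.unc_side hp i
  unc_t := by have := fun {a b} => H.unc_side (a := a) (b := b) hp (i + 1); rwa [add_assoc] at this
  s_ne_t := H.cor_ne hp (by clear * -; revert i; decide)
  nbr {k} hk hkd hks hkt := by
    have p1 := H.pos hp i
    have p2 := H.pos hp (i + 1)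
    have e1 := fun v => H.empty (v := v) hp i
    have e2 := fun v => H.empty (v := v) hp (i + 1)
    rw [add_assoc, one_add_one_eq_two] at p2 e2
    by_cases hkp : k = p
    · subst hkp
      refine .inl ⟨H.spoke hp _, H.spoke hp _, fun h => ?_, fun h => ?_⟩
      · exact e2 _ (H.cor_mem hp i) h.swap
      · exact e1 _ (H.cor_mem hp (i + 2)) h.rot
    right
    have hkd' := H.ne hkd
    have c1 : (0:ℝ) < cr (P (cor p (i+1))) (P (cor p i)) (P (cor p (i+2))) := by
      rw [cr_swap]; linarith
    have c2 : (0:ℝ) < cr (P (cor p (i+1))) (P (cor p (i+2))) (P p) := by rwa [cr_rot]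
    have c3 : (0:ℝ) < cr (P (cor p (i+1))) (P p) (P (cor p i)) := by rwa [cr_rot, cr_rot]
    have n1 := H.gp_cor hp (i := i + 1) (j := i) (by clear * -; revert i; decide) hk hkd' hks
    have n2 := H.gp_cor hp (i := i + 1) (j := i + 2) (by clear * -; revert i; decide) hk hkd' hkt
    have n3 := H.gp_spoke hp (i := i + 1) hk hkp hkd'
    rcases cone_cases c1 c2 c3 n1 n2 (by rwa [cr_swap, neg_ne_zero]) with h | h | h
    · exact ⟨mul_pos h.1 c1, mul_pos h.2 c1⟩
    · have := Crs.of_cone h.1 h.2 c2 (fun h => e2 _ hk (h.rot.rot))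
        (by rw [cr_swap, neg_ne_zero]; exact H.gp_spoke hp hk hkp hkt)
      exact absurd (crs_swap_left.1 (crs_swap_right.1 this)) (H.unc_spoke hp _ hk (H.cor_mem hp _) hkd)
    · have := Crs.of_cone h.1 h.2 c3 (fun h => e1 _ hk h.rot)
        (H.gp_spoke hp hk hkp hks)
      exact absurd (crs_swap_left.1 this) (H.unc_spoke hp _ hk (H.cor_mem hp _) hkd)

lemma exists_convex (H : KiteHyp S K cor E Cx A B C P) (hp : p ∈ K) :
    ∃ P', KiteHyp S K cor E Cx A B C P' ∧
      ∀ i, 0 < cr (P' (cor p i)) (P' (cor p (i + 1))) (P' (cor p (i + 2))) := by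
  by_cases h : ∀ i, 0 < cr (P (cor p i)) (P (cor p (i + 1))) (P (cor p (i + 2)))
  · exact ⟨P, H, h⟩
  push Not at h
  obtain ⟨i, hi⟩ := h
  have hi' : cr (P (cor p i)) (P (cor p (i + 1))) (P (cor p (i + 2))) < 0 :=
    lt_of_le_of_ne hi (H.gp_cor hp (by clear * -; revert i; decide) (H.cor_mem hp _)
      (H.cor_ne hp (by clear * -; revert i; decide)) (H.cor_ne hp (by clear * -; revert i; decide)))
  obtain ⟨P', h⟩ := (H.flatHyp hp i hi').exists_flat H.fin (ω := -1) (by norm_num)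
  have H' := H.transport h.gp h.same
  refine ⟨P', H', ?_⟩
  have hs := h.side
  have hs' : 0 < cr (P' (cor p i)) (P' (cor p (i + 1))) (P' (cor p (i + 2))) := by
    by_contra! h0
    nlinarith
  obtain ⟨-, n1⟩ := h.near (H.sub hp) (H.ne_cor hp hp _) (H.ne_cor hp hp _) (H.ne_cor hp hp _)
  obtain ⟨m1, m2⟩ := h.near (H.cor_mem hp (i + 3)) (H.cor_ne hp (by clear * -; revert i; decide))
    (H.cor_ne hp (by clear * -; revert i; decide)) (H.cor_ne hp (by clear * -; revert i; decide))
  have p1 := H'.pos hp i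
  have p3 := H'.pos hp (i + 2)
  have p4 := H'.pos hp (i + 3)
  rw [show i + 2 + 1 = i + 3 by ring] at p3
  rw [show i + 3 + 1 = i by clear * -; revert i; decide] at p4
  rw [cr_rot (P' p) (P' (cor p i)) (P' (cor p (i+1)))] at n1
  have k1 := pos_of_mul_pos_left n1 p1.le
  have k2 := cr_add (P' (cor p i)) (P' (cor p (i + 2))) (P' (cor p (i + 3))) (P' p)
  rw [cr_rot (P' p) (P' (cor p (i + 2))),
    cr_rot (P' p) (P' (cor p (i + 3)))] at k2
  have k3 : 0 < cr (P' (cor p i)) (P' (cor p (i + 2))) (P' (cor p (i + 3))) := by linarith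
  have k4 := pos_of_mul_pos_right m1 k3.le
  have k5 := pos_of_mul_pos_right m2 k3.le
  intro j
  obtain h | h | h | h : j = i ∨ j = i + 1 ∨ j = i + 2 ∨ j = i + 3 := by
    clear * -; revert i j; decide
  · rwa [h]
  · rwa [h, show i + 1 + 1 = i + 2 by ring, show i + 1 + 2 = i + 3 by ring]
  · rwa [h, show i + 2 + 1 = i + 3 by ring, show i + 2 + 2 = i by clear * -; revert i; decide,
      cr_rot]
  · rwa [h, show i + 3 + 1 = i by clear * -; revert i; decide,
      show i + 3 + 2 = i + 1 by clear * -; revert i; decide, cr_rot, cr_rot]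

end KiteHyp

end kites

section kites

namespace KiteHyp

variable {N : Type*} {S K : Set N} {cor : N → ZMod 4 → N} {E : N → N → Prop}
  {Cx : N → N → N → N → Prop} {A B C : N} {P : N → ℝ × ℝ} {p : N}

lemma not_inTri_half (H : KiteHyp S K cor E Cx A B C P) (hp : p ∈ K)
    (hc : ∀ i, 0 < cr (P (cor p i)) (P (cor p (i + 1))) (P (cor p (i + 2)))) (i : ZMod 4) {v : N}
    (hv : v ∈ S) (hvp : v ≠ p) :
    ¬ InTri (P (cor p i)) (P (cor p (i + 1))) (P (cor p (i + 2))) (P v) := by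
  by_cases va : v = cor p i
  · subst va; simp [InTri]
  by_cases vb : v = cor p (i + 1)
  · subst vb; simp [InTri]
  by_cases vc : v = cor p (i + 2)
  · subst vc; simp [InTri]
  have e1 : i + 1 + 1 = i + 2 := by ring
  have e2 : i + 1 + 2 = i + 3 := by ring
  have e3 : i + 2 + 1 = i + 3 := by ring
  have e4 : i + 2 + 2 = i := by clear * -; revert i; decide
  have e5 : i + 3 + 1 = i := by clear * -; revert i; decide
  have e6 : i + 3 + 2 = i + 1 := by clear * -; revert i; decide
  have p2 := H.pos hp (i + 1)
  have p3 := H.pos hp (i + 2)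
  have p4 := H.pos hp (i + 3)
  have q2 := hc (i + 1)
  have q3 := hc (i + 2)
  have q4 := hc (i + 3)
  have t2 := H.empty hp (i + 1) hv
  have t3 := H.empty hp (i + 2) hv
  have t4 := H.empty hp (i + 3) hv
  rw [e1] at p2 t2
  rw [e3] at p3 t3
  rw [e5] at p4 t4
  rw [e1, e2] at q2
  rw [e3, e4] at q3
  rw [e5, e6] at q4
  exact _root_.not_inTri_half (H.pos hp i) p2 p3 p4 (hc i) q2 q3 q4 (H.gp_spoke hp hv hvp va)
    (H.gp_spoke hp hv hvp vb) (H.gp_spoke hp hv hvp vc)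
    (fun h => H.gp_spoke hp hv hvp fun h' => h (by rw [h']))
    (H.gp_spoke hp (H.cor_mem hp _) (H.ne_cor hp hp _).symm
      (H.cor_ne hp (by clear * -; revert i; decide)))
    (H.empty hp i hv) t2 t3 t4

lemma not_crs_diag (H : KiteHyp S K cor E Cx A B C P) (hp : p ∈ K)
    (hc : ∀ i, 0 < cr (P (cor p i)) (P (cor p (i + 1))) (P (cor p (i + 2)))) (i : ZMod 4) {a b : N}
    (ha : a ∈ S) (hb : b ∈ S) (hap : a ≠ p) (hbp : b ≠ p) (hab : E a b) :
    ¬ Crs (P a) (P b) (P (cor p i)) (P (cor p (i + 2))) := by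
  have key (i : ZMod 4) (h1 : a ≠ cor p (i + 1)) (h2 : b ≠ cor p (i + 1)) :
      ¬ Crs (P a) (P b) (P (cor p i)) (P (cor p (i + 2))) := by
    intro h
    obtain ⟨-, -, a1, a2, b1, b2⟩ := h.ne_of
    have g1 {v : N} (hv : v ∈ S) (h1 : v ≠ cor p i) (h2 : v ≠ cor p (i + 1)) :=
      H.gp_cor hp (i := i) (j := i + 1) (by clear * -; revert i; decide) hv h1 h2
    have g2 {v : N} (hv : v ∈ S) (h1 : v ≠ cor p (i + 1)) (h2 : v ≠ cor p (i + 2)) :=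
      H.gp_cor hp (i := i + 1) (j := i + 2) (by clear * -; revert i; decide) hv h1 h2
    rcases h.triangle (H.not_inTri_half hp hc i ha hap) (H.not_inTri_half hp hc i hb hbp)
      (H.gp _ ha _ hb _ (H.cor_mem hp _) (H.ne hab) h2 h1) (g1 ha a1 h1) (g2 ha h1 a2)
      (g1 hb b1 h2) (g2 hb h2 b2) (hc i).ne' with h | h
    · exact H.unc_side hp i ha hb hab h
    · have := H.unc_side hp (i + 1) ha hb hab
      rw [add_assoc, one_add_one_eq_two] at this
      exact this h
  by_cases hi : a ≠ cor p (i + 1) ∧ b ≠ cor p (i + 1)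
  · exact key i hi.1 hi.2
  have e1 : i + 1 + 2 = i + 3 := by ring
  have e3 : i + 3 + 2 = i + 1 := by clear * -; revert i; decide
  have nd : ∀ {x y}, E x y → x = cor p (i + 1) → y ≠ cor p (i + 3) := by
    rintro x y h rfl rfl
    exact H.ndiag hp (i + 1) (by rwa [e1])
  have n13 : cor p (i + 1) ≠ cor p (i + 3) := H.cor_ne hp (by clear * -; revert i; decide)
  have h3 : a ≠ cor p (i + 3) ∧ b ≠ cor p (i + 3) := by
    rw [not_and_or, not_not, not_not] at hi
    rcases hi with h | h
    · exact ⟨fun h' => n13 (h.symm.trans h'), nd hab h⟩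
    · exact ⟨nd (H.symm hab) h, fun h' => n13 (h.symm.trans h')⟩
  have := key (i + 2) (by rw [show i + 2 + 1 = i + 3 by ring]; exact h3.1)
    (by rw [show i + 2 + 1 = i + 3 by ring]; exact h3.2)
  rwa [show i + 2 + 2 = i by clear * -; revert i; decide, crs_swap_right] at this

lemma remove (H : KiteHyp S K cor E Cx A B C P) (hp : p ∈ K)
    (hc : ∀ i, 0 < cr (P (cor p i)) (P (cor p (i + 1))) (P (cor p (i + 2)))) :
    KiteHyp (S \ {p}) (K \ {p}) cor
      (fun a b => E a b ∨ ∃ i, a = cor p i ∧ b = cor p (i + 2)) Cx A B C P := by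
  have e4 (i : ZMod 4) : i + 2 + 2 = i := by clear * -; revert i; decide
  have key {a b c e : N} (ha : a ∈ S \ {p}) (hb : b ∈ S \ {p}) (hab : E a b)
      (h : ∃ i, c = cor p i ∧ e = cor p (i + 2)) : ¬ Crs (P a) (P b) (P c) (P e) := by
    obtain ⟨i, rfl, rfl⟩ := h
    exact H.not_crs_diag hp hc i ha.1 hb.1 ha.2 hb.2 hab
  have key' {a b c e : N} (hcS : c ∈ S \ {p}) (heS : e ∈ S \ {p}) (hce : E c e)
      (h : ∃ i, a = cor p i ∧ b = cor p (i + 2)) : ¬ Crs (P a) (P b) (P c) (P e) :=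
    fun h' => key hcS heS hce h h'.symm
  have two (i j : ZMod 4) (h : Crs (P (cor p i)) (P (cor p (i + 2))) (P (cor p j))
      (P (cor p (j + 2)))) : j = i + 1 ∨ j = i + 3 := by
    obtain ⟨-, -, h1, h2, -, -⟩ := h.ne_of
    have k1 : i ≠ j := fun h => h1 (by rw [h])
    have k2 : i ≠ j + 2 := fun h => h2 (by rw [← h])
    clear * - k1 k2
    revert i j; decide
  exact
  { H with
    fin := H.fin.sdiff
    gp := fun a ha b hb c hc => H.gp a ha.1 b hb.1 c hc.1
    symm := by
      rintro a b (h | ⟨i, rfl, rfl⟩)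
      · exact .inl (H.symm h)
      · exact .inr ⟨i + 2, rfl, by rw [e4]⟩
    ne := by
      rintro a b (h | ⟨i, rfl, rfl⟩)
      · exact H.ne h
      · exact H.cor_ne hp (by clear * -; revert i; decide)
    sides := by
      rintro a b c e ha hb hcS he (h1 | h1) (h2 | h2) h
      · exact .inl (H.sides ha.1 hb.1 hcS.1 he.1 h1 h2 h)
      · exact absurd h (key ha hb h1 h2)
      · exact absurd h (key' hcS he h2 h1)
      · obtain ⟨i, rfl, rfl⟩ := h1
        obtain ⟨j, rfl, rfl⟩ := h2
        rcases two i j h with rfl | rfl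
        · exact .inl (H.side hp i)
        · have := H.side hp (i + 3)
          rw [show i + 3 + 1 = i by clear * -; revert i; decide] at this
          exact .inl (H.symm this)
    wedge := by
      rintro a b c e v ha hb hcS he hv (h1 | h1) (h2 | h2) h
      · exact H.wedge ha.1 hb.1 hcS.1 he.1 hv.1 h1 h2 h
      · exact absurd h (key ha hb h1 h2)
      · exact absurd h (key' hcS he h2 h1)
      · obtain ⟨i, rfl, rfl⟩ := h1
        obtain ⟨j, rfl, rfl⟩ := h2
        intro h'
        rcases two i j h with rfl | rfl
        · exact H.not_inTri_half hp hc i hv.1 hv.2 h'.rot.swap.rot.rot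
        · have := H.not_inTri_half hp hc (i + 2) hv.1 hv.2
          rw [e4, show i + 2 + 1 = i + 3 by ring] at this
          exact this h'.rot
    cx := by
      rintro a b c e ha hb hcS he (h1 | h1) (h2 | h2) h
      · exact H.cx ha.1 hb.1 hcS.1 he.1 h1 h2 h
      · exact absurd h (key ha hb h1 h2)
      · exact absurd h (key' hcS he h2 h1)
      · obtain ⟨i, rfl, rfl⟩ := h1
        obtain ⟨j, rfl, rfl⟩ := h2
        rcases two i j h with rfl | rfl
        · rw [show i + 1 + 2 = i + 3 by ring]
          exact (H.diag_cx hp i).1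
        · rw [show i + 3 + 2 = i + 1 by clear * -; revert i; decide]
          exact (H.diag_cx hp i).2
    memA := ⟨H.memA, fun h => H.nmemA (h ▸ hp)⟩
    memB := ⟨H.memB, fun h => H.nmemB (h ▸ hp)⟩
    memC := ⟨H.memC, fun h => H.nmemC (h ▸ hp)⟩
    AB := .inl H.AB
    BC := .inl H.BC
    AC := .inl H.AC
    nmemA := fun h => H.nmemA h.1
    nmemB := fun h => H.nmemB h.1
    nmemC := fun h => H.nmemC h.1
    inside := fun hv => H.inside hv.1
    sub := Set.sdiff_subset_sdiff_left H.sub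
    cor_mem := fun hq i => ⟨H.cor_mem hq.1 i, fun h => H.cor_nmem hq.1 i (h ▸ hp)⟩
    cor_nmem := fun hq i h => H.cor_nmem hq.1 i h.1
    cor_inj := fun hq => H.cor_inj hq.1
    spoke := fun hq i => .inl (H.spoke hq.1 i)
    nbr := by
      rintro q v hq hv (h | ⟨i, rfl, -⟩)
      · exact H.nbr hq.1 hv.1 h
      · exact absurd hq.1 (H.cor_nmem hp i)
    side := fun hq i => .inl (H.side hq.1 i)
    pos := fun hq => H.pos hq.1
    empty := fun hq i hv => H.empty hq.1 i hv.1
    unc_spoke := by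
      rintro q a b hq i ha hb (h | h)
      · exact H.unc_spoke hq.1 i ha.1 hb.1 h
      · exact key' ⟨H.sub hq.1, hq.2⟩ ⟨H.cor_mem hq.1 i, fun h => H.cor_nmem hq.1 i (h ▸ hp)⟩
          (H.spoke hq.1 i) h
    unc_side := by
      rintro q a b hq i ha hb (h | h)
      · exact H.unc_side hq.1 i ha.1 hb.1 h
      · exact key' ⟨H.cor_mem hq.1 i, fun h => H.cor_nmem hq.1 i (h ▸ hp)⟩
          ⟨H.cor_mem hq.1 _, fun h => H.cor_nmem hq.1 _ (h ▸ hp)⟩ (H.side hq.1 i) h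
    ndiag := by
      rintro q hq i (h | ⟨j, h⟩)
      · exact H.ndiag hq.1 i h
      · exact H.diag_ne hq.1 hp hq.2 i j h
    diag_ne := fun hq hr => H.diag_ne hq.1 hr.1
    diag_cx := fun hq => H.diag_cx hq.1 }

end KiteHyp

end kites

section finite_drawings

/-- The closed triangle `a b c`. -/
def Tri (a b c : ℝ × ℝ) : Set (ℝ × ℝ) :=
  {x | ∃ α β γ : ℝ, 0 ≤ α ∧ 0 ≤ β ∧ 0 ≤ γ ∧ α + β + γ = 1 ∧ x = α • a + β • b + γ • c}

/-- A straight-line drawing on `F` in the triangle `A B C` in which only the pairs of edges in `Cx`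
may cross. -/
structure FinDraw {N : Type*} (F : Set N) (E : N → N → Prop) (Cx : N → N → N → N → Prop)
    (A B C : N) (P : N → ℝ × ℝ) : Prop where
  memA : A ∈ F
  memB : B ∈ F
  memC : C ∈ F
  nondeg : cr (P A) (P B) (P C) ≠ 0
  inj : Set.InjOn P F
  avoid : ∀ {a b v}, a ∈ F → b ∈ F → v ∈ F → E a b → v ≠ a → v ≠ b →
    P v ∉ segment ℝ (P a) (P b)
  disj : ∀ {a b c e}, a ∈ F → b ∈ F → c ∈ F → e ∈ F → E a b → E c e → a ≠ c → a ≠ e → b ≠ c →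
    b ≠ e → ¬ Cx a b c e → Disjoint (segment ℝ (P a) (P b)) (segment ℝ (P c) (P e))
  hull : ∀ {v}, v ∈ F → P v ∈ Tri (P A) (P B) (P C)

variable {a b c e v x : ℝ × ℝ}

lemma cr_lineMap (a b x y : ℝ × ℝ) (t s : ℝ) :
    cr a b (t • x + s • y) = t * cr a b x + s * cr a b y + (1 - t - s) * cr a b 0 := by
  unfold cr
  simp only [Prod.fst_add, Prod.smul_fst, Prod.snd_add, Prod.smul_snd, smul_eq_mul, Prod.fst_zero,
    Prod.snd_zero]
  ring

lemma cr_comb (a b x y : ℝ × ℝ) {t s : ℝ} (h : t + s = 1) :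
    cr a b (t • x + s • y) = t * cr a b x + s * cr a b y := by
  rw [cr_lineMap, show 1 - t - s = 0 by linarith]
  ring

lemma cr_eq_zero_of_mem_segment (h : x ∈ segment ℝ a b) : cr a b x = 0 := by
  obtain ⟨t, s, -, -, h, rfl⟩ := h
  rw [cr_comb _ _ _ _ h]
  simp

lemma crs_of_mem_segment (h1 : x ∈ segment ℝ a b) (h2 : x ∈ segment ℝ c e) (n1 : cr a b c ≠ 0)
    (n2 : cr a b e ≠ 0) (n3 : cr c e a ≠ 0) (n4 : cr c e b ≠ 0) : Crs a b c e := by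
  have key {a b c e : ℝ × ℝ} (h1 : x ∈ segment ℝ a b) (h2 : x ∈ segment ℝ c e)
      (n1 : cr a b c ≠ 0) (n2 : cr a b e ≠ 0) : cr a b c * cr a b e < 0 := by
    have h := cr_eq_zero_of_mem_segment h1
    obtain ⟨t, s, ht, hs, hts, rfl⟩ := h2
    rw [cr_comb _ _ _ _ hts] at h
    by_contra! h0
    have h3 : 0 < cr a b c * cr a b e := lt_of_le_of_ne h0 (mul_ne_zero n1 n2).symm
    rcases ht.eq_or_lt with rfl | ht
    · have : s = 1 := by linarith
      simp [this] at h
      exact n2 h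
    · nlinarith [mul_nonneg hs h3.le, mul_pos ht (mul_self_pos.2 n1),
        congrArg (cr a b c * ·) h]
  exact ⟨key h1 h2 n1 n2, key h2 h1 n3 n4⟩

lemma Crs.exists_mem (h : Crs a b c e) : ∃ x ∈ segment ℝ a b, x ∈ segment ℝ c e := by
  have hd : cr c e a - cr c e b = -(cr a b c - cr a b e) := by unfold cr; ring
  have key {u v : ℝ} (h : u * v < 0) : 0 ≤ -v / (u - v) ∧ 0 ≤ u / (u - v) ∧
      -v / (u - v) + u / (u - v) = 1 := by
    have hne : u - v ≠ 0 := by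
      intro h0
      have : u = v := by linarith
      subst this
      nlinarith [mul_self_nonneg u]
    refine ⟨?_, ?_, by field_simp; ring⟩
    · rcases mul_neg_iff.1 h with h | h
      · exact div_nonneg (by linarith) (by linarith)
      · exact div_nonneg_of_nonpos (by linarith) (by linarith)
    · rcases mul_neg_iff.1 h with h | h
      · exact div_nonneg (by linarith) (by linarith)
      · exact div_nonneg_of_nonpos (by linarith) (by linarith)
  obtain ⟨k1, k2, k3⟩ := key h.1
  obtain ⟨l1, l2, l3⟩ := key h.2
  refine ⟨_, ⟨_, _, l1, l2, l3, rfl⟩, ⟨_, _, k1, k2, k3, ?_⟩⟩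
  have hne : cr a b c - cr a b e ≠ 0 := by
    intro h0; rw [h0] at k3; simp at k3
  rw [hd]
  refine Prod.ext ?_ ?_
  · simp only [Prod.fst_add, Prod.smul_fst, smul_eq_mul]
    field_simp
    unfold cr
    ring
  · simp only [Prod.snd_add, Prod.smul_snd, smul_eq_mul]
    field_simp
    unfold cr
    ring

lemma bary_eq (h : cr a b c ≠ 0) : x = (cr b c x / cr a b c) • a + (cr c a x / cr a b c) • b +
    (cr a b x / cr a b c) • c := by
  refine Prod.ext ?_ ?_
  · simp only [Prod.fst_add, Prod.smul_fst, smul_eq_mul]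
    field_simp
    unfold cr
    ring
  · simp only [Prod.snd_add, Prod.smul_snd, smul_eq_mul]
    field_simp
    unfold cr
    ring

lemma bary_sum (h : cr a b c ≠ 0) :
    cr b c x / cr a b c + cr c a x / cr a b c + cr a b x / cr a b c = 1 := by
  rw [← add_div, ← add_div, div_eq_one_iff_eq h, ← cr_add a b c x]
  ring

lemma InTri.mem_tri (h : InTri a b c x) : x ∈ Tri a b c := by
  have h0 := h.cr_ne
  have hs := cr_add a b c x
  refine ⟨_, _, _, ?_, ?_, ?_, bary_sum h0, bary_eq h0⟩ <;> rcases h with h | h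
  · exact div_nonneg h.2.1.le (by linarith)
  · exact div_nonneg_of_nonpos h.2.1.le (by linarith)
  · exact div_nonneg h.2.2.le (by linarith)
  · exact div_nonneg_of_nonpos h.2.2.le (by linarith)
  · exact div_nonneg h.1.le (by linarith)
  · exact div_nonneg_of_nonpos h.1.le (by linarith)

lemma left_mem_tri (a b c : ℝ × ℝ) : a ∈ Tri a b c := ⟨1, 0, 0, by simp⟩
lemma mid_mem_tri (a b c : ℝ × ℝ) : b ∈ Tri a b c := ⟨0, 1, 0, by simp⟩
lemma right_mem_tri (a b c : ℝ × ℝ) : c ∈ Tri a b c := ⟨0, 0, 1, by simp⟩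

namespace KiteHyp

variable {N : Type*} {S K : Set N} {cor : N → ZMod 4 → N} {E : N → N → Prop}
  {Cx : N → N → N → N → Prop} {A B C : N} {P : N → ℝ × ℝ} {p : N}

lemma finDraw (H : KiteHyp S K cor E Cx A B C P) : FinDraw S E Cx A B C P where
  memA := H.memA
  memB := H.memB
  memC := H.memC
  nondeg := H.gp _ H.memA _ H.memB _ H.memC (H.ne H.AB) (H.ne H.BC) (H.ne H.AC)
  inj := H.gp.injOn H.memA H.memB H.memC (H.ne H.AB) (H.ne H.BC) (H.ne H.AC)
  avoid {a b v} ha hb hv h h1 h2 h3 :=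
    H.gp _ ha _ hb _ hv (H.ne h) h2.symm h1.symm (cr_eq_zero_of_mem_segment h3)
  disj {a b c e} ha hb hc he h1 h2 n1 n2 n3 n4 hx := by
    rw [Set.disjoint_left]
    intro x hx1 hx2
    refine hx (H.cx ha hb hc he h1 h2 (crs_of_mem_segment hx1 hx2 ?_ ?_ ?_ ?_))
    · exact H.gp _ ha _ hb _ hc (H.ne h1) n3 n1
    · exact H.gp _ ha _ hb _ he (H.ne h1) n4 n2
    · exact H.gp _ hc _ he _ ha (H.ne h2) n2.symm n1.symm
    · exact H.gp _ hc _ he _ hb (H.ne h2) n4.symm n3.symm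
  hull {v} hv := by
    by_cases h1 : v = A
    · rw [h1]; exact left_mem_tri _ _ _
    by_cases h2 : v = B
    · rw [h2]; exact mid_mem_tri _ _ _
    by_cases h3 : v = C
    · rw [h3]; exact right_mem_tri _ _ _
    exact (H.inside hv h1 h2 h3).mem_tri

theorem exists_finDraw (H : KiteHyp S K cor E Cx A B C P) :
    ∃ P', FinDraw (S \ K) (fun a b => E a b ∨ ∃ p ∈ K, ∃ i, a = cor p i ∧ b = cor p (i + 2))
      Cx A B C P' := by
  have hK : K.Finite := H.fin.subset H.sub
  induction hn : K.ncard generalizing S K E P with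
  | zero =>
    obtain rfl : K = ∅ := (Set.ncard_eq_zero hK).1 hn
    exact ⟨P, by simpa using H.finDraw⟩
  | succ n ih =>
    obtain ⟨p, hp⟩ : K.Nonempty := by
      rw [Set.nonempty_iff_ne_empty]; rintro rfl; simp at hn
    obtain ⟨P₁, H₁, hc⟩ := H.exists_convex hp
    obtain ⟨P', h⟩ := ih (H₁.remove hp hc) hK.sdiff
      (by rw [Set.ncard_sdiff_singleton_of_mem hp, hn]; rfl)
    refine ⟨P', ?_⟩
    convert h using 1
    · ext v
      simp only [Set.mem_sdiff, Set.mem_singleton_iff]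
      have : v = p → v ∈ K := fun h => h ▸ hp
      tauto
    · ext a b
      simp only [Set.mem_sdiff, Set.mem_singleton_iff, or_assoc]
      refine or_congr_right ⟨?_, ?_⟩
      · rintro ⟨q, hq, h⟩
        by_cases hqp : q = p
        · exact .inl (hqp ▸ h)
        · exact .inr ⟨q, ⟨hq, hqp⟩, h⟩
      · rintro (h | ⟨q, hq, h⟩)
        · exact ⟨p, hp, h⟩
        · exact ⟨q, hq.1, h⟩

end KiteHyp

end finite_drawings

open Filter Topology

section thin_triangles

variable {a b c u s m x y z : ℝ × ℝ}

lemma tri_comm : Tri b a c = Tri a b c := by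
  ext x
  constructor <;> rintro ⟨α, β, γ, h1, h2, h3, h4, rfl⟩ <;>
    exact ⟨β, α, γ, h2, h1, h3, by linarith, by abel⟩

lemma convex_tri (a b c : ℝ × ℝ) : Convex ℝ (Tri a b c) := by
  rintro _ ⟨α, β, γ, h1, h2, h3, h4, rfl⟩ _ ⟨α', β', γ', h1', h2', h3', h4', rfl⟩ t t' ht ht' h
  refine ⟨t * α + t' * α', t * β + t' * β', t * γ + t' * γ', by positivity, by positivity,
    by positivity, ?_, ?_⟩
  · linear_combination t * h4 + t' * h4' + h
  · module

lemma Convex.tri_subset {C : Set (ℝ × ℝ)} (hC : Convex ℝ C) (ha : a ∈ C) (hb : b ∈ C)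
    (hc : c ∈ C) : Tri a b c ⊆ C := by
  rintro _ ⟨α, β, γ, h1, h2, h3, h4, rfl⟩
  have := hC.sum_mem (t := Finset.univ) (w := ![α, β, γ]) (z := ![a, b, c])
    (by intro i _; fin_cases i <;> simpa) (by simpa [Fin.sum_univ_three]) 
    (by intro i _; fin_cases i <;> simpa)
  simpa [Fin.sum_univ_three] using this

lemma segment_subset_tri (hx : x ∈ Tri a b c) (hy : y ∈ Tri a b c) :
    segment ℝ x y ⊆ Tri a b c := (convex_tri a b c).segment_subset hx hy

lemma dist_segment_of_mem_tri (hm : m ∈ segment ℝ u s) (hx : x ∈ Tri u s z) :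
    ∃ y ∈ segment ℝ u s, dist x y ≤ dist z m := by
  obtain ⟨α, β, γ, h1, h2, h3, h4, rfl⟩ := hx
  refine ⟨α • u + β • s + γ • m, ?_, ?_⟩
  · exact (convex_segment u s).tri_subset (left_mem_segment ℝ u s) (right_mem_segment ℝ u s) hm
      ⟨α, β, γ, h1, h2, h3, h4, rfl⟩
  · rw [dist_add_left, dist_smul₀, Real.norm_of_nonneg h3]
    nlinarith [dist_nonneg (x := z) (y := m)]

lemma eventually_disjoint_tri {K : Set (ℝ × ℝ)} (hK : IsClosed K)
    (h : Disjoint K (segment ℝ u s)) (hm : m ∈ segment ℝ u s) :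
    ∀ᶠ z in 𝓝 m, Disjoint K (Tri u s z) := by
  have hc : IsCompact (segment ℝ u s) := by
    rw [segment_eq_image_lineMap]
    exact isCompact_Icc.image AffineMap.lineMap_continuous
  obtain ⟨δ, hδ, hsub⟩ := hc.exists_thickening_subset_open hK.isOpen_compl
    (Set.subset_compl_iff_disjoint_left.2 h)
  filter_upwards [Metric.ball_mem_nhds m hδ] with z hz
  rw [Set.disjoint_right]
  intro x hx
  obtain ⟨y, hy, hxy⟩ := dist_segment_of_mem_tri hm hx
  exact hsub (Metric.mem_thickening_iff.2 ⟨y, hy, hxy.trans_lt hz⟩)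

lemma isClosed_segment (a b : ℝ × ℝ) : IsClosed (segment ℝ a b) := by
  rw [segment_eq_image_lineMap]
  exact (isCompact_Icc.image AffineMap.lineMap_continuous).isClosed

lemma exists_separating (h1 : b ∉ segment ℝ u s) (h2 : s ∉ segment ℝ u b) :
    ∃ f : ℝ × ℝ →L[ℝ] ℝ, 0 < f (s - u) ∧ f (b - u) ≤ 0 := by
  let g : ℝ × ℝ →L[ℝ] ℝ :=
    (b.1 - u.1) • ContinuousLinearMap.snd ℝ ℝ ℝ - (b.2 - u.2) • ContinuousLinearMap.fst ℝ ℝ ℝ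
  have hg (w : ℝ × ℝ) : g w = (b.1 - u.1) * w.2 - (b.2 - u.2) * w.1 := by simp [g]
  have hgb : g (b - u) = 0 := by rw [hg]; simp; ring
  rcases lt_trichotomy (g (s - u)) 0 with h | h | h
  · exact ⟨-g, by simpa using h, by simp [hgb]⟩
  · let f : ℝ × ℝ →L[ℝ] ℝ :=
      (s.1 - u.1) • ContinuousLinearMap.fst ℝ ℝ ℝ + (s.2 - u.2) • ContinuousLinearMap.snd ℝ ℝ ℝ
    have hf (w : ℝ × ℝ) : f w = (s.1 - u.1) * w.1 + (s.2 - u.2) * w.2 := by simp [f]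
    have hsu : s ≠ u := by rintro rfl; exact h2 (left_mem_segment ℝ _ _)
    have hpos : 0 < f (s - u) := by
      rw [hf]
      by_contra! h0
      simp only [Prod.fst_sub, Prod.snd_sub] at h0
      refine hsu (Prod.ext ?_ ?_) <;>
        nlinarith [mul_self_nonneg (s.1 - u.1), mul_self_nonneg (s.2 - u.2)]
    refine ⟨f, hpos, ?_⟩
    by_contra! h0
    have key : f (s - u) • (b - u) = f (b - u) • (s - u) := by
      rw [hg] at h
      simp only [Prod.fst_sub, Prod.snd_sub] at h
      rw [hf, hf]
      refine Prod.ext ?_ ?_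
      · simp only [Prod.fst_sub, Prod.snd_sub, Prod.smul_fst, smul_eq_mul]
        linear_combination (s.2 - u.2) * h
      · simp only [Prod.fst_sub, Prod.snd_sub, Prod.smul_snd, smul_eq_mul]
        linear_combination (-(s.1 - u.1)) * h
    rcases le_total (f (b - u)) (f (s - u)) with hle | hle
    · refine h1 (segment_eq_image' ℝ u s ▸ ⟨f (b - u) / f (s - u), ⟨by positivity,
        div_le_one_of_le₀ hle hpos.le⟩, ?_⟩)
      simp only
      rw [div_eq_inv_mul, mul_smul, ← key, smul_smul, inv_mul_cancel₀ hpos.ne', one_smul]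
      abel
    · refine h2 (segment_eq_image' ℝ u b ▸ ⟨f (s - u) / f (b - u), ⟨by positivity,
        div_le_one_of_le₀ hle h0.le⟩, ?_⟩)
      simp only
      rw [div_eq_inv_mul, mul_smul, key, smul_smul, inv_mul_cancel₀ h0.ne', one_smul]
      abel
  · exact ⟨g, h, hgb.le⟩

lemma eventually_tri_inter_left (h1 : b ∉ segment ℝ u s) (h2 : s ∉ segment ℝ u b)
    (hm : m ∈ openSegment ℝ u s) :
    ∀ᶠ z in 𝓝 m, ∀ x ∈ segment ℝ u b, x ∈ Tri u s z → x = u := by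
  obtain ⟨f, hs, hb⟩ := exists_separating h1 h2
  have hmu : 0 < f (m - u) := by
    obtain ⟨t, t', ht, ht', h, rfl⟩ := hm
    rw [show t • u + t' • s - u = t' • (s - u) by
      rw [show t = 1 - t' by linarith]; module, map_smul]
    exact mul_pos ht' hs
  have hev : ∀ᶠ z in 𝓝 m, 0 < f (z - u) :=
    (Continuous.tendsto (by fun_prop : Continuous fun z => f (z - u)) m).eventually_const_lt hmu
  filter_upwards [hev] with z hz x hx hx'
  obtain ⟨t, t', ht, ht', h, rfl⟩ := hx
  obtain ⟨α, β, γ, k1, k2, k3, k4, hx'⟩ := hx'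
  have e1 : f (t • u + t' • b - u) = t' * f (b - u) := by
    rw [show t • u + t' • b - u = t' • (b - u) by
      rw [show t = 1 - t' by linarith]; module, map_smul, smul_eq_mul]
  have e2 : f (t • u + t' • b - u) = β * f (s - u) + γ * f (z - u) := by
    rw [hx', show α • u + β • s + γ • z - u = β • (s - u) + γ • (z - u) by
      rw [show α = 1 - β - γ by linarith]; module, map_add, map_smul, map_smul, smul_eq_mul,
      smul_eq_mul]
  have hle : t' * f (b - u) ≤ 0 := mul_nonpos_of_nonneg_of_nonpos ht' hb
  have b1 := mul_nonneg k2 hs.le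
  have b2 := mul_nonneg k3 hz.le
  have hβ : β = 0 := by
    have : β * f (s - u) = 0 := by linarith
    exact (mul_eq_zero.1 this).resolve_right hs.ne'
  have hγ : γ = 0 := by
    have : γ * f (z - u) = 0 := by linarith
    exact (mul_eq_zero.1 this).resolve_right hz.ne'
  rw [hx', hβ, hγ, show α = 1 by linarith]
  simp

lemma eventually_tri_inter_right (h1 : b ∉ segment ℝ u s) (h2 : u ∉ segment ℝ s b)
    (hm : m ∈ openSegment ℝ u s) :
    ∀ᶠ z in 𝓝 m, ∀ x ∈ segment ℝ s b, x ∈ Tri u s z → x = s := by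
  simp_rw [tri_comm (b := u)]
  exact eventually_tri_inter_left (by rwa [segment_symm]) h2 (by rwa [openSegment_symm])

lemma eq_of_mem_segments (h1 : b ∉ segment ℝ u s) (h2 : s ∉ segment ℝ u b)
    (hx : x ∈ segment ℝ u b) (hx' : x ∈ segment ℝ u s) : x = u := by
  have hm : (1 / 2 : ℝ) • u + (1 / 2 : ℝ) • s ∈ openSegment ℝ u s :=
    ⟨1 / 2, 1 / 2, by norm_num, by norm_num, by norm_num, rfl⟩
  refine (eventually_tri_inter_left h1 h2 hm).self_of_nhds x hx ?_
  obtain ⟨t, t', ht, ht', h, rfl⟩ := hx'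
  exact ⟨t, t', 0, ht, ht', le_rfl, by linarith, by simp⟩

end thin_triangles

section projective

variable {a b c a' b' c' x y z : ℝ × ℝ} {wa wb wc : ℝ}

/-- The denominator of the projective map `projMap`. -/
noncomputable def projDen (a b c : ℝ × ℝ) (wa wb wc : ℝ) (x : ℝ × ℝ) : ℝ :=
  wa * cr b c x / cr a b c + wb * cr c a x / cr a b c + wc * cr a b x / cr a b c

/-- The projective map taking the triangle `a b c` to `a' b' c'`, with weights `wa`, `wb`, `wc`. -/
noncomputable def projMap (a b c a' b' c' : ℝ × ℝ) (wa wb wc : ℝ) (x : ℝ × ℝ) : ℝ × ℝ :=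
  (projDen a b c wa wb wc x)⁻¹ • ((wa * cr b c x / cr a b c) • a' +
    (wb * cr c a x / cr a b c) • b' + (wc * cr a b x / cr a b c) • c')

lemma cr_bary_left (α β γ : ℝ) (h : α + β + γ = 1) :
    cr b c (α • a + β • b + γ • c) = α * cr a b c := by
  have : α = 1 - β - γ := by linarith
  subst this
  unfold cr
  simp only [Prod.fst_add, Prod.smul_fst, Prod.snd_add, Prod.smul_snd, smul_eq_mul]
  ring

lemma cr_bary_mid (α β γ : ℝ) (h : α + β + γ = 1) :
    cr c a (α • a + β • b + γ • c) = β * cr a b c := by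
  have := cr_bary_left (a := b) (b := c) (c := a) β γ α (by linarith)
  rw [cr_rot a b c] at this
  rw [← this]; congr 1; abel

lemma cr_bary_right (α β γ : ℝ) (h : α + β + γ = 1) :
    cr a b (α • a + β • b + γ • c) = γ * cr a b c := by
  have := cr_bary_left (a := c) (b := a) (c := b) γ α β (by linarith)
  rw [cr_rot b c a, cr_rot a b c] at this
  rw [← this]; congr 1; abel

lemma projDen_bary (h0 : cr a b c ≠ 0) (α β γ : ℝ) (h : α + β + γ = 1) :
    projDen a b c wa wb wc (α • a + β • b + γ • c) = wa * α + wb * β + wc * γ := by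
  unfold projDen
  rw [cr_bary_left _ _ _ h, cr_bary_mid _ _ _ h, cr_bary_right _ _ _ h]
  field_simp

lemma projMap_bary (h0 : cr a b c ≠ 0) (α β γ : ℝ) (h : α + β + γ = 1) :
    projMap a b c a' b' c' wa wb wc (α • a + β • b + γ • c) =
      (wa * α + wb * β + wc * γ)⁻¹ • ((wa * α) • a' + (wb * β) • b' + (wc * γ) • c') := by
  unfold projMap
  rw [projDen_bary h0 _ _ _ h, cr_bary_left _ _ _ h, cr_bary_mid _ _ _ h, cr_bary_right _ _ _ h]
  simp only [← mul_assoc, mul_div_assoc, div_self h0, mul_one]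

lemma projDen_pos (h0 : cr a b c ≠ 0) (ha : 0 < wa) (hb : 0 < wb) (hc : 0 < wc)
    (hx : x ∈ Tri a b c) : 0 < projDen a b c wa wb wc x := by
  obtain ⟨α, β, γ, h1, h2, h3, h, rfl⟩ := hx
  rw [projDen_bary h0 _ _ _ h]
  have := mul_nonneg ha.le h1
  have := mul_nonneg hb.le h2
  have := mul_nonneg hc.le h3
  rcases h1.eq_or_lt with rfl | h1
  · rcases h2.eq_or_lt with rfl | h2
    · have : γ = 1 := by linarith
      subst this; simpa
    · have := mul_pos hb h2; linarith
  · have := mul_pos ha h1; linarith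

lemma projMap_mem (h0 : cr a b c ≠ 0) (ha : 0 < wa) (hb : 0 < wb) (hc : 0 < wc)
    (hx : x ∈ Tri a b c) : projMap a b c a' b' c' wa wb wc x ∈ Tri a' b' c' := by
  have hp := projDen_pos h0 ha hb hc hx
  obtain ⟨α, β, γ, h1, h2, h3, h, rfl⟩ := hx
  rw [projDen_bary h0 _ _ _ h] at hp
  rw [projMap_bary h0 _ _ _ h]
  refine ⟨wa * α / (wa * α + wb * β + wc * γ), wb * β / (wa * α + wb * β + wc * γ),
    wc * γ / (wa * α + wb * β + wc * γ), by positivity, by positivity, by positivity, ?_, ?_⟩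
  · field_simp
  · simp only [div_eq_inv_mul, smul_add, smul_smul]

lemma projMap_left (h0 : cr a b c ≠ 0) (ha : 0 < wa) :
    projMap a b c a' b' c' wa wb wc a = a' := by
  have := projMap_bary (a' := a') (b' := b') (c' := c') (wa := wa) (wb := wb) (wc := wc) h0 1 0 0
    (by norm_num)
  simpa [ha.ne'] using this

lemma projMap_mid (h0 : cr a b c ≠ 0) (hb : 0 < wb) :
    projMap a b c a' b' c' wa wb wc b = b' := by
  have := projMap_bary (a' := a') (b' := b') (c' := c') (wa := wa) (wb := wb) (wc := wc) h0 0 1 0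
    (by norm_num)
  simpa [hb.ne'] using this

lemma projMap_right (h0 : cr a b c ≠ 0) (hc : 0 < wc) :
    projMap a b c a' b' c' wa wb wc c = c' := by
  have := projMap_bary (a' := a') (b' := b') (c' := c') (wa := wa) (wb := wb) (wc := wc) h0 0 0 1
    (by norm_num)
  simpa [hc.ne'] using this

lemma projMap_comb (h0 : cr a b c ≠ 0) (ha : 0 < wa) (hb : 0 < wb) (hc : 0 < wc)
    (hx : x ∈ Tri a b c) (hy : y ∈ Tri a b c) {t s : ℝ}
    (hts : t + s = 1) :
    projMap a b c a' b' c' wa wb wc (t • x + s • y) =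
      (t * projDen a b c wa wb wc x + s * projDen a b c wa wb wc y)⁻¹ •
        ((t * projDen a b c wa wb wc x) • projMap a b c a' b' c' wa wb wc x +
          (s * projDen a b c wa wb wc y) • projMap a b c a' b' c' wa wb wc y) := by
  have hpx := projDen_pos h0 ha hb hc hx
  have hpy := projDen_pos h0 ha hb hc hy
  have e : projDen a b c wa wb wc (t • x + s • y) =
      t * projDen a b c wa wb wc x + s * projDen a b c wa wb wc y := by
    unfold projDen
    rw [cr_comb _ _ _ _ hts, cr_comb _ _ _ _ hts, cr_comb _ _ _ _ hts]
    ring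
  unfold projMap
  rw [e, cr_comb _ _ _ _ hts, cr_comb _ _ _ _ hts, cr_comb _ _ _ _ hts, mul_smul, mul_smul,
    smul_inv_smul₀ hpx.ne', smul_inv_smul₀ hpy.ne']
  congr 1
  module

lemma projMap_segment_subset (h0 : cr a b c ≠ 0) (ha : 0 < wa) (hb : 0 < wb) (hc : 0 < wc)
    (hx : x ∈ Tri a b c) (hy : y ∈ Tri a b c) :
    segment ℝ (projMap a b c a' b' c' wa wb wc x) (projMap a b c a' b' c' wa wb wc y) ⊆
      projMap a b c a' b' c' wa wb wc '' segment ℝ x y := by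
  have hpx := projDen_pos h0 ha hb hc hx
  have hpy := projDen_pos h0 ha hb hc hy
  rintro _ ⟨t, s, ht, hs, hts, rfl⟩
  have hcomb {t s : ℝ} := projMap_comb (a' := a') (b' := b') (c' := c') (t := t) (s := s) h0 ha hb
    hc hx hy
  generalize projDen a b c wa wb wc x = p at *
  generalize projDen a b c wa wb wc y = q at *
  have hd : 0 < t * q + s * p := by
    rcases ht.eq_or_lt with rfl | ht
    · have : s = 1 := by linarith
      subst this; simpa
    · have := mul_pos ht hpy
      have := mul_nonneg hs hpx.le
      linarith
  have h1 : t * q / (t * q + s * p) + s * p / (t * q + s * p) = 1 := by field_simp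
  refine ⟨(t * q / (t * q + s * p)) • x + (s * p / (t * q + s * p)) • y,
    ⟨_, _, by positivity, by positivity, h1, rfl⟩, ?_⟩
  rw [hcomb h1]
  have e : t * q / (t * q + s * p) * p + s * p / (t * q + s * p) * q = p * q / (t * q + s * p) := by
    rw [div_mul_eq_mul_div, div_mul_eq_mul_div, ← add_div]
    congr 1
    linear_combination p * q * hts
  rw [e, smul_add, smul_smul, smul_smul]
  generalize t * q + s * p = D at *
  congr 2 <;> field_simp

lemma projMap_injOn (h0 : cr a b c ≠ 0) (h0' : cr a' b' c' ≠ 0) (ha : 0 < wa) (hb : 0 < wb)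
    (hc : 0 < wc) : Set.InjOn (projMap a b c a' b' c' wa wb wc) (Tri a b c) := by
  intro x hx y hy hxy
  have key {x : ℝ × ℝ} (hx : x ∈ Tri a b c) :
      projMap a' b' c' a b c wa⁻¹ wb⁻¹ wc⁻¹ (projMap a b c a' b' c' wa wb wc x) = x := by
    have hp := projDen_pos h0 ha hb hc hx
    obtain ⟨α, β, γ, h1, h2, h3, h, rfl⟩ := hx
    rw [projDen_bary h0 _ _ _ h] at hp
    rw [projMap_bary h0 _ _ _ h]
    set d := wa * α + wb * β + wc * γ with hd
    rw [smul_add, smul_add, smul_smul, smul_smul, smul_smul, projMap_bary h0' _ _ _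
      (by rw [← mul_add, ← mul_add, ← hd, inv_mul_cancel₀ hp.ne'])]
    have e1 : wa⁻¹ * (d⁻¹ * (wa * α)) = d⁻¹ * α := by field_simp
    have e2 : wb⁻¹ * (d⁻¹ * (wb * β)) = d⁻¹ * β := by field_simp
    have e3 : wc⁻¹ * (d⁻¹ * (wc * γ)) = d⁻¹ * γ := by field_simp
    rw [e1, e2, e3, ← mul_add, ← mul_add, h, mul_one, inv_inv, smul_add, smul_add, smul_smul,
      smul_smul, smul_smul, mul_inv_cancel_left₀ hp.ne', mul_inv_cancel_left₀ hp.ne',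
      mul_inv_cancel_left₀ hp.ne']
  rw [← key hx, ← key hy, hxy]

lemma projMap_disjoint (h0 : cr a b c ≠ 0) (h0' : cr a' b' c' ≠ 0) (ha : 0 < wa) (hb : 0 < wb)
    (hc : 0 < wc) {x y z w : ℝ × ℝ} (hx : x ∈ Tri a b c) (hy : y ∈ Tri a b c)
    (hz : z ∈ Tri a b c) (hw : w ∈ Tri a b c) (h : Disjoint (segment ℝ x y) (segment ℝ z w)) :
    Disjoint (segment ℝ (projMap a b c a' b' c' wa wb wc x) (projMap a b c a' b' c' wa wb wc y))
      (segment ℝ (projMap a b c a' b' c' wa wb wc z) (projMap a b c a' b' c' wa wb wc w)) := by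
  refine Set.disjoint_of_subset (projMap_segment_subset h0 ha hb hc hx hy)
    (projMap_segment_subset h0 ha hb hc hz hw) ?_
  rw [Set.disjoint_iff_inter_eq_empty, ← (projMap_injOn h0 h0' ha hb hc).image_inter
    (segment_subset_tri hx hy) (segment_subset_tri hz hw), h.inter_eq, Set.image_empty]

variable {N : Type*} {F : Set N} {E : N → N → Prop} {Cx : N → N → N → N → Prop} {A B C : N}
  {P : N → ℝ × ℝ}

lemma FinDraw.map (H : FinDraw F E Cx A B C P) (h0' : cr a' b' c' ≠ 0) (ha : 0 < wa)
    (hb : 0 < wb) (hc : 0 < wc) :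
    FinDraw F E Cx A B C
      fun v => projMap (P A) (P B) (P C) a' b' c' wa wb wc (P v) where
  memA := H.memA
  memB := H.memB
  memC := H.memC
  nondeg := by
    rw [projMap_left H.nondeg ha, projMap_mid H.nondeg hb, projMap_right H.nondeg hc]
    exact h0'
  inj x hx y hy h := H.inj hx hy
    (projMap_injOn H.nondeg h0' ha hb hc (H.hull hx) (H.hull hy) h)
  avoid {a b v} ha' hb' hv h h1 h2 h3 := by
    have := projMap_disjoint H.nondeg h0' ha hb hc (H.hull ha') (H.hull hb') (H.hull hv)
      (H.hull hv) (by
        rw [segment_same, Set.disjoint_singleton_right]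
        exact H.avoid ha' hb' hv h h1 h2)
    rw [segment_same, Set.disjoint_singleton_right] at this
    exact this h3
  disj ha' hb' hc' he' h1 h2 n1 n2 n3 n4 hx :=
    projMap_disjoint H.nondeg h0' ha hb hc (H.hull ha') (H.hull hb') (H.hull hc') (H.hull he')
      (H.disj ha' hb' hc' he' h1 h2 n1 n2 n3 n4 hx)
  hull {v} hv := by
    rw [projMap_left H.nondeg ha, projMap_mid H.nondeg hb, projMap_right H.nondeg hc]
    exact projMap_mem H.nondeg ha hb hc (H.hull hv)

lemma FinDraw.map_special (H : FinDraw F E Cx A B C P) {v : N}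
    (hv : InTri (P A) (P B) (P C) (P v)) {μ : ℝ} (h0 : 0 < μ) (h1 : μ < 1)
    (h0' : cr a' b' c' ≠ 0) :
    ∃ P', FinDraw F E Cx A B C P' ∧ P' A = a' ∧ P' B = b' ∧ P' C = c' ∧
      ∃ t : ℝ, 0 < t ∧ t < 1 ∧ P' v = (1 - t) • ((1 - μ) • a' + μ • b') + t • c' := by
  have hd := H.nondeg
  have hα : 0 < cr (P B) (P C) (P v) / cr (P A) (P B) (P C) := by
    rcases hv with h | h
    · exact div_pos h.2.1 (by have := cr_add (P A) (P B) (P C) (P v); linarith)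
    · exact div_pos_of_neg_of_neg h.2.1 (by have := cr_add (P A) (P B) (P C) (P v); linarith)
  have hβ : 0 < cr (P C) (P A) (P v) / cr (P A) (P B) (P C) := by
    rcases hv with h | h
    · exact div_pos h.2.2 (by have := cr_add (P A) (P B) (P C) (P v); linarith)
    · exact div_pos_of_neg_of_neg h.2.2 (by have := cr_add (P A) (P B) (P C) (P v); linarith)
  have hγ : 0 < cr (P A) (P B) (P v) / cr (P A) (P B) (P C) := by
    rcases hv with h | h
    · exact div_pos h.1 (by have := cr_add (P A) (P B) (P C) (P v); linarith)
    · exact div_pos_of_neg_of_neg h.1 (by have := cr_add (P A) (P B) (P C) (P v); linarith)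
  have hsum := bary_sum (x := P v) hd
  have heq := bary_eq (x := P v) hd
  generalize cr (P B) (P C) (P v) / cr (P A) (P B) (P C) = α at *
  generalize cr (P C) (P A) (P v) / cr (P A) (P B) (P C) = β at *
  generalize cr (P A) (P B) (P v) / cr (P A) (P B) (P C) = γ at *
  have ha : 0 < (1 - μ) / α := div_pos (by linarith) hα
  have hb : 0 < μ / β := div_pos h0 hβ
  refine ⟨_, H.map (wa := (1 - μ) / α) (wb := μ / β) (wc := 1) h0' ha hb one_pos,
    projMap_left hd ha, projMap_mid hd hb, projMap_right hd one_pos, γ / (1 + γ), by positivity,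
    by rw [div_lt_one (by positivity)]; linarith, ?_⟩
  rw [heq, projMap_bary hd _ _ _ hsum, div_mul_cancel₀ _ hα.ne', div_mul_cancel₀ _ hβ.ne', one_mul,
    show 1 - μ + μ + γ = 1 + γ by ring, show 1 - γ / (1 + γ) = (1 + γ)⁻¹ by field_simp; ring,
    smul_add, div_eq_inv_mul, mul_smul]

end projective

open Filter Topology

section insertion

variable {N : Type*} {F F₁ F₂ : Set N} {E : N → N → Prop} {Cx : N → N → N → N → Prop}
  {A B C u s p : N} {P P₁ P₂ : N → ℝ × ℝ}

/-- A straight-line drawing on `F` in which only the pairs of edges in `Cx` may cross. -/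
structure StraightOn (F : Set N) (E : N → N → Prop) (Cx : N → N → N → N → Prop)
    (P : N → ℝ × ℝ) : Prop where
  inj : Set.InjOn P F
  avoid : ∀ {a b v}, a ∈ F → b ∈ F → v ∈ F → E a b → v ≠ a → v ≠ b →
    P v ∉ segment ℝ (P a) (P b)
  disj : ∀ {a b c e}, a ∈ F → b ∈ F → c ∈ F → e ∈ F → E a b → E c e → a ≠ c → a ≠ e → b ≠ c →
    b ≠ e → ¬ Cx a b c e → Disjoint (segment ℝ (P a) (P b)) (segment ℝ (P c) (P e))

lemma FinDraw.straightOn (H : FinDraw F E Cx A B C P) : StraightOn F E Cx P where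
  inj := H.inj
  avoid := H.avoid
  disj := H.disj

/-- The triangle over the edge `u s` with apex `z` meets the drawing only in that edge. -/
structure ThinTri (F : Set N) (E : N → N → Prop) (u s : N) (P : N → ℝ × ℝ) (z : ℝ × ℝ) :
    Prop where
  edge : ∀ {a b}, a ∈ F → b ∈ F → E a b → a ≠ u → a ≠ s → b ≠ u → b ≠ s →
    Disjoint (segment ℝ (P a) (P b)) (Tri (P u) (P s) z)
  left : ∀ {b}, b ∈ F → E u b → b ≠ u → b ≠ s → ∀ x ∈ segment ℝ (P u) (P b),
    x ∈ Tri (P u) (P s) z → x = P u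
  right : ∀ {b}, b ∈ F → E s b → b ≠ u → b ≠ s → ∀ x ∈ segment ℝ (P s) (P b),
    x ∈ Tri (P u) (P s) z → x = P s
  node : ∀ {v}, v ∈ F → v ≠ u → v ≠ s → P v ∉ Tri (P u) (P s) z

lemma StraightOn.eventually_thinTri (H : StraightOn F E Cx P) (hF : F.Finite)
    (hu : u ∈ F) (hs : s ∈ F) (hus : E u s) (hne : u ≠ s) (hcx : ∀ c e, ¬ Cx c e u s) {m : ℝ × ℝ}
    (hm : m ∈ openSegment ℝ (P u) (P s)) : ∀ᶠ z in 𝓝 m, ThinTri F E u s P z := by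
  have h1 : ∀ᶠ z in 𝓝 m, ∀ a ∈ F, ∀ b ∈ F, E a b → a ≠ u → a ≠ s → b ≠ u → b ≠ s →
      Disjoint (segment ℝ (P a) (P b)) (Tri (P u) (P s) z) := by
    refine (eventually_all_finite hF).2 fun a ha => (eventually_all_finite hF).2 fun b hb => ?_
    simp only [eventually_imp_distrib_left]
    intro h n1 n2 n3 n4
    exact eventually_disjoint_tri (isClosed_segment _ _)
      (H.disj ha hb hu hs h hus n1 n2 n3 n4 (hcx _ _)) (openSegment_subset_segment _ _ _ hm)
  have h2 : ∀ᶠ z in 𝓝 m, ∀ b ∈ F, E u b → b ≠ u → b ≠ s → ∀ x ∈ segment ℝ (P u) (P b),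
      x ∈ Tri (P u) (P s) z → x = P u := by
    refine (eventually_all_finite hF).2 fun b hb => ?_
    simp only [eventually_imp_distrib_left]
    intro h n1 n2
    exact eventually_tri_inter_left (H.avoid hu hs hb hus n1 n2)
      (H.avoid hu hb hs h hne.symm n2.symm) hm
  have h3 : ∀ᶠ z in 𝓝 m, ∀ b ∈ F, E s b → b ≠ u → b ≠ s → ∀ x ∈ segment ℝ (P s) (P b),
      x ∈ Tri (P u) (P s) z → x = P s := by
    refine (eventually_all_finite hF).2 fun b hb => ?_
    simp only [eventually_imp_distrib_left]
    intro h n1 n2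
    exact eventually_tri_inter_right (H.avoid hu hs hb hus n1 n2)
      (H.avoid hs hb hu h hne n1.symm) hm
  have h4 : ∀ᶠ z in 𝓝 m, ∀ v ∈ F, v ≠ u → v ≠ s → P v ∉ Tri (P u) (P s) z := by
    refine (eventually_all_finite hF).2 fun v hv => ?_
    simp only [eventually_imp_distrib_left]
    intro n1 n2
    filter_upwards [eventually_disjoint_tri (isClosed_singleton (x := P v))
      (Set.disjoint_singleton_left.2 (H.avoid hu hs hv hus n1 n2))
      (openSegment_subset_segment _ _ _ hm)] with z hz
    exact Set.disjoint_singleton_left.1 hz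
  filter_upwards [h1, h2, h3, h4] with z k1 k2 k3 k4
  exact ⟨fun ha hb h => k1 _ ha _ hb h, fun hb h => k2 _ hb h, fun hb h => k3 _ hb h,
    fun hv => k4 _ hv⟩

open Classical in
lemma StraightOn.insert (h₁ : StraightOn F₁ E Cx P₁) (h₂ : FinDraw F₂ E Cx u s p P₂)
    (hu : u ∈ F₁) (hs : s ∈ F₁) (hsymm : ∀ {a b}, E a b → E b a) 
    (hinter : ∀ {v}, v ∈ F₁ → v ∈ F₂ → v = u ∨ v = s ∨ v = p)
    (hE : ∀ {a b}, a ∈ F₁ → b ∈ F₂ → b ≠ p → b ∉ F₁ → E a b → a = u ∨ a = s)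
    (hPu : P₂ u = P₁ u) (hPs : P₂ s = P₁ s) (hz : ThinTri F₁ E u s P₁ (P₂ p)) :
    StraightOn (F₁ ∪ F₂ \ {p}) E Cx fun v => if v ∈ F₁ then P₁ v else P₂ v := by
  have hup : u ≠ p := fun h => h₂.nondeg (by rw [h, cr_rot]; simp)
  have hsp : s ≠ p := fun h => h₂.nondeg (by rw [h]; simp)
  set P : N → ℝ × ℝ := fun v => if v ∈ F₁ then P₁ v else P₂ v with hP
  have e₁ {v : N} (hv : v ∈ F₁) : P v = P₁ v := if_pos hv
  have e₂ {v : N} (hv : v ∈ F₂ \ {p}) : P v = P₂ v := by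
    by_cases h : v ∈ F₁
    · rw [e₁ h]
      rcases hinter h hv.1 with rfl | rfl | rfl
      · exact hPu.symm
      · exact hPs.symm
      · exact absurd rfl hv.2
    · exact if_neg h
  have hu₂ : u ∈ F₂ \ {p} := ⟨h₂.memA, hup⟩
  have hs₂ : s ∈ F₂ \ {p} := ⟨h₂.memB, hsp⟩
  have hull {v : N} (hv : v ∈ F₂ \ {p}) : P₂ v ∈ Tri (P₁ u) (P₁ s) (P₂ p) := by
    rw [← hPu, ← hPs]; exact h₂.hull hv.1
  have hmem {v : N} (hv : v ∈ F₁ ∪ F₂ \ {p}) : v ∈ F₂ \ {p} ∨ v ∈ F₁ ∧ v ≠ u ∧ v ≠ s := by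
    by_cases h : v ∈ F₂ \ {p}
    · exact Or.inl h
    · refine Or.inr ⟨hv.resolve_right h, ?_, ?_⟩ <;> rintro rfl <;> contradiction
  have hedge {a b : N} (ha : a ∈ F₁ ∪ F₂ \ {p}) (hb : b ∈ F₁ ∪ F₂ \ {p}) (h : E a b) :
      (a ∈ F₂ \ {p} ∧ b ∈ F₂ \ {p}) ∨ (a ∈ F₁ ∧ b ∈ F₁ ∧ (b ∉ F₂ \ {p} ∨ a ∉ F₂ \ {p})) := by
    by_cases ha₂ : a ∈ F₂ \ {p} <;> by_cases hb₂ : b ∈ F₂ \ {p}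
    · exact Or.inl ⟨ha₂, hb₂⟩
    · refine Or.inr ⟨?_, hb.resolve_right hb₂, Or.inl hb₂⟩
      by_contra ha₁
      rcases hE (hb.resolve_right hb₂) ha₂.1 ha₂.2 ha₁ (hsymm h) with rfl | rfl <;> contradiction
    · refine Or.inr ⟨ha.resolve_right ha₂, ?_, Or.inr ha₂⟩
      by_contra hb₁
      rcases hE (ha.resolve_right ha₂) hb₂.1 hb₂.2 hb₁ h with rfl | rfl <;> contradiction
    · exact Or.inr ⟨ha.resolve_right ha₂, hb.resolve_right hb₂, Or.inl hb₂⟩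
  -- the intersection of a main edge and the triangle
  have main {a b : N} (ha : a ∈ F₁) (hb : b ∈ F₁) (h : E a b) (hb₂ : b ∉ F₂ \ {p}) {x : ℝ × ℝ}
      (hx : x ∈ segment ℝ (P₁ a) (P₁ b)) (hx' : x ∈ Tri (P₁ u) (P₁ s) (P₂ p)) :
      (a = u ∨ a = s) ∧ x = P₁ a := by
    have bu : b ≠ u := by rintro rfl; contradiction
    have bs : b ≠ s := by rintro rfl; contradiction
    by_cases au : a = u
    · subst au; exact ⟨Or.inl rfl, hz.left hb h bu bs x hx hx'⟩
    by_cases as : a = s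
    · subst as; exact ⟨Or.inr rfl, hz.right hb h bu bs x hx hx'⟩
    exact (Set.disjoint_left.1 (hz.edge ha hb h au as bu bs) hx hx').elim
  have main' {a b : N} (ha : a ∈ F₁) (hb : b ∈ F₁) (h : E a b)
      (hab : b ∉ F₂ \ {p} ∨ a ∉ F₂ \ {p}) {x : ℝ × ℝ}
      (hx : x ∈ segment ℝ (P₁ a) (P₁ b)) (hx' : x ∈ Tri (P₁ u) (P₁ s) (P₂ p)) :
      ∃ w, (w = a ∨ w = b) ∧ (w = u ∨ w = s) ∧ x = P₂ w := by
    have hP₂ {w : N} (hw : w = u ∨ w = s) : P₂ w = P₁ w := by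
      rcases hw with rfl | rfl <;> assumption
    rcases hab with hb₂ | ha₂
    · obtain ⟨h1, h2⟩ := main ha hb h hb₂ hx hx'
      exact ⟨a, Or.inl rfl, h1, h2.trans (hP₂ h1).symm⟩
    · rw [segment_symm] at hx
      obtain ⟨h1, h2⟩ := main hb ha (hsymm h) ha₂ hx hx'
      exact ⟨b, Or.inr rfl, h1, h2.trans (hP₂ h1).symm⟩
  have hw₂ {w : N} (hw : w = u ∨ w = s) : w ∈ F₂ := by
    rcases hw with rfl | rfl
    · exact hu₂.1
    · exact hs₂.1
  refine ⟨?_, ?_, ?_⟩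
  · have key {v w : N} (hv : v ∈ F₂ \ {p}) (hw : w ∈ F₁ ∧ w ≠ u ∧ w ≠ s) : P v ≠ P w := by
      rw [e₂ hv, e₁ hw.1]
      intro h
      exact hz.node hw.1 hw.2.1 hw.2.2 (h ▸ hull hv)
    intro v hv w hw h
    rcases hmem hv with hv | hv <;> rcases hmem hw with hw | hw
    · rw [e₂ hv, e₂ hw] at h
      exact h₂.inj hv.1 hw.1 h
    · exact absurd h (key hv hw)
    · exact absurd h.symm (key hw hv)
    · rw [e₁ hv.1, e₁ hw.1] at h
      exact h₁.inj hv.1 hw.1 h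
  · intro a b v ha hb hv h va vb hmem'
    rcases hedge ha hb h with ⟨ha, hb⟩ | ⟨ha, hb, hab⟩
    · rcases hmem hv with hv | hv
      · rw [e₂ ha, e₂ hb, e₂ hv] at hmem'
        exact h₂.avoid ha.1 hb.1 hv.1 h va vb hmem'
      · rw [e₂ ha, e₂ hb, e₁ hv.1] at hmem'
        exact hz.node hv.1 hv.2.1 hv.2.2 (segment_subset_tri (hull ha) (hull hb) hmem')
    · by_cases hv₁ : v ∈ F₁
      · rw [e₁ ha, e₁ hb, e₁ hv₁] at hmem'
        exact h₁.avoid ha hb hv₁ h va vb hmem'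
      · have hv := hv.resolve_left hv₁
        rw [e₁ ha, e₁ hb, e₂ hv] at hmem'
        obtain ⟨w, hw, hw', hw''⟩ := main' ha hb h hab hmem' (hull hv)
        have := h₂.inj hv.1 (hw₂ hw') hw''
        subst this
        rcases hw' with rfl | rfl <;> contradiction
  · have key {a b c e : N} (ha : a ∈ F₁) (hb : b ∈ F₁) (hab : b ∉ F₂ \ {p} ∨ a ∉ F₂ \ {p})
        (hc : c ∈ F₂ \ {p}) (he : e ∈ F₂ \ {p}) (h : E a b) (h' : E c e) (n1 : a ≠ c) (n2 : a ≠ e)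
        (n3 : b ≠ c) (n4 : b ≠ e) :
        Disjoint (segment ℝ (P a) (P b)) (segment ℝ (P c) (P e)) := by
      rw [e₁ ha, e₁ hb, e₂ hc, e₂ he, Set.disjoint_left]
      intro x hx hx'
      obtain ⟨w, hw, hw', rfl⟩ := main' ha hb h hab hx
        (segment_subset_tri (hull hc) (hull he) hx')
      refine h₂.avoid hc.1 he.1 (hw₂ hw') h' ?_ ?_ hx' <;>
        rcases hw with rfl | rfl <;> assumption
    intro a b c e ha hb hc he h h' n1 n2 n3 n4 hx
    rcases hedge ha hb h with ⟨ha, hb⟩ | ⟨ha, hb, hab⟩ <;>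
      rcases hedge hc he h' with ⟨hc, he⟩ | ⟨hc, he, hce⟩
    · rw [e₂ ha, e₂ hb, e₂ hc, e₂ he]
      exact h₂.disj ha.1 hb.1 hc.1 he.1 h h' n1 n2 n3 n4 hx
    · exact (key hc he hce ha hb h' h n1.symm n3.symm n2.symm n4.symm).symm
    · exact key ha hb hab hc he h h' n1 n2 n3 n4
    · rw [e₁ ha, e₁ hb, e₁ hc, e₁ he]
      exact h₁.disj ha hb hc he h h' n1 n2 n3 n4 hx

lemma FinDraw.merge (h₁ : FinDraw F₁ E Cx A B C P₁) (h₂ : FinDraw F₂ E Cx u s p P₂)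
    (hF : F₁.Finite) (hu : u ∈ F₁) (hs : s ∈ F₁)
    (hsymm : ∀ {a b}, E a b → E b a) (hus : E u s) (hcx : ∀ c e, ¬ Cx c e u s)
    (hinter : ∀ {v}, v ∈ F₁ → v ∈ F₂ → v = u ∨ v = s ∨ v = p)
    (hE : ∀ {a b}, a ∈ F₁ → b ∈ F₂ → b ≠ p → b ∉ F₁ → E a b → a = u ∨ a = s) :
    ∃ P, FinDraw (F₁ ∪ F₂ \ {p}) E Cx A B C P := by
  have hne : u ≠ s := fun h => h₂.nondeg (by rw [h]; simp)
  have hPne : P₁ u ≠ P₁ s := fun h => hne (h₁.inj hu hs h)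
  obtain ⟨g, hg, hg0⟩ : ∃ g ∈ Tri (P₁ A) (P₁ B) (P₁ C), cr (P₁ u) (P₁ s) g ≠ 0 := by
    by_contra! h
    have hA := h _ (left_mem_tri _ _ _)
    have hB := h _ (mid_mem_tri _ _ _)
    have hC := h _ (right_mem_tri _ _ _)
    refine h₁.nondeg ?_
    by_contra h0
    apply hPne
    generalize P₁ A = a at *
    generalize P₁ B = b at *
    generalize P₁ C = c at *
    generalize P₁ u = x at *
    generalize P₁ s = y at *
    have e1 : (y.1 - x.1) * cr a b c = 0 := by
      unfold cr at *
      linear_combination (c.1 - b.1) * hA + (a.1 - c.1) * hB + (b.1 - a.1) * hC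
    have e2 : (y.2 - x.2) * cr a b c = 0 := by
      unfold cr at *
      linear_combination (c.2 - b.2) * hA + (a.2 - c.2) * hB + (b.2 - a.2) * hC
    refine Prod.ext ?_ ?_
    · linarith [(mul_eq_zero.1 e1).resolve_right h0]
    · linarith [(mul_eq_zero.1 e2).resolve_right h0]
  have hm : (1 / 2 : ℝ) • P₁ u + (1 / 2 : ℝ) • P₁ s ∈ openSegment ℝ (P₁ u) (P₁ s) :=
    ⟨1 / 2, 1 / 2, by norm_num, by norm_num, by norm_num, rfl⟩
  set m := (1 / 2 : ℝ) • P₁ u + (1 / 2 : ℝ) • P₁ s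
  have hmT : m ∈ Tri (P₁ A) (P₁ B) (P₁ C) :=
    segment_subset_tri (h₁.hull hu) (h₁.hull hs) (openSegment_subset_segment _ _ _ hm)
  have hev := h₁.straightOn.eventually_thinTri hF hu hs hus hne hcx hm
  have ht : Tendsto (fun ε : ℝ => (1 - ε) • m + ε • g) (𝓝[>] 0) (𝓝 m) := by
    have : Continuous fun ε : ℝ => (1 - ε) • m + ε • g := by fun_prop
    have h := this.tendsto 0
    simp only [sub_zero, one_smul, zero_smul, add_zero] at h
    exact h.mono_left nhdsWithin_le_nhds
  obtain ⟨ε, hz, hε⟩ := ((ht.eventually hev).and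
    (Ioo_mem_nhdsGT (show (0 : ℝ) < 1 by norm_num))).exists
  have hzT : (1 - ε) • m + ε • g ∈ Tri (P₁ A) (P₁ B) (P₁ C) :=
    (convex_tri _ _ _) hmT hg (by linarith [hε.2]) hε.1.le (by ring)
  have h0 : cr (P₁ u) (P₁ s) ((1 - ε) • m + ε • g) ≠ 0 := by
    rw [cr_comb _ _ _ _ (by ring),
      cr_eq_zero_of_mem_segment (openSegment_subset_segment _ _ _ hm), mul_zero, zero_add]
    exact mul_ne_zero hε.1.ne' hg0
  have h₂' := h₂.map (wa := 1) (wb := 1) (wc := 1) h0 one_pos one_pos one_pos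
  have hA := projMap_left (wb := 1) (wc := 1) (a' := P₁ u) (b' := P₁ s)
    (c' := (1 - ε) • m + ε • g) h₂.nondeg one_pos
  have hB := projMap_mid (wa := 1) (wc := 1) (a' := P₁ u) (b' := P₁ s)
    (c' := (1 - ε) • m + ε • g) h₂.nondeg one_pos
  have hC := projMap_right (wa := 1) (wb := 1) (a' := P₁ u) (b' := P₁ s)
    (c' := (1 - ε) • m + ε • g) h₂.nondeg one_pos
  have hS := h₁.straightOn.insert h₂' hu hs hsymm hinter hE hA hB
    (by simp only [hC]; exact hz)
  classical
  refine ⟨_, ⟨Or.inl h₁.memA, Or.inl h₁.memB, Or.inl h₁.memC, ?_, hS.inj, hS.avoid, hS.disj, ?_⟩⟩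
  · simp only [h₁.memA, h₁.memB, h₁.memC, if_true]
    exact h₁.nondeg
  · intro v hv
    simp only [h₁.memA, h₁.memB, h₁.memC, if_true]
    split_ifs with h
    · exact h₁.hull h
    · have := h₂'.hull (hv.resolve_left h).1
      rw [hA, hB, hC] at this
      exact (convex_tri _ _ _).tri_subset (h₁.hull hu) (h₁.hull hs) hzT this

end insertion

section stars

lemma not_inTri_corner {a b c p u s : ℝ × ℝ} {D : ℝ} (hp : D * cr b c p < D * cr b c a)
    (hu : D * cr b c u < D * cr b c a) (hs : D * cr b c s < D * cr b c a) :
    ¬ InTri p u s a := by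
  intro h
  have h1 := cr_bary b c p u s a
  have h2 := cr_add p u s a
  have h3 : cr u s a * (D * cr b c a - D * cr b c p) + cr s p a * (D * cr b c a - D * cr b c u) +
      cr p u a * (D * cr b c a - D * cr b c s) = 0 := by
    rw [← h2] at h1
    linear_combination D * h1
  rcases h with ⟨k1, k2, k3⟩ | ⟨k1, k2, k3⟩
  · have := mul_pos k2 (sub_pos.2 hp)
    have := mul_pos k3 (sub_pos.2 hu)
    have := mul_pos k1 (sub_pos.2 hs)
    linarith
  · have := mul_neg_of_neg_of_pos k2 (sub_pos.2 hp)
    have := mul_neg_of_neg_of_pos k3 (sub_pos.2 hu)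
    have := mul_neg_of_neg_of_pos k1 (sub_pos.2 hs)
    linarith

/-- A planar straight-line drawing of `E` on `S` in general position, with outer triangle `A B C`,
in which the nodes of `K` are centres of star-shaped quadrilaterals. -/
structure StarHyp {N : Type*} (S K : Set N) (cor : N → ZMod 4 → N) (E : N → N → Prop)
    (Cx : N → N → N → N → Prop) (A B C : N) (P : N → ℝ × ℝ) : Prop where
  fin : S.Finite
  gp : GenPos S P
  symm : ∀ {a b}, E a b → E b a
  ne : ∀ {a b}, E a b → a ≠ b
  planar : ∀ {a b c e}, a ∈ S → b ∈ S → c ∈ S → e ∈ S → E a b → E c e →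
    ¬ Crs (P a) (P b) (P c) (P e)
  memA : A ∈ S
  memB : B ∈ S
  memC : C ∈ S
  AB : E A B
  BC : E B C
  AC : E A C
  nmemA : A ∉ K
  nmemB : B ∉ K
  nmemC : C ∉ K
  inside : ∀ {v}, v ∈ S → v ≠ A → v ≠ B → v ≠ C → InTri (P A) (P B) (P C) (P v)
  sub : K ⊆ S
  cor_mem : ∀ {p}, p ∈ K → ∀ i, cor p i ∈ S
  cor_nmem : ∀ {p}, p ∈ K → ∀ i, cor p i ∉ K
  cor_inj : ∀ {p}, p ∈ K → Function.Injective (cor p)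
  spoke : ∀ {p}, p ∈ K → ∀ i, E p (cor p i)
  nbr : ∀ {p v}, p ∈ K → v ∈ S → E p v → ∃ i, v = cor p i
  side : ∀ {p}, p ∈ K → ∀ i, E (cor p i) (cor p (i + 1))
  pos : ∀ {p}, p ∈ K → ∀ i, 0 < cr (P p) (P (cor p i)) (P (cor p (i + 1)))
  ndiag : ∀ {p}, p ∈ K → ∀ i, ¬ E (cor p i) (cor p (i + 2))
  diag_ne : ∀ {p q}, p ∈ K → q ∈ K → p ≠ q → ∀ i j,
    ¬ (cor p i = cor q j ∧ cor p (i + 2) = cor q (j + 2))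
  diag_cx : ∀ {p}, p ∈ K → ∀ i,
    Cx (cor p i) (cor p (i + 2)) (cor p (i + 1)) (cor p (i + 3)) ∧
    Cx (cor p i) (cor p (i + 2)) (cor p (i + 3)) (cor p (i + 1))
  side_ncx : ∀ {p}, p ∈ K → ∀ i a b, ¬ Cx a b (cor p i) (cor p (i + 1))

lemma FinDraw.congr {N : Type*} {F : Set N} {E E' : N → N → Prop} {Cx : N → N → N → N → Prop}
    {A B C : N} {P : N → ℝ × ℝ} (H : FinDraw F E Cx A B C P)
    (h : ∀ {a b}, a ∈ F → b ∈ F → E' a b → E a b) : FinDraw F E' Cx A B C P where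
  __ := H
  avoid ha hb hv hE := H.avoid ha hb hv (h ha hb hE)
  disj ha hb hc he h1 h2 := H.disj ha hb hc he (h ha hb h1) (h hc he h2)

namespace StarHyp

variable {N : Type*} {S K : Set N} {cor : N → ZMod 4 → N} {E : N → N → Prop}
  {Cx : N → N → N → N → Prop} {A B C : N} {P : N → ℝ × ℝ} {p : N}

lemma kiteHyp (H : StarHyp S K cor E Cx A B C P)
    (h : ∀ {p v}, p ∈ K → ∀ i, v ∈ S →
      ¬ InTri (P p) (P (cor p i)) (P (cor p (i + 1))) (P v)) :
    KiteHyp S K cor E Cx A B C P where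
  __ := H
  sides ha hb hc he h1 h2 hx := (H.planar ha hb hc he h1 h2 hx).elim
  wedge ha hb hc he _ h1 h2 hx := (H.planar ha hb hc he h1 h2 hx).elim
  cx ha hb hc he h1 h2 hx := (H.planar ha hb hc he h1 h2 hx).elim
  empty := h
  unc_spoke hp i ha hb hab := H.planar ha hb (H.sub hp) (H.cor_mem hp i) hab (H.spoke hp i)
  unc_side hp i ha hb hab := H.planar ha hb (H.cor_mem hp _) (H.cor_mem hp _) hab (H.side hp i)

lemma rotate (H : StarHyp S K cor E Cx A B C P) : StarHyp S K cor E Cx B C A P where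
  __ := H
  memA := H.memB
  memB := H.memC
  memC := H.memA
  AB := H.BC
  BC := H.symm H.AC
  AC := H.symm H.AB
  nmemA := H.nmemB
  nmemB := H.nmemC
  nmemC := H.nmemA
  inside hv h1 h2 h3 := (H.inside hv h3 h1 h2).rot

lemma corner_not_inTri (H : StarHyp S K cor E Cx A B C P) {a b c : N} (ha : a ∈ S) (hb : b ∈ S)
    (hc : c ∈ S) : ¬ InTri (P a) (P b) (P c) (P A) := by
  have key {v : N} (hv : v ∈ S) (hvA : v ≠ A) :
      cr (P A) (P B) (P C) * cr (P B) (P C) (P v) <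
        cr (P A) (P B) (P C) * cr (P B) (P C) (P A) := by
    have h0 := H.gp _ H.memA _ H.memB _ H.memC (H.ne H.AB) (H.ne H.BC) (H.ne H.AC)
    have h1 := mul_self_pos.2 h0
    rw [cr_rot (P A)]
    by_cases vB : v = B
    · subst vB
      rw [show cr (P v) (P C) (P v) = 0 by unfold cr; ring]
      simpa using h1
    by_cases vC : v = C
    · subst vC; simpa using h1
    have h2 := cr_add (P A) (P B) (P C) (P v)
    rcases H.inside hv hvA vB vC with ⟨k1, k2, k3⟩ | ⟨k1, k2, k3⟩
    · exact mul_lt_mul_of_pos_left (by linarith) (by linarith)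
    · exact mul_lt_mul_of_neg_left (by linarith) (by linarith)
  intro h
  have hA : a ≠ A ∧ b ≠ A ∧ c ≠ A := by
    refine ⟨?_, ?_, ?_⟩ <;> rintro rfl <;> simp [InTri] at h
  exact not_inTri_corner (key ha hA.1) (key hb hA.2.1) (key hc hA.2.2) h

lemma cor_not_inTri (H : StarHyp S K cor E Cx A B C P) (hp : p ∈ K) (i j : ZMod 4) :
    ¬ InTri (P p) (P (cor p i)) (P (cor p (i + 1))) (P (cor p j)) := by
  intro h
  obtain ⟨h1, h2, h3⟩ := h.pos (H.pos hp i)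
  have hj : j = i ∨ j = i + 1 ∨ j = i + 2 ∨ j = i + 3 :=
    (by decide : ∀ i j : ZMod 4, j = i ∨ j = i + 1 ∨ j = i + 2 ∨ j = i + 3) i j
  rcases hj with rfl | rfl | rfl | rfl
  · simp at h1
  · simp at h2
  · have := H.pos hp (i + 1)
    rw [show i + 1 + 1 = i + 2 by ring] at this
    rw [cr_swap] at h3
    linarith
  · have := H.pos hp (i + 3)
    rw [(by decide : ∀ i : ZMod 4, i + 3 + 1 = i) i, cr_swap']
      at this
    linarith

lemma attached (H : StarHyp S K cor E Cx A B C P) (hp : p ∈ K) (i : ZMod 4) {v w : N}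
    (hv : v ∈ S) (hw : w ∈ S) (h : E v w) (hvin : InTri (P p) (P (cor p i)) (P (cor p (i + 1))) (P v))
    (hwin : ¬ InTri (P p) (P (cor p i)) (P (cor p (i + 1))) (P w)) :
    w = cor p i ∨ w = cor p (i + 1) := by
  have hpS := H.sub hp
  have hu := H.cor_mem hp i
  have hs := H.cor_mem hp (i + 1)
  have n1 := H.ne (H.spoke hp i)
  have n2 := H.ne (H.spoke hp (i + 1))
  have n3 := H.ne (H.side hp i)
  have hvn : v ≠ p ∧ v ≠ cor p i ∧ v ≠ cor p (i + 1) := by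
    refine ⟨?_, ?_, ?_⟩ <;> rintro rfl <;> simp [InTri] at hvin
  by_cases wp : w = p
  · subst wp
    obtain ⟨j, rfl⟩ := H.nbr hp hv (H.symm h)
    exact (H.cor_not_inTri hp i j hvin).elim
  by_contra! hne
  have hvw := H.ne h
  rcases hvin.exit hwin (H.gp _ hpS _ hu _ hw n1 hne.1.symm (Ne.symm wp))
    (H.gp _ hu _ hs _ hw n3 hne.2.symm hne.1.symm) (H.gp _ hs _ hpS _ hw n2.symm (Ne.symm wp)
      hne.2.symm) (H.gp _ hv _ hpS _ hw hvn.1 (Ne.symm wp) hvw)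
    (H.gp _ hv _ hu _ hw hvn.2.1 hne.1.symm hvw) (H.gp _ hv _ hs _ hw hvn.2.2 hne.2.symm hvw)
    with hx | hx | hx
  · exact H.planar hv hw hpS hu h (H.spoke hp _) hx
  · exact H.planar hv hw hu hs h (H.side hp _) hx
  · exact H.planar hv hw hs hpS h (H.symm (H.spoke hp _)) hx

theorem exists_finDraw (H : StarHyp S K cor E Cx A B C P) :
    ∃ P', FinDraw (S \ K) (fun a b => E a b ∨ ∃ p ∈ K, ∃ i, a = cor p i ∧ b = cor p (i + 2))
      Cx A B C P' := by
  induction hn : S.ncard using Nat.strong_induction_on generalizing S K A B C with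
  | _ n ih =>
  subst hn
  by_cases hemp : ∀ {p v}, p ∈ K → ∀ i, v ∈ S →
      ¬ InTri (P p) (P (cor p i)) (P (cor p (i + 1))) (P v)
  · exact (H.kiteHyp hemp).exists_finDraw
  push Not at hemp
  obtain ⟨p, v₀, hp, i, hv₀, hv₀in⟩ := hemp
  have hpS := H.sub hp
  have huS := H.cor_mem hp i
  have hsS := H.cor_mem hp (i + 1)
  have huK := H.cor_nmem hp i
  have hsK := H.cor_nmem hp (i + 1)
  have hcor {q : N} (hq : q ∈ K) (j : ZMod 4) : cor q j ∈ S := H.cor_mem hq j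
  have hside := H.side hp i
  have hspu := H.spoke hp i
  have hsps := H.spoke hp (i + 1)
  have hnd {q : N} (hq : q ∈ K) (j : ZMod 4) : ¬ (cor q j = cor p i ∧ cor q (j + 2) = cor p (i + 1)) ∧
      ¬ (cor q j = cor p (i + 1) ∧ cor q (j + 2) = cor p i) := by
    refine ⟨fun h => H.ndiag hq j ?_, fun h => H.ndiag hq j ?_⟩
    · rw [h.1, h.2]; exact hside
    · rw [h.1, h.2]; exact H.symm hside
  have hpos := H.pos hp i
  set Q : Set N := {v | v ∈ S ∧ InTri (P p) (P (cor p i)) (P (cor p (i + 1))) (P v)} with hQ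
  have hatt {v w : N} (hv : v ∈ Q) (hw : w ∈ S) (h : E v w) (hwQ : w ∉ Q) :
      w = cor p i ∨ w = cor p (i + 1) :=
    H.attached hp i hv.1 hw h hv.2 fun h' => hwQ ⟨hw, h'⟩
  have hpQ : p ∉ Q := fun h => by have := h.2; simp [InTri] at this
  have huQ : cor p i ∉ Q := fun h => by have := h.2; simp [InTri] at this
  have hsQ : cor p (i + 1) ∉ Q := fun h => by have := h.2; simp [InTri] at this
  have hAQ : A ∉ Q := fun h => H.corner_not_inTri hpS huS hsS h.2
  have hBQ : B ∉ Q := fun h => H.rotate.corner_not_inTri hpS huS hsS h.2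
  have hCQ : C ∉ Q := fun h => H.rotate.rotate.corner_not_inTri hpS huS hsS h.2
  have hcorQ {q : N} (hq : q ∈ K) (j : ZMod 4) (hc : cor q j ∈ Q) : q ∈ Q := by
    by_contra hqQ
    rcases hatt hc (H.sub hq) (H.symm (H.spoke hq j)) hqQ with rfl | rfl <;> contradiction
  have hcorQ' {q : N} (hq : q ∈ K) (hqQ : q ∈ Q) (j : ZMod 4) :
      cor q j ∈ Q ∨ cor q j = cor p i ∨ cor q j = cor p (i + 1) := by
    by_cases h : cor q j ∈ Q
    · exact Or.inl h
    · exact Or.inr (hatt hqQ (hcor hq j) (H.spoke hq j) h)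
  have hopp : cor p (i + 2) ∈ S ∧ cor p (i + 2) ∉ Q ∧ cor p (i + 2) ≠ cor p i ∧
      cor p (i + 2) ≠ cor p (i + 1) ∧ cor p (i + 2) ≠ p := by
    refine ⟨hcor hp _, fun h => H.cor_not_inTri hp i _ h.2, fun h => ?_, fun h => ?_,
      (H.ne (H.spoke hp _)).symm⟩
    · exact (by decide : ∀ i : ZMod 4, i + 2 ≠ i) i (H.cor_inj hp h)
    · exact (by decide : ∀ i : ZMod 4, i + 2 ≠ i + 1) i (H.cor_inj hp h)
  have hpu := H.ne hspu
  have hps := H.ne hsps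
  have hS₂ : Q ∪ {cor p i, cor p (i + 1), p} ⊆ S := by
    rintro v (hv | rfl | rfl | rfl)
    exacts [hv.1, huS, hsS, hpS]
  have hdiag {q : N} (hq : q ∈ K) (j : ZMod 4) : cor q j ≠ cor q (j + 2) := fun h =>
    (by decide : ∀ i : ZMod 4, i ≠ i + 2) j (H.cor_inj hq h)
  obtain ⟨P₁, h₁⟩ := ih (S \ Q).ncard (Set.ncard_lt_ncard (Set.sdiff_subset.ssubset_of_mem_notMem
    hv₀ (fun h => h.2 ⟨hv₀, hv₀in⟩)) H.fin) (S := S \ Q) (K := K \ Q) (A := A) (B := B) (C := C)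
    { H with
      fin := H.fin.sdiff
      gp := fun a ha b hb c hc => H.gp a ha.1 b hb.1 c hc.1
      planar := fun ha hb hc he => H.planar ha.1 hb.1 hc.1 he.1
      memA := ⟨H.memA, hAQ⟩
      memB := ⟨H.memB, hBQ⟩
      memC := ⟨H.memC, hCQ⟩
      nmemA := fun h => H.nmemA h.1
      nmemB := fun h => H.nmemB h.1
      nmemC := fun h => H.nmemC h.1
      inside := fun hv => H.inside hv.1
      sub := Set.sdiff_subset_sdiff_left H.sub
      cor_mem := fun hq j => ⟨hcor hq.1 j, fun h => hq.2 (hcorQ hq.1 j h)⟩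
      cor_nmem := fun hq j h => H.cor_nmem hq.1 j h.1
      cor_inj := fun hq => H.cor_inj hq.1
      spoke := fun hq => H.spoke hq.1
      nbr := fun hq hv => H.nbr hq.1 hv.1
      side := fun hq => H.side hq.1
      pos := fun hq => H.pos hq.1
      ndiag := fun hq => H.ndiag hq.1
      diag_ne := fun hq hr => H.diag_ne hq.1 hr.1
      diag_cx := fun hq => H.diag_cx hq.1
      side_ncx := fun hq => H.side_ncx hq.1 } rfl
  obtain ⟨P₂, h₂⟩ := ih (Q ∪ {cor p i, cor p (i + 1), p}).ncard
    (Set.ncard_lt_ncard (hS₂.ssubset_of_mem_notMem hopp.1 (by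
      rintro (h | h | h | h)
      exacts [hopp.2.1 h, hopp.2.2.1 h, hopp.2.2.2.1 h, hopp.2.2.2.2 h])) H.fin)
    (S := Q ∪ {cor p i, cor p (i + 1), p}) (K := K ∩ Q) (A := cor p i) (B := cor p (i + 1)) (C := p)
    { H with
      fin := H.fin.subset hS₂
      gp := fun a ha b hb c hc => H.gp a (hS₂ ha) b (hS₂ hb) c (hS₂ hc)
      planar := fun ha hb hc he => H.planar (hS₂ ha) (hS₂ hb) (hS₂ hc) (hS₂ he)
      memA := by simp
      memB := by simp
      memC := by simp
      AB := hside
      BC := H.symm hsps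
      AC := H.symm hspu
      nmemA := fun h => huQ h.2
      nmemB := fun h => hsQ h.2
      nmemC := fun h => hpQ h.2
      inside := fun hv h1 h2 h3 => by
        rcases hv with hv | hv | hv | hv
        · exact hv.2.rot
        exacts [absurd hv h1, absurd hv h2, absurd hv h3]
      sub := fun q hq => Or.inl hq.2
      cor_mem := fun hq j => by
        rcases hcorQ' hq.1 hq.2 j with h | h | h
        · exact Or.inl h
        · rw [h]; simp
        · rw [h]; simp
      cor_nmem := fun hq j h => H.cor_nmem hq.1 j h.1
      cor_inj := fun hq => H.cor_inj hq.1
      spoke := fun hq => H.spoke hq.1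
      nbr := fun hq hv => H.nbr hq.1 (hS₂ hv)
      side := fun hq => H.side hq.1
      pos := fun hq => H.pos hq.1
      ndiag := fun hq => H.ndiag hq.1
      diag_ne := fun hq hr => H.diag_ne hq.1 hr.1
      diag_cx := fun hq => H.diag_cx hq.1
      side_ncx := fun hq => H.side_ncx hq.1 } rfl
  have h₁' : FinDraw ((S \ Q) \ (K \ Q))
      (fun a b => E a b ∨ ∃ p ∈ K, ∃ i, a = cor p i ∧ b = cor p (i + 2)) Cx A B C P₁ := by
    refine h₁.congr fun {a b} ha hb h => ?_
    rcases h with h | ⟨q, hq, j, rfl, rfl⟩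
    · exact Or.inl h
    · refine Or.inr ⟨q, ⟨hq, fun hqQ => ?_⟩, j, rfl, rfl⟩
      have k1 := (hcorQ' hq hqQ j).resolve_left ha.1.2
      have k2 := (hcorQ' hq hqQ (j + 2)).resolve_left hb.1.2
      have := hnd hq j
      have := hdiag hq j
      grind
  have h₂' : FinDraw ((Q ∪ {cor p i, cor p (i + 1), p}) \ (K ∩ Q))
      (fun a b => E a b ∨ ∃ p ∈ K, ∃ i, a = cor p i ∧ b = cor p (i + 2)) Cx (cor p i) (cor p (i + 1))
      p P₂ := by
    refine h₂.congr fun {a b} ha hb h => ?_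
    rcases h with h | ⟨q, hq, j, rfl, rfl⟩
    · exact Or.inl h
    · refine Or.inr ⟨q, ⟨hq, ?_⟩, j, rfl, rfl⟩
      by_contra hqQ
      have k1 := ha.1.resolve_left fun h => hqQ (hcorQ hq _ h)
      have k2 := hb.1.resolve_left fun h => hqQ (hcorQ hq _ h)
      have k3 : cor q j ≠ p := fun h => H.cor_nmem hq j (h ▸ hp)
      have k4 : cor q (j + 2) ≠ p := fun h => H.cor_nmem hq (j + 2) (h ▸ hp)
      have := hnd hq j
      have := hdiag hq j
      simp only [Set.mem_insert_iff, Set.mem_singleton_iff] at k1 k2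
      grind
  obtain ⟨P', h'⟩ := h₁'.merge h₂' (H.fin.sdiff.sdiff) ⟨⟨huS, huQ⟩, fun h => huK h.1⟩
    ⟨⟨hsS, hsQ⟩, fun h => hsK h.1⟩
    (by
      rintro a b (h | ⟨q, hq, j, rfl, rfl⟩)
      · exact Or.inl (H.symm h)
      · exact Or.inr ⟨q, hq, j + 2, rfl, by rw [(by decide : ∀ j : ZMod 4, j + 2 + 2 = j) j]⟩)
    (Or.inl hside) (fun c e => H.side_ncx hp i c e)
    (by
      rintro v ⟨⟨-, hv⟩, -⟩ ⟨hv' | hv', -⟩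
      · contradiction
      · simpa using hv')
    (by
      rintro a b ⟨⟨haS, haQ⟩, haK⟩ ⟨hb, hbK⟩ hbp hb₁ h
      have hbQ : b ∈ Q := by
        rcases hb with hb | rfl | rfl | rfl
        · exact hb
        · exact (hb₁ ⟨⟨huS, huQ⟩, fun h => huK h.1⟩).elim
        · exact (hb₁ ⟨⟨hsS, hsQ⟩, fun h => hsK h.1⟩).elim
        · exact absurd rfl hbp
      rcases h with h | ⟨q, hq, j, rfl, rfl⟩
      · exact hatt hbQ haS (H.symm h) haQ
      · exact (hcorQ' hq (hcorQ hq _ hbQ) j).resolve_left haQ)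
  have hunion : (S \ Q) \ (K \ Q) ∪ ((Q ∪ {cor p i, cor p (i + 1), p}) \ (K ∩ Q)) \ {p} =
      S \ K := by
    ext v
    simp only [Set.mem_union, Set.mem_sdiff, Set.mem_inter_iff, Set.mem_insert_iff,
      Set.mem_singleton_iff]
    have : v ∈ Q → v ∈ S := fun h => h.1
    constructor
    · grind
    · grind
  rw [hunion] at h'
  exact ⟨P', h'⟩

end StarHyp

end stars

section chains

/-- A planar straight-line drawing of `E` on `S` in general position, in which the nodes of `K` are
centres of star-shaped quadrilaterals. A side of such a quadrilateral may be subdivided by a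
node `ch p i` adjacent to the centre. -/
structure ChainHyp {N : Type*} (S K : Set N) (cor ch : N → ZMod 4 → N) (E : N → N → Prop)
    (P : N → ℝ × ℝ) : Prop where
  fin : S.Finite
  gp : GenPos S P
  symm : ∀ {a b}, E a b → E b a
  ne : ∀ {a b}, E a b → a ≠ b
  planar : ∀ {a b c e}, a ∈ S → b ∈ S → c ∈ S → e ∈ S → E a b → E c e →
    ¬ Crs (P a) (P b) (P c) (P e)
  sub : K ⊆ S
  cor_mem : ∀ {p}, p ∈ K → ∀ i, cor p i ∈ S
  cor_nmem : ∀ {p}, p ∈ K → ∀ i, cor p i ∉ K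
  cor_inj : ∀ {p}, p ∈ K → Function.Injective (cor p)
  spoke : ∀ {p}, p ∈ K → ∀ i, E p (cor p i)
  nbr : ∀ {p v}, p ∈ K → v ∈ S → E p v → ∃ i, v = cor p i ∨ v = ch p i
  side : ∀ {p}, p ∈ K → ∀ i, ch p i ∉ S → E (cor p i) (cor p (i + 1))
  pos : ∀ {p}, p ∈ K → ∀ i, ch p i ∉ S → 0 < cr (P p) (P (cor p i)) (P (cor p (i + 1)))
  ndiag : ∀ {p}, p ∈ K → ∀ i, ¬ E (cor p i) (cor p (i + 2))
  side_diag : ∀ {p q}, p ∈ K → q ∈ K → ∀ i j,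
    ¬ (cor p i = cor q j ∧ cor p (i + 1) = cor q (j + 2))
  ch_nmem : ∀ {p}, p ∈ K → ∀ i, ch p i ∉ K
  ch_cor : ∀ {p q}, p ∈ K → q ∈ K → ∀ i j, ch p i ≠ cor q j
  ch_inj : ∀ {p q}, p ∈ K → q ∈ K → ∀ {i j}, ch p i = ch q j → p = q ∧ i = j
  ch_mid : ∀ {p}, p ∈ K → ∀ i, ch p i ∈ S → E (ch p i) p
  ch_left : ∀ {p}, p ∈ K → ∀ i, ch p i ∈ S → E (ch p i) (cor p i)
  ch_right : ∀ {p}, p ∈ K → ∀ i, ch p i ∈ S → E (ch p i) (cor p (i + 1))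
  ch_nbr : ∀ {p v}, p ∈ K → ∀ i, ch p i ∈ S → v ∈ S → E (ch p i) v →
    v = p ∨ v = cor p i ∨ v = cor p (i + 1)
  ch_nadj : ∀ {p}, p ∈ K → ∀ i, ch p i ∈ S → ¬ E (cor p i) (cor p (i + 1))
  pos_left : ∀ {p}, p ∈ K → ∀ i, ch p i ∈ S → 0 < cr (P p) (P (cor p i)) (P (ch p i))
  pos_right : ∀ {p}, p ∈ K → ∀ i, ch p i ∈ S → 0 < cr (P p) (P (ch p i)) (P (cor p (i + 1)))
  empty_left : ∀ {p v}, p ∈ K → ∀ i, ch p i ∈ S → v ∈ S →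
    ¬ InTri (P p) (P (cor p i)) (P (ch p i)) (P v)
  empty_right : ∀ {p v}, p ∈ K → ∀ i, ch p i ∈ S → v ∈ S →
    ¬ InTri (P p) (P (ch p i)) (P (cor p (i + 1))) (P v)
  primary : ∀ {p}, p ∈ K → ∀ i, ch p i ∈ S → ∃ q ∈ K, ∃ j, ch q j ∈ S ∧
    s(cor q j, cor q (j + 1)) = s(cor p i, cor p (i + 1)) ∧
    ∀ r ∈ K, ∀ k, ch r k ∈ S → r ≠ q →
      s(cor r k, cor r (k + 1)) = s(cor q j, cor q (j + 1)) →
      (InTri (P (cor r k)) (P (ch r k)) (P (cor r (k + 1))) (P r) ↔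
        InTri (P (cor r k)) (P (ch q j)) (P (cor r (k + 1))) (P r))

namespace ChainHyp

variable {N : Type*} {S K : Set N} {cor ch : N → ZMod 4 → N} {E : N → N → Prop}
  {A B C : N} {P P' : N → ℝ × ℝ} {p : N}

lemma cor_ne (H : ChainHyp S K cor ch E P) (hp : p ∈ K) {i j : ZMod 4} (h : i ≠ j) :
    cor p i ≠ cor p j := fun h' => h (H.cor_inj hp h')

lemma cor_ne_succ (H : ChainHyp S K cor ch E P) (hp : p ∈ K) (i : ZMod 4) :
    cor p i ≠ cor p (i + 1) := H.cor_ne hp (by revert i; decide)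

lemma ne_cor (H : ChainHyp S K cor ch E P) {q : N} (hp : p ∈ K) (hq : q ∈ K) (i : ZMod 4) :
    q ≠ cor p i := by
  rintro rfl
  exact H.cor_nmem hp i hq

lemma tri_transport (hs : SameOn S P P' E) {a b c : N} (ha : a ∈ S) (hb : b ∈ S) (hc : c ∈ S)
    (h1 : E a b) (h2 : E b c) (h3 : E a c) (h : ∀ {v}, v ∈ S → ¬ InTri (P a) (P b) (P c) (P v))
    {v : N} (hv : v ∈ S) : ¬ InTri (P' a) (P' b) (P' c) (P' v) := by
  by_cases va : v = a
  · subst va; simp [InTri]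
  by_cases vb : v = b
  · subst vb; simp [InTri]
  by_cases vc : v = c
  · subst vc; simp [InTri]
  rw [hs.tri _ ha _ hb _ hc _ hv h1 h2 h3 va vb vc]
  exact h hv

lemma quad_transport (H : ChainHyp S K cor ch E P) (hs : SameOn S P P' E) {q r : N} (hq : q ∈ K)
    (hr : r ∈ K) {j k : ZMod 4} (hqS : ch q j ∈ S) (hrS : ch r k ∈ S)
    (h : s(cor r k, cor r (k + 1)) = s(cor q j, cor q (j + 1))) :
    ((InTri (P' (cor r k)) (P' (ch r k)) (P' (cor r (k + 1))) (P' r) ↔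
        InTri (P' (cor r k)) (P' (ch q j)) (P' (cor r (k + 1))) (P' r)) ↔
      (InTri (P (cor r k)) (P (ch r k)) (P (cor r (k + 1))) (P r) ↔
        InTri (P (cor r k)) (P (ch q j)) (P (cor r (k + 1))) (P r))) := by
  have h1 := H.ch_left hr k hrS
  have h2 := H.ch_right hr k hrS
  have h3 := H.ch_left hq j hqS
  have h4 := H.ch_right hq j hqS
  have h5 : E (cor r (k + 1)) (ch q j) ∧ E (ch q j) (cor r k) := by
    rcases Sym2.eq_iff.1 h with h | h <;> rw [h.1, h.2]
    · exact ⟨H.symm h4, h3⟩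
    · exact ⟨H.symm h3, h4⟩
  have := hs.quad _ (H.cor_mem hr k) _ hrS _ (H.cor_mem hr (k + 1)) _ hqS _ (H.sub hr) (H.symm h1)
    h2 h5.1 h5.2 (H.cor_ne_succ hr k) (H.ne_cor hr hr _) (fun h => H.ch_nmem hr k (h ▸ hr))
    (H.ne_cor hr hr _) (fun h => H.ch_nmem hq j (h ▸ hr))
  have e (a b c v : ℝ × ℝ) : InTri a b c v ↔ InTri a c b v := by
    rw [← inTri_rot, inTri_swap, inTri_rot, inTri_swap, ← inTri_rot, inTri_swap, inTri_rot]
  rwa [e _ (P' (ch q j)), e _ (P (ch q j))]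

lemma transport (H : ChainHyp S K cor ch E P) (hgp : GenPos S P') (hs : SameOn S P P' E) :
    ChainHyp S K cor ch E P' where
  __ := H
  gp := hgp
  planar ha hb hc he h1 h2 h := H.planar ha hb hc he h1 h2 ((hs.crs _ ha _ hb _ hc _ he h1 h2).1 h)
  pos hp i h := (hs.orient _ (H.sub hp) _ (H.cor_mem hp _) _ (H.cor_mem hp _) (H.spoke hp _)
    (H.side hp _ h) (H.spoke hp _)).2 (H.pos hp i h)
  pos_left hp i h := (hs.orient _ (H.sub hp) _ (H.cor_mem hp _) _ h (H.spoke hp _)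
    (H.symm (H.ch_left hp _ h)) (H.symm (H.ch_mid hp _ h))).2 (H.pos_left hp i h)
  pos_right hp i h := (hs.orient _ (H.sub hp) _ h _ (H.cor_mem hp _) (H.symm (H.ch_mid hp _ h))
    (H.ch_right hp _ h) (H.spoke hp _)).2 (H.pos_right hp i h)
  empty_left hp i h := tri_transport hs (H.sub hp) (H.cor_mem hp _) h (H.spoke hp _)
    (H.symm (H.ch_left hp _ h)) (H.symm (H.ch_mid hp _ h)) (H.empty_left hp i h)
  empty_right hp i h := tri_transport hs (H.sub hp) h (H.cor_mem hp _) (H.symm (H.ch_mid hp _ h))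
    (H.ch_right hp _ h) (H.spoke hp _) (H.empty_right hp i h)
  primary hp i h := by
    obtain ⟨q, hq, j, hj, he, hr⟩ := H.primary hp i h
    refine ⟨q, hq, j, hj, he, fun r hrK k hk hrq he' => ?_⟩
    rw [H.quad_transport hs hq hrK hj hk he']
    exact hr r hrK k hk hrq he'

/-- The nodes subdividing the side between `u` and `s`. -/
def subdiv (K : Set N) (cor ch : N → ZMod 4 → N) (e : Sym2 N) : Set N :=
  {v | ∃ p ∈ K, ∃ i, v = ch p i ∧ s(cor p i, cor p (i + 1)) = e}

lemma cor_notMem_subdiv (H : ChainHyp S K cor ch E P) (hp : p ∈ K) (i : ZMod 4) (e : Sym2 N) :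
    cor p i ∉ subdiv K cor ch e := by
  rintro ⟨q, hq, j, h, -⟩
  exact H.ch_cor hq hp j i h.symm

lemma mem_K_notMem_subdiv (H : ChainHyp S K cor ch E P) (hp : p ∈ K) (e : Sym2 N) :
    p ∉ subdiv K cor ch e := by
  rintro ⟨q, hq, j, rfl, -⟩
  exact H.ch_nmem hq j hp

lemma ch_mem_subdiv (H : ChainHyp S K cor ch E P) (hp : p ∈ K) (i : ZMod 4) (e : Sym2 N) :
    ch p i ∈ subdiv K cor ch e ↔ s(cor p i, cor p (i + 1)) = e := by
  refine ⟨?_, fun h => ⟨p, hp, i, rfl, h⟩⟩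
  rintro ⟨q, hq, j, h, he⟩
  obtain ⟨rfl, rfl⟩ := H.ch_inj hp hq h
  exact he

lemma flatHyp (H : ChainHyp S K cor ch E P) (hp : p ∈ K) (i : ZMod 4) (hi : ch p i ∈ S) :
    FlatHyp S P E (cor p i) (ch p i) (cor p (i + 1)) where
  mem_s := H.cor_mem hp _
  mem_d := hi
  mem_t := H.cor_mem hp _
  symm := H.symm
  ne := H.ne
  gp := H.gp
  sides ha hb hc he h1 h2 h := (H.planar ha hb hc he h1 h2 h).elim
  wedge ha hb hc he _ h1 h2 h := (H.planar ha hb hc he h1 h2 h).elim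
  sd := H.symm (H.ch_left hp i hi)
  dt := H.ch_right hp i hi
  nst := H.ch_nadj hp i hi
  unc_s ha hb h := H.planar ha hb (H.cor_mem hp _) hi h (H.symm (H.ch_left hp i hi))
  unc_t ha hb h := H.planar ha hb hi (H.cor_mem hp _) h (H.ch_right hp i hi)
  s_ne_t := H.cor_ne_succ hp i
  nbr {k} hk hkd hks hkt := by
    obtain rfl := ((H.ch_nbr hp i hi hk (H.symm hkd)).resolve_right (by tauto))
    refine .inl ⟨H.spoke hp _, H.spoke hp _, fun h => ?_, fun h => ?_⟩
    · exact H.empty_right hp i hi (H.cor_mem hp i) h.swap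
    · exact H.empty_left hp i hi (H.cor_mem hp (i + 1)) h.rot

lemma exists_fewer (H : ChainHyp S K cor ch E P) (hp₀ : p ∈ K) (i₀ : ZMod 4) (hi₀ : ch p i₀ ∈ S) :
    ∃ P', SameOn S P P' E ∧
      ChainHyp (S \ subdiv K cor ch s(cor p i₀, cor p (i₀ + 1))) K cor ch
        (fun a b => E a b ∨ s(a, b) = s(cor p i₀, cor p (i₀ + 1))) P' := by
  obtain ⟨q, hq, j, hj, he, hprim⟩ := H.primary hp₀ i₀ hi₀
  rw [← he]
  clear he hi₀ hp₀
  have hn0 := H.gp _ (H.cor_mem hq j) _ hj _ (H.cor_mem hq (j + 1)) (H.ch_cor hq hq _ _).symm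
    (H.ch_cor hq hq _ _) (H.cor_ne_succ hq j)
  obtain ⟨P', R⟩ : ∃ P', ∃ ω, FlatRes S P P' E (cor q j) (ch q j) (cor q (j + 1)) ω ∧
      cr (P' (cor q j)) (P' (ch q j)) (P' (cor q (j + 1))) < 0 := by
    rcases lt_or_gt_of_ne hn0 with h | h
    · obtain ⟨P', R⟩ := (H.flatHyp hq j hj).exists_flat H.fin (ω := 1) (by norm_num)
      exact ⟨P', 1, R, by nlinarith [R.side]⟩
    · obtain ⟨P', R⟩ := (H.flatHyp hq j hj).exists_flat H.fin (ω := -1) (by norm_num)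
      exact ⟨P', -1, R, by nlinarith [R.side]⟩
  obtain ⟨ω, R, hneg⟩ := R
  have H' := H.transport R.gp R.same
  refine ⟨P', R.same, ?_⟩
  have hprim' : ∀ r ∈ K, ∀ k, ch r k ∈ S → r ≠ q →
      s(cor r k, cor r (k + 1)) = s(cor q j, cor q (j + 1)) →
      (InTri (P' (cor r k)) (P' (ch r k)) (P' (cor r (k + 1))) (P' r) ↔
        InTri (P' (cor r k)) (P' (ch q j)) (P' (cor r (k + 1))) (P' r)) := by
    intro r hr k hk hrq he
    rw [H.quad_transport R.same hq hr hj hk he]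
    exact hprim r hr k hk hrq he
  set u := cor q j with hu
  set s := cor q (j + 1) with hs
  set n := ch q j with hn
  have huS : u ∈ S := H.cor_mem hq _
  have hsS : s ∈ S := H.cor_mem hq _
  have hus : u ≠ s := H.cor_ne_succ hq j
  have hun : u ≠ n := (H.ch_cor hq hq _ _).symm
  have hsn : s ≠ n := (H.ch_cor hq hq _ _).symm
  have hempty {v : N} (hv : v ∈ S) : ¬ InTri (P' u) (P' n) (P' s) (P' v) := by
    by_cases v1 : v = u
    · subst v1; simp [InTri]
    by_cases v2 : v = n
    · subst v2; simp [InTri]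
    by_cases v3 : v = s
    · subst v3; simp [InTri]
    obtain ⟨n1, n2⟩ := R.near hv v1 v2 v3
    rintro (⟨k1, k2, k3⟩ | ⟨k1, k2, k3⟩)
    · rw [cr_swap] at k3
      nlinarith
    · rw [cr_swap] at k3
      nlinarith
  have hposq : 0 < cr (P' q) (P' u) (P' s) := by
    have h1 := H'.pos_left hq j hj
    have h2 := H'.pos_right hq j hj
    have h3 := cr_add (P' u) (P' n) (P' s) (P' q)
    rw [cr_rot (P' q) (P' u), cr_rot (P' q) (P' n), cr_rot (P' q) (P' s), cr_swap' _ (P' u) (P' s)] at h3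
    linarith
  have hpos {r : N} (hr : r ∈ K) {k : ZMod 4} (hk : ch r k ∈ S)
      (he : s(cor r k, cor r (k + 1)) = s(u, s)) :
      0 < cr (P' r) (P' (cor r k)) (P' (cor r (k + 1))) := by
    by_cases hrq : r = q
    · subst hrq
      rcases Sym2.eq_iff.1 he with h | h
      · rwa [h.1, h.2]
      · have h1 := H.cor_inj hr h.1
        have h2 := H.cor_inj hr h.2
        exact ((by decide : ∀ j k : ZMod 4, k = j + 1 → k + 1 = j → False) _ _ h1 h2).elim
    have h1 := H'.pos_left hr k hk
    have h2 := H'.pos_right hr k hk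
    have h3 := cr_add (P' (cor r k)) (P' (ch r k)) (P' (cor r (k + 1))) (P' r)
    rw [cr_rot (P' r) (P' (cor r k)), cr_rot (P' r) (P' (ch r k)),
      cr_rot (P' r) (P' (cor r (k + 1))), cr_swap' _ (P' (cor r k)) (P' (cor r (k + 1)))] at h3
    have h4 : ¬ InTri (P' (cor r k)) (P' (ch r k)) (P' (cor r (k + 1))) (P' r) := by
      rw [hprim' r hr k hk hrq he]
      rcases Sym2.eq_iff.1 he with h | h <;> rw [h.1, h.2]
      · exact hempty (H.sub hr)
      · exact fun h => hempty (H.sub hr) (h.rot.swap)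
    by_contra! h5
    have h6 := H'.gp _ (H.sub hr) _ (H.cor_mem hr k) _ (H.cor_mem hr (k + 1)) (H.ne_cor hr hr _)
      (H.cor_ne_succ hr k) (H.ne_cor hr hr _)
    have h7 := lt_of_le_of_ne h5 h6
    refine h4 (.inl ⟨by rwa [cr_rot], by rwa [cr_rot], ?_⟩)
    rw [cr_rot, cr_swap']
    linarith
  have hcross {a b : N} (ha : a ∈ S \ subdiv K cor ch s(u, s)) (hb : b ∈ S \ subdiv K cor ch s(u, s))
      (h : E a b) : ¬ Crs (P' a) (P' b) (P' u) (P' s) := by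
    intro hx
    obtain ⟨hab, -, hau, has, hbu, hbs⟩ := hx.ne_of
    have hno : n ∈ subdiv K cor ch s(u, s) := (H.ch_mem_subdiv hq j _).2 rfl
    have han : a ≠ n := by rintro rfl; exact ha.2 hno
    have hbn : b ≠ n := by rintro rfl; exact hb.2 hno
    have g {x y z : N} (hx : x ∈ S) (hy : y ∈ S) (hz : z ∈ S) := R.gp x hx y hy z hz
    rcases hx.triangle (b := P' n) (hempty ha.1) (hempty hb.1) (g ha.1 hb.1 hj hab hbn han)
      (g huS hj ha.1 hun han.symm hau.symm) (g hj hsS ha.1 hsn.symm has.symm han.symm)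
      (g huS hj hb.1 hun hbn.symm hbu.symm) (g hj hsS hb.1 hsn.symm hbs.symm hbn.symm) hneg.ne
      with h' | h'
    · exact H'.planar ha.1 hb.1 huS hj h (H.symm (H.ch_left hq j hj)) h'
    · exact H'.planar ha.1 hb.1 hj hsS h (H.ch_right hq j hj) h'
  have hnew {a b : N} (h : s(a, b) = s(u, s)) : (a = u ∧ b = s) ∨ (a = s ∧ b = u) := by
    simpa using h
  have hK {r : N} (hr : r ∈ K) : r ≠ u ∧ r ≠ s := ⟨H.ne_cor hq hr _, H.ne_cor hq hr _⟩
  have hKe {r v : N} (hr : r ∈ K) : s(r, v) ≠ s(u, s) := by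
    intro h
    rcases hnew h with h | h
    · exact (hK hr).1 h.1
    · exact (hK hr).2 h.1
  have hce {r v : N} (hr : r ∈ K) (k : ZMod 4) : s(ch r k, v) ≠ s(u, s) := by
    intro h
    rcases hnew h with h | h
    · exact H.ch_cor hr hq _ _ h.1
    · exact H.ch_cor hr hq _ _ h.1
  have hchS {r : N} {k : ZMod 4} (hr : r ∈ K) (h : ch r k ∉ S \ subdiv K cor ch s(u, s)) :
      ch r k ∉ S ∨ (ch r k ∈ S ∧ s(cor r k, cor r (k + 1)) = s(u, s)) := by
    by_cases h' : ch r k ∈ S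
    · refine .inr ⟨h', (H.ch_mem_subdiv hr k _).1 ?_⟩
      by_contra h''
      exact h ⟨h', h''⟩
    · exact .inl h'
  exact
  { H' with
    fin := H.fin.sdiff
    gp := fun a ha b hb c hc => R.gp a ha.1 b hb.1 c hc.1
    symm := by
      rintro a b (h | h)
      · exact .inl (H.symm h)
      · exact .inr (by rwa [Sym2.eq_swap])
    ne := by
      rintro a b (h | h)
      · exact H.ne h
      · rintro rfl
        rcases hnew h with h | h
        · exact hus (h.1.symm.trans h.2)
        · exact hus (h.2.symm.trans h.1)
    planar := by
      rintro a b c e ha hb hc he (h1 | h1) (h2 | h2)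
      · exact H'.planar ha.1 hb.1 hc.1 he.1 h1 h2
      · rcases hnew h2 with ⟨rfl, rfl⟩ | ⟨rfl, rfl⟩
        · exact hcross ha hb h1
        · exact fun h => hcross ha hb h1 (crs_swap_right.1 h)
      · rcases hnew h1 with ⟨rfl, rfl⟩ | ⟨rfl, rfl⟩
        · exact fun h => hcross hc he h2 h.symm
        · exact fun h => hcross hc he h2 (crs_swap_left.1 h).symm
      · intro h
        have := h.ne_of
        have := hnew h1
        have := hnew h2
        grind
    sub := fun r hr => ⟨H.sub hr, H.mem_K_notMem_subdiv hr _⟩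
    cor_mem := fun hr k => ⟨H.cor_mem hr k, H.cor_notMem_subdiv hr k _⟩
    spoke := fun hr k => .inl (H.spoke hr k)
    nbr := fun hr hv h => H.nbr hr hv.1 (h.resolve_right (hKe hr))
    side := fun hr k h => by
      rcases hchS hr h with h | h
      · exact .inl (H.side hr k h)
      · exact .inr h.2
    pos := fun hr k h => by
      rcases hchS hr h with h | h
      · exact H'.pos hr k h
      · exact hpos hr h.1 h.2
    ndiag := by
      rintro r hr k (h | h)
      · exact H.ndiag hr k h
      · rcases hnew h with h | h
        · exact H.side_diag hq hr j k ⟨h.1.symm, h.2.symm⟩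
        · refine H.side_diag hq hr j (k + 2) ⟨h.2.symm, ?_⟩
          rw [(by decide : ∀ k : ZMod 4, k + 2 + 2 = k) k]
          exact h.1.symm
    ch_mid := fun hr k h => .inl (H.ch_mid hr k h.1)
    ch_left := fun hr k h => .inl (H.ch_left hr k h.1)
    ch_right := fun hr k h => .inl (H.ch_right hr k h.1)
    ch_nbr := fun hr k h hv h' => H.ch_nbr hr k h.1 hv.1 (h'.resolve_right (hce hr k))
    ch_nadj := by
      rintro r hr k h (h' | h')
      · exact H.ch_nadj hr k h.1 h'
      · exact h.2 ((H.ch_mem_subdiv hr k _).2 h')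
    pos_left := fun hr k h => H'.pos_left hr k h.1
    pos_right := fun hr k h => H'.pos_right hr k h.1
    empty_left := fun hr k h hv => H'.empty_left hr k h.1 hv.1
    empty_right := fun hr k h hv => H'.empty_right hr k h.1 hv.1
    primary := by
      intro r hr k h
      obtain ⟨q', hq', j', hj', he', h'⟩ := H'.primary hr k h.1
      refine ⟨q', hq', j', ⟨hj', fun h'' => h.2 ?_⟩, he', fun r hr k hk => h' r hr k hk.1⟩
      rw [H.ch_mem_subdiv hq'] at h''
      rw [H.ch_mem_subdiv hr, ← he', h''] }

theorem exists_finDraw {Cx : N → N → N → N → Prop} (H : ChainHyp S K cor ch E P)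
    (hA : A ∈ S) (hB : B ∈ S) (hC : C ∈ S) (hAB : E A B) (hBC : E B C) (hAC : E A C)
    (hAK : A ∉ K) (hBK : B ∉ K) (hCK : C ∉ K) (hch : ∀ p ∈ K, ∀ i, A ≠ ch p i ∧ B ≠ ch p i ∧ C ≠ ch p i)
    (inside : ∀ {v}, v ∈ S → v ≠ A → v ≠ B → v ≠ C → InTri (P A) (P B) (P C) (P v))
    (diag_ne : ∀ {p q}, p ∈ K → q ∈ K → p ≠ q → ∀ i j,
      ¬ (cor p i = cor q j ∧ cor p (i + 2) = cor q (j + 2)))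
    (diag_cx : ∀ {p}, p ∈ K → ∀ i,
      Cx (cor p i) (cor p (i + 2)) (cor p (i + 1)) (cor p (i + 3)) ∧
      Cx (cor p i) (cor p (i + 2)) (cor p (i + 3)) (cor p (i + 1)))
    (side_ncx : ∀ {p}, p ∈ K → ∀ i a b, ¬ Cx a b (cor p i) (cor p (i + 1))) :
    ∃ P', FinDraw ((S \ K) \ {v | ∃ p ∈ K, ∃ i, v = ch p i})
      (fun a b => E a b ∨ ∃ p ∈ K, ∃ i, a = cor p i ∧ b = cor p (i + 2)) Cx A B C P' := by
  induction hn : S.ncard using Nat.strong_induction_on generalizing S E P with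
  | _ n ih =>
  subst hn
  by_cases hpend : ∃ p ∈ K, ∃ i, ch p i ∈ S
  · obtain ⟨p, hp, i, hi⟩ := hpend
    obtain ⟨P', hs, H'⟩ := H.exists_fewer hp i hi
    have hX {X : N} (hX : X ∈ S) (hX' : ∀ p ∈ K, ∀ i, X ≠ ch p i) :
        X ∈ S \ subdiv K cor ch s(cor p i, cor p (i + 1)) := by
      refine ⟨hX, ?_⟩
      rintro ⟨q, hq, j, h, -⟩
      exact hX' q hq j h
    obtain ⟨P'', h⟩ := ih _ (Set.ncard_lt_ncard (Set.sdiff_subset.ssubset_of_mem_notMem hi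
      (fun h => h.2 ((H.ch_mem_subdiv hp i _).2 rfl))) H.fin) H' (hX hA fun p hp i => (hch p hp i).1)
      (hX hB fun p hp i => (hch p hp i).2.1) (hX hC fun p hp i => (hch p hp i).2.2)
      (.inl hAB) (.inl hBC) (.inl hAC) (fun {v} hv h1 h2 h3 =>
        (hs.tri _ hA _ hB _ hC _ hv.1 hAB hBC hAC h1 h2 h3).2 (inside hv.1 h1 h2 h3)) rfl
    have hset : ((S \ subdiv K cor ch s(cor p i, cor p (i + 1))) \ K) \ {v | ∃ p ∈ K, ∃ i, v = ch p i} =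
        (S \ K) \ {v | ∃ p ∈ K, ∃ i, v = ch p i} := by
      ext v
      simp only [Set.mem_sdiff, Set.mem_ofPred_eq, subdiv]
      constructor
      · tauto
      · rintro ⟨⟨h1, h2⟩, h3⟩
        refine ⟨⟨⟨h1, ?_⟩, h2⟩, h3⟩
        rintro ⟨p, hp, i, h, -⟩
        exact h3 ⟨p, hp, i, h⟩
    rw [hset] at h
    exact ⟨P'', h.congr fun _ _ h => h.imp_left .inl⟩
  · push Not at hpend
    have hstar : StarHyp S K cor E Cx A B C P :=
      { H with
        memA := hA, memB := hB, memC := hC, AB := hAB, BC := hBC, AC := hAC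
        nmemA := hAK, nmemB := hBK, nmemC := hCK
        inside := inside
        nbr := fun {p v} hp hv h => by
          obtain ⟨i, h | h⟩ := H.nbr hp hv h
          · exact ⟨i, h⟩
          · exact (hpend p hp i (h ▸ hv)).elim
        side := fun {p} hp i => H.side hp i (hpend p hp i)
        pos := fun {p} hp i => H.pos hp i (hpend p hp i)
        diag_ne := diag_ne
        diag_cx := diag_cx
        side_ncx := side_ncx }
    have hset : (S \ K) \ {v | ∃ p ∈ K, ∃ i, v = ch p i} = S \ K := by
      refine sdiff_eq_left.2 (Set.disjoint_left.2 ?_)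
      rintro v hv ⟨p, hp, i, rfl⟩
      exact hpend p hp i hv.1
    rw [hset]
    exact hstar.exists_finDraw

end ChainHyp

end chains

section frame

variable {N : Type*} {S K : Set N} {cor ch : N → ZMod 4 → N} {E : N → N → Prop}
  {A B C : N} {P P' : N → ℝ × ℝ}

lemma FlatRes.not_inTri {s d t : N} {ω : ℝ} (R : FlatRes S P P' E s d t ω) {v : N} (hv : v ∈ S) :
    ¬ InTri (P' s) (P' d) (P' t) (P' v) := by
  by_cases v1 : v = s
  · subst v1; simp [InTri]
  by_cases v2 : v = d
  · subst v2; simp [InTri]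
  by_cases v3 : v = t
  · subst v3; simp [InTri]
  obtain ⟨n1, n2⟩ := R.near hv v1 v2 v3
  rintro (⟨k1, k2, k3⟩ | ⟨k1, k2, k3⟩)
  · rw [cr_swap] at k3
    nlinarith
  · rw [cr_swap] at k3
    nlinarith

lemma GenPos.not_crs_of_empty (hgp : GenPos S P)
    (hplanar : ∀ {a b c e}, a ∈ S → b ∈ S → c ∈ S → e ∈ S → E a b → E c e →
      ¬ Crs (P a) (P b) (P c) (P e)) {u n s a b : N} (hu : u ∈ S) (hn : n ∈ S) (hs : s ∈ S)
    (hun : u ≠ n) (hns : n ≠ s) (hus : u ≠ s) (h1 : E u n) (h2 : E n s)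
    (hempty : ∀ {v}, v ∈ S → ¬ InTri (P u) (P n) (P s) (P v)) (ha : a ∈ S) (hb : b ∈ S)
    (han : a ≠ n) (hbn : b ≠ n) (h : E a b) : ¬ Crs (P a) (P b) (P u) (P s) := by
  intro hx
  obtain ⟨hab, -, hau, has, hbu, hbs⟩ := hx.ne_of
  have g {x y z : N} (hx : x ∈ S) (hy : y ∈ S) (hz : z ∈ S) := hgp x hx y hy z hz
  rcases hx.triangle (b := P n) (hempty ha) (hempty hb) (g ha hb hn hab hbn han)
    (g hu hn ha hun han.symm hau.symm) (g hn hs ha hns has.symm han.symm)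
    (g hu hn hb hun hbn.symm hbu.symm) (g hn hs hb hns hbs.symm hbn.symm)
    (g hu hn hs hun hns hus) with h' | h'
  · exact hplanar ha hb hu hn h h1 h'
  · exact hplanar ha hb hn hs h h2 h'

theorem ChainHyp.exists_finDraw_of_flat {Cx : N → N → N → N → Prop} (H : ChainHyp S K cor ch E P)
    {d : N} (hA : A ∈ S) (hB : B ∈ S) (hC : C ∈ S) (hd : d ∈ S) (hAB : E A B) (hBC : E B C)
    (hAd : E A d) (hdC : E d C) (hAC : ¬ E A C) (hne : A ≠ C) (hBd : B ≠ d)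
    (hAK : A ∉ K) (hBK : B ∉ K) (hCK : C ∉ K) (hdK : d ∉ K)
    (hch : ∀ p ∈ K, ∀ i, A ≠ ch p i ∧ B ≠ ch p i ∧ C ≠ ch p i ∧ d ≠ ch p i)
    (hdcor : ∀ p ∈ K, ∀ i, d ≠ cor p i) (hdnbr : ∀ {v}, v ∈ S → E d v → v = A ∨ v = C)
    (inside : ∀ {v}, v ∈ S → v ≠ A → v ≠ B → v ≠ C → v ≠ d →
      InTri (P A) (P d) (P C) (P v) ∧ ¬ InTri (P A) (P C) (P B) (P v))
    (side_ne : ∀ p ∈ K, ∀ i, s(cor p i, cor p (i + 1)) ≠ s(A, C))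
    (diag_nAC : ∀ p ∈ K, ∀ i, s(cor p i, cor p (i + 2)) ≠ s(A, C))
    (diag_ne : ∀ {p q}, p ∈ K → q ∈ K → p ≠ q → ∀ i j,
      ¬ (cor p i = cor q j ∧ cor p (i + 2) = cor q (j + 2)))
    (diag_cx : ∀ {p}, p ∈ K → ∀ i,
      Cx (cor p i) (cor p (i + 2)) (cor p (i + 1)) (cor p (i + 3)) ∧
      Cx (cor p i) (cor p (i + 2)) (cor p (i + 3)) (cor p (i + 1)))
    (side_ncx : ∀ {p}, p ∈ K → ∀ i a b, ¬ Cx a b (cor p i) (cor p (i + 1))) :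
    ∃ P', FinDraw (((S \ {d}) \ K) \ {v | ∃ p ∈ K, ∃ i, v = ch p i})
      (fun a b => (E a b ∨ s(a, b) = s(A, C)) ∨ ∃ p ∈ K, ∃ i, a = cor p i ∧ b = cor p (i + 2))
      Cx A B C P' := by
  have hflat : FlatHyp S P E A d C :=
    { mem_s := hA, mem_d := hd, mem_t := hC, symm := H.symm, ne := H.ne, gp := H.gp
      sides := fun ha hb hc he h1 h2 h => (H.planar ha hb hc he h1 h2 h).elim
      wedge := fun ha hb hc he _ h1 h2 h => (H.planar ha hb hc he h1 h2 h).elim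
      sd := hAd, dt := hdC, nst := hAC
      unc_s := fun ha hb h => H.planar ha hb hA hd h hAd
      unc_t := fun ha hb h => H.planar ha hb hd hC h hdC
      s_ne_t := hne
      nbr := fun hk hkd h1 h2 => by
        rcases hdnbr hk (H.symm hkd) with h | h <;> contradiction }
  obtain ⟨P', R⟩ := hflat.exists_flat H.fin (ω := 1) (by norm_num)
  have H' := H.transport R.gp R.same
  have hinside {v : N} (hv : v ∈ S) (h1 : v ≠ A) (h2 : v ≠ B) (h3 : v ≠ C) (h4 : v ≠ d) :
      InTri (P' A) (P' B) (P' C) (P' v) := by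
    have hq := R.same.quad _ hA _ hd _ hC _ hB _ hv hAd hdC (H.symm hBC) (H.symm hAB) hne
      h1 h4 h3 h2
    have h5 := inside hv h1 h2 h3 h4
    have h6 := R.not_inTri hv
    have h7 : InTri (P' A) (P' C) (P' B) (P' v) := by
      by_contra h7
      simp [h5.1, h5.2, h6, h7] at hq
    exact h7.rot.rot.swap
  have hAd' := H.ne hAd
  have hdC' := H.ne hdC
  have hcross {a b : N} (ha : a ∈ S \ {d}) (hb : b ∈ S \ {d}) (h : E a b) :
      ¬ Crs (P' a) (P' b) (P' A) (P' C) :=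
    R.gp.not_crs_of_empty H'.planar hA hd hC hAd' hdC' hne hAd hdC R.not_inTri ha.1 hb.1
      ha.2 hb.2 h
  have hnew {a b : N} (h : s(a, b) = s(A, C)) : (a = A ∧ b = C) ∨ (a = C ∧ b = A) := by
    simpa using h
  have hKe {r v : N} (hr : r ∈ K) : s(r, v) ≠ s(A, C) := by
    intro h
    rcases hnew h with h | h
    · exact hAK (h.1 ▸ hr)
    · exact hCK (h.1 ▸ hr)
  have hce {r v : N} (hr : r ∈ K) (k : ZMod 4) : s(ch r k, v) ≠ s(A, C) := by
    intro h
    rcases hnew h with h | h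
    · exact (hch r hr k).1 h.1.symm
    · exact (hch r hr k).2.2.1 h.1.symm
  have hchS {r : N} {k : ZMod 4} (hr : r ∈ K) (h : ch r k ∉ S \ {d}) : ch r k ∉ S :=
    fun h' => h ⟨h', (hch r hr k).2.2.2.symm⟩
  have H₂ : ChainHyp (S \ {d}) K cor ch (fun a b => E a b ∨ s(a, b) = s(A, C)) P' :=
  { H' with
    fin := H.fin.sdiff
    gp := fun a ha b hb c hc => R.gp a ha.1 b hb.1 c hc.1
    symm := by
      rintro a b (h | h)
      · exact .inl (H.symm h)
      · exact .inr (by rwa [Sym2.eq_swap])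
    ne := by
      rintro a b (h | h)
      · exact H.ne h
      · rintro rfl
        rcases hnew h with h | h
        · exact hne (h.1.symm.trans h.2)
        · exact hne (h.2.symm.trans h.1)
    planar := by
      rintro a b c e ha hb hc he (h1 | h1) (h2 | h2)
      · exact H'.planar ha.1 hb.1 hc.1 he.1 h1 h2
      · rcases hnew h2 with ⟨rfl, rfl⟩ | ⟨rfl, rfl⟩
        · exact hcross ha hb h1
        · exact fun h => hcross ha hb h1 (crs_swap_right.1 h)
      · rcases hnew h1 with ⟨rfl, rfl⟩ | ⟨rfl, rfl⟩
        · exact fun h => hcross hc he h2 h.symm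
        · exact fun h => hcross hc he h2 (crs_swap_left.1 h).symm
      · intro h
        have := h.ne_of
        have := hnew h1
        have := hnew h2
        grind
    sub := fun r hr => ⟨H.sub hr, fun h => hdK (h ▸ hr)⟩
    cor_mem := fun hr k => ⟨H.cor_mem hr k, (hdcor _ hr k).symm⟩
    spoke := fun hr k => .inl (H.spoke hr k)
    nbr := fun hr hv h => H.nbr hr hv.1 (h.resolve_right (hKe hr))
    side := fun hr k h => .inl (H.side hr k (hchS hr h))
    pos := fun hr k h => H'.pos hr k (hchS hr h)
    ndiag := by
      rintro r hr k (h | h)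
      · exact H.ndiag hr k h
      · exact diag_nAC r hr k h
    ch_mid := fun hr k h => .inl (H.ch_mid hr k h.1)
    ch_left := fun hr k h => .inl (H.ch_left hr k h.1)
    ch_right := fun hr k h => .inl (H.ch_right hr k h.1)
    ch_nbr := fun hr k h hv h' => H.ch_nbr hr k h.1 hv.1 (h'.resolve_right (hce hr k))
    ch_nadj := by
      rintro r hr k h (h' | h')
      · exact H.ch_nadj hr k h.1 h'
      · exact side_ne r hr k h'
    pos_left := fun hr k h => H'.pos_left hr k h.1
    pos_right := fun hr k h => H'.pos_right hr k h.1
    empty_left := fun hr k h hv => H'.empty_left hr k h.1 hv.1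
    empty_right := fun hr k h hv => H'.empty_right hr k h.1 hv.1
    primary := by
      intro r hr k h
      obtain ⟨q', hq', j', hj', he', h'⟩ := H'.primary hr k h.1
      exact ⟨q', hq', j', ⟨hj', (hch q' hq' j').2.2.2.symm⟩, he', fun r hr k hk => h' r hr k hk.1⟩ }
  exact H₂.exists_finDraw ⟨hA, hAd'⟩ ⟨hB, hBd⟩ ⟨hC, hdC'.symm⟩ (.inl hAB) (.inl hBC) (.inr rfl)
    hAK hBK hCK (fun p hp i => ⟨(hch p hp i).1, (hch p hp i).2.1, (hch p hp i).2.2.1⟩)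
    (fun hv h1 h2 h3 => hinside hv.1 h1 h2 h3 hv.2) diag_ne diag_cx side_ncx

end frame

section insertion

open Filter Topology

lemma GenPos.exists_near {N : Type*} {S : Set N} {P : N → ℝ × ℝ} (H : GenPos S P) (hS : S.Finite)
    {p u s : N} (hp : p ∈ S) (hu : u ∈ S) (hs : s ∈ S) (h : 0 < cr (P p) (P u) (P s)) :
    ∃ x, (∀ v ∈ S, ∀ w ∈ S, v ≠ w → v ≠ p → w ≠ p → 0 < cr (P v) (P w) x * cr (P v) (P w) (P p)) ∧
      (∀ w ∈ S, w ≠ p → cr (P p) x (P w) ≠ 0) ∧ 0 < cr (P p) (P u) x ∧ 0 < cr (P p) x (P s) ∧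
      InTri (P p) (P u) (P s) x := by
  have hpu : p ≠ u := by rintro rfl; simp at h
  have hps : p ≠ s := by rintro rfl; simp at h
  have hus : u ≠ s := by rintro rfl; simp at h
  obtain ⟨l, hl0, hl⟩ : ∃ l : ℝ, 0 < l ∧ ∀ w ∈ S, w ≠ p →
      cr (P p) (P u) (P w) + l * cr (P p) (P s) (P w) ≠ 0 := by
    have hfin : ((fun w => - cr (P p) (P u) (P w) / cr (P p) (P s) (P w)) '' S).Finite :=
      hS.image _
    obtain ⟨l, hl, hl'⟩ := (Set.Ioi_infinite (0 : ℝ)).exists_notMem_finite hfin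
    refine ⟨l, hl, fun w hw hwp h0 => ?_⟩
    by_cases hws : w = s
    · subst hws
      simp only [cr_self_right, mul_zero, add_zero] at h0
      exact h.ne' h0
    · have h1 := H p hp s hs w hw hps (Ne.symm hws) hwp.symm
      refine hl' ⟨w, hw, ?_⟩
      field_simp
      linarith
  set x : ℝ → ℝ × ℝ := fun ε => P p + ε • ((P u - P p) + l • (P s - P p)) with hx
  have hx0 : Tendsto x (𝓝[>] 0) (𝓝 (P p)) := by
    have : Continuous x := by fun_prop
    have h1 := this.tendsto 0
    simp only [hx, zero_smul, add_zero] at h1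
    exact h1.mono_left nhdsWithin_le_nhds
  have hcr (v w : N) : Tendsto (fun ε => cr (P v) (P w) (x ε)) (𝓝[>] 0)
      (𝓝 (cr (P v) (P w) (P p))) := by
    have : Continuous fun y => cr (P v) (P w) y := by unfold cr; fun_prop
    exact (this.tendsto _).comp hx0
  have hev : ∀ᶠ ε in 𝓝[>] (0 : ℝ), ∀ v ∈ S, ∀ w ∈ S, v ≠ w → v ≠ p → w ≠ p →
      0 < cr (P v) (P w) (x ε) * cr (P v) (P w) (P p) := by
    refine (eventually_all_finite hS).2 fun v hv => (eventually_all_finite hS).2 fun w hw => ?_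
    by_cases hc : v ≠ w ∧ v ≠ p ∧ w ≠ p
    · have h0 := mul_self_pos.2 (H v hv w hw p hp hc.1 hc.2.2 hc.2.1)
      filter_upwards [((hcr v w).mul_const _).eventually (lt_mem_nhds h0)] with ε hε _ _ _ using hε
    · exact .of_forall fun ε h1 h2 h3 => (hc ⟨h1, h2, h3⟩).elim
  obtain ⟨ε, hε, hε0⟩ := (hev.and self_mem_nhdsWithin).exists
  have hε0 : 0 < ε := hε0
  have e1 (w : N) : cr (P p) (x ε) (P w) =
      ε * (cr (P p) (P u) (P w) + l * cr (P p) (P s) (P w)) := by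
    simp only [hx, cr, Prod.fst_add, Prod.snd_add, Prod.smul_fst, Prod.smul_snd, Prod.fst_sub,
      Prod.snd_sub, smul_eq_mul]
    ring
  have e2 : 0 < cr (P p) (P u) (x ε) := by
    rw [cr_swap', e1, cr_swap' _ (P u) (P s), cr_self_right]
    have := mul_pos hε0 (mul_pos hl0 h)
    linarith
  have e3 : 0 < cr (P p) (x ε) (P s) := by
    rw [e1, cr_self_right]
    have := mul_pos hε0 h
    linarith
  refine ⟨x ε, hε, fun w hw hwp => ?_, e2, e3, .inl ⟨e2, ?_, ?_⟩⟩
  · rw [e1]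
    exact mul_ne_zero hε0.ne' (hl w hw hwp)
  · have := hε u hu s hs hus hpu.symm hps.symm
    rw [cr_rot (P p)] at this
    exact pos_of_mul_pos_left this h.le
  · rwa [cr_rot, cr_rot]

lemma cone_disjoint {p e : ℝ × ℝ} {c : ZMod 4 → ℝ × ℝ} (h : ∀ i, 0 < cr p (c i) (c (i + 1)))
    {i j : ZMod 4} (hij : i ≠ j) (h1 : 0 < cr p (c i) e) (h2 : 0 < cr p e (c (i + 1)))
    (h3 : 0 < cr p (c j) e) (h4 : 0 < cr p e (c (j + 1))) : False := by
  have hj : j = i + 1 ∨ i = j + 1 ∨ j = i + 2 := by clear * - hij; revert i j; decide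
  rcases hj with rfl | rfl | rfl
  · rw [cr_swap'] at h2; linarith
  · rw [cr_swap'] at h4; linarith
  have k0 := h i
  have k1 := h (i + 1)
  have k2 := h (i + 2)
  have k3 := h (i + 3)
  rw [show i + 1 + 1 = i + 2 by ring] at k1
  rw [show i + 2 + 1 = i + 3 by ring] at k2 h4
  rw [(by decide : ∀ i : ZMod 4, i + 3 + 1 = i) i] at k3
  have id₁ (a b d : ℝ × ℝ) : cr p e d * cr p a b = cr p e b * cr p a d + cr p a e * cr p b d := by
    unfold cr; ring
  have m1 := id₁ (c i) (c (i + 1)) (c (i + 3))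
  rw [cr_swap' p (c (i + 3)) (c i)] at m1
  have m2 : 0 < cr p (c (i + 1)) (c (i + 3)) := by
    by_contra! h0
    nlinarith [mul_pos h4 k0, mul_pos h2 k3, mul_nonneg h1.le (neg_nonneg.2 h0)]
  have m3 := id₁ (c (i + 2)) (c (i + 3)) (c (i + 1))
  rw [cr_swap' p (c (i + 1)) (c (i + 2)), cr_swap' p (c (i + 1)) (c (i + 3))] at m3
  nlinarith [mul_pos h2 k2, mul_pos h4 k1, mul_pos h3 m2]

end insertion

section insertion

lemma mul_neg_of_same {a b a' b' : ℝ} (h₁ : 0 < a * a') (h₂ : 0 < b * b') (h : a * b < 0) :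
    a' * b' < 0 := by
  by_contra! h0
  nlinarith [mul_pos h₁ h₂, mul_nonneg (neg_nonneg.2 h.le) h0]

lemma not_inTri_of_same {p w z v : ℝ × ℝ} (h : 0 < cr w v z * cr w v p) : ¬ InTri p w z v := by
  rw [cr_rot p w v, cr_swap' w z v] at h
  rintro (⟨h1, h2, -⟩ | ⟨h1, h2, -⟩)
  · nlinarith [mul_pos h1 h2]
  · nlinarith [mul_pos_of_neg_of_neg h1 h2]

lemma InTri.of_same {a b c p z : ℝ × ℝ} (h : InTri a b c z) (h₁ : 0 < cr a b z * cr a b p)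
    (h₂ : 0 < cr b c z * cr b c p) (h₃ : 0 < cr c a z * cr c a p) : InTri a b c p := by
  rcases h with ⟨k1, k2, k3⟩ | ⟨k1, k2, k3⟩
  · exact .inl ⟨pos_of_mul_pos_right h₁ k1.le, pos_of_mul_pos_right h₂ k2.le,
      pos_of_mul_pos_right h₃ k3.le⟩
  · exact .inr ⟨neg_of_mul_pos_right h₁ k1.le, neg_of_mul_pos_right h₂ k2.le,
      neg_of_mul_pos_right h₃ k3.le⟩

lemma not_inTri_left {a b c : ℝ × ℝ} : ¬ InTri a b c a := by simp [InTri]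
lemma not_inTri_mid {a b c : ℝ × ℝ} : ¬ InTri a b c b := by simp [InTri]
lemma not_inTri_right {a b c : ℝ × ℝ} : ¬ InTri a b c c := by simp [InTri]

section cone

variable {p u s z e : ℝ × ℝ}

lemma cone_of_crs_left (h : 0 < cr p u s) (h₁ : 0 < cr p u z) (h₂ : 0 < cr p z s)
    (hs : 0 < cr u e z * cr u e p) (hX : Crs z u p e) : 0 < cr p u e ∧ 0 < cr p e s := by
  obtain ⟨x1, x2⟩ := hX
  have e1 : cr z u p = - cr p u z := by unfold cr; ring
  have e2 : cr u e z = cr z u e := cr_rot z u e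
  have e3 : cr u e p = cr p u e := cr_rot p u e
  have e4 : cr p e u = - cr p u e := cr_swap' _ _ _
  rw [e1] at x1
  rw [e2, e3] at hs
  rw [e4] at x2
  have k1 : 0 < cr z u e := by
    by_contra! h0
    nlinarith
  have k2 : 0 < cr p u e := pos_of_mul_pos_right hs k1.le
  have k3 : 0 < cr p e z := by
    by_contra! h0
    nlinarith
  refine ⟨k2, ?_⟩
  have id : cr p e s * cr p u z = cr p e z * cr p u s + cr p u e * cr p z s := by
    unfold cr; ring
  refine pos_of_mul_pos_left (b := cr p u z) ?_ h₁.le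
  rw [id]
  positivity

lemma cone_of_crs_right (h : 0 < cr p u s) (h₁ : 0 < cr p u z) (h₂ : 0 < cr p z s)
    (hs : 0 < cr s e z * cr s e p) (hX : Crs z s p e) : 0 < cr p u e ∧ 0 < cr p e s := by
  obtain ⟨x1, x2⟩ := hX
  have e1 : cr z s p = cr p z s := by unfold cr; ring
  have e2 : cr s e z = cr z s e := cr_rot z s e
  have e3 : cr s e p = - cr p e s := by unfold cr; ring
  rw [e1] at x1
  rw [e2, e3] at hs
  have k1 : cr z s e < 0 := by
    by_contra! h0
    nlinarith
  have k2 : 0 < cr p e s := by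
    by_contra! h0
    nlinarith
  have k3 : cr p e z < 0 := by
    by_contra! h0
    nlinarith
  refine ⟨?_, k2⟩
  have id : cr p u e * cr p z s = cr p u z * cr p e s + cr p u s * (- cr p e z) := by
    unfold cr; ring
  refine pos_of_mul_pos_left (b := cr p z s) ?_ h₂.le
  rw [id]
  have := neg_pos.2 k3
  positivity

end cone

/-- A planar straight-line drawing of `E` on `S` in general position, in which the nodes of `K` are
centres of star-shaped quadrilaterals whose sides may be missing. -/
structure CentreHyp {N : Type*} (S K : Set N) (cor : N → ZMod 4 → N) (E : N → N → Prop)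
    (P : N → ℝ × ℝ) : Prop where
  fin : S.Finite
  gp : GenPos S P
  symm : ∀ {a b}, E a b → E b a
  ne : ∀ {a b}, E a b → a ≠ b
  mem : ∀ {a b}, E a b → a ∈ S
  planar : ∀ {a b c e}, E a b → E c e → ¬ Crs (P a) (P b) (P c) (P e)
  sub : K ⊆ S
  cor_nmem : ∀ {p}, p ∈ K → ∀ i, cor p i ∉ K
  cor_inj : ∀ {p}, p ∈ K → Function.Injective (cor p)
  spoke : ∀ {p}, p ∈ K → ∀ i, E p (cor p i)
  nbr : ∀ {p v}, p ∈ K → E p v → ∃ i, v = cor p i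
  pos : ∀ {p}, p ∈ K → ∀ i, 0 < cr (P p) (P (cor p i)) (P (cor p (i + 1)))
  ndiag : ∀ {p}, p ∈ K → ∀ i, ¬ E (cor p i) (cor p (i + 2))
  side_diag : ∀ {p q}, p ∈ K → q ∈ K → ∀ i j,
    ¬ (cor p i = cor q j ∧ cor p (i + 1) = cor q (j + 2))

/-- The edges of `E` and of the stars around the nodes `ch p i`. -/
def chainAdj {N : Type*} (K : Set N) (cor ch : N → ZMod 4 → N) (E : N → N → Prop) (a b : N) : Prop :=
  E a b ∨ (∃ p ∈ K, ∃ i, a = ch p i ∧ (b = p ∨ b = cor p i ∨ b = cor p (i + 1))) ∨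
    (∃ p ∈ K, ∃ i, b = ch p i ∧ (a = p ∨ a = cor p i ∨ a = cor p (i + 1)))

/-- The nodes of `S` and the nodes subdividing the sides in `D`. -/
def withChains {N : Type*} (S : Set N) (ch : N → ZMod 4 → N) (D : Set (N × ZMod 4)) : Set N :=
  S ∪ {v | ∃ x ∈ D, v = ch x.1 x.2}

namespace CentreHyp

variable {N : Type*} {S K : Set N} {cor ch : N → ZMod 4 → N} {E : N → N → Prop}
  {P P' : N → ℝ × ℝ} {p : N} {D : Set (N × ZMod 4)}

lemma cor_mem (H : CentreHyp S K cor E P) (hp : p ∈ K) (i : ZMod 4) : cor p i ∈ S :=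
  H.mem (H.symm (H.spoke hp i))

lemma cor_ne_succ (H : CentreHyp S K cor E P) (hp : p ∈ K) (i : ZMod 4) :
    cor p i ≠ cor p (i + 1) := fun h =>
  (by decide : ∀ i : ZMod 4, i ≠ i + 1) i (H.cor_inj hp h)

lemma ne_cor (H : CentreHyp S K cor E P) {q : N} (hp : p ∈ K) (hq : q ∈ K) (i : ZMod 4) :
    q ≠ cor p i := by
  rintro rfl
  exact H.cor_nmem hp i hq

/-- The positions `P'` extend `P` to subdividing nodes close to the centres. -/
structure Extends (S K : Set N) (cor ch : N → ZMod 4 → N) (E : N → N → Prop) (P : N → ℝ × ℝ)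
    (D : Set (N × ZMod 4)) (P' : N → ℝ × ℝ) : Prop where
  eq : ∀ v ∈ S, P' v = P v
  gp : GenPos (withChains S ch D) P'
  planar : ∀ {a b c e}, a ∈ withChains S ch D → b ∈ withChains S ch D → c ∈ withChains S ch D →
    e ∈ withChains S ch D → chainAdj K cor ch E a b → chainAdj K cor ch E c e →
    ¬ Crs (P' a) (P' b) (P' c) (P' e)
  tri : ∀ x ∈ D, InTri (P x.1) (P (cor x.1 x.2)) (P (cor x.1 (x.2 + 1))) (P' (ch x.1 x.2))
  empty_left : ∀ x ∈ D, ∀ v ∈ withChains S ch D,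
    ¬ InTri (P x.1) (P (cor x.1 x.2)) (P' (ch x.1 x.2)) (P' v)
  empty_right : ∀ x ∈ D, ∀ v ∈ withChains S ch D,
    ¬ InTri (P x.1) (P' (ch x.1 x.2)) (P (cor x.1 (x.2 + 1))) (P' v)

lemma adj_ch (H : CentreHyp S K cor E P) (hch : ∀ p ∈ K, ∀ i, ch p i ∉ S)
    (hinj : ∀ p ∈ K, ∀ q ∈ K, ∀ i j, ch p i = ch q j → p = q ∧ i = j) (hp : p ∈ K) {i : ZMod 4}
    {v : N} (h : chainAdj K cor ch E (ch p i) v) : v = p ∨ v = cor p i ∨ v = cor p (i + 1) := by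
  rcases h with h | ⟨q, hq, j, h, h'⟩ | ⟨q, hq, j, h, h'⟩
  · exact (hch p hp i (H.mem h)).elim
  · obtain ⟨rfl, rfl⟩ := hinj p hp q hq i j h
    exact h'
  · rcases h' with h' | h' | h'
    · exact (hch p hp i (h' ▸ H.sub hq)).elim
    · exact (hch p hp i (h' ▸ H.cor_mem hq _)).elim
    · exact (hch p hp i (h' ▸ H.cor_mem hq _)).elim

lemma adj_symm (H : CentreHyp S K cor E P) {a b : N} (h : chainAdj K cor ch E a b) :
    chainAdj K cor ch E b a := by
  rcases h with h | h | h
  exacts [.inl (H.symm h), .inr (.inr h), .inr (.inl h)]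

lemma adj_center (H : CentreHyp S K cor E P) (hch : ∀ p ∈ K, ∀ i, ch p i ∉ S) (hp : p ∈ K) {v : N}
    (h : chainAdj K cor ch E p v) : ∃ i, v = cor p i ∨ v = ch p i := by
  rcases h with h | ⟨q, hq, j, h, h'⟩ | ⟨q, hq, j, h, h'⟩
  · obtain ⟨i, h⟩ := H.nbr hp h
    exact ⟨i, .inl h⟩
  · exact (hch q hq j (h ▸ H.sub hp)).elim
  · rcases h' with rfl | h' | h'
    · exact ⟨j, .inr h⟩
    · exact (H.ne_cor hq hp _ h').elim
    · exact (H.ne_cor hq hp _ h').elim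

lemma adj_mem {a b : N} (ha : a ∈ S) (hb : b ∈ S)
    (hch : ∀ p ∈ K, ∀ i, ch p i ∉ S) (h : chainAdj K cor ch E a b) : E a b := by
  rcases h with h | ⟨q, hq, j, rfl, -⟩ | ⟨q, hq, j, rfl, -⟩
  · exact h
  · exact (hch q hq j ha).elim
  · exact (hch q hq j hb).elim

lemma exists_extends (H : CentreHyp S K cor E P) (hch : ∀ p ∈ K, ∀ i, ch p i ∉ S)
    (hinj : ∀ p ∈ K, ∀ q ∈ K, ∀ i j, ch p i = ch q j → p = q ∧ i = j) (hD : D.Finite) :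
    (∀ x ∈ D, x.1 ∈ K) → ∃ P', Extends S K cor ch E P D P' := by
  classical
  induction D, hD using Set.Finite.induction_on with
  | empty =>
    intro _
    have h0 : withChains S ch ∅ = S := by simp [withChains]
    refine ⟨P, fun _ _ => rfl, by rw [h0]; exact H.gp, ?_, by simp, by simp, by simp⟩
    rw [h0]
    exact fun ha hb hc he h1 h2 => H.planar (adj_mem ha hb hch h1) (adj_mem hc he hch h2)
  | @insert x D hx hD ih =>
    intro hK
    obtain ⟨P', J⟩ := ih fun y hy => hK y (Set.mem_insert_of_mem _ hy)
    obtain ⟨p, i⟩ := x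
    have hp : p ∈ K := hK _ (Set.mem_insert _ _)
    have hDK : ∀ x ∈ D, x.1 ∈ K := fun y hy => hK y (Set.mem_insert_of_mem _ hy)
    set T := withChains S ch D with hT
    have hST : S ⊆ T := Set.subset_union_left
    have hTfin : T.Finite := by
      refine H.fin.union ((hD.image fun x => ch x.1 x.2).subset ?_)
      rintro v ⟨x, hx, rfl⟩
      exact ⟨x, hx, rfl⟩
    have hpT := hST (H.sub hp)
    have huT := hST (H.cor_mem hp i)
    have hsT := hST (H.cor_mem hp (i + 1))
    have hpos (j : ZMod 4) : 0 < cr (P' p) (P' (cor p j)) (P' (cor p (j + 1))) := by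
      rw [J.eq _ (H.sub hp), J.eq _ (H.cor_mem hp _), J.eq _ (H.cor_mem hp _)]
      exact H.pos hp j
    obtain ⟨z, hz, hzp, hz1, hz2, hz3⟩ := J.gp.exists_near hTfin hpT huT hsT (hpos i)
    set n := ch p i with hn
    have hnT : n ∉ T := by
      rintro (h | ⟨y, hy, h⟩)
      · exact hch p hp i h
      · obtain ⟨h1, h2⟩ := hinj p hp y.1 (hDK y hy) _ _ h
        exact hx (by rwa [h1, h2])
    have hT' : withChains S ch (insert (p, i) D) = insert n T := by
      ext v
      simp only [withChains, hT, Set.mem_union, Set.mem_ofPred_eq, Set.mem_insert_iff,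
        exists_eq_or_imp]
      tauto
    have hQ {v : N} (hv : v ∈ T) : Function.update P' n z v = P' v :=
      Function.update_of_ne (fun h => hnT (by rw [← h]; exact hv)) _ _
    have hQn : Function.update P' n z n = z := Function.update_self _ _ _
    have hadj {v : N} (h : chainAdj K cor ch E n v) : v = p ∨ v = cor p i ∨ v = cor p (i + 1) :=
      H.adj_ch hch hinj hp h
    have hpu : p ≠ cor p i := H.ne_cor hp hp _
    have hps : p ≠ cor p (i + 1) := H.ne_cor hp hp _
    have hus : cor p i ≠ cor p (i + 1) := H.cor_ne_succ hp i
    have hspu : chainAdj K cor ch E p (cor p i) := .inl (H.spoke hp i)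
    have hsps : chainAdj K cor ch E p (cor p (i + 1)) := .inl (H.spoke hp (i + 1))
    -- no neighbour of `p` lies in the open cone
    have hcone {e : N} (he : e ∈ T) (h : chainAdj K cor ch E p e) :
        ¬ (0 < cr (P' p) (P' (cor p i)) (P' e) ∧ 0 < cr (P' p) (P' e) (P' (cor p (i + 1)))) := by
      rintro ⟨h1, h2⟩
      obtain ⟨j, rfl | rfl⟩ := H.adj_center hch hp h
      · have hj : j = i ∨ j = i + 1 ∨ j = i + 2 ∨ j = i + 3 := by clear * -; revert i j; decide
        have k1 := hpos (i + 1)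
        have k2 := hpos (i + 3)
        rw [add_assoc, one_add_one_eq_two] at k1
        rw [(by decide : ∀ i : ZMod 4, i + 3 + 1 = i) i] at k2
        rcases hj with rfl | rfl | rfl | rfl
        · simp at h1
        · simp at h2
        · rw [cr_swap'] at h2; linarith
        · rw [cr_swap'] at h1; linarith
      · rcases he with he | ⟨y, hy, he⟩
        · exact hch p hp j he
        obtain ⟨h3, h4⟩ := hinj p hp y.1 (hDK y hy) _ _ he
        have hij : i ≠ j := by
          rintro rfl
          exact hx (by rwa [h3, h4])
        have h5 := J.tri y hy
        rw [← he, ← h3, ← h4] at h5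
        rw [← J.eq _ (H.sub hp), ← J.eq _ (H.cor_mem hp _), ← J.eq _ (H.cor_mem hp _)] at h5
        obtain ⟨m1, m2, m3⟩ := h5.pos (hpos j)
        exact cone_disjoint (c := fun i => P' (cor p i)) hpos hij h1 h2 m1
          (by rwa [cr_rot (P' (cor p (j + 1)))])
    have hnew {v c e : N} (hv : v ∈ T) (hc : c ∈ T) (he : e ∈ T) (h : chainAdj K cor ch E n v)
        (h' : chainAdj K cor ch E c e) : ¬ Crs z (P' v) (P' c) (P' e) := by
      intro hX
      obtain ⟨-, ce, -, -, vc, ve⟩ := hX.ne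
      have ce : c ≠ e := fun h => ce (by rw [h])
      have vc : v ≠ c := fun h => vc (by rw [h])
      have ve : v ≠ e := fun h => ve (by rw [h])
      obtain ⟨x1, x2⟩ := hX
      by_cases hvp : v = p
      · subst hvp
        have := hz c hc e he ce vc.symm ve.symm
        linarith
      have hEv : chainAdj K cor ch E p v := by
        rcases hadj h with rfl | rfl | rfl
        exacts [(hvp rfl).elim, hspu, hsps]
      have hE (w : N) (hw : w ∈ T) (hwv : w ≠ v) (hpw : chainAdj K cor ch E p w) (hwp : w ≠ p) :
          ¬ Crs z (P' v) (P' p) (P' w) := by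
        intro hX
        refine hcone hw hpw ?_
        have hs := hz v hv w hw hwv.symm hvp hwp
        rcases (hadj h).resolve_left hvp with rfl | rfl
        · exact cone_of_crs_left (hpos i) hz1 hz2 hs hX
        · exact cone_of_crs_right (hpos i) hz1 hz2 hs hX
      by_cases hcp : c = p
      · subst hcp
        exact hE e he ve.symm h' ce.symm ⟨x1, x2⟩
      by_cases hep : e = p
      · subst hep
        exact hE c hc vc.symm (H.adj_symm h') ce (crs_swap_right.1 ⟨x1, x2⟩)
      have s1 := hz v hv c hc vc hvp hcp
      have s2 := hz v hv e he ve hvp hep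
      have s3 := hz c hc e he ce hcp hep
      rw [cr_rot z, cr_rot (P' p)] at s1 s2
      have s4 : 0 < cr (P' c) (P' e) (P' v) * cr (P' c) (P' e) (P' v) :=
        mul_self_pos.2 (J.gp c hc e he v hv ce ve.symm vc.symm)
      exact J.planar hpT hv hc he hEv h' ⟨mul_neg_of_same s1 s2 x1, mul_neg_of_same s3 s4 x2⟩
    have hzT {v w : N} (hv : v ∈ T) (hw : w ∈ T) (hvw : v ≠ w) : cr (P' v) (P' w) z ≠ 0 := by
      by_cases hvp : v = p
      · subst hvp
        rw [cr_swap']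
        exact neg_ne_zero.2 (hzp w hw hvw.symm)
      by_cases hwp : w = p
      · subst hwp
        rw [← cr_rot]
        exact hzp v hv hvp
      · exact left_ne_zero_of_mul (hz v hv w hw hvw hvp hwp).ne'
    have hnT' {v : N} (h : chainAdj K cor ch E n v) : v ∈ T := by
      rcases hadj h with rfl | rfl | rfl
      exacts [hpT, huT, hsT]
    have hpl {b c e : N} (hc : c ∈ insert n T) (he : e ∈ insert n T) (h : chainAdj K cor ch E n b)
        (h' : chainAdj K cor ch E c e) : ¬ Crs z (P' b) (Function.update P' n z c)
          (Function.update P' n z e) := by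
      intro hX
      rcases hc with rfl | hc
      · exact hX.ne.2.2.1 hQn.symm
      rcases he with rfl | he
      · exact hX.ne.2.2.2.1 hQn.symm
      rw [hQ hc, hQ he] at hX
      exact hnew (hnT' h) hc he h h' hX
    have hE1 {w v : N} (hw : w ∈ T) (hpw : p ≠ w) (hv : v ∈ insert n T) :
        ¬ InTri (P' p) (P' w) z (Function.update P' n z v) := by
      rcases hv with rfl | hv
      · rw [hQn]
        exact not_inTri_right
      rw [hQ hv]
      by_cases hvp : v = p
      · rw [hvp]
        exact not_inTri_left
      by_cases hvw : v = w
      · rw [hvw]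
        exact not_inTri_mid
      exact not_inTri_of_same (hz w hw v hv (Ne.symm hvw) hpw.symm hvp)
    have hE2 {y : N × ZMod 4} {w : N} (hy : y ∈ D)
        (hw : w = cor y.1 y.2 ∨ w = cor y.1 (y.2 + 1))
        (hemp : ∀ v ∈ T, ¬ InTri (P' y.1) (P' w) (P' (ch y.1 y.2)) (P' v)) :
        ¬ InTri (P' y.1) (P' w) (P' (ch y.1 y.2)) z := by
      intro hI
      have hyK := hDK y hy
      have hwS : w ∈ S := by rcases hw with rfl | rfl <;> exact H.cor_mem hyK _
      by_cases hyp : y.1 = p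
      · have hij : i ≠ y.2 := by
          rintro rfl
          exact hx (by rwa [← hyp])
        have h5 := J.tri y hy
        rw [← J.eq _ (H.sub hyK), ← J.eq _ (H.cor_mem hyK _), ← J.eq _ (H.cor_mem hyK _)] at h5
        have h6 : InTri (P' y.1) (P' (cor y.1 y.2)) (P' (cor y.1 (y.2 + 1))) z := by
          rcases hw with rfl | rfl
          · exact h5.trans (inTri_rot.1 hI)
          · exact (h5.rot.rot.trans (hI.swap.rot.rot)).rot
        rw [hyp] at h6
        obtain ⟨m1, m2, m3⟩ := h6.pos (hpos y.2)
        exact cone_disjoint (c := fun i => P' (cor p i)) hpos hij hz1 hz2 m1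
          (by rwa [cr_rot (P' (cor p (y.2 + 1)))])
      · have hyT := hST (H.sub hyK)
        have hwT := hST hwS
        have hmT : ch y.1 y.2 ∈ T := .inr ⟨y, hy, rfl⟩
        have hwp : w ≠ p := by
          rcases hw with rfl | rfl <;> exact (H.ne_cor hyK hp _).symm
        have hyw : y.1 ≠ w := by
          rcases hw with rfl | rfl <;> exact H.ne_cor hyK hyK _
        have hmS := hch _ hyK y.2
        have hmp : ch y.1 y.2 ≠ p := fun h => hmS (h ▸ H.sub hp)
        have hwm : w ≠ ch y.1 y.2 := fun h => hmS (h ▸ hwS)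
        have hmy : ch y.1 y.2 ≠ y.1 := fun h => hmS (by rw [h]; exact H.sub hyK)
        exact hemp p hpT (hI.of_same (hz _ hyT _ hwT hyw hyp hwp) (hz _ hwT _ hmT hwm hwp hmp)
          (hz _ hmT _ hyT hmy hmp hyp))
    refine ⟨Function.update P' n z, ?_, ?_, ?_, ?_, ?_, ?_⟩
    · intro v hv
      rw [hQ (hST hv), J.eq v hv]
    · rw [hT']
      rintro a (rfl | ha) b (rfl | hb) c (rfl | hc) hab hbc hac
      · exact (hab rfl).elim
      · exact (hab rfl).elim
      · exact (hac rfl).elim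
      · rw [hQn, hQ hb, hQ hc, ← cr_rot]
        exact hzT hb hc hbc
      · exact (hbc rfl).elim
      · rw [hQn, hQ ha, hQ hc, cr_rot (P' c)]
        exact hzT hc ha hac.symm
      · rw [hQn, hQ ha, hQ hb]
        exact hzT ha hb hab
      · rw [hQ ha, hQ hb, hQ hc]
        exact J.gp a ha b hb c hc hab hbc hac
    · rw [hT']
      rintro a b c e ha hb hc he hab hce hX
      rcases ha with rfl | ha
      · rw [hQn, hQ (hnT' hab)] at hX
        exact hpl hc he hab hce hX
      rcases hb with rfl | hb
      · have hab := H.adj_symm hab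
        rw [hQn, hQ (hnT' hab)] at hX
        exact hpl hc he hab hce hX.swap_left
      rcases hc with rfl | hc
      · rw [hQn, hQ (hnT' hce)] at hX
        exact hpl (.inr ha) (.inr hb) hce hab hX.symm
      rcases he with rfl | he
      · have hce := H.adj_symm hce
        rw [hQn, hQ (hnT' hce)] at hX
        exact hpl (.inr ha) (.inr hb) hce hab hX.symm.swap_left
      rw [hQ ha, hQ hb, hQ hc, hQ he] at hX
      exact J.planar ha hb hc he hab hce hX
    · rintro y (rfl | hy)
      · rw [← J.eq _ (H.sub hp), ← J.eq _ (H.cor_mem hp _), ← J.eq _ (H.cor_mem hp _)]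
        simpa only [← hn, hQn] using hz3
      · rw [hQ (.inr ⟨y, hy, rfl⟩)]
        exact J.tri y hy
    · rw [hT']
      rintro y (rfl | hy) v hv hI
      · refine hE1 huT hpu hv ?_
        simpa only [← hn, hQn, J.eq _ (H.sub hp), J.eq _ (H.cor_mem hp _)] using hI
      · rw [hQ (.inr ⟨y, hy, rfl⟩)] at hI
        rcases hv with rfl | hv
        · rw [hQn, ← J.eq _ (H.sub (hDK y hy)), ← J.eq _ (H.cor_mem (hDK y hy) _)] at hI
          refine hE2 hy (.inl rfl) (fun v hv h => J.empty_left y hy v hv ?_) hI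
          rwa [J.eq _ (H.sub (hDK y hy)), J.eq _ (H.cor_mem (hDK y hy) _)] at h
        · rw [hQ hv] at hI
          exact J.empty_left y hy v hv hI
    · rw [hT']
      rintro y (rfl | hy) v hv hI
      · refine hE1 hsT hps hv (InTri.swap (InTri.rot (InTri.rot ?_)))
        simpa only [← hn, hQn, J.eq _ (H.sub hp), J.eq _ (H.cor_mem hp _)] using hI
      · rw [hQ (.inr ⟨y, hy, rfl⟩)] at hI
        rcases hv with rfl | hv
        · rw [hQn, ← J.eq _ (H.sub (hDK y hy)), ← J.eq _ (H.cor_mem (hDK y hy) _)] at hI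
          refine hE2 hy (.inr rfl) (fun v hv h => J.empty_right y hy v hv ?_)
            hI.rot.rot.swap
          rw [J.eq _ (H.sub (hDK y hy)), J.eq _ (H.cor_mem (hDK y hy) _)] at h
          exact h.rot.rot.swap
        · rw [hQ hv] at hI
          exact J.empty_right y hy v hv hI

end CentreHyp

end insertion

section insertion

namespace CentreHyp

variable {N : Type*} {S K : Set N} {cor ch : N → ZMod 4 → N} {E : N → N → Prop}
  {P P' : N → ℝ × ℝ} {D : Set (N × ZMod 4)}

lemma InTri.not_inTri_apex {p u s n : ℝ × ℝ} (h : InTri p u s n) : ¬ InTri u s n p := by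
  intro h'
  have h1 := h.rot.trans h'.rot.rot
  exact not_inTri_right h1

lemma Extends.exists_primary (H : CentreHyp S K cor E P) (J : Extends S K cor ch E P D P')
    (hD : D.Finite) (hDK : ∀ x ∈ D, x.1 ∈ K) {x : N × ZMod 4} (hx : x ∈ D) :
    ∃ y ∈ D, s(cor y.1 y.2, cor y.1 (y.2 + 1)) = s(cor x.1 x.2, cor x.1 (x.2 + 1)) ∧
      ∀ z ∈ D, s(cor z.1 z.2, cor z.1 (z.2 + 1)) = s(cor y.1 y.2, cor y.1 (y.2 + 1)) →
        ¬ InTri (P' (cor z.1 z.2)) (P' (ch y.1 y.2)) (P' (cor z.1 (z.2 + 1))) (P' z.1) := by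
  set T := withChains S ch D
  have hT : T.Finite := by
    refine H.fin.union ((hD.image fun x => ch x.1 x.2).subset ?_)
    rintro v ⟨x, hx, rfl⟩
    exact ⟨x, hx, rfl⟩
  have hST : S ⊆ T := Set.subset_union_left
  let f (y : N × ZMod 4) : Set N :=
    {v ∈ T | InTri (P' (cor y.1 y.2)) (P' (cor y.1 (y.2 + 1))) (P' (ch y.1 y.2)) (P' v)}
  obtain ⟨y, ⟨hy, hyx⟩, hmin⟩ := Set.exists_min_image
    {y ∈ D | s(cor y.1 y.2, cor y.1 (y.2 + 1)) = s(cor x.1 x.2, cor x.1 (x.2 + 1))}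
    (fun y => (f y).ncard) (hD.sep _) ⟨x, hx, rfl⟩
  refine ⟨y, hy, hyx, fun z hz hzy hI => ?_⟩
  have hI := hI.rot.rot
  have h1 := J.tri z hz
  rw [← J.eq _ (H.sub (hDK z hz)), ← J.eq _ (H.cor_mem (hDK z hz) _),
    ← J.eq _ (H.cor_mem (hDK z hz) _)] at h1
  have hyz (v : N) : InTri (P' (cor y.1 y.2)) (P' (cor y.1 (y.2 + 1))) (P' (ch y.1 y.2)) (P' v) ↔
      InTri (P' (cor z.1 z.2)) (P' (cor z.1 (z.2 + 1))) (P' (ch y.1 y.2)) (P' v) := by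
    rcases Sym2.eq_iff.1 hzy with ⟨h, h'⟩ | ⟨h, h'⟩ <;> rw [h, h']
    exact inTri_swap
  refine (hmin z ⟨hz, hzy.trans hyx⟩).not_gt (Set.ncard_lt_ncard ?_ (hT.sep _))
  refine ⟨fun v hv => ⟨hv.1, (hyz v).2 ?_⟩, fun h => ?_⟩
  · exact (hI.trans (h1.rot.trans hv.2.rot.rot).swap.rot.rot).swap
  · exact InTri.not_inTri_apex h1 (h ⟨hST (H.sub (hDK z hz)), (hyz z.1).2 hI.swap⟩).2

theorem exists_chainHyp (H : CentreHyp S K cor E P) (hch : ∀ p ∈ K, ∀ i, ch p i ∉ S)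
    (hinj : ∀ p ∈ K, ∀ q ∈ K, ∀ i j, ch p i = ch q j → p = q ∧ i = j) :
    ∃ D P', (∀ x ∈ D, x.1 ∈ K) ∧ Extends S K cor ch E P D P' ∧
      ChainHyp (withChains S ch D) K cor ch (chainAdj K cor ch E) P' := by
  set D : Set (N × ZMod 4) := {x | x.1 ∈ K ∧ ¬ E (cor x.1 x.2) (cor x.1 (x.2 + 1))} with hDdef
  have hD : D.Finite :=
    ((H.fin.subset H.sub).prod (Set.finite_univ (α := ZMod 4))).subset fun x hx => ⟨hx.1, trivial⟩
  have hDK : ∀ x ∈ D, x.1 ∈ K := fun x hx => hx.1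
  obtain ⟨P', J⟩ := H.exists_extends hch hinj hD hDK
  have hST : S ⊆ withChains S ch D := Set.subset_union_left
  have hmem {p : N} (hp : p ∈ K) (i : ZMod 4) : ch p i ∈ withChains S ch D ↔ (p, i) ∈ D := by
    refine ⟨?_, fun h => .inr ⟨_, h, rfl⟩⟩
    rintro (h | ⟨y, hy, h⟩)
    · exact (hch p hp i h).elim
    · obtain ⟨h1, h2⟩ := hinj p hp _ (hDK y hy) _ _ h
      rwa [h1, h2]
  have hpos {p : N} (hp : p ∈ K) (i : ZMod 4) :
      0 < cr (P' p) (P' (cor p i)) (P' (cor p (i + 1))) := by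
    rw [J.eq _ (H.sub hp), J.eq _ (H.cor_mem hp _), J.eq _ (H.cor_mem hp _)]
    exact H.pos hp i
  have htri {p : N} (hp : p ∈ K) (i : ZMod 4) (h : ch p i ∈ withChains S ch D) :
      InTri (P' p) (P' (cor p i)) (P' (cor p (i + 1))) (P' (ch p i)) := by
    rw [J.eq _ (H.sub hp), J.eq _ (H.cor_mem hp _), J.eq _ (H.cor_mem hp _)]
    exact J.tri _ ((hmem hp i).1 h)
  refine ⟨D, P', hDK, J, ?_⟩
  constructor
  case fin =>
    refine H.fin.union ((hD.image fun x => ch x.1 x.2).subset ?_)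
    rintro v ⟨x, hx, rfl⟩
    exact ⟨x, hx, rfl⟩
  case gp => exact J.gp
  case symm => exact fun h => H.adj_symm h
  case ne =>
    rintro a b (h | ⟨p, hp, i, rfl, h⟩ | ⟨p, hp, i, rfl, h⟩) rfl
    · exact H.ne h rfl
    all_goals
      rcases h with h | h | h
      · exact hch p hp i (by rw [h]; exact H.sub hp)
      · exact hch p hp i (by rw [h]; exact H.cor_mem hp _)
      · exact hch p hp i (by rw [h]; exact H.cor_mem hp _)
  case planar => exact fun ha hb hc he => J.planar ha hb hc he
  case sub => exact H.sub.trans hST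
  case cor_mem => exact fun hp i => hST (H.cor_mem hp i)
  case cor_nmem => exact H.cor_nmem
  case cor_inj => exact H.cor_inj
  case spoke => exact fun hp i => .inl (H.spoke hp i)
  case nbr => exact fun hp _ h => H.adj_center hch hp h
  case side =>
    intro p hp i h
    rw [hmem hp] at h
    by_contra h'
    exact h ⟨hp, fun h => h' (.inl h)⟩
  case pos => exact fun hp i _ => hpos hp i
  case ndiag =>
    exact fun hp i h => H.ndiag hp i (adj_mem (H.cor_mem hp _) (H.cor_mem hp _) hch h)
  case side_diag => exact H.side_diag
  case ch_nmem => exact fun hp i h => hch _ hp i (H.sub h)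
  case ch_cor => exact fun hp hq i j h => hch _ hp i (h ▸ H.cor_mem hq j)
  case ch_inj => exact fun hp hq _ _ h => hinj _ hp _ hq _ _ h
  case ch_mid => exact fun {p} hp i _ => .inr (.inl ⟨p, hp, i, rfl, .inl rfl⟩)
  case ch_left => exact fun {p} hp i _ => .inr (.inl ⟨p, hp, i, rfl, .inr (.inl rfl)⟩)
  case ch_right => exact fun {p} hp i _ => .inr (.inl ⟨p, hp, i, rfl, .inr (.inr rfl)⟩)
  case ch_nbr => exact fun hp i _ _ h => H.adj_ch hch hinj hp h
  case ch_nadj =>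
    intro p hp i h h'
    exact ((hmem hp i).1 h).2 (adj_mem (H.cor_mem hp _) (H.cor_mem hp _) hch h')
  case pos_left => exact fun hp i h => ((htri hp i h).pos (hpos hp i)).1
  case pos_right =>
    intro p hp i h
    rw [cr_rot (P' (cor p (i + 1)))]
    exact ((htri hp i h).pos (hpos hp i)).2.2
  case empty_left =>
    intro p v hp i h hv
    rw [J.eq _ (H.sub hp), J.eq _ (H.cor_mem hp _)]
    exact J.empty_left _ ((hmem hp i).1 h) v hv
  case empty_right =>
    intro p v hp i h hv
    rw [J.eq _ (H.sub hp), J.eq _ (H.cor_mem hp _)]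
    exact J.empty_right _ ((hmem hp i).1 h) v hv
  case primary =>
    intro p hp i h
    obtain ⟨y, hy, hyp, h'⟩ := J.exists_primary H hD hDK ((hmem hp i).1 h)
    refine ⟨y.1, hDK y hy, y.2, .inr ⟨y, hy, rfl⟩, hyp, fun r hr k hrk _ hk => ?_⟩
    refine iff_of_false (fun h => ?_) (h' (r, k) ((hmem hr k).1 hrk) hk)
    exact InTri.not_inTri_apex (htri hr k hrk) h.rot.rot.swap

end CentreHyp

end insertion

section insertion

lemma InTri.mul_pos {a b c v : ℝ × ℝ} (h : InTri a b c v) : 0 < cr a b v * cr a b c := by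
  have := cr_add a b c v
  rcases h with ⟨h1, h2, h3⟩ | ⟨h1, h2, h3⟩
  · exact _root_.mul_pos h1 (by linarith)
  · exact mul_pos_of_neg_of_neg h1 (by linarith)

lemma InTri.of_corners {a b c p u s n : ℝ × ℝ} (hp : InTri a b c p)
    (hu : InTri a b c u ∨ u = a ∨ u = b ∨ u = c) (hs : InTri a b c s ∨ s = a ∨ s = b ∨ s = c)
    (hn : InTri p u s n) : InTri a b c n := by
  wlog h : 0 < cr a b c generalizing a b
  · have h' : 0 < cr b a c := by
      rw [cr_swap]
      exact neg_pos.2 (lt_of_le_of_ne (not_lt.1 h) hp.cr_ne)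
    exact (this hp.swap (hu.imp InTri.swap (by tauto)) (hs.imp InTri.swap (by tauto)) h').swap
  wlog hD : 0 < cr p u s generalizing u s
  · refine this hn.rot.rot.swap hs hu ?_
    rw [cr_swap']
    exact neg_pos.2 (lt_of_le_of_ne (not_lt.1 hD) hn.cr_ne)
  have hcl {w : ℝ × ℝ} (hw : InTri a b c w ∨ w = a ∨ w = b ∨ w = c) :
      0 ≤ cr a b w ∧ 0 ≤ cr b c w ∧ 0 ≤ cr c a w := by
    have e1 : cr b c a = cr a b c := cr_rot _ _ _
    have e2 : cr c a b = cr a b c := by rw [cr_rot b c a, e1]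
    rcases hw with hw | rfl | rfl | rfl
    · obtain ⟨k1, k2, k3⟩ := hw.pos h
      exact ⟨k1.le, k2.le, k3.le⟩
    · simp [e1, h.le]
    · simp [e2, h.le]
    · simp [h.le]
  obtain ⟨p1, p2, p3⟩ := hp.pos h
  obtain ⟨u1, u2, u3⟩ := hcl hu
  obtain ⟨s1, s2, s3⟩ := hcl hs
  obtain ⟨n1, n2, n3⟩ := hn.pos hD
  have key {x y : ℝ × ℝ} (hp : 0 < cr x y p) (hu : 0 ≤ cr x y u) (hs : 0 ≤ cr x y s) :
      0 < cr x y n := by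
    refine pos_of_mul_pos_left (b := cr p u s) ?_ hD.le
    rw [cr_bary]
    positivity
  exact .inl ⟨key p1 u1 s1, key p2 u2 s2, key p3 u3 s3⟩

variable {N : Type*} {S K : Set N} {cor ch : N → ZMod 4 → N} {E : N → N → Prop}
  {A B C : N} {P : N → ℝ × ℝ}

theorem CentreHyp.exists_finDraw {Cx : N → N → N → N → Prop} (H : CentreHyp S K cor E P)
    {d : N} (hA : A ∈ S) (hB : B ∈ S) (hC : C ∈ S) (hd : d ∈ S) (hAB : E A B) (hBC : E B C)
    (hAd : E A d) (hdC : E d C) (hAC : ¬ E A C) (hne : A ≠ C) (hBd : B ≠ d)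
    (hAK : A ∉ K) (hBK : B ∉ K) (hCK : C ∉ K) (hdK : d ∉ K)
    (hch : ∀ p ∈ K, ∀ i, ch p i ∉ S)
    (hinj : ∀ p ∈ K, ∀ q ∈ K, ∀ i j, ch p i = ch q j → p = q ∧ i = j)
    (hBcor : ∀ p ∈ K, ∀ i, B ≠ cor p i) (hdcor : ∀ p ∈ K, ∀ i, d ≠ cor p i)
    (hdnbr : ∀ {v}, E d v → v = A ∨ v = C)
    (hBd' : cr (P A) (P C) (P B) * cr (P A) (P C) (P d) < 0)
    (inside : ∀ {v}, v ∈ S → v ≠ A → v ≠ B → v ≠ C → v ≠ d → InTri (P A) (P d) (P C) (P v))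
    (side_ne : ∀ p ∈ K, ∀ i, s(cor p i, cor p (i + 1)) ≠ s(A, C))
    (diag_nAC : ∀ p ∈ K, ∀ i, s(cor p i, cor p (i + 2)) ≠ s(A, C))
    (diag_ne : ∀ {p q}, p ∈ K → q ∈ K → p ≠ q → ∀ i j,
      ¬ (cor p i = cor q j ∧ cor p (i + 2) = cor q (j + 2)))
    (diag_cx : ∀ {p}, p ∈ K → ∀ i,
      Cx (cor p i) (cor p (i + 2)) (cor p (i + 1)) (cor p (i + 3)) ∧
      Cx (cor p i) (cor p (i + 2)) (cor p (i + 3)) (cor p (i + 1)))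
    (side_ncx : ∀ {p}, p ∈ K → ∀ i a b, ¬ Cx a b (cor p i) (cor p (i + 1))) :
    ∃ P', FinDraw ((S \ {d}) \ K)
      (fun a b => (E a b ∨ s(a, b) = s(A, C)) ∨ ∃ p ∈ K, ∃ i, a = cor p i ∧ b = cor p (i + 2))
      Cx A B C P' := by
  obtain ⟨D, P', hDK, J, H'⟩ := H.exists_chainHyp hch hinj
  have hST : S ⊆ withChains S ch D := Set.subset_union_left
  have hne' {v p : N} (hv : v ∈ S) (hp : p ∈ K) (i : ZMod 4) : v ≠ ch p i :=
    fun h => hch p hp i (h ▸ hv)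
  have hopp {v : ℝ × ℝ} (h : InTri (P A) (P d) (P C) v) : ¬ InTri (P A) (P C) (P B) v := by
    intro h'
    have k1 : 0 < cr (P A) (P C) v * cr (P A) (P C) (P B) := h'.mul_pos
    have k2 : 0 < cr (P A) (P C) v * cr (P A) (P C) (P d) := h.rot.rot.swap.mul_pos
    nlinarith [mul_pos k1 k2, mul_self_nonneg (cr (P A) (P C) v)]
  have hnbr' {v : N} (_ : v ∈ withChains S ch D) (h : chainAdj K cor ch E d v) :
      v = A ∨ v = C := by
    rcases h with h | ⟨p, hp, i, h, -⟩ | ⟨p, hp, i, -, h | h | h⟩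
    · exact hdnbr h
    · exact (hne' hd hp i h).elim
    · exact (hdK (h ▸ hp)).elim
    · exact (hdcor p hp i h).elim
    · exact (hdcor p hp _ h).elim
  have hins {v : N} (hv : v ∈ withChains S ch D) (hvA : v ≠ A) (hvB : v ≠ B) (hvC : v ≠ C)
      (hvd : v ≠ d) : InTri (P' A) (P' d) (P' C) (P' v) ∧ ¬ InTri (P' A) (P' C) (P' B) (P' v) := by
    rw [J.eq A hA, J.eq B hB, J.eq C hC, J.eq d hd]
    suffices InTri (P A) (P d) (P C) (P' v) from ⟨this, hopp this⟩
    rcases hv with hv | ⟨⟨p, i⟩, hx, rfl⟩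
    · rw [J.eq v hv]
      exact inside hv hvA hvB hvC hvd
    · have hp : p ∈ K := hDK _ hx
      have hn {q : N} (h : q ∉ K) : p ≠ q := fun h' => h (h' ▸ hp)
      have hc (j : ZMod 4) : InTri (P A) (P d) (P C) (P (cor p j)) ∨ P (cor p j) = P A ∨
          P (cor p j) = P d ∨ P (cor p j) = P C := by
        by_cases h1 : cor p j = A
        · exact .inr (.inl (by rw [h1]))
        by_cases h2 : cor p j = C
        · exact .inr (.inr (.inr (by rw [h2])))
        exact .inl (inside (H.cor_mem hp j) h1 (hBcor p hp j).symm h2 (hdcor p hp j).symm)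
      exact (inside (H.sub hp) (hn hAK) (hn hBK) (hn hCK) (hn hdK)).of_corners (hc _) (hc _)
        (J.tri _ hx)
  obtain ⟨Q, hQ⟩ := H'.exists_finDraw_of_flat (Cx := Cx) (d := d) (hST hA) (hST hB) (hST hC)
    (hST hd) (.inl hAB) (.inl hBC) (.inl hAd) (.inl hdC) (fun h => hAC (adj_mem hA hC hch h)) hne
    hBd hAK hBK hCK hdK (fun p hp i => ⟨hne' hA hp i, hne' hB hp i, hne' hC hp i, hne' hd hp i⟩)
    hdcor hnbr' hins side_ne diag_nAC diag_ne diag_cx side_ncx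
  refine ⟨Q, ?_⟩
  have hset : ((withChains S ch D \ {d}) \ K) \ {v | ∃ p ∈ K, ∃ i, v = ch p i} =
      (S \ {d}) \ K := by
    ext v
    simp only [withChains, Set.mem_sdiff, Set.mem_union, Set.mem_ofPred_eq,
      Set.mem_singleton_iff, not_exists, not_and]
    constructor
    · rintro ⟨⟨⟨h | ⟨x, hx, h⟩, h1⟩, h2⟩, h3⟩
      · exact ⟨⟨h, h1⟩, h2⟩
      · exact (h3 _ (hDK x hx) _ h).elim
    · rintro ⟨⟨h, h1⟩, h2⟩
      exact ⟨⟨⟨.inl h, h1⟩, h2⟩, fun p hp i => hne' h hp i⟩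
  rw [hset] at hQ
  refine hQ.congr fun ha hb h => ?_
  rcases h with (h | h) | h
  exacts [.inl (.inl (.inl h)), .inl (.inr h), .inr h]

end insertion

open Filter Topology

section perturbation

variable {N : Type*} {S : Set N} {P : N → ℝ × ℝ}

lemma continuous_cr {X : Type*} [TopologicalSpace X] {f g h : X → ℝ × ℝ} (hf : Continuous f)
    (hg : Continuous g) (hh : Continuous h) : Continuous fun x => cr (f x) (g x) (h x) := by
  unfold cr; fun_prop

lemma eventually_quadratic_ne {c₀ c₁ c₂ : ℝ} (h : c₂ ≠ 0) :
    ∀ᶠ ε in 𝓝[≠] (0 : ℝ), c₀ + ε * c₁ + ε ^ 2 * c₂ ≠ 0 := by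
  have key {f : ℝ → ℝ} (hf : Continuous f) (h0 : f 0 ≠ 0) : ∀ᶠ ε in 𝓝[≠] (0 : ℝ), f ε ≠ 0 :=
    (hf.continuousAt.eventually_ne h0).filter_mono nhdsWithin_le_nhds
  by_cases h0 : c₀ = 0
  · by_cases h1 : c₁ = 0
    · filter_upwards [self_mem_nhdsWithin] with ε hε
      have hε : ε ≠ 0 := hε
      simp [h0, h1, h, hε]
    · filter_upwards [self_mem_nhdsWithin, key (f := fun ε => c₁ + ε * c₂) (by fun_prop)
        (by simpa)] with ε hε h2
      have := mul_ne_zero hε h2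
      contrapose! this
      linear_combination this - h0
  · exact key (by fun_prop) (by simpa)

lemma exists_genPos_of_eventually (hS : S.Finite) {Φ : (N → ℝ × ℝ) → Prop}
    (h : ∀ᶠ P' in 𝓝 P, Φ P') : ∃ P', GenPos S P' ∧ Φ P' := by
  obtain ⟨t, ht⟩ : ∃ t : N → ℝ, Set.InjOn t S := by
    obtain ⟨f, hf⟩ := Set.countable_iff_exists_injOn.1 hS.countable
    exact ⟨fun v => f v, fun a ha b hb h => hf ha hb (Nat.cast_injective h)⟩
  let m : N → ℝ × ℝ := fun v => (t v, t v ^ 2)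
  have hm : ∀ᶠ ε in 𝓝[≠] (0 : ℝ), GenPos S fun v => P v + ε • m v := by
    refine (eventually_all_finite hS).2 fun a ha => (eventually_all_finite hS).2 fun b hb =>
      (eventually_all_finite hS).2 fun c hc => ?_
    simp only [eventually_imp_distrib_left]
    intro n1 n2 n3
    have h2 : (t b - t a) * (t c - t a) * (t c - t b) ≠ 0 :=
      mul_ne_zero (mul_ne_zero (sub_ne_zero.2 fun h => n1 (ht hb ha h).symm)
        (sub_ne_zero.2 fun h => n3 (ht hc ha h).symm)) (sub_ne_zero.2 fun h => n2 (ht hc hb h).symm)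
    filter_upwards [eventually_quadratic_ne (c₀ := cr (P a) (P b) (P c))
      (c₁ := ((P b).1 - (P a).1) * (t c ^ 2 - t a ^ 2) + (t b - t a) * ((P c).2 - (P a).2)
        - ((P b).2 - (P a).2) * (t c - t a) - (t b ^ 2 - t a ^ 2) * ((P c).1 - (P a).1)) h2]
      with ε hε
    convert hε using 1
    simp only [cr, m, Prod.fst_add, Prod.snd_add, Prod.smul_fst, Prod.smul_snd, smul_eq_mul]
    ring
  have hlim : Tendsto (fun ε : ℝ => fun v => P v + ε • m v) (𝓝[≠] 0) (𝓝 P) := by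
    refine Tendsto.mono_left ?_ nhdsWithin_le_nhds
    have : Continuous fun ε : ℝ => fun v => P v + ε • m v := by fun_prop
    simpa using this.tendsto 0
  obtain ⟨ε, h1, h2⟩ := (hm.and (hlim.eventually h)).exists
  exact ⟨_, h1, h2⟩

lemma eventually_not_crs {a b c e : N}
    (h : Disjoint (segment ℝ (P a) (P b)) (segment ℝ (P c) (P e))) :
    ∀ᶠ P' in 𝓝 P, ¬ Crs (P' a) (P' b) (P' c) (P' e) := by
  have hc : IsCompact (segment ℝ (P a) (P b)) := by
    rw [segment_eq_image_lineMap]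
    exact isCompact_Icc.image AffineMap.lineMap_continuous
  obtain ⟨f, u, v, h1, h2, h3⟩ := geometric_hahn_banach_compact_closed (convex_segment _ _) hc
    (convex_segment _ _) (isClosed_segment _ _) h
  have ev (w : N) : Tendsto (fun P' : N → ℝ × ℝ => f (P' w)) (𝓝 P) (𝓝 (f (P w))) :=
    (by fun_prop : Continuous fun P' : N → ℝ × ℝ => f (P' w)).tendsto P
  filter_upwards [(ev a).eventually_lt_const (h1 _ (left_mem_segment ℝ _ _)),
    (ev b).eventually_lt_const (h1 _ (right_mem_segment ℝ _ _)),
    (ev c).eventually_const_lt (h3 _ (left_mem_segment ℝ _ _)),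
    (ev e).eventually_const_lt (h3 _ (right_mem_segment ℝ _ _))] with P' k1 k2 k3 k4 hx
  obtain ⟨x, hx1, hx2⟩ := hx.exists_mem
  have g1 : f x < u := (convex_halfSpace_lt f.isLinear u).segment_subset k1 k2 hx1
  have g2 : v < f x := (convex_halfSpace_gt f.isLinear v).segment_subset k3 k4 hx2
  linarith

lemma eventually_cr_pos {a b c : N} (h : 0 < cr (P a) (P b) (P c)) :
    ∀ᶠ P' in 𝓝 P, 0 < cr (P' a) (P' b) (P' c) :=
  ((continuous_cr (by fun_prop) (by fun_prop) (by fun_prop) :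
    Continuous fun P' : N → ℝ × ℝ => cr (P' a) (P' b) (P' c)).tendsto P).eventually_const_lt h

lemma isOpen_inTri {X : Type*} [TopologicalSpace X] {f g h k : X → ℝ × ℝ} (hf : Continuous f)
    (hg : Continuous g) (hh : Continuous h) (hk : Continuous k) :
    IsOpen {x | InTri (f x) (g x) (h x) (k x)} := by
  have h1 := continuous_cr hf hg hk
  have h2 := continuous_cr hg hh hk
  have h3 := continuous_cr hh hf hk
  have h0 : Continuous fun _ : X => (0 : ℝ) := continuous_const
  have := (((isOpen_lt h0 h1).inter (isOpen_lt h0 h2)).inter (isOpen_lt h0 h3)).union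
    (((isOpen_lt h1 h0).inter (isOpen_lt h2 h0)).inter (isOpen_lt h3 h0))
  convert this using 1
  ext x
  simp only [InTri, Set.mem_setOf_eq, Set.mem_union, Set.mem_inter_iff]
  tauto

end perturbation

section triangles

variable {a b c e p q r v w x y z : ℝ × ℝ}

lemma isClosed_tri (a b c : ℝ × ℝ) : IsClosed (Tri a b c) := by
  have : Tri a b c = (fun t : Fin 3 → ℝ => t 0 • a + t 1 • b + t 2 • c) '' stdSimplex ℝ (Fin 3) := by
    ext x
    constructor
    · rintro ⟨α, β, γ, h1, h2, h3, h4, rfl⟩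
      refine ⟨![α, β, γ], ⟨fun i => by fin_cases i <;> simpa, by simpa [Fin.sum_univ_three]⟩, ?_⟩
      simp
    · rintro ⟨t, ⟨h1, h2⟩, rfl⟩
      exact ⟨t 0, t 1, t 2, h1 0, h1 1, h1 2, by rw [← h2, Fin.sum_univ_three], rfl⟩
  rw [this]
  exact ((isCompact_stdSimplex ℝ (Fin 3)).image (by fun_prop)).isClosed

lemma inTri_or_mem_side (h0 : cr a b c ≠ 0) (hv : v ∈ Tri a b c) :
    InTri a b c v ∨ v ∈ segment ℝ a b ∨ v ∈ segment ℝ b c ∨ v ∈ segment ℝ c a := by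
  obtain ⟨α, β, γ, h1, h2, h3, h4, rfl⟩ := hv
  rcases h1.eq_or_lt with rfl | h1
  · exact .inr (.inr (.inl ⟨β, γ, h2, h3, by linarith, by simp⟩))
  rcases h2.eq_or_lt with rfl | h2
  · exact .inr (.inr (.inr ⟨γ, α, h3, h1.le, by linarith, by simp [add_comm]⟩))
  rcases h3.eq_or_lt with rfl | h3
  · exact .inr (.inl ⟨α, β, h1.le, h2.le, by linarith, by simp⟩)
  have hα : α = 1 - β - γ := by linarith
  have e1 : cr a b (α • a + β • b + γ • c) = γ * cr a b c := by
    simp only [cr, hα, Prod.fst_add, Prod.snd_add, Prod.smul_fst, Prod.smul_snd, smul_eq_mul]; ring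
  have e2 : cr b c (α • a + β • b + γ • c) = α * cr a b c := by
    simp only [cr, hα, Prod.fst_add, Prod.snd_add, Prod.smul_fst, Prod.smul_snd, smul_eq_mul]; ring
  have e3 : cr c a (α • a + β • b + γ • c) = β * cr a b c := by
    simp only [cr, hα, Prod.fst_add, Prod.snd_add, Prod.smul_fst, Prod.smul_snd, smul_eq_mul]; ring
  left
  unfold InTri
  rw [e1, e2, e3]
  rcases lt_or_gt_of_ne h0 with h0 | h0
  · exact .inr ⟨mul_neg_of_pos_of_neg h3 h0, mul_neg_of_pos_of_neg h1 h0,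
      mul_neg_of_pos_of_neg h2 h0⟩
  · exact .inl ⟨mul_pos h3 h0, mul_pos h1 h0, mul_pos h2 h0⟩

lemma IsPreconnected.inTri {K : Set (ℝ × ℝ)} (hK : IsPreconnected K) (hr : r ∈ K)
    (h : InTri a b c r) (h1 : Disjoint K (segment ℝ a b)) (h2 : Disjoint K (segment ℝ b c))
    (h3 : Disjoint K (segment ℝ c a)) (hv : v ∈ K) : InTri a b c v := by
  have hopen : IsOpen {v | InTri a b c v} :=
    isOpen_inTri continuous_const continuous_const continuous_const continuous_id
  refine hK.subset_left_of_subset_union (u := {v | InTri a b c v}) (v := (Tri a b c)ᶜ) hopen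
    (isClosed_tri a b c).isOpen_compl ?_ ?_ ⟨r, hr, h⟩ hv
  · exact Set.disjoint_left.2 fun w hw hw' => hw' (InTri.mem_tri hw)
  · intro w hw
    by_cases hT : w ∈ Tri a b c
    · rcases inTri_or_mem_side h.cr_ne hT with h' | h' | h' | h'
      · exact .inl h'
      · exact (Set.disjoint_left.1 h1 hw h').elim
      · exact (Set.disjoint_left.1 h2 hw h').elim
      · exact (Set.disjoint_left.1 h3 hw h').elim
    · exact .inr hT

lemma InTri.exists_mem_side (h : InTri a b c r) (hv : ¬ InTri a b c v) :
    ∃ w ∈ segment ℝ r v, w ∈ segment ℝ a b ∨ w ∈ segment ℝ b c ∨ w ∈ segment ℝ c a := by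
  by_contra! hno
  exact hv ((convex_segment r v).isPreconnected.inTri (left_mem_segment ℝ r v) h
    (Set.disjoint_left.2 fun w hw => (hno w hw).1) (Set.disjoint_left.2 fun w hw => (hno w hw).2.1)
    (Set.disjoint_left.2 fun w hw => (hno w hw).2.2) (right_mem_segment ℝ r v))

lemma InTri.of_mem_segment (h : InTri a b c r) (hv : v ∈ Tri a b c) (hw : w ∈ segment ℝ r v)
    (hne : w ≠ v) : InTri a b c w := by
  obtain ⟨t, s, ht, hs, hts, rfl⟩ := hw
  have ht : 0 < t := by
    refine lt_of_le_of_ne ht fun h0 => hne ?_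
    rw [← h0, show s = 1 by linarith]; simp
  obtain ⟨α, β, γ, h1, h2, h3, h4, rfl⟩ := hv
  have hα : α = 1 - β - γ := by linarith
  have e1 : cr a b (α • a + β • b + γ • c) = γ * cr a b c := by
    simp only [cr, hα, Prod.fst_add, Prod.snd_add, Prod.smul_fst, Prod.smul_snd, smul_eq_mul]; ring
  have e2 : cr b c (α • a + β • b + γ • c) = α * cr a b c := by
    simp only [cr, hα, Prod.fst_add, Prod.snd_add, Prod.smul_fst, Prod.smul_snd, smul_eq_mul]; ring
  have e3 : cr c a (α • a + β • b + γ • c) = β * cr a b c := by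
    simp only [cr, hα, Prod.fst_add, Prod.snd_add, Prod.smul_fst, Prod.smul_snd, smul_eq_mul]; ring
  unfold InTri
  rw [cr_comb _ _ _ _ hts, cr_comb _ _ _ _ hts, cr_comb _ _ _ _ hts, e1, e2, e3]
  have hadd := cr_add a b c r
  rcases h with ⟨g1, g2, g3⟩ | ⟨g1, g2, g3⟩
  · have : 0 < cr a b c := by linarith
    left; constructorm* _ ∧ _ <;> positivity
  · have : 0 < - cr a b c := by linarith
    have g1 : 0 < - cr a b r := by linarith
    have g2 : 0 < - cr b c r := by linarith
    have g3 : 0 < - cr c a r := by linarith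
    right
    refine ⟨?_, ?_, ?_⟩ <;> rw [← neg_pos]
    · have : 0 < t * -cr a b r + s * (γ * -cr a b c) := by positivity
      linarith
    · have : 0 < t * -cr b c r + s * (α * -cr a b c) := by positivity
      linarith
    · have : 0 < t * -cr c a r + s * (β * -cr a b c) := by positivity
      linarith

end triangles

open Filter Topology

section triangles

variable {a b c e p q r v w x y z : ℝ × ℝ}

lemma eq_lineMap_of_cr (hab : a ≠ b) (h : cr a b c = 0) : ∃ t : ℝ, c = a + t • (b - a) := by
  unfold cr at h
  by_cases h1 : b.1 - a.1 = 0
  · have h2 : b.2 - a.2 ≠ 0 := fun h2 => hab (Prod.ext (by linarith) (by linarith))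
    refine ⟨(c.2 - a.2) / (b.2 - a.2), Prod.ext ?_ ?_⟩
    · have : (b.2 - a.2) * (c.1 - a.1) = 0 := by rw [h1] at h; linarith
      have := (mul_eq_zero.1 this).resolve_left h2
      simp [h1]; linarith
    · simp; field_simp; ring
  · refine ⟨(c.1 - a.1) / (b.1 - a.1), Prod.ext ?_ ?_⟩
    · simp; field_simp; ring
    · simp; field_simp; linarith

lemma mem_segment_of_param {a d : ℝ × ℝ} {s t u : ℝ} (h1 : s ≤ t) (h2 : t ≤ u) :
    a + t • d ∈ segment ℝ (a + s • d) (a + u • d) := by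
  have : t ∈ segment ℝ s u := by rw [segment_eq_Icc (h1.trans h2)]; exact ⟨h1, h2⟩
  obtain ⟨α, β, hα, hβ, h, rfl⟩ := this
  refine ⟨α, β, hα, hβ, h, ?_⟩
  rw [show α = 1 - β by linarith]
  simp only [smul_eq_mul]
  module

private lemma cr_ne_zero_of_meet (hc : c ∉ segment ℝ a b) (he : e ∉ segment ℝ a b)
    (ha : a ∉ segment ℝ c e) (hb : b ∉ segment ℝ c e) (h1 : x ∈ segment ℝ a b)
    (h2 : x ∈ segment ℝ c e) : cr a b c ≠ 0 := by
  intro h0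
  have hab : a ≠ b := by
    rintro rfl
    rw [segment_same] at h1
    exact ha (h1 ▸ h2)
  have h := cr_eq_zero_of_mem_segment h1
  obtain ⟨t, s, ht, hs, hts, rfl⟩ := h2
  rw [cr_comb _ _ _ _ hts, h0] at h
  have hs0 : s ≠ 0 := by
    rintro rfl
    apply hc
    convert h1 using 1
    rw [show t = 1 by linarith]; simp
  have he0 : cr a b e = 0 := by simpa [hs0] using h
  obtain ⟨γ, hγ⟩ := eq_lineMap_of_cr hab h0
  obtain ⟨η, hη⟩ := eq_lineMap_of_cr hab he0
  have ea : a = a + (0 : ℝ) • (b - a) := by simp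
  have eb : b = a + (1 : ℝ) • (b - a) := by simp
  have out {u : ℝ} (hu : a + u • (b - a) ∉ segment ℝ a b) : u < 0 ∨ 1 < u := by
    by_contra! hcon
    apply hu
    have := mem_segment_of_param (a := a) (d := b - a) hcon.1 hcon.2
    rwa [← ea, ← eb] at this
  have hc' := out (hγ ▸ hc)
  have he' := out (hη ▸ he)
  have hx : t • c + s • e = a + (t * γ + s * η) • (b - a) := by
    conv_lhs => rw [hγ, hη]
    rw [show t = 1 - s by linarith]; module
  have hin : 0 ≤ t * γ + s * η ∧ t * γ + s * η ≤ 1 := by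
    rw [hx, segment_eq_image'] at h1
    obtain ⟨θ, hθ, hθ'⟩ := h1
    have : (θ - (t * γ + s * η)) • (b - a) = 0 := by
      rw [sub_smul]; exact sub_eq_zero.2 (add_left_cancel hθ')
    rcases smul_eq_zero.1 this with h | h
    · rw [← sub_eq_zero.1 h]; exact hθ
    · exact (hab (sub_eq_zero.1 h).symm).elim
  rcases hc' with hc' | hc' <;> rcases he' with he' | he'
  · nlinarith [mul_nonneg ht (neg_nonneg.2 hc'.le), mul_nonneg hs (neg_nonneg.2 he'.le),
      mul_pos (lt_of_le_of_ne hs hs0.symm) (neg_pos.2 he')]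
  · apply ha
    have := mem_segment_of_param (a := a) (d := b - a) hc'.le (by linarith : (0 : ℝ) ≤ η)
    rwa [← ea, ← hγ, ← hη] at this
  · apply ha
    have := mem_segment_of_param (a := a) (d := b - a) he'.le (by linarith : (0 : ℝ) ≤ γ)
    rwa [← ea, ← hγ, ← hη, segment_symm] at this
  · nlinarith [mul_nonneg ht (sub_nonneg.2 hc'.le), mul_pos (lt_of_le_of_ne hs hs0.symm)
      (sub_pos.2 he')]

lemma crs_of_meet (hc : c ∉ segment ℝ a b) (he : e ∉ segment ℝ a b)
    (ha : a ∉ segment ℝ c e) (hb : b ∉ segment ℝ c e) (h1 : x ∈ segment ℝ a b)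
    (h2 : x ∈ segment ℝ c e) : Crs a b c e := by
  refine crs_of_mem_segment h1 h2 (cr_ne_zero_of_meet hc he ha hb h1 h2)
    (cr_ne_zero_of_meet he hc ?_ ?_ h1 ?_) (cr_ne_zero_of_meet ha hb hc he h2 h1)
    (cr_ne_zero_of_meet hb ha ?_ ?_ h2 ?_) <;> rwa [segment_symm]

lemma Crs.eq_of_mem (h : Crs a b c e) (hx : x ∈ segment ℝ a b) (hx' : x ∈ segment ℝ c e)
    (hy : y ∈ segment ℝ a b) (hy' : y ∈ segment ℝ c e) : x = y := by
  have h1 := cr_eq_zero_of_mem_segment hx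
  have h2 := cr_eq_zero_of_mem_segment hy
  obtain ⟨t, s, -, -, hts, rfl⟩ := hx'
  obtain ⟨t', s', -, -, hts', rfl⟩ := hy'
  rw [cr_comb _ _ _ _ hts, show t = 1 - s by linarith] at h1
  rw [cr_comb _ _ _ _ hts', show t' = 1 - s' by linarith] at h2
  have hne : cr a b e - cr a b c ≠ 0 := by
    intro h0
    have := h.1
    rw [show cr a b e = cr a b c by linarith] at this
    nlinarith [mul_self_nonneg (cr a b c)]
  have : s = s' := mul_right_cancel₀ hne (by linarith)
  rw [show t = t' by linarith, this]

lemma inTri_of_meet (hp : 0 < cr a c x * cr a c p)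
    (hq : q ∈ segment ℝ x y) (hq' : q ∈ openSegment ℝ a c)
    (h1 : Disjoint (segment ℝ x y) (segment ℝ a p))
    (h2 : Disjoint (segment ℝ x y) (segment ℝ p c)) : InTri a p c x := by
  have hcq : cr a c q = 0 := cr_eq_zero_of_mem_segment (openSegment_subset_segment _ _ _ hq')
  have hp0 : cr a c p ≠ 0 := fun h0 => by simp [h0] at hp
  have hside {ε : ℝ} (hε : 0 < ε) : 0 < cr a c (q + ε • (x - q)) * cr a c p := by
    have : cr a c (q + ε • (x - q)) = ε * cr a c x := by
      have : q + ε • (x - q) = (1 - ε) • q + ε • x := by module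
      rw [this, cr_comb _ _ _ _ (by ring), hcq]; ring
    rw [this, mul_assoc]; exact mul_pos hε hp
  have hev : ∀ᶠ ε in 𝓝[>] (0 : ℝ), InTri a p c (q + ε • (x - q)) := by
    obtain ⟨t, s, ht, hs, hts, hqe⟩ := hq'
    have e1 : cr a p q = - s * cr a c p := by
      rw [← hqe, cr_comb _ _ _ _ hts, cr_self_outer, cr_swap' a c p]; ring
    have e2 : cr p c q = - t * cr a c p := by
      rw [← hqe, cr_comb _ _ _ _ hts, cr_self_right, cr_rot, ← cr_rot, ← cr_rot a c p, cr_swap c p a]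
      ring
    have lim (u v : ℝ × ℝ) : Tendsto (fun ε : ℝ => cr u v (q + ε • (x - q)) * cr a c p) (𝓝[>] 0)
        (𝓝 (cr u v q * cr a c p)) := by
      have : Continuous fun ε : ℝ => cr u v (q + ε • (x - q)) :=
        continuous_cr continuous_const continuous_const (by fun_prop)
      refine Tendsto.mul_const _ (Tendsto.mono_left ?_ nhdsWithin_le_nhds)
      simpa using this.tendsto 0
    have hsq : 0 < cr a c p * cr a c p := mul_self_pos.2 hp0
    filter_upwards [self_mem_nhdsWithin, (lim a p).eventually_lt_const (u := 0) (by rw [e1]; nlinarith),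
      (lim p c).eventually_lt_const (u := 0) (by rw [e2]; nlinarith)] with ε k0 k1 k2
    have k3 := hside k0
    rw [← neg_neg (cr a c (q + _)), ← cr_swap] at k3
    rcases lt_or_gt_of_ne hp0 with h0 | h0
    · exact .inl ⟨pos_of_mul_neg_left k1 h0.le, pos_of_mul_neg_left k2 h0.le,
        by nlinarith⟩
    · refine .inr ⟨?_, ?_, by nlinarith⟩
      · exact neg_of_mul_neg_left k1 h0.le
      · exact neg_of_mul_neg_left k2 h0.le
  obtain ⟨ε, hin, hε1, hε0⟩ := (hev.and ((eventually_lt_nhds (zero_lt_one' ℝ)).filter_mono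
    nhdsWithin_le_nhds |>.and self_mem_nhdsWithin)).exists
  have hε0 : 0 < ε := hε0
  have hsub : segment ℝ (q + ε • (x - q)) x ⊆ segment ℝ x y := by
    refine (convex_segment x y).segment_subset ?_ (left_mem_segment ℝ x y)
    exact (convex_segment x y).segment_subset hq (left_mem_segment ℝ x y)
      ⟨1 - ε, ε, by linarith, hε0.le, by ring, by module⟩
  refine (convex_segment _ x).isPreconnected.inTri (left_mem_segment ℝ _ x) hin
    (h1.mono_left hsub) (h2.mono_left hsub) ?_ (right_mem_segment ℝ _ x)
  rw [Set.disjoint_left]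
  intro w hw hw'
  have h0 : cr a c w = 0 := by rw [segment_symm] at hw'; exact cr_eq_zero_of_mem_segment hw'
  obtain ⟨t, s, ht, hs, hts, rfl⟩ := hw
  rw [cr_comb _ _ _ _ hts] at h0
  have k := hside hε0
  have : t * (cr a c (q + ε • (x - q)) * cr a c p) + s * (cr a c x * cr a c p) = 0 := by
    linear_combination cr a c p * h0
  rcases ht.eq_or_lt with rfl | ht
  · have : s = 1 := by linarith
    subst this
    linarith
  · have := mul_pos ht k
    have := mul_nonneg hs hp.le
    linarith

end triangles

open Filter Topology

section layouts

variable {V : Type*} {G : SimpleGraph V} {P : V → ℝ × ℝ} {a b c d e f g u v w x y z : V}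
  {p q r : ℝ × ℝ}

/-- The straight-line drawings of the edges `a b` and `c e` cross properly. -/
def Meet (G : SimpleGraph V) (P : V → ℝ × ℝ) (a b c e : V) : Prop :=
  G.Adj a b ∧ G.Adj c e ∧ Crs (P a) (P b) (P c) (P e)

lemma Meet.symm (h : Meet G P a b c e) : Meet G P c e a b := ⟨h.2.1, h.1, h.2.2.symm⟩
lemma Meet.swap_left (h : Meet G P a b c e) : Meet G P b a c e := ⟨h.1.symm, h.2.1, h.2.2.swap_left⟩
lemma Meet.swap_right (h : Meet G P a b c e) : Meet G P a b e c := h.symm.swap_left.symm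

lemma Meet.ne (h : Meet G P a b c e) : a ≠ c ∧ a ≠ e ∧ b ≠ c ∧ b ≠ e :=
  (Crs.ne_of h.2.2).2.2

lemma Meet.congr_right (h : Meet G P a b c e) (hs : s(u, v) = s(c, e)) : Meet G P a b u v := by
  rcases Sym2.eq_iff.1 hs with ⟨rfl, rfl⟩ | ⟨rfl, rfl⟩
  exacts [h, h.swap_right]

lemma Meet.congr_left (h : Meet G P a b c e) (hs : s(u, v) = s(a, b)) : Meet G P u v c e :=
  (h.symm.congr_right hs).symm

/-- A straight-line drawing in which every edge is crossed at most once. -/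
structure Layout (G : SimpleGraph V) (P : V → ℝ × ℝ) : Prop where
  inj : Function.Injective P
  avoid : ∀ {a b v}, G.Adj a b → v ≠ a → v ≠ b → P v ∉ segment ℝ (P a) (P b)
  one : ∀ {a b c e c' e'}, Meet G P a b c e → Meet G P a b c' e' → s(c, e) = s(c', e')

lemma eq_of_mem_segment_mem_segment {a x y : ℝ × ℝ} (h1 : x ∈ segment ℝ a y)
    (h2 : y ∈ segment ℝ a x) : x = y := by
  have e1 := dist_add_dist_of_mem_segment h1
  have e2 := dist_add_dist_of_mem_segment h2
  rw [dist_comm y x] at e2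
  exact dist_eq_zero.1 (by linarith [dist_nonneg (x := x) (y := y)])

namespace Layout

lemma meet_of_mem (H : Layout G P) (h1 : G.Adj a b) (h2 : G.Adj c e) (n1 : a ≠ c) (n2 : a ≠ e)
    (n3 : b ≠ c) (n4 : b ≠ e) (hp : p ∈ segment ℝ (P a) (P b)) (hp' : p ∈ segment ℝ (P c) (P e)) :
    Meet G P a b c e :=
  ⟨h1, h2, crs_of_meet (H.avoid h1 n1.symm n3.symm) (H.avoid h1 n2.symm n4.symm)
    (H.avoid h2 n1 n2) (H.avoid h2 n3 n4) hp hp'⟩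

lemma eq_of_share (H : Layout G P) (h1 : G.Adj w a) (h2 : G.Adj w b) (hab : a ≠ b)
    (hr : r ∈ segment ℝ (P w) (P a)) (hr' : r ∈ segment ℝ (P w) (P b)) : r = P w :=
  eq_of_mem_segments (H.avoid h2 h1.ne' hab) (H.avoid h1 h2.ne' hab.symm) hr hr'

lemma meet_or_share (H : Layout G P) (h1 : G.Adj a b) (h2 : G.Adj c e) (hne : s(a, b) ≠ s(c, e))
    (hp : p ∈ segment ℝ (P a) (P b)) (hp' : p ∈ segment ℝ (P c) (P e)) :
    Meet G P a b c e ∨ ∃ v, (v = a ∨ v = b) ∧ (v = c ∨ v = e) ∧ p = P v := by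
  by_cases n1 : a = c
  · subst n1
    exact .inr ⟨a, .inl rfl, .inl rfl, H.eq_of_share h1 h2 (by rintro rfl; simp at hne) hp hp'⟩
  by_cases n2 : a = e
  · subst n2
    rw [segment_symm] at hp'
    exact .inr ⟨a, .inl rfl, .inr rfl,
      H.eq_of_share h1 h2.symm (by rintro rfl; simp [Sym2.eq_swap] at hne) hp hp'⟩
  by_cases n3 : b = c
  · subst n3
    rw [segment_symm] at hp
    exact .inr ⟨b, .inr rfl, .inl rfl,
      H.eq_of_share h1.symm h2 (by rintro rfl; simp [Sym2.eq_swap] at hne) hp hp'⟩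
  by_cases n4 : b = e
  · subst n4
    rw [segment_symm] at hp hp'
    exact .inr ⟨b, .inr rfl, .inr rfl,
      H.eq_of_share h1.symm h2.symm (by rintro rfl; simp at hne) hp hp'⟩
  exact .inl (H.meet_of_mem h1 h2 n1 n2 n3 n4 hp hp')

lemma eq_of_mem_half (H : Layout G P) (hm : Meet G P a b c d) (hp : p ∈ segment ℝ (P a) (P b))
    (hp' : p ∈ segment ℝ (P c) (P d)) (hwz : G.Adj w z) (h1 : s(w, z) ≠ s(a, b))
    (h2 : s(w, z) ≠ s(c, d)) (hr : r ∈ segment ℝ (P w) (P z)) (hr' : r ∈ segment ℝ (P a) p) :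
    r = P a := by
  have hsub := (convex_segment (P a) (P b)).segment_subset (left_mem_segment ℝ _ _) hp
  rcases H.meet_or_share hwz hm.1 h1 hr (hsub hr') with h | ⟨v, -, rfl | rfl, rfl⟩
  · exact (h2 (H.one h.symm hm)).elim
  · rfl
  · have := eq_of_mem_segment_mem_segment hr' hp
    rw [← this] at hp'
    exact (H.avoid hm.2.1 hm.ne.2.2.1 hm.ne.2.2.2 hp').elim

end Layout

/-- The edges `a b` and `c d` cross in `p`, and the edge `a c` is crossed by an edge from a vertex `x`
inside the triangle `a p c`. -/
structure Pocket (G : SimpleGraph V) (P : V → ℝ × ℝ) (a b c d x y : V) (p : ℝ × ℝ) : Prop where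
  layout : Layout G P
  meet : Meet G P a b c d
  mem_left : p ∈ segment ℝ (P a) (P b)
  mem_right : p ∈ segment ℝ (P c) (P d)
  side : Meet G P a c x y
  inside : InTri (P a) p (P c) (P x)

lemma Layout.exists_pocket (H : Layout G P) (h : Meet G P a b c d) (h' : Meet G P a c x y) :
    ∃ p, Pocket G P a b c d x y p ∨ Pocket G P a b c d y x p := by
  obtain ⟨p, hp, hp'⟩ := h.2.2.exists_mem
  obtain ⟨q, hq, hq'⟩ := h'.2.2.exists_mem
  have hqo : q ∈ openSegment ℝ (P a) (P c) := by
    refine mem_openSegment_of_ne_left_right ?_ ?_ hq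
    · rintro rfl; exact H.avoid h'.2.1 h'.ne.1 h'.ne.2.1 hq'
    · rintro rfl; exact H.avoid h'.2.1 h'.ne.2.2.1 h'.ne.2.2.2 hq'
  have n1 : s(x, y) ≠ s(a, b) := by
    intro h0
    rcases Sym2.eq_iff.1 h0 with ⟨h0, -⟩ | ⟨-, h0⟩
    exacts [h'.ne.1 h0.symm, h'.ne.2.1 h0.symm]
  have n2 : s(x, y) ≠ s(c, d) := by
    intro h0
    rcases Sym2.eq_iff.1 h0 with ⟨h0, -⟩ | ⟨-, h0⟩
    exacts [h'.ne.2.2.1 h0.symm, h'.ne.2.2.2 h0.symm]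
  have d1 : Disjoint (segment ℝ (P x) (P y)) (segment ℝ (P a) p) := by
    refine Set.disjoint_left.2 fun r hr hr' => ?_
    rw [H.eq_of_mem_half h hp hp' h'.2.1 n1 n2 hr hr'] at hr
    exact H.avoid h'.2.1 h'.ne.1 h'.ne.2.1 hr
  have d2 : Disjoint (segment ℝ (P x) (P y)) (segment ℝ p (P c)) := by
    refine Set.disjoint_left.2 fun r hr hr' => ?_
    rw [segment_symm] at hr'
    rw [H.eq_of_mem_half h.symm hp' hp h'.2.1 n2 n1 hr hr'] at hr
    exact H.avoid h'.2.1 h'.ne.2.2.1 h'.ne.2.2.2 hr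
  have hp0 : cr (P a) (P c) p ≠ 0 := by
    intro h0
    obtain ⟨t, s, ht, hs, hts, rfl⟩ := hp
    rw [cr_comb _ _ _ _ hts, cr_self_outer, mul_zero, zero_add] at h0
    have k : cr (P a) (P c) (P b) ≠ 0 := by
      intro k
      have := h.2.2.1
      rw [cr_swap', k] at this
      simp at this
    have : s = 0 := (mul_eq_zero.1 h0).resolve_right k
    subst this
    rw [show t = 1 by linarith] at hp'
    simp only [one_smul, zero_smul, add_zero] at hp'
    exact H.avoid h.2.1 h.ne.1 h.ne.2.1 hp'
  have hxy := h'.2.2.1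
  refine ⟨p, ?_⟩
  rcases lt_or_gt_of_ne (mul_ne_zero (left_ne_zero_of_mul hxy.ne) hp0) with hx | hx
  · right
    have hy : 0 < cr (P a) (P c) (P y) * cr (P a) (P c) p := by
      have := mul_pos_of_neg_of_neg hxy hx
      have h2 : 0 < (cr (P a) (P c) (P x)) ^ 2 := by
        have := left_ne_zero_of_mul hxy.ne; positivity
      by_contra! hcon
      nlinarith
    rw [segment_symm] at d1 d2 hq'
    exact ⟨H, h, hp, hp', h'.swap_right, inTri_of_meet hy hq' hqo d1 d2⟩
  · exact .inl ⟨H, h, hp, hp', h', inTri_of_meet hx hq' hqo d1 d2⟩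

namespace Pocket

/-- The vertices inside the triangle of a pocket. -/
def inner (P : V → ℝ × ℝ) (a c : V) (p : ℝ × ℝ) : Set V := {v | InTri (P a) p (P c) (P v)}

/-- The vertices inside the triangle of a pocket together with the two ends of its base. -/
def piece (P : V → ℝ × ℝ) (a c : V) (p : ℝ × ℝ) : Set V := {v | v ∈ inner P a c p ∨ v = a ∨ v = c}

lemma symm (H : Pocket G P a b c d x y p) : Pocket G P c d a b x y p where
  layout := H.layout
  meet := H.meet.symm
  mem_left := H.mem_right
  mem_right := H.mem_left
  side := H.side.swap_left
  inside := H.inside.rot.swap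

lemma not_inner_left (H : Pocket G P a b c d x y p) : a ∉ inner P a c p := fun h => by
  simpa [inner, InTri] using h

lemma not_inner_left' (H : Pocket G P a b c d x y p) : b ∉ inner P a c p := fun h => by
  have h0 : cr (P a) p (P b) = 0 := by rw [cr_swap', cr_eq_zero_of_mem_segment H.mem_left, neg_zero]
  rcases h with ⟨h, -, -⟩ | ⟨h, -, -⟩ <;> exact h.ne (by rw [h0])

lemma inner_symm : inner P c a p = inner P a c p :=
  Set.ext fun _ => ⟨fun h => InTri.swap (InTri.rot h), fun h => InTri.swap (InTri.rot h)⟩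

lemma not_inner_right (H : Pocket G P a b c d x y p) : c ∉ inner P a c p := by
  rw [← inner_symm]; exact H.symm.not_inner_left

lemma not_inner_right' (H : Pocket G P a b c d x y p) : d ∉ inner P a c p := by
  rw [← inner_symm]; exact H.symm.not_inner_left'

lemma not_inner_far (H : Pocket G P a b c d x y p) : y ∉ inner P a c p := fun h => by
  have h1 := InTri.mul_pos H.inside.rot.rot
  have h2 := InTri.mul_pos (InTri.rot (InTri.rot h))
  have h3 := H.side.2.2.1
  rw [cr_swap (P c) (P a), cr_swap (P c) (P a)] at h3
  nlinarith [mul_pos h1 h2, mul_self_nonneg (cr (P c) (P a) p)]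

lemma edge_ne_of_inner (H : Pocket G P a b c d x y p) (hv : v ∈ inner P a c p) :
    s(v, w) ≠ s(a, b) ∧ s(v, w) ≠ s(c, d) := by
  constructor <;> intro h <;> rcases Sym2.eq_iff.1 h with ⟨rfl, -⟩ | ⟨rfl, -⟩
  exacts [H.not_inner_left hv, H.not_inner_left' hv, H.not_inner_right hv, H.not_inner_right' hv]

lemma exists_exit (H : Pocket G P a b c d x y p) (hwz : G.Adj w z) (h1 : s(w, z) ≠ s(a, b))
    (h2 : s(w, z) ≠ s(c, d)) (hr : r ∈ segment ℝ (P w) (P z)) (hin : InTri (P a) p (P c) r)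
    (hz : z ∉ inner P a c p) : ∃ r' ∈ segment ℝ r (P z), r' ∈ segment ℝ (P a) (P c) := by
  have hsub : segment ℝ r (P z) ⊆ segment ℝ (P w) (P z) :=
    (convex_segment _ _).segment_subset hr (right_mem_segment ℝ _ _)
  obtain ⟨r', hr', h | h | h⟩ := hin.exists_mem_side hz
  · refine ⟨r', hr', ?_⟩
    rw [H.layout.eq_of_mem_half H.meet H.mem_left H.mem_right hwz h1 h2 (hsub hr') h]
    exact left_mem_segment ℝ _ _
  · refine ⟨r', hr', ?_⟩
    rw [segment_symm] at h
    rw [H.layout.eq_of_mem_half H.meet.symm H.mem_right H.mem_left hwz h2 h1 (hsub hr') h]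
    exact right_mem_segment ℝ _ _
  · exact ⟨r', hr', by rwa [segment_symm]⟩

lemma inner_or_inner (H : Pocket G P a b c d x y p) (hwz : G.Adj w z) (h1 : s(w, z) ≠ s(a, b))
    (h2 : s(w, z) ≠ s(c, d)) (hr : r ∈ segment ℝ (P w) (P z)) (hin : InTri (P a) p (P c) r) :
    w ∈ inner P a c p ∨ z ∈ inner P a c p := by
  by_contra! hno
  obtain ⟨s, hs, hs'⟩ := H.exists_exit hwz h1 h2 hr hin hno.2
  rw [segment_symm] at hr
  rw [Sym2.eq_swap] at h1 h2
  obtain ⟨t, ht, ht'⟩ := H.exists_exit hwz.symm h1 h2 hr hin hno.1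
  have hrac : r ∈ segment ℝ (P a) (P c) := by
    refine (convex_segment (P a) (P c)).segment_subset ht' hs' ?_
    rw [segment_symm] at hr
    obtain ⟨α, hα, rfl⟩ := (segment_eq_image' ℝ (P w) (P z)).subset hr
    obtain ⟨β, hβ, rfl⟩ := (segment_eq_image' ℝ _ _).subset hs
    obtain ⟨γ, hγ, rfl⟩ := (segment_eq_image' ℝ _ _).subset ht
    simp only
    have e (x y : ℝ) (hxy : y = x) : P w + y • (P z - P w) = P w + x • (P z - P w) := by rw [hxy]
    have := mem_segment_of_param (a := P w) (d := P z - P w) (s := α - γ * α) (t := α)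
      (u := α + β * (1 - α)) (by nlinarith [hα.1, hγ.1, mul_nonneg hγ.1 hα.1])
      (by nlinarith [hα.2, mul_nonneg hβ.1 (sub_nonneg.2 hα.2)])
    convert this using 1
    congr 1 <;> module
  have h0 : cr (P c) (P a) r = 0 := by
    rw [segment_symm] at hrac; exact cr_eq_zero_of_mem_segment hrac
  rcases hin with ⟨-, -, h⟩ | ⟨-, -, h⟩ <;> exact h.ne (by rw [h0])

lemma nbr (H : Pocket G P a b c d x y p) (hv : v ∈ inner P a c p) (hvw : G.Adj v w) :
    w ∈ piece P a c p ∨ s(v, w) = s(x, y) := by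
  by_cases hw : w ∈ inner P a c p
  · exact .inl (.inl hw)
  by_cases hwa : w = a
  · exact .inl (.inr (.inl hwa))
  by_cases hwc : w = c
  · exact .inl (.inr (.inr hwc))
  obtain ⟨h1, h2⟩ := H.edge_ne_of_inner hv (w := w)
  obtain ⟨r, hr, hr'⟩ := H.exists_exit hvw h1 h2 (left_mem_segment ℝ _ _) hv hw
  refine .inr (H.layout.one (H.layout.meet_of_mem H.side.1 hvw ?_ (Ne.symm hwa) ?_ (Ne.symm hwc)
    hr' hr) H.side)
  · rintro rfl; exact H.not_inner_left hv
  · rintro rfl; exact H.not_inner_right hv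

lemma mem_tri_of_piece (H : Pocket G P a b c d x y p) (hv : v ∈ piece P a c p) :
    P v ∈ Tri (P a) p (P c) := by
  rcases hv with hv | rfl | rfl
  exacts [InTri.mem_tri hv, left_mem_tri _ _ _, right_mem_tri _ _ _]

lemma not_piece_far (H : Pocket G P a b c d x y p) : y ∉ piece P a c p := by
  rintro (h | rfl | rfl)
  exacts [H.not_inner_far h, H.side.ne.2.1 rfl, H.side.ne.2.2.2 rfl]

lemma inTri_of_meet (H : Pocket G P a b c d x y p) (hm : Meet G P u v w z)
    (hu : u ∈ inner P a c p) (hv : v ∈ piece P a c p) (hr : r ∈ segment ℝ (P u) (P v))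
    (hr' : r ∈ segment ℝ (P w) (P z)) : InTri (P a) p (P c) r := by
  refine InTri.of_mem_segment hu (H.mem_tri_of_piece hv) hr ?_
  rintro rfl
  exact H.layout.avoid hm.2.1 hm.ne.2.2.1 hm.ne.2.2.2 hr'

private lemma mem_piece_of_mem (H : Pocket G P a b c d x y p) (hm : Meet G P u v w z)
    (hu : u ∈ inner P a c p) (hw : w ∈ inner P a c p) : z ∈ piece P a c p := by
  refine (H.nbr hw hm.2.1).resolve_right fun h => ?_
  have := H.layout.one (hm.symm.congr_left h.symm) H.side.symm
  rcases Sym2.eq_iff.1 this with ⟨rfl, -⟩ | ⟨rfl, -⟩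
  exacts [H.not_inner_left hu, H.not_inner_right hu]

lemma mem_of_meet (H : Pocket G P a b c d x y p) (hm : Meet G P u v w z)
    (hu : u ∈ inner P a c p) (hv : v ∈ piece P a c p) :
    w ∈ piece P a c p ∧ z ∈ piece P a c p ∧ (w ∈ inner P a c p ∨ z ∈ inner P a c p) := by
  obtain ⟨r, hr, hr'⟩ := hm.2.2.exists_mem
  have hin := H.inTri_of_meet hm hu hv hr hr'
  obtain ⟨e1, e2⟩ := H.edge_ne_of_inner hu (w := v)
  have h1 : s(w, z) ≠ s(a, b) := fun h =>
    e2 (H.layout.one (hm.symm.congr_left h.symm) H.meet)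
  have h2 : s(w, z) ≠ s(c, d) := fun h =>
    e1 (H.layout.one (hm.symm.congr_left h.symm) H.meet.symm)
  rcases H.inner_or_inner hm.2.1 h1 h2 hr' hin with h | h
  · exact ⟨.inl h, H.mem_piece_of_mem hm hu h, .inl h⟩
  · exact ⟨H.mem_piece_of_mem hm.swap_right hu h, .inl h, .inr h⟩

lemma inner_of_meet (H : Pocket G P a b c d x y p) (hm : Meet G P u v w z)
    (hu : u ∈ piece P a c p) (hv : v ∈ piece P a c p) (hw : w ∈ piece P a c p)
    (hz : z ∈ piece P a c p) : u ∈ inner P a c p ∨ v ∈ inner P a c p := by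
  by_contra! hno
  have huv : u ≠ v := hm.1.ne
  have h : s(a, c) = s(u, v) := by
    rcases hu.resolve_left hno.1 with rfl | rfl <;> rcases hv.resolve_left hno.2 with rfl | rfl
    exacts [(huv rfl).elim, rfl, Sym2.eq_swap, (huv rfl).elim]
  rcases Sym2.eq_iff.1 (H.layout.one (hm.congr_left h) H.side) with ⟨-, rfl⟩ | ⟨rfl, -⟩
  exacts [H.not_piece_far hz, H.not_piece_far hw]

lemma side_uncrossed [Finite V] (H : Pocket G P a b c d x y p)
    (hmin : ∀ {a' b' c' d' x' y' p'}, Pocket G P a' b' c' d' x' y' p' →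
      (inner P a c p).ncard ≤ (inner P a' c' p').ncard)
    (hm : Meet G P u v w z) (hu : u ∈ piece P a c p) (hv : v ∈ piece P a c p)
    (hw : w ∈ piece P a c p) (hz : z ∈ piece P a c p) : ¬ Meet G P u w f g := by
  intro h
  obtain ⟨f', g', r, H'⟩ : ∃ f' g' r, Pocket G P u v w z f' g' r := by
    obtain ⟨r, h | h⟩ := H.layout.exists_pocket hm h
    exacts [⟨_, _, r, h⟩, ⟨_, _, r, h⟩]
  have hr : InTri (P a) p (P c) r := by
    rcases H.inner_of_meet hm hu hv hw hz with h' | h'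
    · exact H.inTri_of_meet hm h' hv H'.mem_left H'.mem_right
    · exact H.inTri_of_meet (hm.swap_left) h' hu (segment_symm ℝ (P u) (P v) ▸ H'.mem_left)
        H'.mem_right
  have hc {k : V} (hk : k ∈ piece P a c p) :
      InTri (P a) p (P c) (P k) ∨ P k = P a ∨ P k = p ∨ P k = P c := by
    rcases hk with hk | rfl | rfl
    exacts [.inl hk, .inr (.inl rfl), .inr (.inr (.inr rfl))]
  have hsub : inner P u w r ⊂ inner P a c p := by
    refine (Set.ssubset_iff_of_subset fun k hk => ?_).2 ?_
    · exact InTri.of_corners hr (hc hu) (hc hw) (InTri.swap (hk : InTri (P u) r (P w) (P k)))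
    · rcases H.inner_of_meet hm hu hv hw hz with h' | h'
      exacts [⟨u, h', H'.not_inner_left⟩, ⟨v, h', H'.not_inner_left'⟩]
  exact (Set.ncard_lt_ncard hsub (Set.toFinite _)).not_ge (hmin H')

end Pocket

end layouts

open Filter Topology

section fragments

variable {V : Type*} {G : SimpleGraph V} {P : V → ℝ × ℝ} {a b c d e f g u v w x y z : V}
  {u' v' w' z' : V} {p q r r' : ℝ × ℝ}

namespace Layout

lemma eq_or_eq (H : Layout G P) (h : G.Adj a b) (hv : P v ∈ segment ℝ (P a) (P b)) :
    v = a ∨ v = b := by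
  by_contra! hno
  exact H.avoid h hno.1 hno.2 hv

lemma ne_of_meet (H : Layout G P) (hm : Meet G P u v w z) (hr : r ∈ segment ℝ (P u) (P v))
    (hr' : r ∈ segment ℝ (P w) (P z)) (k : V) : r ≠ P k := by
  rintro rfl
  rcases H.eq_or_eq hm.1 hr with rfl | rfl
  exacts [H.avoid hm.2.1 hm.ne.1 hm.ne.2.1 hr', H.avoid hm.2.1 hm.ne.2.2.1 hm.ne.2.2.2 hr']

lemma edge_eq_or (H : Layout G P) (hm : Meet G P u v w z) (hr : r ∈ segment ℝ (P u) (P v))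
    (hr' : r ∈ segment ℝ (P w) (P z)) (h : G.Adj a b) (hab : r ∈ segment ℝ (P a) (P b)) :
    s(a, b) = s(u, v) ∨ s(a, b) = s(w, z) := by
  by_contra! hno
  rcases H.meet_or_share h hm.1 hno.1 hab hr with h' | ⟨k, -, -, hk⟩
  · exact hno.2 (H.one h'.symm hm)
  · exact H.ne_of_meet hm hr hr' k hk

lemma eq_of_same (H : Layout G P) (hm : Meet G P u v w z) (hr : r ∈ segment ℝ (P u) (P v))
    (hr' : r ∈ segment ℝ (P w) (P z)) (hm' : Meet G P u' v' w' z')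
    (hq : q ∈ segment ℝ (P u') (P v')) (hq' : q ∈ segment ℝ (P w') (P z'))
    (h : s(u', v') = s(u, v)) : q = r := by
  have h2 := H.one hm (hm'.congr_left h.symm)
  have aux {a b a' b' : V} (h : s(a, b) = s(a', b')) :
      segment ℝ (P a) (P b) = segment ℝ (P a') (P b') := by
    rcases Sym2.eq_iff.1 h with ⟨rfl, rfl⟩ | ⟨rfl, rfl⟩
    exacts [rfl, segment_symm _ _ _]
  rw [aux h] at hq
  rw [← aux h2] at hq'
  exact Crs.eq_of_mem hm.2.2 hq hq' hr hr'

end Layout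

/-- The point `r` is the crossing of an edge at `u`. -/
def Half (G : SimpleGraph V) (P : V → ℝ × ℝ) (r : ℝ × ℝ) (u : V) : Prop :=
  ∃ v w z, Meet G P u v w z ∧ r ∈ segment ℝ (P u) (P v) ∧ r ∈ segment ℝ (P w) (P z)

lemma Half.eq_or (H : Layout G P) (h : Half G P r u) (hm : Meet G P a b c d)
    (hr : r ∈ segment ℝ (P a) (P b)) (hr' : r ∈ segment ℝ (P c) (P d)) :
    u = a ∨ u = b ∨ u = c ∨ u = d := by
  obtain ⟨v, w, z, h, h1, -⟩ := h
  rcases H.edge_eq_or hm hr hr' h.1 h1 with h | h <;> rcases Sym2.eq_iff.1 h with ⟨h, -⟩ | ⟨h, -⟩ <;>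
    simp [h]

lemma Half.disjoint (H : Layout G P) (h : Half G P r u) (h' : Half G P r' u') (hr : r ≠ r')
    (hu : u ≠ u') : Disjoint (segment ℝ r (P u)) (segment ℝ r' (P u')) := by
  obtain ⟨v, w, z, hm, h1, h2⟩ := h
  obtain ⟨v', w', z', hm', h1', h2'⟩ := h'
  refine Set.disjoint_left.2 fun q hq hq' => ?_
  rw [segment_symm] at hq hq'
  have hsub : q ∈ segment ℝ (P u') (P v') :=
    (convex_segment _ _).segment_subset (left_mem_segment ℝ _ _) h1' hq'
  by_cases n1 : s(u', v') = s(u, v)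
  · exact hr (H.eq_of_same hm h1 h2 hm' h1' h2' n1).symm
  by_cases n2 : s(u', v') = s(w, z)
  · exact hr (H.eq_of_same hm.symm h2 h1 hm' h1' h2' n2).symm
  have := H.eq_of_mem_half hm h1 h2 hm'.1 n1 n2 hsub hq
  subst this
  rcases H.eq_or_eq hm'.1 hsub with h | rfl
  · exact hu h
  · exact H.ne_of_meet hm' h1' h2' _ (eq_of_mem_segment_mem_segment h1' hq')

lemma Half.disjoint_edge (H : Layout G P) (h : Half G P r u) (hab : G.Adj a b)
    (hr : r ∉ segment ℝ (P a) (P b)) (ha : a ≠ u) (hb : b ≠ u) :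
    Disjoint (segment ℝ r (P u)) (segment ℝ (P a) (P b)) := by
  obtain ⟨v, w, z, hm, h1, h2⟩ := h
  refine Set.disjoint_left.2 fun q hq hq' => ?_
  rw [segment_symm] at hq
  have aux {a' b' : V} (h : s(a, b) = s(a', b')) :
      segment ℝ (P a) (P b) = segment ℝ (P a') (P b') := by
    rcases Sym2.eq_iff.1 h with ⟨rfl, rfl⟩ | ⟨rfl, rfl⟩
    exacts [rfl, segment_symm _ _ _]
  have := H.eq_of_mem_half hm h1 h2 hab (fun h => hr (aux h ▸ h1)) (fun h => hr (aux h ▸ h2)) hq' hq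
  subst this
  exact H.avoid hab ha.symm hb.symm hq'

lemma Half.disjoint_uncrossed (H : Layout G P) (h : Half G P r u) (hab : G.Adj a b)
    (hno : ∀ f g, ¬ Meet G P a b f g) (ha : a ≠ u) (hb : b ≠ u) :
    Disjoint (segment ℝ r (P u)) (segment ℝ (P a) (P b)) := by
  refine h.disjoint_edge H hab (fun hr => ?_) ha hb
  obtain ⟨v, w, z, hm, h1, h2⟩ := h
  rcases H.edge_eq_or hm h1 h2 hab hr with h | h
  exacts [hno _ _ (hm.congr_left h), hno _ _ (hm.symm.congr_left h)]

/-- The crossings of the edges of a pocket. -/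
def Pocket.centres (G : SimpleGraph V) (P : V → ℝ × ℝ) (a c : V) (p : ℝ × ℝ) : Set (ℝ × ℝ) :=
  {r | ∃ u v w z, u ∈ piece P a c p ∧ v ∈ piece P a c p ∧ w ∈ piece P a c p ∧ z ∈ piece P a c p ∧
    Meet G P u v w z ∧ r ∈ segment ℝ (P u) (P v) ∧ r ∈ segment ℝ (P w) (P z)}

/-- The edges of a pocket, cut at their crossings, and three edges at the far vertex `y`. -/
inductive Pocket.Frag (G : SimpleGraph V) (P : V → ℝ × ℝ) (a c x y : V) (p : ℝ × ℝ) {α : Type*}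
    (ι : ℝ × ℝ → α) : V ⊕ α → V ⊕ α → Prop
  | plain {u v : V} : u ∈ piece P a c p → v ∈ piece P a c p → G.Adj u v →
      (∀ f g, ¬ Meet G P u v f g) → Frag G P a c x y p ι (.inl u) (.inl v)
  | half {r : ℝ × ℝ} {u : V} : r = p ∨ r ∈ centres G P a c p → u ∈ piece P a c p → Half G P r u →
      Frag G P a c x y p ι (.inr (ι r)) (.inl u)
  | far {u : V} : u = a ∨ u = x ∨ u = c → Frag G P a c x y p ι (.inl y) (.inl u)

namespace Pocket

variable {α : Type*} {ι : ℝ × ℝ → α} {n m n' m' : V ⊕ α} {Q : V ⊕ α → ℝ × ℝ}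

lemma inTri_of_centre (H : Pocket G P a b c d x y p) (hr : r ∈ centres G P a c p) :
    InTri (P a) p (P c) r := by
  obtain ⟨u, v, w, z, hu, hv, hw, hz, hm, h1, h2⟩ := hr
  rcases H.inner_of_meet hm hu hv hw hz with h | h
  · exact H.inTri_of_meet hm h hv h1 h2
  · exact H.inTri_of_meet hm.swap_left h hu (segment_symm ℝ (P u) (P v) ▸ h1) h2

lemma apex_nmem (H : Pocket G P a b c d x y p) : p ∉ centres G P a c p := fun h => by
  simpa [InTri] using H.inTri_of_centre h

lemma nmem_side (H : Pocket G P a b c d x y p) (hr : r = p ∨ r ∈ centres G P a c p) :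
    r ∉ segment ℝ (P x) (P y) := by
  intro h
  have hx : x ∈ inner P a c p := H.inside
  rcases hr with rfl | ⟨u, v, w, z, hu, hv, hw, hz, hm, h1, h2⟩
  · rcases H.layout.edge_eq_or H.meet H.mem_left H.mem_right H.side.2.1 h with h | h
    exacts [(H.edge_ne_of_inner hx).1 h, (H.edge_ne_of_inner hx).2 h]
  · rcases H.layout.edge_eq_or hm h1 h2 H.side.2.1 h with h | h <;>
      rcases Sym2.eq_iff.1 h with ⟨-, rfl⟩ | ⟨-, rfl⟩ <;> exact H.not_piece_far ‹_›

lemma mem_tri_of_node (H : Pocket G P a b c d x y p) (hr : r = p ∨ r ∈ centres G P a c p) :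
    r ∈ Tri (P a) p (P c) := by
  rcases hr with rfl | hr
  exacts [mid_mem_tri _ _ _, (H.inTri_of_centre hr).mem_tri]

lemma far_mul_neg (H : Pocket G P a b c d x y p) :
    cr (P a) (P c) (P y) * cr (P a) (P c) p < 0 := by
  have h1 := InTri.mul_pos H.inside.rot.rot
  have h3 := H.side.2.2.1
  rw [cr_swap (P c) (P a), cr_swap (P c) (P a)] at h3
  rw [cr_swap (P c), cr_swap (P c)]
  have h4 : cr (P c) (P a) (P x) * cr (P c) (P a) (P y) < 0 := by linarith
  have := mul_neg_of_same h1 (mul_self_pos.2 (right_ne_zero_of_mul h4.ne)) h4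
  nlinarith

lemma eq_of_mem_far (H : Pocket G P a b c d x y p) (hq : q ∈ segment ℝ (P y) (P a))
    (hq' : q ∈ Tri (P a) p (P c)) : q = P a := by
  obtain ⟨t, s, ht, hs, hts, rfl⟩ := hq
  obtain ⟨α, β, γ, h1, h2, h3, h4, h5⟩ := hq'
  have k1 := cr_comb (P a) (P c) (P y) (P a) hts
  rw [cr_self_outer, mul_zero, add_zero] at k1
  have k2 : cr (P a) (P c) (t • P y + s • P a) = β * cr (P a) (P c) p := by
    rw [h5, show α = 1 - β - γ by linarith]; simp only [cr, Prod.fst_add, Prod.snd_add,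
      Prod.smul_fst, Prod.smul_snd, smul_eq_mul]; ring
  have h := H.far_mul_neg
  have ht0 : t = 0 := by
    have : t * (cr (P a) (P c) (P y) * cr (P a) (P c) p) = β * (cr (P a) (P c) p) ^ 2 := by
      linear_combination cr (P a) (P c) p * (k2 - k1)
    by_contra h0
    have : 0 < t := lt_of_le_of_ne ht (Ne.symm h0)
    nlinarith [mul_nonneg h2 (sq_nonneg (cr (P a) (P c) p))]
  rw [ht0, show s = 1 by linarith]; simp

lemma Frag.mem_tri (H : Pocket G P a b c d x y p) (hι : ∀ r, Q (.inr (ι r)) = r)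
    (hP : ∀ v, Q (.inl v) = P v) (h : Frag G P a c x y p ι n m) (hn : n ≠ .inl y) :
    Q n ∈ Tri (P a) p (P c) ∧ Q m ∈ Tri (P a) p (P c) := by
  cases h with
  | plain hu hv => rw [hP, hP]; exact ⟨H.mem_tri_of_piece hu, H.mem_tri_of_piece hv⟩
  | half hr hu => rw [hι, hP]; exact ⟨H.mem_tri_of_node hr, H.mem_tri_of_piece hu⟩
  | far => exact (hn rfl).elim

lemma Frag.eq_or_eq (H : Pocket G P a b c d x y p) (hι : ∀ r, Q (.inr (ι r)) = r)
    (hP : ∀ v, Q (.inl v) = P v) (h : Frag G P a c x y p ι n m) (hn : n ≠ .inl y)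
    (hv : P v ∈ segment ℝ (Q n) (Q m)) : n = .inl v ∨ m = .inl v := by
  cases h with
  | plain hu hv' hadj =>
    rw [hP, hP] at hv
    rcases H.layout.eq_or_eq hadj hv with rfl | rfl
    exacts [.inl rfl, .inr rfl]
  | half hr hu hh =>
    obtain ⟨v', w, z, hm, h1, h2⟩ := hh
    rw [hι, hP, segment_symm] at hv
    have hv2 := (convex_segment _ _).segment_subset (left_mem_segment ℝ _ _) h1 hv
    rcases H.layout.eq_or_eq hm.1 hv2 with rfl | rfl
    · exact .inr rfl
    · exact (H.layout.ne_of_meet hm h1 h2 _ (eq_of_mem_segment_mem_segment h1 hv)).elim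
  | far => exact (hn rfl).elim

private lemma Frag.disjoint_far (H : Pocket G P a b c d x y p) (hι : ∀ r, Q (.inr (ι r)) = r)
    (hP : ∀ v, Q (.inl v) = P v) (h : Frag G P a c x y p ι n m) (hn : n ≠ .inl y)
    (hu : u = a ∨ u = x ∨ u = c) (hnu : n ≠ .inl u) (hmu : m ≠ .inl u) :
    Disjoint (segment ℝ (P y) (P u)) (segment ℝ (Q n) (Q m)) := by
  refine Set.disjoint_left.2 fun q hq hq' => ?_
  have ht := (convex_tri _ _ _).segment_subset (h.mem_tri H hι hP hn).1 (h.mem_tri H hι hP hn).2 hq'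
  have key (h' : q = P u) : False := by
    subst h'
    exact (h.eq_or_eq H hι hP hn hq').elim hnu hmu
  rcases hu with rfl | rfl | rfl
  · exact key (H.eq_of_mem_far hq ht)
  · rw [segment_symm] at hq
    cases h with
    | @plain v w hv hw hvw hno =>
      rw [hP, hP] at hq'
      rcases H.layout.meet_or_share hvw H.side.2.1 (fun h => hno _ _ (H.side.symm.congr_left h))
        hq' hq with h | ⟨k, h1, rfl | rfl, -⟩
      · exact hno _ _ h
      · rcases h1 with rfl | rfl
        exacts [hnu rfl, hmu rfl]
      · rcases h1 with rfl | rfl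
        exacts [H.not_piece_far hv, H.not_piece_far hw]
    | half hr hv hh =>
      rw [hι, hP] at hq'
      refine Set.disjoint_left.1 (hh.disjoint_edge H.layout H.side.2.1 (H.nmem_side hr) ?_ ?_) hq' hq
      · rintro rfl; exact hmu rfl
      · rintro rfl; exact H.not_piece_far hv
    | far => exact (hn rfl).elim
  · refine key (H.symm.eq_of_mem_far hq ?_)
    have : Tri (P u) p (P a) = Tri (P a) p (P u) := by
      ext
      constructor <;> rintro ⟨α, β, γ, h1, h2, h3, h4, rfl⟩ <;>
        exact ⟨γ, β, α, h3, h2, h1, by linarith, by abel⟩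
    rwa [this]

lemma Frag.disjoint (H : Pocket G P a b c d x y p) (hι : ∀ r, Q (.inr (ι r)) = r)
    (hP : ∀ v, Q (.inl v) = P v) (h : Frag G P a c x y p ι n m) (h' : Frag G P a c x y p ι n' m')
    (h1 : n ≠ n') (h2 : n ≠ m') (h3 : m ≠ n') (h4 : m ≠ m') :
    Disjoint (segment ℝ (Q n) (Q m)) (segment ℝ (Q n') (Q m')) := by
  cases h' with
  | far hu =>
    rw [hP, hP]
    exact (h.disjoint_far H hι hP h1 hu h2 h4).symm
  | @plain u' v' hu' hv' hadj' hno' =>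
    cases h with
    | far hu =>
      rw [hP y, hP]
      exact (Frag.plain hu' hv' hadj' hno').disjoint_far H hι hP h1.symm hu h3.symm h4.symm
    | plain hu hv hadj hno =>
      simp only [hP]
      refine Set.disjoint_left.2 fun q hq hq' => hno _ _ (H.layout.meet_of_mem hadj hadj'
        (ne_of_apply_ne _ h1) (ne_of_apply_ne _ h2) (ne_of_apply_ne _ h3) (ne_of_apply_ne _ h4)
        hq hq')
    | half hr hu hh =>
      simp only [hP, hι]
      exact hh.disjoint_uncrossed H.layout hadj' hno' (ne_of_apply_ne _ h3.symm)
        (ne_of_apply_ne _ h4.symm)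
  | half hr' hu' hh' =>
    cases h with
    | far hu =>
      rw [hP y, hP]
      exact (Frag.half hr' hu' hh').disjoint_far H hι hP h1.symm hu h3.symm h4.symm
    | plain hu hv hadj hno =>
      simp only [hP, hι]
      exact (hh'.disjoint_uncrossed H.layout hadj hno (ne_of_apply_ne _ h2)
        (ne_of_apply_ne _ h4)).symm
    | half hr hu hh =>
      simp only [hP, hι]
      exact hh.disjoint H.layout hh' (by rintro rfl; exact h1 rfl) (ne_of_apply_ne _ h4)

end Pocket
end fragments

open Filter Topology

section pocket

variable {V : Type*} {G : SimpleGraph V} {P : V → ℝ × ℝ} {a b c d e f g u v w x y z : V}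
  {p q r : ℝ × ℝ}

lemma cr_pos_of_openSegment {a b c r : ℝ × ℝ} (hr : r ∈ openSegment ℝ a b) (h : 0 < cr a c b) :
    0 < cr r a c ∧ 0 < cr r c b := by
  obtain ⟨t, s, ht, hs, hts, rfl⟩ := hr
  have e1 : cr (t • a + s • b) a c = s * cr a c b := by
    rw [← cr_rot _ a c, cr_comb _ _ _ _ hts]
    simp
  have e2 : cr (t • a + s • b) c b = t * cr a c b := by
    rw [← cr_rot _ c b, cr_comb _ _ _ _ hts, cr_rot a c b]
    simp
  rw [e1, e2]
  exact ⟨mul_pos hs h, mul_pos ht h⟩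

lemma Layout.mem_openSegment (H : Layout G P) (hm : Meet G P u v w z) (hr : r ∈ segment ℝ (P u) (P v))
    (hr' : r ∈ segment ℝ (P w) (P z)) : r ∈ openSegment ℝ (P u) (P v) :=
  mem_openSegment_of_ne_left_right (H.ne_of_meet hm hr hr' u).symm (H.ne_of_meet hm hr hr' v).symm hr

namespace Pocket

lemma exists_cor (H : Pocket G P a b c d x y p) (hr : r ∈ centres G P a c p) :
    ∃ k : ZMod 4 → V, ∀ i, k i ∈ piece P a c p ∧ Meet G P (k i) (k (i + 2)) (k (i + 1)) (k (i + 3)) ∧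
      r ∈ segment ℝ (P (k i)) (P (k (i + 2))) ∧ 0 < cr r (P (k i)) (P (k (i + 1))) := by
  obtain ⟨u, v, w, z, hu, hv, hw, hz, hm, h1, h2⟩ := hr
  wlog h : 0 < cr (P u) (P w) (P v) generalizing w z
  · refine this z w hz hw hm.swap_right (segment_symm ℝ (P w) (P z) ▸ h2) ?_
    have := hm.2.2.1
    rw [cr_swap' (P u) (P v) (P w), neg_pos, not_lt] at h
    rw [cr_swap' (P u) (P v) (P z)]
    have h0 := left_ne_zero_of_mul this.ne
    have : 0 < cr (P u) (P v) (P w) := lt_of_le_of_ne h h0.symm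
    nlinarith
  have h' : 0 < cr (P v) (P z) (P u) := by
    have := hm.2.2.1
    rw [cr_swap' (P u) (P v) (P w)] at h
    rw [cr_rot (P u) (P v) (P z)]
    nlinarith
  have k1 := cr_pos_of_openSegment (H.layout.mem_openSegment hm h1 h2) h
  have h1' : r ∈ segment ℝ (P v) (P u) := segment_symm ℝ (P u) (P v) ▸ h1
  have h2' : r ∈ segment ℝ (P z) (P w) := segment_symm ℝ (P w) (P z) ▸ h2
  have k2 := cr_pos_of_openSegment (H.layout.mem_openSegment hm.swap_left h1' h2) h'
  refine ⟨fun i => (![u, w, v, z] : Fin 4 → V) i, fun i => ?_⟩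
  fin_cases i
  · exact ⟨hu, hm, h1, k1.1⟩
  · exact ⟨hw, hm.symm.swap_right, h2, k1.2⟩
  · exact ⟨hv, hm.swap_left.swap_right, h1', k2.1⟩
  · exact ⟨hz, hm.symm.swap_left, h2', k2.2⟩

lemma centres_finite [Finite V] : (centres G P a c p).Finite := by
  have : ∀ k : V × V × V × V, {r | Meet G P k.1 k.2.1 k.2.2.1 k.2.2.2 ∧
      r ∈ segment ℝ (P k.1) (P k.2.1) ∧ r ∈ segment ℝ (P k.2.2.1) (P k.2.2.2)}.Subsingleton :=
    fun k r hr s hs => Crs.eq_of_mem hr.1.2.2 hr.2.1 hr.2.2 hs.2.1 hs.2.2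
  refine (Set.finite_iUnion fun k => (this k).finite).subset ?_
  rintro r ⟨u, v, w, z, -, -, -, -, h⟩
  exact Set.mem_iUnion.2 ⟨(u, v, w, z), h⟩

/-- The labels of the vertices and of the crossings of a pocket; the labels `(r, some i)` are
reserved for the sides of the crossing `r`. -/
abbrev Node (V : Type*) := V ⊕ (ℝ × ℝ) × Option (ZMod 4)

/-- The positions of the labels. -/
def nodePos (P : V → ℝ × ℝ) : Node V → ℝ × ℝ := Sum.elim P Prod.fst

/-- The labels of the vertices and of the crossings of a pocket. -/
def nodes (G : SimpleGraph V) (P : V → ℝ × ℝ) (a c y : V) (p : ℝ × ℝ) : Set (Node V) :=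
  Sum.inl '' (insert y (piece P a c p)) ∪ (fun r => Sum.inr (r, none)) '' insert p (centres G P a c p)

/-- The fragments of a pocket, as a symmetric relation on labels. -/
def FragAdj (G : SimpleGraph V) (P : V → ℝ × ℝ) (a c x y : V) (p : ℝ × ℝ) (n m : Node V) : Prop :=
  Frag G P a c x y p (fun r => (r, none)) n m ∨ Frag G P a c x y p (fun r => (r, none)) m n

variable {n m : Node V} {k : ℝ × ℝ → ZMod 4 → V}

lemma Frag.mem (H : Pocket G P a b c d x y p)
    (h : Frag G P a c x y p (fun r => (r, (none : Option (ZMod 4)))) n m) :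
    n ∈ nodes G P a c y p ∧ m ∈ nodes G P a c y p ∧ n ≠ m := by
  cases h with
  | plain hu hv hadj => exact ⟨.inl ⟨_, .inr hu, rfl⟩, .inl ⟨_, .inr hv, rfl⟩, by simp [hadj.ne]⟩
  | half hr hu => exact ⟨.inr ⟨_, hr, rfl⟩, .inl ⟨_, .inr hu, rfl⟩, by simp⟩
  | far hu =>
    refine ⟨.inl ⟨_, .inl rfl, rfl⟩, .inl ⟨_, .inr ?_, rfl⟩, ?_⟩
    · rcases hu with rfl | rfl | rfl
      exacts [.inr (.inl rfl), .inl H.inside, .inr (.inr rfl)]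
    · rintro h
      obtain rfl := Sum.inl_injective h
      have := H.side.ne
      have := H.side.2.1.ne
      tauto

lemma nodes_finite [Finite V] : (nodes G P a c y p).Finite :=
  ((Set.toFinite _).image _).union ((centres_finite.insert p).image _)

lemma exists_nodePos [Finite V] (H : Pocket G P a b c d x y p)
    (hk : ∀ r ∈ centres G P a c p, ∀ i, 0 < cr r (P (k r i)) (P (k r (i + 1)))) :
    ∃ Q : Node V → ℝ × ℝ, GenPos (nodes G P a c y p) Q ∧
      (∀ n m n' m', FragAdj G P a c x y p n m → FragAdj G P a c x y p n' m' →
        ¬ Crs (Q n) (Q m) (Q n') (Q m')) ∧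
      (∀ r ∈ centres G P a c p, ∀ i,
        0 < cr (Q (.inr (r, none))) (Q (.inl (k r i))) (Q (.inl (k r (i + 1))))) ∧
      cr (Q (.inl a)) (Q (.inl c)) (Q (.inl y)) * cr (Q (.inl a)) (Q (.inl c)) (Q (.inr (p, none))) < 0 ∧
      ∀ n ∈ nodes G P a c y p, n ≠ .inl a → n ≠ .inl y → n ≠ .inl c → n ≠ .inr (p, none) →
        InTri (Q (.inl a)) (Q (.inr (p, none))) (Q (.inl c)) (Q n) := by
  have hF : (nodes G P a c y p).Finite := nodes_finite
  have key : ∀ᶠ Q in 𝓝 (nodePos P), (∀ n ∈ nodes G P a c y p, ∀ m ∈ nodes G P a c y p,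
      ∀ n' ∈ nodes G P a c y p, ∀ m' ∈ nodes G P a c y p,
      FragAdj G P a c x y p n m → FragAdj G P a c x y p n' m' → ¬ Crs (Q n) (Q m) (Q n') (Q m')) ∧
      (∀ r ∈ centres G P a c p, ∀ i,
        0 < cr (Q (.inr (r, none))) (Q (.inl (k r i))) (Q (.inl (k r (i + 1))))) ∧
      cr (Q (.inl a)) (Q (.inl c)) (Q (.inl y)) * cr (Q (.inl a)) (Q (.inl c)) (Q (.inr (p, none))) < 0 ∧
      ∀ n ∈ nodes G P a c y p, n ≠ .inl a → n ≠ .inl y → n ≠ .inl c → n ≠ .inr (p, none) →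
        InTri (Q (.inl a)) (Q (.inr (p, none))) (Q (.inl c)) (Q n) := by
    refine .and ?_ (.and ?_ (.and ?_ ?_))
    · refine (eventually_all_finite hF).2 fun n _ => (eventually_all_finite hF).2 fun m _ =>
        (eventually_all_finite hF).2 fun n' _ => (eventually_all_finite hF).2 fun m' _ => ?_
      simp only [eventually_imp_distrib_left]
      intro h h'
      by_cases h0 : n ≠ n' ∧ n ≠ m' ∧ m ≠ n' ∧ m ≠ m'
      · refine eventually_not_crs ?_
        obtain ⟨h1, h2, h3, h4⟩ := h0
        have hd {n m n' m' : Node V} (h : Frag G P a c x y p (fun r => (r, none)) n m)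
            (h' : Frag G P a c x y p (fun r => (r, none)) n' m') :=
          h.disjoint (Q := nodePos P) H (fun _ => rfl) (fun _ => rfl) h'
        rcases h with h | h <;> rcases h' with h' | h'
        · exact hd h h' h1 h2 h3 h4
        · rw [segment_symm ℝ (nodePos P n')]; exact hd h h' h2 h1 h4 h3
        · rw [segment_symm ℝ (nodePos P n)]; exact hd h h' h3 h4 h1 h2
        · rw [segment_symm ℝ (nodePos P n), segment_symm ℝ (nodePos P n')]
          exact hd h h' h4 h3 h2 h1
      · exact .of_forall fun Q hQ => h0 (Crs.ne_of hQ).2.2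
    · refine (eventually_all_finite centres_finite).2 fun r hr => eventually_all.2 fun i => ?_
      exact eventually_cr_pos (hk r hr i)
    · refine IsOpen.mem_nhds ?_ H.far_mul_neg
      exact isOpen_lt ((continuous_cr (by fun_prop) (by fun_prop) (by fun_prop)).mul
        (continuous_cr (by fun_prop) (by fun_prop) (by fun_prop))) continuous_const
    · refine (eventually_all_finite hF).2 fun n hn => ?_
      simp only [eventually_imp_distrib_left]
      intro h1 h2 h3 h4
      refine (isOpen_inTri (by fun_prop) (by fun_prop) (by fun_prop) (by fun_prop)).mem_nhds ?_
      rcases hn with ⟨v, rfl | hv | rfl | rfl, rfl⟩ | ⟨r, rfl | hr, rfl⟩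
      exacts [(h2 rfl).elim, hv, (h1 rfl).elim, (h3 rfl).elim, (h4 rfl).elim, H.inTri_of_centre hr]
  obtain ⟨Q, hQ, h1, h2⟩ := exists_genPos_of_eventually hF key
  refine ⟨Q, hQ, fun n m n' m' h h' => ?_, h2⟩
  have hm {n m : Node V} (h : FragAdj G P a c x y p n m) :
      n ∈ nodes G P a c y p ∧ m ∈ nodes G P a c y p := by
    rcases h with h | h
    exacts [⟨(h.mem H).1, (h.mem H).2.1⟩, ⟨(h.mem H).2.1, (h.mem H).1⟩]
  exact h1 n (hm h).1 m (hm h).2 n' (hm h').1 m' (hm h').2 h h'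

end Pocket
end pocket

open Filter Topology

section pocket

variable {V : Type*} {G : SimpleGraph V} {P : V → ℝ × ℝ} {a b c d e f g u v w x y z : V}
  {p q r : ℝ × ℝ}

namespace Pocket

/-- A crossing in which no edge joins `a` and `c`. -/
def MeetOff (G : SimpleGraph V) (P : V → ℝ × ℝ) (a c u v w z : V) : Prop :=
  Meet G P u v w z ∧ s(u, v) ≠ s(a, c) ∧ s(w, z) ≠ s(a, c)

variable {n m : Node V} {k : ℝ × ℝ → ZMod 4 → V}

lemma ne_base (H : Pocket G P a b c d x y p) (hm : Meet G P u v w z) (hw : w ∈ piece P a c p)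
    (hz : z ∈ piece P a c p) : s(u, v) ≠ s(a, c) := by
  intro h
  rcases Sym2.eq_iff.1 (H.layout.one (hm.congr_left h.symm) H.side) with ⟨-, rfl⟩ | ⟨rfl, -⟩
  exacts [H.not_piece_far hz, H.not_piece_far hw]

/-- The data of a centre, see `Pocket.exists_cor`. -/
def CorHyp (G : SimpleGraph V) (P : V → ℝ × ℝ) (a c : V) (p : ℝ × ℝ)
    (k : ℝ × ℝ → ZMod 4 → V) : Prop :=
  ∀ r ∈ centres G P a c p, ∀ i, k r i ∈ piece P a c p ∧
    Meet G P (k r i) (k r (i + 2)) (k r (i + 1)) (k r (i + 3)) ∧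
    r ∈ segment ℝ (P (k r i)) (P (k r (i + 2))) ∧ 0 < cr r (P (k r i)) (P (k r (i + 1)))

lemma CorHyp.mem' (hk : CorHyp G P a c p k) (hr : r ∈ centres G P a c p) (i : ZMod 4) :
    r ∈ segment ℝ (P (k r (i + 1))) (P (k r (i + 3))) := by
  have := (hk r hr (i + 1)).2.2.1
  rwa [show i + 1 + 2 = i + 3 by ring] at this

lemma CorHyp.injective (hk : CorHyp G P a c p k) (hr : r ∈ centres G P a c p) :
    Function.Injective (k r) := by
  have h (i : ZMod 4) := (Crs.ne_of (hk r hr i).2.1.2.2)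
  have h0 := h 0
  have h1 := h 1
  have e : ∀ i j : ZMod 4, i = j ∨ j = i + 2 ∨ j = i + 1 ∨ j = i + 3 := by decide
  intro i j hij
  rcases e i j with rfl | rfl | rfl | rfl
  · rfl
  · exact ((h i).1 hij).elim
  · exact ((h i).2.2.1 hij).elim
  · exact ((h i).2.2.2.1 hij).elim

lemma CorHyp.half (hk : CorHyp G P a c p k) (hr : r ∈ centres G P a c p) (i : ZMod 4) :
    Half G P r (k r i) :=
  ⟨_, _, _, (hk r hr i).2.1, (hk r hr i).2.2.1, hk.mem' hr i⟩

lemma centreHyp [Finite V] (H : Pocket G P a b c d x y p)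
    (hmin : ∀ {a' b' c' d' x' y' p'}, Pocket G P a' b' c' d' x' y' p' →
      (inner P a c p).ncard ≤ (inner P a' c' p').ncard)
    (hk : CorHyp G P a c p k) {Q : Node V → ℝ × ℝ} (hQ : GenPos (nodes G P a c y p) Q)
    (hcrs : ∀ n m n' m', FragAdj G P a c x y p n m → FragAdj G P a c x y p n' m' →
        ¬ Crs (Q n) (Q m) (Q n') (Q m'))
    (hpos : ∀ r ∈ centres G P a c p, ∀ i,
        0 < cr (Q (.inr (r, none))) (Q (.inl (k r i))) (Q (.inl (k r (i + 1))))) :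
    CentreHyp (nodes G P a c y p) ((fun r => Sum.inr (r, none)) '' centres G P a c p)
      (fun n i => .inl (k (nodePos P n) i)) (FragAdj G P a c x y p) Q where
  fin := nodes_finite
  gp := hQ
  symm := Or.symm
  ne h := by
    rcases h with h | h
    exacts [(h.mem H).2.2, (h.mem H).2.2.symm]
  mem h := by
    rcases h with h | h
    exacts [(h.mem H).1, (h.mem H).2.1]
  planar h h' := hcrs _ _ _ _ h h'
  sub := by
    rintro _ ⟨r, hr, rfl⟩
    exact .inr ⟨r, .inr hr, rfl⟩
  cor_nmem := by
    rintro _ ⟨r, hr, rfl⟩ i ⟨r', -, h⟩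
    simp at h
  cor_inj := by
    rintro _ ⟨r, hr, rfl⟩
    exact Sum.inl_injective.comp (hk.injective hr)
  spoke := by
    rintro _ ⟨r, hr, rfl⟩ i
    exact .inl (.half (.inr hr) (hk r hr i).1 (hk.half hr i))
  nbr := by
    rintro _ v ⟨r, hr, rfl⟩ h
    obtain ⟨u, rfl, hu⟩ : ∃ u, v = .inl u ∧ Half G P r u := by
      rcases h with h | h
      · cases h with
        | half _ _ h => exact ⟨_, rfl, h⟩
      · cases h
    have := hu.eq_or H.layout (hk r hr 0).2.1 (hk r hr 0).2.2.1 (hk.mem' hr 0)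
    rcases this with h | h | h | h
    exacts [⟨_, congrArg _ h⟩, ⟨_, congrArg _ h⟩, ⟨_, congrArg _ h⟩, ⟨_, congrArg _ h⟩]
  pos := by
    rintro _ ⟨r, hr, rfl⟩ i
    exact hpos r hr i
  ndiag := by
    rintro _ ⟨r, hr, rfl⟩ i h
    have h1 := (hk r hr i).2.1
    have n1 : k r i ≠ y := fun h => H.not_piece_far (h ▸ (hk r hr i).1)
    have n2 : k r (i + 2) ≠ y := fun h => H.not_piece_far (h ▸ (hk r hr (i + 2)).1)
    simp only [nodePos, Sum.elim_inr] at h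
    rcases h with h | h
    · generalize hu : (Sum.inl (k r i) : Node V) = n at h
      generalize hv : (Sum.inl (k r (i + 2)) : Node V) = m at h
      cases h with
      | plain _ _ _ hno => cases hu; cases hv; exact hno _ _ h1
      | half => cases hu
      | far => cases hu; exact n1 rfl
    · generalize hu : (Sum.inl (k r i) : Node V) = n at h
      generalize hv : (Sum.inl (k r (i + 2)) : Node V) = m at h
      cases h with
      | plain _ _ _ hno => cases hu; cases hv; exact hno _ _ h1.swap_left
      | half => cases hv
      | far => cases hv; exact n2 rfl
  side_diag := by
    rintro _ _ ⟨r, hr, rfl⟩ ⟨r', hr', rfl⟩ i j ⟨h1, h2⟩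
    simp only [nodePos, Sum.elim_inr] at h1 h2
    have h1 := Sum.inl_injective h1
    have h2 := Sum.inl_injective h2
    refine H.side_uncrossed hmin (hk r hr i).2.1 (hk r hr i).1 (hk r hr _).1 (hk r hr _).1
      (hk r hr _).1 (f := k r' (j + 1)) (g := k r' (j + 3)) ?_
    rw [h1, h2]
    exact (hk r' hr' j).2.1

lemma exists_cor_eq (H : Pocket G P a b c d x y p) (hk : CorHyp G P a c p k)
    (hm : Meet G P u v f g) (hu : u ∈ inner P a c p) (hv : v ∈ piece P a c p) :
    ∃ r ∈ centres G P a c p, ∃ i, u = k r i ∧ v = k r (i + 2) := by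
  obtain ⟨hf, hg, -⟩ := H.mem_of_meet hm hu hv
  obtain ⟨r, h1, h2⟩ := hm.2.2.exists_mem
  have hr : r ∈ centres G P a c p := ⟨u, v, f, g, .inl hu, hv, hf, hg, hm, h1, h2⟩
  refine ⟨r, hr, ?_⟩
  rcases H.layout.edge_eq_or (hk r hr 0).2.1 (hk r hr 0).2.2.1 (hk.mem' hr 0) hm.1 h1 with h | h <;>
    rcases Sym2.eq_iff.1 h with ⟨rfl, rfl⟩ | ⟨rfl, rfl⟩
  exacts [⟨0, rfl, rfl⟩, ⟨2, rfl, rfl⟩, ⟨1, rfl, rfl⟩, ⟨3, rfl, rfl⟩]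

lemma adj_cases (H : Pocket G P a b c d x y p) (hk : CorHyp G P a c p k) (h : G.Adj u v)
    (hu : u ∈ insert y (piece P a c p)) (hv : v ∈ insert y (piece P a c p)) :
    (FragAdj G P a c x y p (.inl u) (.inl v) ∨ s(u, v) = s(a, c)) ∨
      ∃ r ∈ centres G P a c p, ∃ i, u = k r i ∧ v = k r (i + 2) := by
  have far {w : V} (h : G.Adj y w) (hw : w ∈ piece P a c p) : w = a ∨ w = x ∨ w = c := by
    rcases hw with hw | rfl | rfl
    · rcases H.nbr hw h.symm with h | h
      · exact (H.not_piece_far h).elim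
      · rcases Sym2.eq_iff.1 h with ⟨e, -⟩ | ⟨e, -⟩
        exacts [.inr (.inl e), (H.not_inner_far (e ▸ hw)).elim]
    exacts [.inl rfl, .inr (.inr rfl)]
  rcases hu with rfl | hu
  · exact .inl (.inl (.inl (.far (far h (hv.resolve_left h.ne')))))
  rcases hv with rfl | hv
  · exact .inl (.inl (.inr (.far (far h.symm hu))))
  by_cases hno : ∀ f g, ¬ Meet G P u v f g
  · exact .inl (.inl (.inl (.plain hu hv h hno)))
  push Not at hno
  obtain ⟨f, g, hm⟩ := hno
  by_cases hu' : u ∈ inner P a c p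
  · exact .inr (H.exists_cor_eq hk hm hu' hv)
  by_cases hv' : v ∈ inner P a c p
  · obtain ⟨r, hr, i, h1, h2⟩ := H.exists_cor_eq hk hm.swap_left hv' hu
    refine .inr ⟨r, hr, i + 2, h2, ?_⟩
    rw [h1, add_assoc, show (2 + 2 : ZMod 4) = 0 by decide, add_zero]
  · left; right
    have := h.ne
    rcases hu.resolve_left hu' with rfl | rfl <;> rcases hv.resolve_left hv' with rfl | rfl
    exacts [(h.ne rfl).elim, rfl, Sym2.eq_swap, (h.ne rfl).elim]

lemma exists_finDraw [Finite V] (H : Pocket G P a b c d x y p)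
    (hmin : ∀ {a' b' c' d' x' y' p'}, Pocket G P a' b' c' d' x' y' p' →
      (inner P a c p).ncard ≤ (inner P a' c' p').ncard) :
    ∃ P' : V → ℝ × ℝ, FinDraw (insert y (piece P a c p)) G.Adj (MeetOff G P a c) a c y P' ∧
      InTri (P' a) (P' c) (P' y) (P' x) := by
  obtain ⟨k, hk⟩ : ∃ k, CorHyp G P a c p k := by
    have : ∀ r, ∃ kr : ZMod 4 → V, r ∈ centres G P a c p → ∀ i, kr i ∈ piece P a c p ∧
        Meet G P (kr i) (kr (i + 2)) (kr (i + 1)) (kr (i + 3)) ∧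
        r ∈ segment ℝ (P (kr i)) (P (kr (i + 2))) ∧ 0 < cr r (P (kr i)) (P (kr (i + 1))) := by
      intro r
      by_cases hr : r ∈ centres G P a c p
      · exact (H.exists_cor hr).imp fun _ h _ => h
      · exact ⟨fun _ => a, fun h => (hr h).elim⟩
    choose k hk using this
    exact ⟨k, hk⟩
  obtain ⟨Q, hQ, hcrs, hpos, hfar, hins⟩ := H.exists_nodePos fun r hr i => (hk r hr i).2.2.2
  have hac := H.side.1
  have hside := H.side.ne
  have ha : a ∈ piece P a c p := .inr (.inl rfl)
  have hc : c ∈ piece P a c p := .inr (.inr rfl)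
  have hpa : Half G P p a := ⟨_, _, _, H.meet, H.mem_left, H.mem_right⟩
  have hpc : Half G P p c := ⟨_, _, _, H.meet.symm, H.mem_right, H.mem_left⟩
  have hcy {r : ℝ × ℝ} (hr : r ∈ centres G P a c p) (i : ZMod 4) : k r i ≠ y :=
    fun h => H.not_piece_far (h ▸ (hk r hr i).1)
  have hnac : ¬ FragAdj G P a c x y p (.inl a) (.inl c) := by
    intro h
    rcases h with h | h
    all_goals
      generalize hu : (Sum.inl a : Node V) = n at h
      generalize hv : (Sum.inl c : Node V) = m at h
      cases h with
      | plain _ _ _ hno => cases hu; cases hv; first | exact hno _ _ H.side | exact hno _ _ H.side.swap_left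
      | half => first | (cases hu; done) | cases hv
      | far => first | (cases hu; exact hside.2.1 rfl) | (cases hv; exact hside.2.2.2 rfl)
  have hyv {m : Node V} : FragAdj G P a c x y p (.inr (p, none)) m → m = .inl a ∨ m = .inl c := by
    intro h
    obtain ⟨u, rfl, hu, hu'⟩ : ∃ u, m = .inl u ∧ u ∈ piece P a c p ∧ Half G P p u := by
      rcases h with h | h
      · cases h with
        | half _ hu h => exact ⟨_, rfl, hu, h⟩
      · cases h
    rcases hu with hu | rfl | rfl
    · rcases hu'.eq_or H.layout H.meet H.mem_left H.mem_right with rfl | rfl | rfl | rfl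
      exacts [.inl rfl, (H.not_inner_left' hu).elim, .inr rfl, (H.not_inner_right' hu).elim]
    exacts [.inl rfl, .inr rfl]
  let Cx : Node V → Node V → Node V → Node V → Prop := fun n m n' m' => ∃ u v w z,
    n = .inl u ∧ m = .inl v ∧ n' = .inl w ∧ m' = .inl z ∧ MeetOff G P a c u v w z
  have hC := H.centreHyp hmin hk hQ hcrs hpos
  have hsides {r : ℝ × ℝ} (hr : r ∈ centres G P a c p) (i : ZMod 4) (f g : V) :
      ¬ Meet G P (k r i) (k r (i + 1)) f g :=
    H.side_uncrossed hmin (hk r hr i).2.1 (hk r hr i).1 (hk r hr _).1 (hk r hr _).1 (hk r hr _).1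
  have hdiag {r : ℝ × ℝ} (hr : r ∈ centres G P a c p) (i : ZMod 4) :
      s(k r i, k r (i + 2)) ≠ s(a, c) :=
    H.ne_base (hk r hr i).2.1 (hk r hr _).1 (hk r hr _).1
  have hinl {u v w z : V} (h : s((Sum.inl u : Node V), .inl v) = s(.inl w, .inl z)) :
      s(u, v) = s(w, z) := by
    simpa using h
  obtain ⟨P', hP'⟩ := hC.exists_finDraw (Cx := Cx) (ch := fun n i => .inr (nodePos P n, some i))
    (A := .inl a) (B := .inl y) (C := .inl c) (d := .inr (p, none))
    (.inl ⟨a, .inr ha, rfl⟩) (.inl ⟨y, .inl rfl, rfl⟩) (.inl ⟨c, .inr hc, rfl⟩)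
    (.inr ⟨p, .inl rfl, rfl⟩) (.inr (.far (.inl rfl))) (.inl (.far (.inr (.inr rfl))))
    (.inr (.half (.inl rfl) ha hpa)) (.inl (.half (.inl rfl) hc hpc)) hnac (by simp [hac.ne])
    (by simp) (by simp) (by simp) (by simp) (by simp [H.apex_nmem])
    (by rintro _ ⟨r, hr, rfl⟩ i; simp [nodes])
    (by
      rintro _ ⟨r, hr, rfl⟩ _ ⟨r', hr', rfl⟩ i j h
      simp only [nodePos, Sum.elim_inr, Sum.inr.injEq, Prod.mk.injEq, Option.some.injEq] at h
      exact ⟨by rw [h.1], h.2⟩)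
    (by rintro _ ⟨r, hr, rfl⟩ i h; exact hcy hr i (Sum.inl_injective h).symm)
    (by rintro _ _ i; simp) hyv hfar (fun hn h1 h2 h3 h4 => hins _ hn h1 h2 h3 h4)
    (by
      rintro _ ⟨r, hr, rfl⟩ i h
      rcases Sym2.eq_iff.1 (hinl h) with ⟨h1, h2⟩ | ⟨h1, h2⟩ <;> simp only [nodePos, Sum.elim_inr] at h1 h2
      · exact hsides hr i x y (by rw [h1, h2]; exact H.side)
      · exact hsides hr i x y (by rw [h1, h2]; exact H.side.swap_left))
    (by rintro _ ⟨r, hr, rfl⟩ i h; exact hdiag hr i (hinl h))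
    (by
      rintro _ _ ⟨r, hr, rfl⟩ ⟨r', hr', rfl⟩ hne i j ⟨h1, h2⟩
      refine hne ?_
      simp only [nodePos, Sum.elim_inr] at h1 h2
      rw [H.layout.eq_of_same (hk r' hr' j).2.1 (hk r' hr' j).2.2.1 (hk.mem' hr' j)
        (hk r hr i).2.1 (hk r hr i).2.2.1 (hk.mem' hr i)
        (by rw [Sum.inl_injective h1, Sum.inl_injective h2])])
    (by
      rintro _ ⟨r, hr, rfl⟩ i
      have h1 := (hk r hr i).2.1
      have h2 := hdiag hr (i + 1)
      rw [show i + 1 + 2 = i + 3 by ring] at h2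
      exact ⟨⟨_, _, _, _, rfl, rfl, rfl, rfl, h1, hdiag hr i, h2⟩,
        ⟨_, _, _, _, rfl, rfl, rfl, rfl, h1.swap_right, hdiag hr i, by rwa [Sym2.eq_swap]⟩⟩)
    (by
      rintro _ ⟨r, hr, rfl⟩ i n m ⟨u, v, w, z, -, -, h3, h4, h, -⟩
      have h3 := Sum.inl_injective h3
      have h4 := Sum.inl_injective h4
      subst h3 h4
      exact hsides hr i _ _ h.symm)
  have hmem {v : V} (hv : v ∈ insert y (piece P a c p)) :
      (.inl v : Node V) ∈ ((nodes G P a c y p \ {.inr (p, none)}) \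
        ((fun r => Sum.inr (r, none)) '' centres G P a c p)) :=
    ⟨⟨.inl ⟨v, hv, rfl⟩, by simp⟩, by simp⟩
  have hadj {u v : V} (hu : u ∈ insert y (piece P a c p)) (hv : v ∈ insert y (piece P a c p))
      (h : G.Adj u v) : (FragAdj G P a c x y p (.inl u) (.inl v) ∨
        s((.inl u : Node V), .inl v) = s(.inl a, .inl c)) ∨
        ∃ q ∈ (fun r => (Sum.inr (r, none) : Node V)) '' centres G P a c p, ∃ i,
          Sum.inl u = (Sum.inl (k (nodePos P q) i) : Node V) ∧
          Sum.inl v = (Sum.inl (k (nodePos P q) (i + 2)) : Node V) := by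
    rcases H.adj_cases hk h hu hv with (h | h) | ⟨r, hr, i, h1, h2⟩
    · exact .inl (.inl h)
    · exact .inl (.inr (by simpa using h))
    · exact .inr ⟨_, ⟨r, hr, rfl⟩, i, congrArg _ h1, congrArg _ h2⟩
  have hcx {u v w z : V} (h : ¬ MeetOff G P a c u v w z) :
      ¬ Cx (.inl u) (.inl v) (.inl w) (.inl z) := by
    rintro ⟨u', v', w', z', h1, h2, h3, h4, h'⟩
    cases h1; cases h2; cases h3; cases h4
    exact h h'
  have ha' : a ∈ insert y (piece P a c p) := .inr ha
  have hc' : c ∈ insert y (piece P a c p) := .inr hc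
  have hx' : x ∈ insert y (piece P a c p) := .inr (.inl H.inside)
  have hy' : y ∈ insert y (piece P a c p) := .inl rfl
  have hull {v : V} (hv : v ∈ insert y (piece P a c p)) :
      P' (.inl v) ∈ Tri (P' (.inl a)) (P' (.inl c)) (P' (.inl y)) := by
    have := hP'.hull (hmem hv)
    obtain ⟨α, β, γ, h1, h2, h3, h4, h5⟩ := this
    exact ⟨α, γ, β, h1, h3, h2, by linarith, by rw [h5]; abel⟩
  have hnd : cr (P' (.inl a)) (P' (.inl c)) (P' (.inl y)) ≠ 0 := by
    rw [cr_swap']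
    exact neg_ne_zero.2 hP'.nondeg
  refine ⟨fun v => P' (.inl v), ⟨ha', hc', hy', hnd, fun u hu v hv h =>
    Sum.inl_injective (hP'.inj (hmem hu) (hmem hv) h), fun hu hv hw h h1 h2 =>
    hP'.avoid (hmem hu) (hmem hv) (hmem hw) (hadj hu hv h) (by simpa using h1) (by simpa using h2),
    fun hu hv hw hz h h' n1 n2 n3 n4 hno => hP'.disj (hmem hu) (hmem hv) (hmem hw) (hmem hz)
      (hadj hu hv h) (hadj hw hz h') (by simpa using n1) (by simpa using n2) (by simpa using n3)
      (by simpa using n4) (hcx hno), hull⟩, ?_⟩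
  rcases inTri_or_mem_side hnd (hull hx') with h | h | h | h
  · exact h
  · exact (hP'.avoid (hmem ha') (hmem hc') (hmem hx') (hadj ha' hc' hac)
      (by simpa using hside.1.symm) (by simpa using hside.2.2.1.symm) h).elim
  · exact (hP'.avoid (hmem hc') (hmem hy') (hmem hx') (.inl (.inl (.inr (.far (.inr (.inr rfl))))))
      (by simpa using hside.2.2.1.symm) (by simpa using H.side.2.1.ne) h).elim
  · exact (hP'.avoid (hmem hy') (hmem ha') (hmem hx') (.inl (.inl (.inl (.far (.inl rfl)))))
      (by simpa using H.side.2.1.ne) (by simpa using hside.1.symm) h).elim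

end Pocket
end pocket

open Filter Topology

section pocket

variable {V : Type*} {G : SimpleGraph V} {P : V → ℝ × ℝ} {a b c d e f g u v w x y z : V}
  {p q r : ℝ × ℝ}

/-- The drawing `P'` arises from `P` by a change inside a triangle over the edge `a c`, which
removes the crossing of that edge. -/
structure Redrawn (G : SimpleGraph V) (P : V → ℝ × ℝ) (a c : V) (U : Set V) (t : ℝ × ℝ)
    (P' : V → ℝ × ℝ) : Prop where
  layout : Layout G P'
  meet : ∀ {u v w z}, Meet G P' u v w z → Pocket.MeetOff G P a c u v w z
  eq : ∀ {v}, v ∉ U → P' v = P v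
  mem : ∀ {v}, v ∈ U → P' v ∈ Tri (P a) (P c) t
  edge : ∀ {u v}, G.Adj u v →
    segment ℝ (P' u) (P' v) ⊆ segment ℝ (P u) (P v) ∪ Tri (P a) (P c) t

namespace Pocket

/-- The edges other than `x y`. -/
def AdjOff (G : SimpleGraph V) (x y u v : V) : Prop := G.Adj u v ∧ s(u, v) ≠ s(x, y)

lemma straightOn (H : Pocket G P a b c d x y p) (F : Set V) :
    StraightOn F (AdjOff G x y) (MeetOff G P a c) P where
  inj := H.layout.inj.injOn
  avoid _ _ _ h := H.layout.avoid h.1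
  disj {u v w z} _ _ _ _ h h' n1 n2 n3 n4 hno := by
    refine Set.disjoint_left.2 fun r hr hr' => hno ?_
    have hm := H.layout.meet_of_mem h.1 h'.1 n1 n2 n3 n4 hr hr'
    exact ⟨hm, fun e => h'.2 (H.layout.one (hm.congr_left e.symm) H.side),
      fun e => h.2 (H.layout.one (hm.symm.congr_left e.symm) H.side)⟩

lemma eq_of_mem_far_tri (H : Pocket G P a b c d x y p) {ε : ℝ} (h0 : 0 < ε) (h1 : ε < 1)
    (hq : q ∈ segment ℝ (P a) (P c)) (hr : r ∈ segment ℝ ((1 - ε) • q + ε • P y) (P y))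
    (hr' : r ∈ Tri (P a) (P c) ((1 - ε) • q + ε • P y)) : r = (1 - ε) • q + ε • P y := by
  have hy : cr (P a) (P c) (P y) ≠ 0 := right_ne_zero_of_mul H.side.2.2.1.ne
  have hq0 : cr (P a) (P c) q = 0 := cr_eq_zero_of_mem_segment hq
  have hz : cr (P a) (P c) ((1 - ε) • q + ε • P y) = ε * cr (P a) (P c) (P y) := by
    rw [cr_comb _ _ _ _ (by ring), hq0]; ring
  obtain ⟨t, s, ht, hs, hts, rfl⟩ := hr
  obtain ⟨α, β, γ, hα, hβ, hγ, hs', he⟩ := hr'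
  have e := congrArg (cr (P a) (P c)) he
  rw [cr_comb _ _ _ _ hts, hz, show α • P a + β • P c + γ • ((1 - ε) • q + ε • P y) =
    α • P a + β • P c + γ • ((1 - ε) • q + ε • P y) from rfl] at e
  have e' : cr (P a) (P c) (α • P a + β • P c + γ • ((1 - ε) • q + ε • P y)) =
      γ * (ε * cr (P a) (P c) (P y)) := by
    rw [← hz]
    obtain rfl : α = 1 - β - γ := by linarith
    unfold cr
    simp only [Prod.fst_add, Prod.smul_fst, Prod.snd_add, Prod.smul_snd, smul_eq_mul]
    ring
  rw [e'] at e
  have e : t * ε + s = γ * ε := mul_right_cancel₀ hy (by linear_combination e)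
  have : s * (1 - ε) ≤ 0 := by nlinarith
  obtain rfl : s = 0 := by nlinarith
  obtain rfl : t = 1 := by linarith
  simp

lemma exists_redrawn_of_thinTri [Finite V] (H : Pocket G P a b c d x y p)
    (hmin : ∀ {a' b' c' d' x' y' p'}, Pocket G P a' b' c' d' x' y' p' →
      (inner P a c p).ncard ≤ (inner P a' c' p').ncard)
    (hq : q ∈ openSegment ℝ (P a) (P c)) (hq' : q ∈ segment ℝ (P x) (P y)) {ε : ℝ} (h0 : 0 < ε)
    (h1 : ε < 1)
    (hz : ThinTri (inner P a c p)ᶜ (AdjOff G x y) a c P ((1 - ε) • q + ε • P y)) :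
    ∃ P', Redrawn G P a c (inner P a c p) ((1 - ε) • q + ε • P y) P' := by
  classical
  obtain ⟨P₀, hP₀, hin⟩ := H.exists_finDraw hmin
  have hqs := openSegment_subset_segment _ _ _ hq
  set t : ℝ × ℝ := (1 - ε) • q + ε • P y with ht
  have hy : cr (P a) (P c) (P y) ≠ 0 := right_ne_zero_of_mul H.side.2.2.1.ne
  have hq0 : cr (P a) (P c) q = 0 := cr_eq_zero_of_mem_segment hqs
  have hct : cr (P a) (P c) t ≠ 0 := by
    rw [ht, cr_comb _ _ _ _ (by ring), hq0, mul_zero, zero_add]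
    exact mul_ne_zero h0.ne' hy
  obtain ⟨μ', μ, hμ', hμ, hμs, hqe⟩ := id hq
  obtain ⟨Q, hQ, hQa, hQc, hQy, τ, hτ, hτ', hQx⟩ := hP₀.map_special hin hμ (by linarith) hct
  rw [show 1 - μ = μ' by linarith, hqe] at hQx
  have hside := H.side.ne
  have hay : a ∈ insert y (piece P a c p) := .inr (.inr (.inl rfl))
  have hcy : c ∈ insert y (piece P a c p) := .inr (.inr (.inr rfl))
  have hyy : y ∈ insert y (piece P a c p) := .inl rfl
  have hxy : x ∈ insert y (piece P a c p) := .inr (.inl H.inside)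
  have hmem {v : V} : v ∈ insert y (piece P a c p) → v ∉ inner P a c p → v = a ∨ v = c ∨ v = y := by
    rintro (rfl | hv | rfl | rfl) hn
    exacts [.inr (.inr rfl), (hn hv).elim, .inl rfl, .inr (.inl rfl)]
  have hpiece {u v : V} (hu : u ∈ inner P a c p) (h : AdjOff G x y u v) : v ∈ piece P a c p :=
    (H.nbr hu h.1).resolve_right h.2
  have hsymm {u v : V} (h : AdjOff G x y u v) : AdjOff G x y v u :=
    ⟨h.1.symm, by rw [Sym2.eq_swap]; exact h.2⟩
  have hR := (H.straightOn (inner P a c p)ᶜ).insert (hQ.congr fun _ _ (h : AdjOff G x y _ _) => h.1)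
    H.not_inner_left H.not_inner_right hsymm
    (fun h1 h2 => hmem h2 h1) (fun {u v} hu hv hvy hv' h => by
      have := hpiece (not_not.1 hv') (hsymm h)
      exact this.resolve_left hu) hQa hQc (by rw [hQy]; exact hz)
  have huniv : (inner P a c p)ᶜ ∪ insert y (piece P a c p) \ {y} = Set.univ := by
    refine Set.eq_univ_of_forall fun v => ?_
    by_cases hv : v ∈ inner P a c p
    · exact .inr ⟨.inr (.inl hv), by rintro rfl; exact H.not_inner_far hv⟩
    · exact .inl hv
  rw [huniv] at hR
  obtain ⟨R, e1, e1', hR⟩ : ∃ R : V → ℝ × ℝ, (∀ {v}, v ∉ inner P a c p → R v = P v) ∧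
      (∀ {v}, v ∈ inner P a c p → R v = Q v) ∧
      StraightOn Set.univ (AdjOff G x y) (MeetOff G P a c) R :=
    ⟨_, fun h => if_pos h, fun h => if_neg (not_not.2 h), hR⟩
  have e2 {v : V} (hv : v ∈ piece P a c p) : R v = Q v := by
    by_cases h : v ∈ inner P a c p
    · exact e1' h
    · rw [e1 h]
      rcases hv.resolve_left h with rfl | rfl
      exacts [hQa.symm, hQc.symm]
  have hull {v : V} (hv : v ∈ insert y (piece P a c p)) : Q v ∈ Tri (P a) (P c) t := by
    have := hQ.hull hv
    rwa [hQa, hQc, hQy] at this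
  have hRy : R y = P y := e1 H.not_inner_far
  have hRx : R x = Q x := e2 (.inl H.inside)
  have hzx : t ∈ segment ℝ (P x) (P y) := by
    refine (convex_segment _ _).segment_subset hq' (right_mem_segment ℝ _ _) ?_
    exact ⟨1 - ε, ε, by linarith, h0.le, by ring, rfl⟩
  have hsplit : segment ℝ (R x) (R y) ⊆ segment ℝ (Q x) (Q y) ∪ segment ℝ t (P y) := by
    have hp (s : ℝ) : (1 - s) • q + s • P y = q + s • (P y - q) := by module
    have hQx' : Q x = q + (τ * ε) • (P y - q) := by rw [hQx, ht]; module
    rw [hRx, hRy, hQy, hQx', ht, hp]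
    rintro _ ⟨α, β, hα, hβ, hs, rfl⟩
    have e : α • (q + (τ * ε) • (P y - q)) + β • P y = q + (α * (τ * ε) + β) • (P y - q) := by
      obtain rfl : α = 1 - β := by linarith
      module
    rw [e]
    have hw : τ * ε ≤ 1 := mul_le_one₀ hτ'.le h0.le h1.le
    have hm : τ * ε ≤ α * (τ * ε) + β := by
      obtain rfl : α = 1 - β := by linarith
      linarith [mul_nonneg hβ (sub_nonneg.2 hw)]
    rcases le_total (α * (τ * ε) + β) ε with h | h
    · exact .inl (mem_segment_of_param hm h)
    · refine .inr ?_
      have := mem_segment_of_param (a := q) (d := P y - q) h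
        (show α * (τ * ε) + β ≤ 1 by linarith [mul_nonneg hα (sub_nonneg.2 hw)])
      rwa [one_smul, add_sub_cancel] at this
  have hfar : segment ℝ t (P y) ⊆ segment ℝ (P x) (P y) :=
    (convex_segment _ _).segment_subset hzx (right_mem_segment ℝ _ _)
  have htri {r : ℝ × ℝ} (hr : r ∈ segment ℝ t (P y)) (hr' : r ∈ Tri (P a) (P c) t) : r = Q y := by
    rw [H.eq_of_mem_far_tri h0 h1 hqs hr hr', hQy]
  have hQxy : segment ℝ (Q x) (Q y) ⊆ Tri (P a) (P c) t := segment_subset_tri (hull hxy) (hull hyy)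
  have havoid {v : V} (hvx : v ≠ x) (hvy : v ≠ y) : R v ∉ segment ℝ (R x) (R y) := by
    intro h
    by_cases hv : v ∈ piece P a c p
    · rw [e2 hv] at h
      rcases hsplit h with h | h
      · exact hQ.avoid hxy hyy (.inr hv) H.side.2.1 hvx hvy h
      · exact hvy (hQ.inj (.inr hv) hyy (htri h (hull (.inr hv))))
    · rw [e1 fun h => hv (.inl h)] at h
      rcases hsplit h with h | h
      · exact hz.node (fun h => hv (.inl h)) (fun h => hv (.inr (.inl h)))
          (fun h => hv (.inr (.inr h))) (hQxy h)
      · exact H.layout.avoid H.side.2.1 hvx hvy (hfar h)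
  have hends {u v : V} (hu : u ∉ inner P a c p) (hv : v ∉ inner P a c p) (h : AdjOff G x y u v)
      (hac : s(u, v) ≠ s(a, c)) (huac : u = a ∨ u = c) {r : ℝ × ℝ} (hr : r ∈ segment ℝ (P u) (P v))
      (hr' : r ∈ segment ℝ (Q x) (Q y)) : False := by
    rcases huac with rfl | rfl
    · have := hz.left hv h h.1.ne' (by rintro rfl; exact hac rfl) r hr (hQxy hr')
      rw [this, ← hQa] at hr'
      exact hQ.avoid hxy hyy hay H.side.2.1 hside.1 hside.2.1 hr'
    · have := hz.right hv h (by rintro rfl; exact hac Sym2.eq_swap) h.1.ne' r hr (hQxy hr')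
      rw [this, ← hQc] at hr'
      exact hQ.avoid hxy hyy hcy H.side.2.1 hside.2.2.1 hside.2.2.2 hr'
  have hdisj {u v : V} (h : G.Adj u v) (hux : u ≠ x) (hvx : v ≠ x) (huy : u ≠ y) (hvy : v ≠ y) :
      Disjoint (segment ℝ (R x) (R y)) (segment ℝ (R u) (R v)) := by
    have hoff : AdjOff G x y u v := ⟨h, fun e => by
      rcases Sym2.eq_iff.1 e with ⟨e, -⟩ | ⟨e, -⟩
      exacts [hux e, huy e]⟩
    by_cases hpp : u ∈ piece P a c p ∧ v ∈ piece P a c p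
    · obtain ⟨hu, hv⟩ := hpp
      rw [e2 hu, e2 hv]
      refine Set.disjoint_left.2 fun r hr hr' => ?_
      rcases hsplit hr with hr | hr
      · refine Set.disjoint_left.1 (hQ.disj hxy hyy (.inr hu) (.inr hv) H.side.2.1 h hux.symm
          hvx.symm huy.symm hvy.symm fun hm => ?_) hr hr'
        exact hm.2.2 (H.layout.one hm.1 H.side.symm)
      · have := htri hr (segment_subset_tri (hull (.inr hu)) (hull (.inr hv)) hr')
        rw [this] at hr'
        exact hQ.avoid (.inr hu) (.inr hv) hyy h huy.symm hvy.symm hr'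
    · have hu : u ∉ inner P a c p := fun hu => hpp ⟨.inl hu, hpiece hu hoff⟩
      have hv : v ∉ inner P a c p := fun hv => hpp ⟨hpiece hv (hsymm hoff), .inl hv⟩
      have hac : s(u, v) ≠ s(a, c) := fun e => hpp (by
        rcases Sym2.eq_iff.1 e with ⟨rfl, rfl⟩ | ⟨rfl, rfl⟩
        exacts [⟨.inr (.inl rfl), .inr (.inr rfl)⟩, ⟨.inr (.inr rfl), .inr (.inl rfl)⟩])
      rw [e1 hu, e1 hv]
      refine Set.disjoint_left.2 fun r hr hr' => ?_
      rcases hsplit hr with hr | hr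
      · by_cases h1 : u = a ∨ u = c
        · exact hends hu hv hoff hac h1 hr' hr
        by_cases h2 : v = a ∨ v = c
        · rw [segment_symm] at hr'
          exact hends hv hu (hsymm hoff) (by rwa [Sym2.eq_swap]) h2 hr' hr
        push Not at h1 h2
        exact Set.disjoint_left.1 (hz.edge hu hv hoff h1.1 h1.2 h2.1 h2.2) hr' (hQxy hr)
      · exact hac (H.layout.one (H.layout.meet_of_mem H.side.2.1 h hux.symm hvx.symm huy.symm
          hvy.symm (hfar hr) hr') H.side.symm)
  have hmeet {u v w z : V} (h : Meet G R u v w z) : MeetOff G P a c u v w z := by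
    have hne := h.ne
    have hno {u v w z : V} (h : Meet G R u v w z) (e : s(u, v) = s(x, y)) : False := by
      have h' := h.congr_left e.symm
      have hne := h'.ne
      obtain ⟨r, h1, h2⟩ := h'.2.2.exists_mem
      exact Set.disjoint_left.1 (hdisj h.2.1 hne.1.symm hne.2.1.symm hne.2.2.1.symm hne.2.2.2.symm)
        h1 h2
    by_contra hm
    obtain ⟨r, h1, h2⟩ := h.2.2.exists_mem
    exact Set.disjoint_left.1 (hR.disj trivial trivial trivial trivial ⟨h.1, fun e => hno h e⟩
      ⟨h.2.1, fun e => hno h.symm e⟩ hne.1 hne.2.1 hne.2.2.1 hne.2.2.2 hm) h1 h2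
  refine ⟨R, ⟨Set.injOn_univ.1 hR.inj, ?_, fun h h' => H.layout.one (hmeet h).1 (hmeet h').1⟩,
    hmeet, e1, fun {v} hv => ?_, ?_⟩
  · intro u v w h h1 h2
    by_cases e : s(u, v) = s(x, y)
    · rcases Sym2.eq_iff.1 e with ⟨rfl, rfl⟩ | ⟨rfl, rfl⟩
      · exact havoid h1 h2
      · rw [segment_symm]; exact havoid h2 h1
    · exact hR.avoid trivial trivial trivial ⟨h, e⟩ h1 h2
  · rw [e2 (.inl hv)]
    exact hull (.inr (.inl hv))
  · intro u v h
    by_cases e : s(u, v) = s(x, y)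
    · have : segment ℝ (R x) (R y) ⊆ segment ℝ (P x) (P y) ∪ Tri (P a) (P c) t := fun r hr => by
        rcases hsplit hr with h | h
        exacts [.inr (hQxy h), .inl (hfar h)]
      rcases Sym2.eq_iff.1 e with ⟨rfl, rfl⟩ | ⟨rfl, rfl⟩
      · exact this
      · rw [segment_symm ℝ (R u), segment_symm ℝ (P u)]; exact this
    · have key {u v : V} (h : AdjOff G x y u v) (hu : u ∈ inner P a c p) :
          segment ℝ (R u) (R v) ⊆ Tri (P a) (P c) t := by
        rw [e2 (.inl hu), e2 (hpiece hu h)]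
        exact segment_subset_tri (hull (.inr (.inl hu))) (hull (.inr (hpiece hu h)))
      by_cases hu : u ∈ inner P a c p
      · exact (key ⟨h, e⟩ hu).trans Set.subset_union_right
      by_cases hv : v ∈ inner P a c p
      · rw [segment_symm]
        exact (key (hsymm ⟨h, e⟩) hv).trans Set.subset_union_right
      rw [e1 hu, e1 hv]
      exact Set.subset_union_left

lemma exists_redrawn [Finite V] (H : Pocket G P a b c d x y p)
    (hmin : ∀ {a' b' c' d' x' y' p'}, Pocket G P a' b' c' d' x' y' p' →
      (inner P a c p).ncard ≤ (inner P a' c' p').ncard) :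
    ∃ q ∈ openSegment ℝ (P a) (P c), ∃ᶠ t in 𝓝 q, ∃ P', Redrawn G P a c (inner P a c p) t P' := by
  obtain ⟨q, h1, h2⟩ := H.side.2.2.exists_mem
  have hq := H.layout.mem_openSegment H.side h1 h2
  refine ⟨q, hq, ?_⟩
  have hev := (H.straightOn (inner P a c p)ᶜ).eventually_thinTri (Set.toFinite _)
    H.not_inner_left H.not_inner_right ⟨H.side.1, ?_⟩ H.side.1.ne (fun _ _ h => h.2.2 rfl) hq
  · have hT : Tendsto (fun ε : ℝ => (1 - ε) • q + ε • P y) (𝓝[>] 0) (𝓝 q) := by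
      have : Continuous fun ε : ℝ => (1 - ε) • q + ε • P y := by fun_prop
      simpa using (this.tendsto 0).mono_left nhdsWithin_le_nhds
    refine hT.frequently (Eventually.frequently ?_)
    filter_upwards [hT.eventually hev, Ioo_mem_nhdsGT one_pos] with ε hε h
    exact H.exists_redrawn_of_thinTri hmin hq h2 h.1 h.2 hε
  · intro h
    rcases Sym2.eq_iff.1 h with ⟨h, -⟩ | ⟨h, -⟩
    exacts [H.side.ne.1 h, H.side.ne.2.1 h]

end Pocket
end pocket

open Filter Topology

section outer

variable {a c g h v q t w x : ℝ × ℝ} {A B : Set (ℝ × ℝ)}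

lemma mem_segment_of_cone {s : ℝ} (hw : dist w v < dist h v ∨ h = v) (hs : 0 < s)
    (hx : v + s • (w - v) ∈ segment ℝ v h) : w ∈ segment ℝ v h := by
  rw [segment_eq_image'] at hx ⊢
  obtain ⟨k, ⟨hk, hk'⟩, hx⟩ := hx
  have hw' : w - v = (k / s) • (h - v) := by
    rw [div_eq_inv_mul, mul_smul, add_left_cancel hx, inv_smul_smul₀ hs.ne']
  refine ⟨min (k / s) 1, ⟨by positivity, min_le_right _ _⟩, ?_⟩
  simp only
  rcases hw with hw | rfl
  · rw [min_eq_left, ← hw', add_sub_cancel]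
    by_contra! h1
    rw [dist_eq_norm, dist_eq_norm, hw', norm_smul, Real.norm_of_nonneg (by positivity)] at hw
    nlinarith [norm_nonneg (h - v)]
  · simp only [sub_self, smul_zero, add_zero] at hw' ⊢
    exact (sub_eq_zero.1 hw').symm

lemma segment_subset_union (hv : v ∈ segment ℝ g h) :
    segment ℝ g h ⊆ segment ℝ v g ∪ segment ℝ v h := by
  rw [← insert_endpoints_openSegment]
  rintro x (rfl | rfl | hx)
  · exact Or.inl (right_mem_segment _ _ _)
  · exact Or.inr (right_mem_segment _ _ _)
  · rw [segment_eq_image_lineMap] at hv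
    rcases openSegment_subset_union g h (Set.image_subset_range _ _ hv) hx with rfl | hx | hx
    · exact Or.inl (left_mem_segment _ _ _)
    · exact Or.inl (segment_symm ℝ g v ▸ openSegment_subset_segment _ _ _ hx)
    · exact Or.inr (openSegment_subset_segment _ _ _ hx)

/-- Near each of its points, the set `A` is a cone. -/
def IsConeAt (A : Set (ℝ × ℝ)) (v : ℝ × ℝ) : Prop :=
  ∀ᶠ w in 𝓝 v, ∀ s : ℝ, 0 < s → s ≤ 1 → v + s • (w - v) ∈ A → w ∈ A

lemma isConeAt_segment (g h v : ℝ × ℝ) : IsConeAt (segment ℝ g h) v := by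
  by_cases hv : v ∈ segment ℝ g h
  · have key (h : ℝ × ℝ) : ∀ᶠ w in 𝓝 v, dist w v < dist h v ∨ h = v := by
      by_cases hh : h = v
      · simp [hh]
      · filter_upwards [Metric.ball_mem_nhds v (dist_pos.2 hh)] with w hw using Or.inl hw
    filter_upwards [key g, key h] with w hg hh s hs _ hx
    rcases segment_subset_union hv hx with hx | hx
    · exact (convex_segment g h).segment_subset hv (left_mem_segment _ _ _)
        (mem_segment_of_cone hg hs hx)
    · exact (convex_segment g h).segment_subset hv (right_mem_segment _ _ _)
        (mem_segment_of_cone hh hs hx)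
  · obtain ⟨ε, hε, hsub⟩ := Metric.isOpen_iff.1 (isClosed_segment g h).isOpen_compl v hv
    filter_upwards [Metric.ball_mem_nhds v hε] with w hw s hs hs' hx
    exact (hsub ((convex_ball v ε).add_smul_sub_mem (Metric.mem_ball_self hε) hw ⟨hs.le, hs'⟩)
      hx).elim

lemma IsConeAt.iUnion {ι : Type*} [Finite ι] {A : ι → Set (ℝ × ℝ)} (h : ∀ i, IsConeAt (A i) v) :
    IsConeAt (⋃ i, A i) v := by
  filter_upwards [eventually_all.2 h] with w hw s hs hs' hx
  obtain ⟨i, hi⟩ := Set.mem_iUnion.1 hx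
  exact Set.mem_iUnion.2 ⟨i, hw i s hs hs' hi⟩

open OnePlanarity

lemma outerRegion_antitone (h : A ⊆ B) : outerRegion B ⊆ outerRegion A := fun _ hx =>
  ⟨fun hA => hx.1 (h hA), fun hb =>
    hx.2 (hb.subset (connectedComponentIn_mono _ (Set.compl_subset_compl.2 h)))⟩

lemma mem_outerRegion_of_isPreconnected {C : Set (ℝ × ℝ)} (hC : IsPreconnected C)
    (hb : ¬ Bornology.IsBounded C) (hd : Disjoint C A) (hx : x ∈ C) : x ∈ outerRegion A :=
  ⟨Set.disjoint_left.1 hd hx, fun h =>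
    hb (h.subset (hC.subset_connectedComponentIn hx (Set.subset_compl_iff_disjoint_right.2 hd)))⟩

lemma exists_far_path (hA : IsClosed A) (hx : x ∈ outerRegion A) (R : ℝ) :
    ∃ f : ℝ × ℝ, R < ‖f‖ ∧ ∃ K : Set (ℝ × ℝ),
      IsCompact K ∧ IsPreconnected K ∧ x ∈ K ∧ f ∈ K ∧ Disjoint K A := by
  set U := connectedComponentIn Aᶜ x
  have hxU : x ∈ U := mem_connectedComponentIn hx.1
  obtain ⟨f, hf, hR⟩ : ∃ f ∈ U, R < ‖f‖ := by
    by_contra! h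
    exact hx.2 (isBounded_iff_forall_norm_le.2 ⟨R, h⟩)
  have hU : IsPathConnected U :=
    (hA.isOpen_compl.connectedComponentIn).isConnected_iff_isPathConnected.1
      (isConnected_connectedComponentIn_iff.2 hx.1)
  obtain ⟨γ, hγ⟩ := hU.joinedIn x hxU f hf
  refine ⟨f, hR, Set.range γ, isCompact_range γ.continuous, isPreconnected_range γ.continuous,
    ⟨0, γ.source⟩, ⟨1, γ.target⟩, Set.disjoint_left.2 ?_⟩
  rintro _ ⟨s, rfl⟩ hs
  exact connectedComponentIn_subset _ _ (hγ s) hs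

lemma eventually_mem_closure_outerRegion (hA : IsCompact A) (hcone : IsConeAt A v)
    (hac : segment ℝ a c ⊆ A) (hne : a ≠ c) (hv : v ∈ A) (hvo : v ∉ openSegment ℝ a c)
    (hcl : v ∈ closure (outerRegion A)) (hq : q ∈ openSegment ℝ a c) :
    ∀ᶠ t in 𝓝 q, v ∈ closure (outerRegion (A ∪ Tri a c t)) := by
  obtain ⟨w, hw, hwA⟩ : ∃ w, (∀ s : ℝ, 0 < s → s ≤ 1 → v + s • (w - v) ∈ A → w ∈ A) ∧
      w ∈ outerRegion A := by
    obtain ⟨w, h1, h2⟩ := (hcone.and_frequently (mem_closure_iff_frequently.1 hcl)).exists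
    exact ⟨w, h1, h2⟩
  have hseg : ∀ x ∈ segment ℝ v w, x ∈ A → x = v := by
    rw [segment_eq_image']
    rintro _ ⟨s, ⟨hs, hs'⟩, rfl⟩ hx
    rcases hs.eq_or_lt with rfl | hs
    · simp
    · exact (hwA.1 (hw s hs hs' hx)).elim
  obtain ⟨R, hR⟩ := isBounded_iff_forall_norm_le.1 (hA.isBounded.union
    (Metric.isBounded_ball (x := q) (r := 1)))
  have hq' := openSegment_subset_segment ℝ a c hq
  obtain ⟨f, hf, K, hK, hKc, hwK, hfK, hKA⟩ := exists_far_path hA.isClosed hwA R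
  have hthin : ∀ᶠ t in 𝓝 q, ∀ x ∈ segment ℝ v w, x ∈ Tri a c t → x = v := by
    by_cases hva : v = a
    · subst hva
      refine eventually_tri_inter_left (fun h => hwA.1 (hac h)) (fun h => hne ?_) hq
      exact (hseg c h (hac (right_mem_segment _ _ _))).symm
    by_cases hvc : v = c
    · subst hvc
      refine eventually_tri_inter_right (fun h => hwA.1 (hac h)) (fun h => hne ?_) hq
      exact hseg a h (hac (left_mem_segment _ _ _))
    have hd : Disjoint (segment ℝ v w) (segment ℝ a c) := Set.disjoint_left.2 fun x hx hx' => by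
      rw [hseg x hx (hac hx'), ← insert_endpoints_openSegment] at hx'
      rcases hx' with h | h | h <;> contradiction
    filter_upwards [eventually_disjoint_tri (isClosed_segment v w) hd hq'] with t ht x hx hx'
    exact (Set.disjoint_left.1 ht hx hx').elim
  filter_upwards [hthin, eventually_disjoint_tri hK.isClosed (hKA.mono_right hac) hq',
    Metric.ball_mem_nhds q one_pos] with t h1 h2 h3
  have hB : A ∪ Tri a c t ⊆ Metric.closedBall 0 R := by
    have hsub : A ⊆ Metric.closedBall 0 R := fun x hx => by simpa using hR x (Or.inl hx)
    refine Set.union_subset hsub ((convex_closedBall _ _).tri_subset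
      (hsub (hac (left_mem_segment _ _ _))) (hsub (hac (right_mem_segment _ _ _))) ?_)
    simpa using hR t (Or.inr h3)
  set ray := (fun s : ℝ => s • f) '' Set.Ici 1
  have hR0 : 0 ≤ R := (norm_nonneg v).trans (hR v (Or.inl hv))
  have hray : ∀ x ∈ ray, x ∉ A ∪ Tri a c t := by
    rintro _ ⟨s, hs, rfl⟩ hx
    have := hB hx
    rw [mem_closedBall_zero_iff, norm_smul, Real.norm_of_nonneg (zero_le_one.trans hs)] at this
    nlinarith [Set.mem_Ici.1 hs, norm_nonneg f]
  have hrayb : ¬ Bornology.IsBounded ray := fun hb => by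
    obtain ⟨M, hM⟩ := isBounded_iff_forall_norm_le.1 hb
    have hf0 : 0 < ‖f‖ := hR0.trans_lt hf
    have := hM _ ⟨max 1 ((M + 1) / ‖f‖), Set.mem_Ici.2 (le_max_left _ _), rfl⟩
    rw [norm_smul, Real.norm_of_nonneg (by positivity)] at this
    have h4 := mul_le_mul_of_nonneg_right (le_max_right 1 ((M + 1) / ‖f‖)) hf0.le
    rw [div_mul_cancel₀ _ hf0.ne'] at h4
    linarith
  have hrayc : IsPreconnected ray := isPreconnected_Ici.image _ (by fun_prop)
  have hsub : openSegment ℝ v w ⊆ outerRegion (A ∪ Tri a c t) := by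
    intro r hr
    have hrv : r ∈ segment ℝ v w := openSegment_subset_segment _ _ _ hr
    have hvw : v ≠ w := fun h => hwA.1 (h ▸ hv)
    have hv' : v ∉ segment ℝ r w := fun h => by
      obtain ⟨γ, δ, hγ, hδ, hs, rfl⟩ := hr
      obtain ⟨α, β, hα, hβ, hs', h⟩ := h
      have h0 : (α * δ + β) • (v - w) = 0 := by
        have e : v - (α • (γ • v + δ • w) + β • w) = (α * δ + β) • (v - w)
            + (1 - (α * (γ + δ) + β)) • v := by module
        rw [h, hs, mul_one, hs'] at e
        simpa using e.symm
      have := (smul_eq_zero.1 h0).resolve_right (sub_ne_zero.2 hvw)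
      nlinarith [mul_nonneg hα hδ.le]
    have hC : IsPreconnected (segment ℝ r w ∪ K ∪ ray) :=
      ((convex_segment r w).isPreconnected.union w (right_mem_segment _ _ _) hwK hKc).union f
        (Or.inr hfK) ⟨1, Set.self_mem_Ici, one_smul _ _⟩ hrayc
    refine mem_outerRegion_of_isPreconnected hC (fun hb => hrayb (hb.subset
      Set.subset_union_right)) (Set.disjoint_left.2 ?_) (Or.inl (Or.inl (left_mem_segment _ _ _)))
    rintro x ((hx | hx) | hx) hx'
    · have hxs := (convex_segment v w).segment_subset hrv (right_mem_segment _ _ _) hx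
      have : x = v := hx'.elim (hseg x hxs) (h1 x hxs)
      exact hv' (this ▸ hx)
    · exact hx'.elim (Set.disjoint_left.1 hKA hx) (Set.disjoint_left.1 h2 hx)
    · exact hray x hx hx'
  refine closure_mono hsub ?_
  rw [closure_openSegment]
  exact left_mem_segment _ _ _

lemma notMem_closure_outerRegion (hA : segment ℝ a c ∪ segment ℝ c x ∪ segment ℝ x a ⊆ A)
    (hv : InTri a c x v) : v ∉ closure (outerRegion A) := by
  intro h
  obtain ⟨w, hw, hwA⟩ := mem_closure_iff.1 h {v | InTri a c x v}
    (isOpen_inTri continuous_const continuous_const continuous_const continuous_id) hv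
  have hd : Disjoint (connectedComponentIn Aᶜ w) (segment ℝ a c ∪ segment ℝ c x ∪ segment ℝ x a) :=
    (disjoint_compl_left.mono_right hA).mono_left (connectedComponentIn_subset _ _)
  simp only [Set.disjoint_union_right] at hd
  refine hwA.2 ((Metric.isBounded_closedBall (x := 0) (r := max ‖a‖ (max ‖c‖ ‖x‖))).subset ?_)
  refine fun z hz => (convex_closedBall _ _).tri_subset ?_ ?_ ?_ (InTri.mem_tri
    (isPreconnected_connectedComponentIn.inTri (mem_connectedComponentIn hwA.1) hw hd.1.1 hd.1.2
      hd.2 hz)) <;> simp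

end outer

open Filter Topology

namespace OnePlanarity

section layout

variable {V : Type*} {G : SimpleGraph V} {P : V → ℝ × ℝ} {D D' : Drawing G} {S : Set CrossingType}
  {a b c d e u v w x y z : V} {p q t : ℝ × ℝ}

lemma isArc_segment {x y : ℝ × ℝ} (h : x ≠ y) : IsArc (segment ℝ x y) x y := by
  refine ⟨fun t => AffineMap.lineMap x y (t : ℝ), ?_, ?_, by simp, by simp, ?_⟩
  · exact AffineMap.lineMap_continuous.comp continuous_subtype_val
  · exact fun s t hst => Subtype.ext (AffineMap.lineMap_injective ℝ h hst)
  · rw [segment_eq_image_lineMap, Set.image_eq_range]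

lemma Drawing.Crosses.symm {f g : Sym2 V} (h : D.Crosses f g p) : D.Crosses g f p :=
  ⟨h.2.1, h.1, h.2.2.1.symm, h.2.2.2.2.1, h.2.2.2.1, h.2.2.2.2.2⟩

lemma Drawing.IsGeometric.arc_eq (hD : D.IsGeometric) (h : G.Adj a b) :
    D.arc s(a, b) = segment ℝ (D.pos a) (D.pos b) := hD a b h

lemma Drawing.IsGeometric.avoid (hD : D.IsGeometric) (h : G.Adj a b) (h1 : v ≠ a) (h2 : v ≠ b) :
    D.pos v ∉ segment ℝ (D.pos a) (D.pos b) := fun hv => by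
  rw [← hD.arc_eq h] at hv
  rcases Sym2.mem_iff.1 (D.arc_avoid _ h v hv) with h | h <;> contradiction

lemma Drawing.IsGeometric.crosses (hD : D.IsGeometric) (h : Meet G D.pos a b c e)
    (hp : p ∈ segment ℝ (D.pos a) (D.pos b)) (hp' : p ∈ segment ℝ (D.pos c) (D.pos e)) :
    D.Crosses s(a, b) s(c, e) p := by
  have hn := h.ne
  refine ⟨h.1, h.2.1, fun hs => ?_, by rwa [hD.arc_eq h.1], by rwa [hD.arc_eq h.2.1], ?_⟩
  · rcases Sym2.eq_iff.1 hs with ⟨h, -⟩ | ⟨h, -⟩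
    exacts [hn.1 h, hn.2.1 h]
  · rintro ⟨v, rfl⟩
    by_cases h1 : v = a ∨ v = b
    · refine hD.avoid h.2.1 ?_ ?_ hp' <;> rintro rfl <;> tauto
    · push Not at h1
      exact hD.avoid h.1 h1.1 h1.2 hp

lemma Drawing.IsGeometric.layout (hD : D.IsGeometric) (h : D.IsOnePlanar) : Layout G D.pos where
  inj := D.pos_inj
  avoid := hD.avoid
  one h1 h2 := by
    obtain ⟨p, hp, hp'⟩ := h1.2.2.exists_mem
    obtain ⟨q, hq, hq'⟩ := h2.2.2.exists_mem
    exact (h.1 _ _ _ _ _ (hD.crosses h1 hp hp') (hD.crosses h2 hq hq')).1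

lemma Drawing.IsGeometric.meet (hD : D.IsGeometric) (H : Layout G D.pos)
    (h : D.Crosses s(a, b) s(c, e) p) : Meet G D.pos a b c e ∧
      p ∈ segment ℝ (D.pos a) (D.pos b) ∧ p ∈ segment ℝ (D.pos c) (D.pos e) := by
  obtain ⟨h1, h2, hne, hp, hp', hr⟩ := h
  rw [hD.arc_eq h1] at hp
  rw [hD.arc_eq h2] at hp'
  refine ⟨(H.meet_or_share h1 h2 hne hp hp').resolve_right ?_, hp, hp'⟩
  rintro ⟨v, -, -, rfl⟩
  exact hr ⟨v, rfl⟩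

lemma Drawing.IsGeometric.isOnePlanar (hD : D.IsGeometric) (H : Layout G D.pos) :
    D.IsOnePlanar := by
  constructor
  · rintro ⟨a, b⟩ ⟨c, e⟩ ⟨c', e'⟩ p q h1 h2
    obtain ⟨m1, hp, hp'⟩ := hD.meet H h1
    obtain ⟨m2, hq, hq'⟩ := hD.meet H h2
    have hs := H.one m1 m2
    refine ⟨hs, ?_⟩
    have := hD.meet H (show D.Crosses s(a, b) s(c, e) q from hs ▸ h2)
    exact m1.2.2.eq_of_mem hp hp' hq this.2.2
  · rintro ⟨a, b⟩ ⟨c, e⟩ p h v hv hv'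
    have := (hD.meet H h).1.ne
    rcases Sym2.mem_iff.1 hv with rfl | rfl <;> rcases Sym2.mem_iff.1 hv' with rfl | rfl <;> tauto

lemma _root_.Layout.exists_drawing [Finite V] (H : Layout G P) :
    ∃ D : Drawing G, D.IsGeometric ∧ D.pos = P := by
  let A : Sym2 V → Set (ℝ × ℝ) := fun e => {x | ∃ u v, e = s(u, v) ∧ x ∈ segment ℝ (P u) (P v)}
  have hA (u v : V) : A s(u, v) = segment ℝ (P u) (P v) := by
    ext x
    refine ⟨?_, fun h => ⟨u, v, rfl, h⟩⟩
    rintro ⟨u', v', h, hx⟩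
    rcases Sym2.eq_iff.1 h with ⟨rfl, rfl⟩ | ⟨rfl, rfl⟩
    exacts [hx, segment_symm ℝ (P u) (P v) ▸ hx]
  refine ⟨⟨P, H.inj, A, ?_, ?_, ?_⟩, fun u v _ => hA u v, rfl⟩
  · rintro _ he u v rfl
    rw [hA]
    exact isArc_segment (H.inj.ne he.ne)
  · rintro ⟨a, b⟩ he w hw
    by_contra! h
    rw [Sym2.mem_iff, not_or] at h
    exact H.avoid he h.1 h.2 (hA a b ▸ hw)
  · rintro ⟨a, b⟩ he ⟨c, e⟩ he' hne
    change (A s(a, b) ∩ A s(c, e)).Finite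
    rw [hA, hA]
    have hsub : {x | Meet G P a b c e ∧ x ∈ segment ℝ (P a) (P b) ∩ segment ℝ (P c) (P e)}.Finite :=
      Set.Subsingleton.finite fun x hx y hy => hx.1.2.2.eq_of_mem hx.2.1 hx.2.2 hy.2.1 hy.2.2
    refine (hsub.union (Set.finite_range P)).subset fun x hx => ?_
    rcases H.meet_or_share he he' hne hx.1 hx.2 with h | ⟨v, -, -, rfl⟩
    exacts [Or.inl ⟨h, hx⟩, Or.inr ⟨v, rfl⟩]

lemma Drawing.finite_crossingPoints [Finite V] (D : Drawing G) : D.crossingPoints.Finite := by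
  have : D.crossingPoints ⊆ ⋃ i : {i : Sym2 V × Sym2 V //
      i.1 ∈ G.edgeSet ∧ i.2 ∈ G.edgeSet ∧ i.1 ≠ i.2}, D.arc i.1.1 ∩ D.arc i.1.2 := by
    rintro p ⟨e, e', h⟩
    exact Set.mem_iUnion.2 ⟨⟨(e, e'), h.1, h.2.1, h.2.2.1⟩, h.2.2.2.1, h.2.2.2.2.1⟩
  exact (Set.finite_iUnion fun i =>
    D.arc_finite_inter _ i.2.1 _ i.2.2.1 i.2.2.2).subset this

lemma Drawing.IsOnePlanar.eq_or_eq (hD : D.IsOnePlanar) {f g f' g' : Sym2 V}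
    (h : D.Crosses f g p) (h' : D.Crosses f' g' p) : f' = f ∨ f' = g := by
  by_contra! hn
  exact hn.2 (hD.1 _ _ _ _ _ ⟨h.1, h'.1, hn.1.symm, h.2.2.2.1, h'.2.2.2.1, h.2.2.2.2.2⟩ h).1

lemma Drawing.IsOnePlanar.ncard_lt [Finite V] (hD : D.IsOnePlanar) (hD' : D'.IsOnePlanar)
    {g g' : Sym2 V} (hg : D.Crosses g g' q)
    (h : ∀ {f f' p}, D'.Crosses f f' p → (∃ p', D.Crosses f f' p') ∧ f ≠ g ∧ f' ≠ g) :
    D'.crossingPoints.ncard < D.crossingPoints.ncard := by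
  have key (p : D'.crossingPoints) : ∃ p' f f', D'.Crosses f f' p ∧ D.Crosses f f' p' := by
    obtain ⟨p, f, f', hp⟩ := p
    obtain ⟨p', hp'⟩ := (h hp).1
    exact ⟨p', f, f', hp, hp'⟩
  choose φ f f' h1 h2 using key
  have hinj : Function.Injective φ := fun p p' hpp => by
    have e1 := hD.eq_or_eq (h2 p) (hpp ▸ h2 p')
    have e2 := hD.eq_or_eq (h2 p) (hpp ▸ (h2 p').symm)
    have hne := (h1 p').2.2.1
    have hp' := h1 p'
    rcases e1 with e1 | e1 <;> rcases e2 with e2 | e2 <;> rw [e1, e2] at hp' hne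
    · exact (hne rfl).elim
    · exact Subtype.ext (hD'.1 _ _ _ _ _ (h1 p) hp').2
    · exact Subtype.ext (hD'.1 _ _ _ _ _ (h1 p) hp'.symm).2
    · exact (hne rfl).elim
  rw [← Nat.card_coe_set_eq, ← Set.ncard_univ, ← Set.ncard_image_of_injective _ hinj]
  refine Set.ncard_lt_ncard ⟨?_, fun hsub => ?_⟩ D.finite_crossingPoints
  · rintro _ ⟨p, -, rfl⟩
    exact ⟨_, _, h2 p⟩
  · obtain ⟨p, -, hp⟩ := hsub ⟨g, g', hg⟩
    obtain ⟨-, n1, n2⟩ := h (h1 p)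
    rcases hD.eq_or_eq (h2 p) (hp ▸ hg) with h | h
    exacts [n1 h.symm, n2 h.symm]

lemma Drawing.IsGeometric.image_eq (hD : D.IsGeometric) : D.image =
    ⋃ i : {i : V × V // i.1 = i.2 ∨ G.Adj i.1 i.2}, segment ℝ (D.pos i.1.1) (D.pos i.1.2) := by
  ext x
  simp only [Drawing.image, Set.mem_union, Set.mem_iUnion, Set.mem_range]
  constructor
  · rintro (⟨v, rfl⟩ | ⟨⟨a, b⟩, h, hx⟩)
    · exact ⟨⟨(v, v), .inl rfl⟩, left_mem_segment _ _ _⟩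
    · exact ⟨⟨(a, b), .inr h⟩, hD.arc_eq h ▸ hx⟩
  · rintro ⟨⟨⟨a, b⟩, h | h⟩, hx⟩
    · obtain rfl : a = b := h
      exact .inl ⟨a, by rw [segment_same] at hx; exact hx.symm⟩
    · exact .inr ⟨s(a, b), h, (hD.arc_eq h).symm ▸ hx⟩

lemma Drawing.IsGeometric.segment_subset (hD : D.IsGeometric) (h : G.Adj a b) :
    segment ℝ (D.pos a) (D.pos b) ⊆ D.image := fun _ hx => by
  rw [hD.image_eq]
  exact Set.mem_iUnion.2 ⟨⟨(a, b), .inr h⟩, hx⟩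

lemma Drawing.IsGeometric.eventually_onOuterFace [Finite V] (hD : D.IsGeometric) (h : G.Adj a c)
    (hv : D.OnOuterFace v) (hq : q ∈ openSegment ℝ (D.pos a) (D.pos c)) :
    ∀ᶠ t in 𝓝 q, D.pos v ∈ closure (outerRegion (D.image ∪ Tri (D.pos a) (D.pos c) t)) := by
  have hne : D.pos a ≠ D.pos c := D.pos_inj.ne h.ne
  refine eventually_mem_closure_outerRegion ?_ ?_ (hD.segment_subset h) hne (.inl ⟨v, rfl⟩) ?_ hv hq
  · rw [hD.image_eq]
    refine isCompact_iUnion fun i => ?_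
    rw [segment_eq_image_lineMap]
    exact isCompact_Icc.image AffineMap.lineMap_continuous
  · rw [hD.image_eq]
    exact IsConeAt.iUnion fun i => isConeAt_segment _ _ _
  · intro hvo
    by_cases h1 : v = a
    · subst h1; exact hne (left_mem_openSegment_iff.1 hvo)
    by_cases h2 : v = c
    · subst h2; exact hne (right_mem_openSegment_iff.1 hvo)
    exact hD.avoid h h1 h2 (openSegment_subset_segment _ _ _ hvo)

lemma Drawing.IsGeometric.exists_meet_of_not_confined (hD : D.IsGeometric) (H : Layout G D.pos)
    (h : ¬ D.CrossingConfined) :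
    ∃ a b c d x y, Meet G D.pos a b c d ∧ Meet G D.pos a c x y := by
  unfold Drawing.CrossingConfined at h
  push Not at h
  obtain ⟨e, e', p, hc, u, v, hu, hv, n1, n2, ⟨x, y⟩, q, hq⟩ := h
  have hm := (hD.meet H hq).1
  have huv : u ≠ v := hm.1.ne
  have key {e : Sym2 V} (hu : u ∈ e) (hv : v ∈ e) : s(u, v) = e :=
    ((Sym2.mem_and_mem_iff huv).1 ⟨hu, hv⟩).symm
  have hfin {e e' : Sym2 V} (hc : D.Crosses e e' p) (hu : u ∈ e) (hv : v ∈ e') :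
      ∃ a b c d x y, Meet G D.pos a b c d ∧ Meet G D.pos a c x y := by
    obtain ⟨b, rfl⟩ := hu
    obtain ⟨d, rfl⟩ := hv
    exact ⟨u, b, v, d, x, y, (hD.meet H hc).1, hm⟩
  rcases hu with hu | hu <;> rcases hv with hv | hv
  exacts [(n1 (key hu hv)).elim, hfin hc hu hv, hfin hc.symm hu hv, (n2 (key hu hv)).elim]

lemma exists_minimal_pocket (H : Layout G P) (h : Meet G P a b c d) (h' : Meet G P a c x y) :
    ∃ a b c d x y p, Pocket G P a b c d x y p ∧ ∀ {a' b' c' d' x' y' p'},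
      Pocket G P a' b' c' d' x' y' p' →
        (Pocket.inner P a c p).ncard ≤ (Pocket.inner P a' c' p').ncard := by
  classical
  have hex : ∃ n a b c d x y p, Pocket G P a b c d x y p ∧ (Pocket.inner P a c p).ncard = n := by
    obtain ⟨p, hp | hp⟩ := H.exists_pocket h h'
    exacts [⟨_, _, _, _, _, _, _, _, hp, rfl⟩, ⟨_, _, _, _, _, _, _, _, hp, rfl⟩]
  obtain ⟨a, b, c, d, x, y, p, hp, hn⟩ := Nat.find_spec hex
  exact ⟨a, b, c, d, x, y, p, hp, fun hp' =>
    hn.trans_le (Nat.find_min' hex ⟨_, _, _, _, _, _, _, hp', rfl⟩)⟩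

lemma Drawing.IsGeometric.exists_fewer_crossings [Finite V] (hD : D.IsGeometric)
    (hS : D.IsSRestricted S) (h : ¬ D.CrossingConfined) :
    ∃ D' : Drawing G, D'.IsGeometric ∧ D'.IsSRestricted S ∧
      (∀ v, D.OnOuterFace v → D'.OnOuterFace v) ∧
      D'.crossingPoints.ncard < D.crossingPoints.ncard := by
  have H := hD.layout hS.1
  obtain ⟨_, _, _, _, _, _, m1, m2⟩ := hD.exists_meet_of_not_confined H h
  obtain ⟨a, b, c, d, x, y, p, hp, hmin⟩ := exists_minimal_pocket H m1 m2
  obtain ⟨q, hq, hfreq⟩ := hp.exists_redrawn hmin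
  have hac := hp.side.1
  have hout : ∀ᶠ t in 𝓝 q, ∀ v, D.OnOuterFace v →
      D.pos v ∈ closure (outerRegion (D.image ∪ Tri (D.pos a) (D.pos c) t)) := by
    simp only [eventually_all]
    exact fun v hv => hD.eventually_onOuterFace hac hv hq
  obtain ⟨t, ⟨P', hR⟩, ht⟩ := (hfreq.and_eventually hout).exists
  obtain ⟨D', hD', rfl⟩ := hR.layout.exists_drawing
  have hD'1 := hD'.isOnePlanar hR.layout
  have hcr {f f' : Sym2 V} {r : ℝ × ℝ} (hr : D'.Crosses f f' r) :
      (∃ r', D.Crosses f f' r') ∧ f ≠ s(a, c) ∧ f' ≠ s(a, c) := by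
    obtain ⟨u, v⟩ := f
    obtain ⟨w, z⟩ := f'
    obtain ⟨hm, n1, n2⟩ := hR.meet (hD'.meet hR.layout hr).1
    obtain ⟨r', h1, h2⟩ := hm.2.2.exists_mem
    exact ⟨⟨r', hD.crosses hm h1 h2⟩, n1, n2⟩
  refine ⟨D', hD', ⟨hD'1, fun u v w z r hr => ?_⟩, fun v hv => ?_, ?_⟩
  · obtain ⟨⟨r', hr'⟩, -⟩ := hcr hr
    exact hS.2 _ _ _ _ _ hr'
  · have hvI : v ∉ Pocket.inner D.pos a c p := fun hvI => by
      refine notMem_closure_outerRegion (Set.union_subset (Set.union_subset ?_ ?_) ?_) hvI hv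
      · exact ((convex_segment _ _).segment_subset (left_mem_segment _ _ _) hp.mem_left).trans
          (hD.segment_subset hp.meet.1)
      · exact ((convex_segment _ _).segment_subset hp.mem_right (left_mem_segment _ _ _)).trans
          (hD.segment_subset hp.meet.2.1)
      · exact hD.segment_subset hac.symm
    rw [Drawing.OnOuterFace, hR.eq hvI]
    refine closure_mono (outerRegion_antitone ?_) (ht v hv)
    rw [hD'.image_eq]
    refine Set.iUnion_subset ?_
    rintro ⟨⟨u, w⟩, h | h⟩
    · obtain rfl : u = w := h
      simp only [segment_same, Set.singleton_subset_iff]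
      by_cases hu : u ∈ Pocket.inner D.pos a c p
      · exact .inr (hR.mem hu)
      · exact .inl (.inl ⟨u, (hR.eq hu).symm⟩)
    · exact (hR.edge h).trans (Set.union_subset_union_left _ (hD.segment_subset h))
  · obtain ⟨r, h1, h2⟩ := hp.side.2.2.exists_mem
    exact hS.1.ncard_lt hD'1 (hD.crosses hp.side h1 h2) hcr

end layout

theorem geo_srestricted_crossing_confined {V : Type*} [Fintype V] (G : SimpleGraph V)
    (S : Set CrossingType) (hS : S ⊆ goodTypes) :
    (∀ D : Drawing G, D.IsGeometric → D.IsSRestricted S →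
      ∃ D' : Drawing G, D'.IsGeometric ∧ D'.IsSRestricted S ∧ D'.CrossingConfined ∧
        ∀ v : V, D.OnOuterFace v → D'.OnOuterFace v) ∧
    (∀ D : Drawing G, D.IsGeometric → D.IsSRestricted S →
      (∀ D' : Drawing G, D'.IsGeometric → D'.IsSRestricted S →
        D.crossingPoints.ncard ≤ D'.crossingPoints.ncard) →
      D.CrossingConfined) := by
  constructor
  · intro D hD hDS
    induction hn : D.crossingPoints.ncard using Nat.strong_induction_on generalizing D with
    | _ n ih =>
      by_cases hc : D.CrossingConfined
      · exact ⟨D, hD, hDS, hc, fun _ h => h⟩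
      obtain ⟨D₁, h1, h2, h3, h4⟩ := hD.exists_fewer_crossings hDS hc
      obtain ⟨D₂, g1, g2, g3, g4⟩ := ih _ (hn ▸ h4) D₁ h1 h2 rfl
      exact ⟨D₂, g1, g2, g3, fun v hv => g4 v (h3 v hv)⟩
  · intro D hD hDS hmin
    by_contra hc
    obtain ⟨D', h1, h2, -, h4⟩ := hD.exists_fewer_crossings hDS hc
    exact (hmin D' h1 h2).not_gt h4

end OnePlanarity
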